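/- There exists N ∈ ℕ such that the following holds. Let G be a finite abelian group (written additively) of order n ≥ N with ∑_{g∈G} g = 0, and let k ≥ 2 be an integer dividing n − 1. Then there exists an orthomorphism φ of G with φ(0) = 0 such that the permutation induced by φ on G ∖ {0} is a product of (n−1)/k pairwise disjoint cycles, each of length exactly k (equivalently, the cycle type of φ consists of one fixed point and (n−1)/k cycles of length k). -/

import Mathlib

set_option linter.unusedSectionVars false
set_option linter.unusedVariables false
set_option linter.unusedSimpArgs false

namespace FGT
open Finset hiding card card_cons card_fin card_zero coe_add forall_mem_cons map map_cons map_map map_singleton mem_add mem_cons pairwise_cons range singleton_add sum_cons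
open Fintype (card card_fin card_fun card_pos_iff card_prod)
open Function (Embedding Injective Surjective comp comp_def onFun)
open List (cons_append flatMap_cons forall_mem_cons length_cons length_nil map_append map_nil mem_append mem_cons mem_toFinset nil_append nodup_append nodup_cons nodup_nil not_mem_nil pairwise_cons sum_nil)
open Multiset (Nodup card_add card_cons card_pos_iff_exists_mem card_zero coe_add coe_card coe_nil coe_nodup cons_add cons_coe cons_erase exists_cons_of_mem insert_eq_cons map map_coe map_cons map_id' map_map map_singleton mem_add nodup_add nodup_of_le ofList range replicate replicate_add replicate_one replicate_succ singleton_add sum_add sum_coe sum_cons sum_map_singleton sum_replicate sum_zero toFinset_card_le)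
open Nat (cast_add cast_le cast_nonneg cast_sub ceil_le floor_le le_ceil le_mul_of_pos_right mod_eq_of_lt)
open Prod (ext_iff fst fst_add snd snd_add)
open Real (exp exp_add exp_le_exp exp_pos)
open Set (mem_ofPred_eq)

/-- `G` has an orthomorphism fixing `0` that permutes the other elements in `l` cycles of length `k`. -/
def HasOrth (G : Type) [AddCommGroup G] [Fintype G] [DecidableEq G] (l k : ℕ) : Prop :=
  ∃ φ : Equiv.Perm G, Function.Bijective (fun x => φ x - x) ∧ φ 0 = 0 ∧ φ.cycleType = replicate l k

/-- At most half of the group has a given double. -/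
abbrev Half (G : Type) [AddCommGroup G] [Fintype G] [DecidableEq G] : Prop :=
  ∀ κ : G, 2 * (univ.filter fun c : G => c + c = κ).card ≤ card G

/-- Few elements have a given double outside `D`. -/
abbrev Thin {G : Type} [AddCommGroup G] [Fintype G] [DecidableEq G] (D : Finset G) : Prop :=
  ∀ κ ∉ D, 16 * (univ.filter fun c : G => c + c = κ).card ≤ card G

section Nibble
variable {W E : Type*} [Fintype W] [DecidableEq W] [Fintype E] [DecidableEq E]

/-- Indicator of incidence. -/
def ind (inc : E → Finset W) (e : E) (v : W) : ℝ := if v ∈ inc e then 1 else 0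

/-- Weighted degree of a vertex. -/
def wdeg (inc : E → Finset W) (α : E → ℝ) (v : W) : ℝ := ∑ e, α e * ind inc e v

/-- Weighted codegree of two vertices. -/
def wcodeg (inc : E → Finset W) (α : E → ℝ) (u v : W) : ℝ :=
  ∑ e, α e * (ind inc e u * ind inc e v)

/-- Off-diagonal weighted codegree. -/
def acodeg (inc : E → Finset W) (α : E → ℝ) (u v : W) : ℝ :=
  if u = v then 0 else wcodeg inc α u v

lemma ind_nonneg (inc : E → Finset W) (e : E) (v : W) : 0 ≤ ind inc e v := by
  unfold ind; split_ifs <;> norm_num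

lemma ind_sq (inc : E → Finset W) (e : E) (v : W) : ind inc e v * ind inc e v = ind inc e v := by
  unfold ind; split_ifs <;> norm_num

lemma sum_ind (inc : E → Finset W) (e f : E) :
    ∑ u ∈ inc e, ind inc f u = ((inc e ∩ inc f).card : ℝ) := by
  simp [ind, sum_ite_mem]

lemma sum_ind_of_subset (inc : E → Finset W) (f : E) {S : Finset W} (h : inc f ⊆ S) :
    ∑ u ∈ S, ind inc f u = ((inc f).card : ℝ) := by
  simp [ind, sum_ite_mem, inter_eq_right.2 h]

lemma wcodeg_comm (inc : E → Finset W) (α : E → ℝ) (u v : W) :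
    wcodeg inc α u v = wcodeg inc α v u := by
  unfold wcodeg; exact sum_congr rfl fun e _ => by ring

lemma acodeg_comm (inc : E → Finset W) (α : E → ℝ) (u v : W) :
    acodeg inc α u v = acodeg inc α v u := by
  unfold acodeg; rw [wcodeg_comm]; simp [eq_comm]

lemma wcodeg_nonneg (inc : E → Finset W) {α : E → ℝ} (hα : ∀ e, 0 ≤ α e) (u v : W) :
    0 ≤ wcodeg inc α u v :=
  sum_nonneg fun e _ => mul_nonneg (hα e) (mul_nonneg (ind_nonneg ..) (ind_nonneg ..))

lemma acodeg_nonneg (inc : E → Finset W) {α : E → ℝ} (hα : ∀ e, 0 ≤ α e) (u v : W) :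
    0 ≤ acodeg inc α u v := by
  unfold acodeg; split_ifs; exacts [le_rfl, wcodeg_nonneg inc hα u v]

lemma wcodeg_self (inc : E → Finset W) (α : E → ℝ) (v : W) :
    wcodeg inc α v v = wdeg inc α v := by
  unfold wcodeg wdeg; simp [ind_sq]

lemma sum_acodeg (inc : E → Finset W) (α : E → ℝ) {r : ℕ} {S : Finset W}
    (hS : ∀ e, α e ≠ 0 → inc e ⊆ S ∧ (inc e).card = r) {v : W} (hv : v ∈ S) :
    ∑ u ∈ S, acodeg inc α v u = ((r : ℝ) - 1) * wdeg inc α v := by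
  have h1 : ∑ u ∈ S, wcodeg inc α v u = r * wdeg inc α v := by
    unfold wcodeg wdeg
    rw [sum_comm, mul_sum]
    refine sum_congr rfl fun e _ => ?_
    by_cases h : α e = 0
    · simp [h]
    · rw [← mul_sum, ← mul_sum, sum_ind_of_subset inc e (hS e h).1, (hS e h).2]; ring
  have h2 : ∑ u ∈ S, acodeg inc α v u = ∑ u ∈ S, wcodeg inc α v u - wcodeg inc α v v := by
    rw [← add_sum_erase S _ hv, ← add_sum_erase S _ hv]
    simp only [acodeg, if_true]
    have : ∑ u ∈ S.erase v, (if v = u then 0 else wcodeg inc α v u)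
        = ∑ u ∈ S.erase v, wcodeg inc α v u :=
      sum_congr rfl fun u hu => by rw [if_neg (Ne.symm (ne_of_mem_erase hu))]
    linarith
  rw [h2, h1, wcodeg_self]; ring

/-- The estimated degree loss at `v` when `e` and all edges meeting it are removed. -/
def loss (inc : E → Finset W) (α : E → ℝ) (e : E) (v : W) : ℝ :=
  ∑ u ∈ inc e, acodeg inc α v u

/-- The restriction of a weight to the edges disjoint from `e`. -/
def kill (inc : E → Finset W) (α : E → ℝ) (e : E) (f : E) : ℝ :=
  if Disjoint (inc f) (inc e) then α f else 0

lemma loss_nonneg (inc : E → Finset W) {α : E → ℝ} (hα : ∀ e, 0 ≤ α e) (e : E) (v : W) :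
    0 ≤ loss inc α e v := sum_nonneg fun _ _ => acodeg_nonneg inc hα _ _

lemma loss_le (inc : E → Finset W) {α : E → ℝ} {r : ℕ} {γ : ℝ}
    (hγ : ∀ u v, u ≠ v → wcodeg inc α u v ≤ γ) (hγ0 : 0 ≤ γ) {e : E} (he : (inc e).card = r) (v : W) :
    loss inc α e v ≤ r * γ := by
  unfold loss
  calc _ ≤ ∑ u ∈ inc e, γ := sum_le_sum fun u _ => by
        unfold acodeg; split_ifs with h; exacts [hγ0, hγ _ _ h]
    _ = r * γ := by simp [he]

lemma sum_loss_le (inc : E → Finset W) {α : E → ℝ} (hα : ∀ e, 0 ≤ α e) {r : ℕ} {S : Finset W}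
    (hS : ∀ e, α e ≠ 0 → inc e ⊆ S ∧ (inc e).card = r)
    (hd : ∀ v, wdeg inc α v ≤ 1) {e : E} (he : inc e ⊆ S) (her : (inc e).card = r) (hr : 1 ≤ r) :
    ∑ v ∈ S, loss inc α e v ≤ r ^ 2 := by
  unfold loss
  rw [sum_comm]
  have hr' : (1 : ℝ) ≤ r := by exact_mod_cast hr
  calc _ ≤ ∑ u ∈ inc e, (r : ℝ) := sum_le_sum fun u hu => by
        simp_rw [acodeg_comm inc α _ u]
        rw [sum_acodeg inc α hS (he hu)]
        nlinarith [hd u]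
    _ = r ^ 2 := by simp [her]; ring

lemma loss_eq (inc : E → Finset W) (α : E → ℝ) {e : E} {v : W} (hv : v ∉ inc e) :
    loss inc α e v = ∑ f, α f * (ind inc f v * ((inc e ∩ inc f).card : ℝ)) := by
  unfold loss
  have : ∀ u ∈ inc e, acodeg inc α v u = ∑ f, α f * (ind inc f v * ind inc f u) := by
    intro u hu
    unfold acodeg wcodeg
    rw [if_neg]
    rintro rfl; exact hv hu
  rw [sum_congr rfl this, sum_comm]
  refine sum_congr rfl fun f _ => ?_
  rw [← mul_sum, ← mul_sum, sum_ind]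

/-- Error from edges meeting `e` at least twice. -/
def dbl (inc : E → Finset W) (α : E → ℝ) (e : E) (v : W) : ℝ :=
  ∑ f, α f * (ind inc f v * (((inc e ∩ inc f).card : ℝ) * (((inc e ∩ inc f).card : ℝ) - 1)))

lemma card_mul_pred_nonneg (k : ℕ) : 0 ≤ (k : ℝ) * ((k : ℝ) - 1) := by
  rcases Nat.eq_zero_or_pos k with h | h
  · simp [h]
  · have : (1 : ℝ) ≤ k := by exact_mod_cast h
    nlinarith

lemma dbl_nonneg (inc : E → Finset W) {α : E → ℝ} (hα : ∀ e, 0 ≤ α e) (e : E) (v : W) :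
    0 ≤ dbl inc α e v :=
  sum_nonneg fun _ _ => mul_nonneg (hα _) (mul_nonneg (ind_nonneg ..) (card_mul_pred_nonneg _))

lemma wdeg_kill (inc : E → Finset W) {α : E → ℝ} (hα : ∀ e, 0 ≤ α e) {e : E} {v : W}
    (hv : v ∉ inc e) :
    wdeg inc α v - loss inc α e v ≤ wdeg inc (kill inc α e) v ∧
    wdeg inc (kill inc α e) v ≤ wdeg inc α v - loss inc α e v + dbl inc α e v := by
  rw [loss_eq inc α hv]
  unfold wdeg dbl kill
  rw [← sum_sub_distrib, ← sum_add_distrib]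
  constructor
  all_goals
    refine sum_le_sum fun f _ => ?_
    have h1 := hα f
    have h2 := ind_nonneg inc f v
    have h3 := mul_nonneg h1 h2
    by_cases hd : Disjoint (inc f) (inc e)
    · have : inc e ∩ inc f = ∅ := disjoint_iff_inter_eq_empty.1 hd.symm
      simp [hd, this]
    · have : 1 ≤ (inc e ∩ inc f).card := by
        rw [Nat.one_le_iff_ne_zero, card_ne_zero, ← not_disjoint_iff_nonempty_inter]
        exact fun h => hd h.symm
      have : (1 : ℝ) ≤ ((inc e ∩ inc f).card : ℝ) := by exact_mod_cast this
      simp only [hd, if_false]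
      set c := ((inc e ∩ inc f).card : ℝ)
      nlinarith [mul_nonneg h3 (sub_nonneg.2 this), mul_nonneg h3 (mul_self_nonneg (c - 1))]

lemma wdeg_nonneg (inc : E → Finset W) {α : E → ℝ} (hα : ∀ e, 0 ≤ α e) (v : W) :
    0 ≤ wdeg inc α v :=
  sum_nonneg fun _ _ => mul_nonneg (hα _) (ind_nonneg ..)

lemma wdeg_kill_le (inc : E → Finset W) {α : E → ℝ} (hα : ∀ e, 0 ≤ α e) (e : E) (v : W) :
    wdeg inc (kill inc α e) v ≤ wdeg inc α v := by
  unfold wdeg kill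
  refine sum_le_sum fun f _ => mul_le_mul_of_nonneg_right ?_ (ind_nonneg ..)
  split_ifs; exacts [le_rfl, hα f]

lemma sum_dbl_le (inc : E → Finset W) {α : E → ℝ} {r : ℕ} {γ : ℝ}
    {S : Finset W} (hS : ∀ e, α e ≠ 0 → inc e ⊆ S ∧ (inc e).card = r)
    (hγ : ∀ u v, u ≠ v → wcodeg inc α u v ≤ γ) (hγ0 : 0 ≤ γ) {e : E} (her : (inc e).card = r) :
    ∑ v ∈ S, dbl inc α e v ≤ r ^ 3 * γ := by
  have key : ∑ v ∈ S, dbl inc α e v = r * ∑ u ∈ inc e, loss inc α e u := by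
    unfold dbl loss
    rw [sum_comm]
    have h2 : ∀ u ∈ inc e, ∑ u' ∈ inc e, acodeg inc α u u'
        = ∑ f, α f * (ind inc f u * (((inc e ∩ inc f).card : ℝ) - 1)) := by
      intro u hu
      rw [← add_sum_erase (inc e) (fun u' => acodeg inc α u u') hu]
      have h3 : ∑ x ∈ (inc e).erase u, acodeg inc α u x
          = ∑ x ∈ (inc e).erase u, wcodeg inc α u x :=
        sum_congr rfl fun x hx => by
          unfold acodeg; rw [if_neg (Ne.symm (ne_of_mem_erase hx))]
      rw [h3]
      have h4 : ∑ x ∈ (inc e).erase u, wcodeg inc α u x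
          = ∑ x ∈ inc e, wcodeg inc α u x - wcodeg inc α u u := by
        rw [← add_sum_erase (inc e) (fun u' => wcodeg inc α u u') hu]; ring
      rw [h4]
      unfold acodeg wcodeg
      rw [if_pos rfl, sum_comm, zero_add, ← sum_sub_distrib]
      refine sum_congr rfl fun f _ => ?_
      rw [← mul_sum, ← mul_sum, sum_ind, ind_sq]; ring
    have h2' := sum_congr (rfl : inc e = inc e) h2
    rw [h2', sum_comm (s := inc e), mul_sum]
    refine sum_congr rfl fun f _ => ?_
    by_cases h : α f = 0
    · simp [h]
    · rw [← mul_sum, ← mul_sum, ← sum_mul, ← sum_mul,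
        sum_ind_of_subset inc f (hS f h).1, (hS f h).2, sum_ind]
      ring
  rw [key]
  have : ∑ u ∈ inc e, loss inc α e u ≤ r * (r * γ) := by
    calc _ ≤ ∑ u ∈ inc e, (r * γ : ℝ) := sum_le_sum fun u _ => loss_le inc hγ hγ0 her u
      _ = _ := by simp [her]
  have hr0 : (0 : ℝ) ≤ r := cast_nonneg r
  nlinarith

/-- The quadratic potential. -/
def pot (inc : E → Finset W) (α : E → ℝ) (S : Finset W) (y : ℝ) : ℝ :=
  ∑ v ∈ S, (wdeg inc α v - y) ^ 2

lemma pot_kill_le (inc : E → Finset W) {α : E → ℝ} (hα : ∀ e, 0 ≤ α e) {r : ℕ} {S : Finset W}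
    (hS : ∀ e, α e ≠ 0 → inc e ⊆ S ∧ (inc e).card = r) {γ : ℝ}
    (hγ : ∀ u v, u ≠ v → wcodeg inc α u v ≤ γ) (hγ0 : 0 ≤ γ)
    (hd : ∀ v, wdeg inc α v ≤ 1) {e : E} (he : inc e ⊆ S) (her : (inc e).card = r) (hr : 1 ≤ r)
    {y : ℝ} (hy0 : 0 ≤ y) (hy1 : y ≤ 1) {π : ℝ} (hπ : 0 ≤ π) :
    pot inc (kill inc α e) (S \ inc e) (y - π) ≤
      pot inc α S y + 2 * ∑ v ∈ S, (wdeg inc α v - y) * (π - loss inc α e v)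
        + (2 * r ^ 3 * γ + S.card * π ^ 2 + r ^ 3 * γ + 2 * r * π + 2 * r ^ 2 * γ) := by
  set D := loss inc α e with hD
  set d := wdeg inc α with hdd
  have hDn : ∀ v, 0 ≤ D v := loss_nonneg inc hα e
  have hDl : ∀ v, D v ≤ r * γ := loss_le inc hγ hγ0 her
  have hdn : ∀ v, 0 ≤ d v := wdeg_nonneg inc hα
  have h1 : ∀ v ∈ S \ inc e, (wdeg inc (kill inc α e) v - (y - π)) ^ 2 ≤
      (d v - y) ^ 2 + 2 * ((d v - y) * (π - D v)) + 2 * dbl inc α e v + π ^ 2 + r * γ * D v := by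
    intro v hv
    obtain ⟨ha, hb⟩ := wdeg_kill inc hα (mem_sdiff.1 hv).2
    have hc := wdeg_kill_le inc hα e v
    set d' := wdeg inc (kill inc α e) v
    have := hdn v; have := hd v; have := hDn v; have := hDl v
    have hdb := dbl_nonneg inc hα e v
    have hx : |d v - y| ≤ 1 := by rw [abs_le]; constructor <;> linarith
    -- d' = d - Δ, 0 ≤ Δ ≤ D, D - Δ ≤ dbl
    obtain ⟨Δ, hΔ⟩ : ∃ Δ, Δ = d v - d' := ⟨_, rfl⟩
    have e1 : d' = d v - Δ := by linarith
    have e2 : 0 ≤ Δ := by linarith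
    have e3 : Δ ≤ D v := by linarith
    have e4 : D v - Δ ≤ dbl inc α e v := by linarith
    have e5 : (d v - y) * (D v - Δ) ≤ dbl inc α e v := by
      calc _ ≤ |d v - y| * (D v - Δ) := by
            apply mul_le_mul_of_nonneg_right (le_abs_self _); linarith
        _ ≤ 1 * (D v - Δ) := by apply mul_le_mul_of_nonneg_right hx; linarith
        _ ≤ _ := by linarith
    have e6 : (π - Δ) ^ 2 ≤ π ^ 2 + r * γ * D v := by nlinarith
    rw [e1]
    nlinarith
  have h2 : ∀ v ∈ inc e, 0 ≤ (d v - y) ^ 2 + 2 * ((d v - y) * (π - D v)) + 2 * π + 2 * (r * γ) := by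
    intro v hv
    have := hdn v; have := hd v; have := hDn v; have := hDl v
    have hx : |d v - y| ≤ 1 := by rw [abs_le]; constructor <;> linarith
    have hz : |π - D v| ≤ π + r * γ := by rw [abs_le]; constructor <;> linarith
    have : |(d v - y) * (π - D v)| ≤ 1 * (π + r * γ) := by
      rw [abs_mul]; exact mul_le_mul hx hz (abs_nonneg _) zero_le_one
    have := neg_abs_le ((d v - y) * (π - D v))
    nlinarith [sq_nonneg (d v - y)]
  have h3 := sum_le_sum h1
  have h4 := sum_nonneg h2
  simp only [sum_add_distrib, sum_const, nsmul_eq_mul, ← mul_sum, her] at h3 h4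
  have h5 : ∀ F : W → ℝ, ∑ v ∈ S, F v = ∑ v ∈ S \ inc e, F v + ∑ v ∈ inc e, F v :=
    fun F => (sum_sdiff he).symm
  have h6 := sum_dbl_le inc hS hγ hγ0 her
  have h6' : ∑ v ∈ S \ inc e, dbl inc α e v ≤ ∑ v ∈ S, dbl inc α e v :=
    sum_le_sum_of_subset_of_nonneg sdiff_subset fun v _ _ => dbl_nonneg inc hα e v
  have h7 := sum_loss_le inc hα hS hd he her hr
  have h7' : ∑ v ∈ S \ inc e, D v ≤ ∑ v ∈ S, D v :=
    sum_le_sum_of_subset_of_nonneg sdiff_subset fun v _ _ => hDn v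
  have h8 : ((S \ inc e).card : ℝ) * π ^ 2 ≤ S.card * π ^ 2 := by
    apply mul_le_mul_of_nonneg_right _ (sq_nonneg _)
    exact_mod_cast card_le_card sdiff_subset
  have h9 : (r : ℝ) * γ * ∑ v ∈ S \ inc e, D v ≤ r * γ * r ^ 2 :=
    mul_le_mul_of_nonneg_left (h7'.trans h7) (by positivity)
  unfold pot
  rw [h5 (fun v => (d v - y) ^ 2), h5 (fun v => (d v - y) * (π - D v))]
  nlinarith

lemma sum_wdeg (inc : E → Finset W) (α : E → ℝ) {r : ℕ} {S : Finset W}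
    (hS : ∀ e, α e ≠ 0 → inc e ⊆ S ∧ (inc e).card = r) :
    ∑ v ∈ S, wdeg inc α v = r * ∑ e, α e := by
  unfold wdeg
  rw [sum_comm, mul_sum]
  refine sum_congr rfl fun f _ => ?_
  by_cases h : α f = 0
  · simp [h]
  · rw [← mul_sum, sum_ind_of_subset inc f (hS f h).1, (hS f h).2]; ring

lemma sum_weight_loss (inc : E → Finset W) (α : E → ℝ) {r : ℕ} {S : Finset W}
    (hS : ∀ e, α e ≠ 0 → inc e ⊆ S ∧ (inc e).card = r) (v : W) :
    ∑ e, α e * loss inc α e v = ∑ u ∈ S, acodeg inc α v u * wdeg inc α u := by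
  unfold loss wdeg
  simp_rw [mul_sum]
  rw [sum_comm]
  refine sum_congr rfl fun f _ => ?_
  by_cases h : α f = 0
  · simp [h]
  · rw [← sum_subset (hS f h).1]
    · refine sum_congr rfl fun u hu => ?_
      simp [ind, hu]; ring
    · intro u _ hu
      simp [ind, hu]

lemma average_loss_le (inc : E → Finset W) {α : E → ℝ} (hα : ∀ e, 0 ≤ α e) {r : ℕ} (hr : 1 ≤ r)
    {S : Finset W} (hS : ∀ e, α e ≠ 0 → inc e ⊆ S ∧ (inc e).card = r)
    (hd : ∀ v, wdeg inc α v ≤ 1) {y : ℝ} (hy0 : 0 ≤ y) (hm : 0 < (S.card : ℝ)) :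
    ∑ e, α e * ∑ v ∈ S, (wdeg inc α v - y) * (r * (r - 1) * y / S.card - loss inc α e v)
      ≤ (r - 1) * pot inc α S y := by
  set π : ℝ := r * (r - 1) * y / S.card with hπ
  set x : W → ℝ := fun v => wdeg inc α v - y with hx
  have hr' : (1 : ℝ) ≤ r := by exact_mod_cast hr
  set X := ∑ v ∈ S, x v with hX
  set Φ := pot inc α S y with hΦ
  have hΦ' : Φ = ∑ v ∈ S, x v ^ 2 := rfl
  have hXd : r * ∑ e, α e = S.card * y + X := by
    rw [← sum_wdeg inc α hS, hX]
    simp [hx]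
  have hXX : X ^ 2 ≤ S.card * Φ := by
    rw [hΦ', hX]; exact sq_sum_le_card_mul_sum_sq
  have e1 : ∑ e, α e * ∑ v ∈ S, x v * (π - loss inc α e v)
      = (∑ e, α e) * π * X - ∑ v ∈ S, x v * ∑ u ∈ S, acodeg inc α v u * wdeg inc α u := by
    have : ∀ e, α e * ∑ v ∈ S, x v * (π - loss inc α e v)
        = α e * (π * X) - ∑ v ∈ S, x v * (α e * loss inc α e v) := by
      intro e
      rw [hX, mul_sum, mul_sum, mul_sum, ← sum_sub_distrib]
      exact sum_congr rfl fun v _ => by ring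
    simp_rw [this]
    rw [sum_sub_distrib, ← sum_mul, sum_comm]
    simp_rw [← mul_sum, sum_weight_loss inc α hS]
    ring
  have e2 : ∀ v ∈ S, ∑ u ∈ S, acodeg inc α v u * wdeg inc α u
      = (r - 1) * y * (x v + y) + ∑ u ∈ S, acodeg inc α v u * x u := by
    intro v hv
    have : ∀ u, acodeg inc α v u * wdeg inc α u
        = acodeg inc α v u * y + acodeg inc α v u * x u := fun u => by simp only [hx]; ring
    simp_rw [this]
    rw [sum_add_distrib, ← sum_mul, sum_acodeg inc α hS hv]
    simp only [hx]; ring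
  have e3 : ∑ v ∈ S, x v * ∑ u ∈ S, acodeg inc α v u * wdeg inc α u
      = (r - 1) * y * Φ + (r - 1) * y ^ 2 * X
        + ∑ v ∈ S, ∑ u ∈ S, acodeg inc α v u * (x v * x u) := by
    rw [hΦ', hX, mul_sum, mul_sum, ← sum_add_distrib,
      ← sum_add_distrib]
    refine sum_congr rfl fun v hv => ?_
    rw [e2 v hv, mul_add, mul_sum]
    congr 1
    · ring
    · exact sum_congr rfl fun u _ => by ring
  have e4 : -((r - 1) * Φ) ≤ ∑ v ∈ S, ∑ u ∈ S, acodeg inc α v u * (x v * x u) := by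
    have h1 : ∑ v ∈ S, ∑ u ∈ S, acodeg inc α v u * (x v ^ 2 / 2)
        ≤ (r - 1) * Φ / 2 := by
      rw [hΦ', mul_sum, sum_div]
      refine sum_le_sum fun v hv => ?_
      rw [← sum_mul, sum_acodeg inc α hS hv]
      have : ((r : ℝ) - 1) * wdeg inc α v ≤ (r - 1) * 1 :=
        mul_le_mul_of_nonneg_left (hd v) (by linarith)
      nlinarith [sq_nonneg (x v)]
    have h2 : ∑ v ∈ S, ∑ u ∈ S, acodeg inc α v u * (x u ^ 2 / 2)
        = ∑ v ∈ S, ∑ u ∈ S, acodeg inc α v u * (x v ^ 2 / 2) := by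
      rw [sum_comm]
      exact sum_congr rfl fun v _ => sum_congr rfl fun u _ => by
        rw [acodeg_comm]
    have h3 : ∑ v ∈ S, ∑ u ∈ S, acodeg inc α v u * (-(x v ^ 2 / 2) - (x u ^ 2 / 2))
        ≤ ∑ v ∈ S, ∑ u ∈ S, acodeg inc α v u * (x v * x u) := by
      refine sum_le_sum fun v _ => sum_le_sum fun u _ => ?_
      exact mul_le_mul_of_nonneg_left (by nlinarith [sq_nonneg (x v + x u)])
        (acodeg_nonneg inc hα v u)
    have h4 : ∑ v ∈ S, ∑ u ∈ S, acodeg inc α v u * (-(x v ^ 2 / 2) - (x u ^ 2 / 2))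
        = -(∑ v ∈ S, ∑ u ∈ S, acodeg inc α v u * (x v ^ 2 / 2))
          - ∑ v ∈ S, ∑ u ∈ S, acodeg inc α v u * (x u ^ 2 / 2) := by
      simp_rw [mul_sub, mul_neg, sum_sub_distrib, sum_neg_distrib]
    linarith
  have e5 : (∑ e, α e) * π * X = (r - 1) * y ^ 2 * X + (r - 1) * y * (X ^ 2 / S.card) := by
    have : (∑ e, α e) * r = S.card * y + X := by rw [← hXd]; ring
    have h : (∑ e, α e) * π * X = ((∑ e, α e) * r) * ((r - 1) * y / S.card) * X := by
      rw [hπ]; ring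
    rw [h, this]; field_simp
  have e6 : X ^ 2 / S.card ≤ Φ := by rw [div_le_iff₀ hm]; linarith
  have e7 : (r - 1) * y * (X ^ 2 / S.card) ≤ (r - 1) * y * Φ :=
    mul_le_mul_of_nonneg_left e6 (mul_nonneg (by linarith) hy0)
  rw [e1, e3, e5]
  linarith

lemma exists_good_edge (inc : E → Finset W) {α : E → ℝ} (hα : ∀ e, 0 ≤ α e) {r : ℕ} (hr : 1 ≤ r)
    {S : Finset W} (hS : ∀ e, α e ≠ 0 → inc e ⊆ S ∧ (inc e).card = r) {γ : ℝ}
    (hγ : ∀ u v, u ≠ v → wcodeg inc α u v ≤ γ) (hγ0 : 0 ≤ γ)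
    (hd : ∀ v, wdeg inc α v ≤ 1) {y : ℝ} (hy0 : 0 ≤ y) (hy1 : y ≤ 1) (hm : 0 < (S.card : ℝ))
    (hW : 0 < ∑ e, α e) (bad : Finset E) {β : ℝ} (hβ0 : 0 ≤ β) (hbad : ∑ e ∈ bad, α e ≤ β)
    (hβ : 2 * β ≤ ∑ e, α e) :
    ∃ e, α e ≠ 0 ∧ e ∉ bad ∧ pot inc (kill inc α e) (S \ inc e) (y - r * (r - 1) * y / S.card) ≤
      pot inc α S y + 2 * (2 * ((r - 1) * pot inc α S y) + 4 * r ^ 2 * β) / (∑ e, α e)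
        + (5 * r ^ 3 * γ + 3 * r ^ 4 / S.card) := by
  by_contra hcon
  push Not at hcon
  have hr' : (1 : ℝ) ≤ r := by exact_mod_cast hr
  set π : ℝ := r * (r - 1) * y / S.card with hπ
  have hπ0 : 0 ≤ π := by
    rw [hπ]; apply div_nonneg _ hm.le
    exact mul_nonneg (mul_nonneg (by linarith) (by linarith)) hy0
  have hπ1 : π ≤ r ^ 2 / S.card := by
    rw [hπ]; gcongr
    nlinarith [mul_nonneg (by linarith : (0:ℝ) ≤ r) (by linarith : (0:ℝ) ≤ r - 1)]
  have hK : 2 * r ^ 3 * γ + S.card * π ^ 2 + r ^ 3 * γ + 2 * r * π + 2 * r ^ 2 * γ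
      ≤ 5 * r ^ 3 * γ + 3 * r ^ 4 / S.card := by
    have h1 : (S.card : ℝ) * π ^ 2 ≤ (r : ℝ) ^ 4 / S.card := by
      calc (S.card : ℝ) * π ^ 2 ≤ S.card * ((r : ℝ) ^ 2 / S.card) ^ 2 := by gcongr
        _ = (r : ℝ) ^ 4 / S.card := by field_simp
    have h2 : 2 * r * π ≤ 2 * r ^ 4 / S.card := by
      calc 2 * r * π ≤ 2 * r * (r ^ 2 / S.card) := by gcongr
        _ = 2 * r ^ 3 / S.card := by ring
        _ ≤ 2 * r ^ 4 / S.card := by gcongr; norm_num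
    have h3 : (r : ℝ) ^ 2 * γ ≤ r ^ 3 * γ := by gcongr; norm_num
    have h4 : (3 * r ^ 4 / S.card : ℝ) = r ^ 4 / S.card + 2 * r ^ 4 / S.card := by ring
    linarith
  set Φ := pot inc α S y
  set K : ℝ := 5 * r ^ 3 * γ + 3 * r ^ 4 / S.card
  set T : E → ℝ := fun e => ∑ v ∈ S, (wdeg inc α v - y) * (π - loss inc α e v) with hT
  set X : ℝ := 2 * (2 * ((r - 1) * Φ) + 4 * r ^ 2 * β) / (∑ e, α e) with hX
  have hΦ0 : 0 ≤ Φ := sum_nonneg fun v _ => sq_nonneg _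
  have hX0 : 0 ≤ X := by
    rw [hX]
    have : 0 ≤ (r - 1) * Φ := mul_nonneg (by linarith) hΦ0
    positivity
  have hgood : ∀ e, α e ≠ 0 → e ∉ bad → X < 2 * T e := by
    intro e he hb
    have := pot_kill_le inc hα hS hγ hγ0 hd (hS e he).1 (hS e he).2 hr hy0 hy1 hπ0
    have := hcon e he hb
    simp only [hT]
    linarith
  have hlow : ∀ e, α e ≠ 0 → -(2 * (r : ℝ) ^ 2) ≤ T e := by
    intro e he
    have h1 : ∀ v ∈ S, -(π + loss inc α e v) ≤ (wdeg inc α v - y) * (π - loss inc α e v) := by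
      intro v _
      have a1 := loss_nonneg inc hα e v
      have a2 := wdeg_nonneg inc hα v
      have a3 := hd v
      have hx : |wdeg inc α v - y| ≤ 1 := by rw [abs_le]; constructor <;> linarith
      have hz : |π - loss inc α e v| ≤ π + loss inc α e v := by rw [abs_le]; constructor <;> linarith
      have := mul_le_mul hx hz (abs_nonneg _) zero_le_one
      rw [← abs_mul, one_mul] at this
      linarith [neg_abs_le ((wdeg inc α v - y) * (π - loss inc α e v))]
    have h2 := sum_le_sum h1
    rw [sum_neg_distrib, sum_add_distrib, sum_const, nsmul_eq_mul] at h2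
    have h3 := sum_loss_le inc hα hS hd (hS e he).1 (hS e he).2 hr
    have h4 : S.card * π ≤ (r : ℝ) ^ 2 := by
      calc S.card * π ≤ S.card * ((r : ℝ) ^ 2 / S.card) := by gcongr
        _ = _ := by field_simp
    simp only [hT]
    linarith
  have h2 := average_loss_le inc hα hr hS hd hy0 hm
  change ∑ e, α e * T e ≤ (r - 1) * Φ at h2
  have hWX : (∑ e, α e) * X = 2 * (2 * ((r - 1) * Φ) + 4 * r ^ 2 * β) := by
    rw [hX]; field_simp
  have h4 : ∑ e, α e * (X / 2) - ∑ e ∈ bad, α e * (X / 2 + 2 * r ^ 2)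
      ≥ (∑ e, α e) * (X / 4) - 2 * r ^ 2 * β := by
    rw [← sum_mul, ← sum_mul]
    have : (∑ e ∈ bad, α e) * (X / 2 + 2 * r ^ 2) ≤ β * (X / 2 + 2 * r ^ 2) :=
      mul_le_mul_of_nonneg_right hbad (by positivity)
    nlinarith [mul_le_mul_of_nonneg_right hβ hX0]
  obtain ⟨e0, he0, hb0⟩ : ∃ e, α e ≠ 0 ∧ e ∉ bad := by
    by_contra hall
    push Not at hall
    have : ∑ e, α e ≤ ∑ e ∈ bad, α e := by
      rw [← sum_filter_ne_zero]
      refine sum_le_sum_of_subset_of_nonneg (fun e he => ?_) fun e _ _ => hα e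
      exact hall e (by simpa using he)
    linarith
  have h5 : ∑ e, α e * (X / 2) - ∑ e ∈ bad, α e * (X / 2 + 2 * r ^ 2) < ∑ e, α e * T e := by
    have : ∑ e ∈ bad, α e * (X / 2 + 2 * r ^ 2)
        = ∑ e, (if e ∈ bad then α e * (X / 2 + 2 * r ^ 2) else 0) := by simp
    rw [this, ← sum_sub_distrib]
    refine sum_lt_sum (fun e _ => ?_) ⟨e0, mem_univ _, ?_⟩
    · rcases eq_or_ne (α e) 0 with h | h
      · simp [h]
      · split_ifs with hb
        · nlinarith [mul_le_mul_of_nonneg_left (hlow e h) (hα e)]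
        · rw [sub_zero]
          exact mul_le_mul_of_nonneg_left (by linarith [hgood e h hb]) (hα e)
    · rw [if_neg hb0, sub_zero]
      exact mul_lt_mul_of_pos_left (by linarith [hgood e0 he0 hb0])
        (lt_of_le_of_ne (hα e0) he0.symm)
  linarith

/-- The weight restricted to edges inside `S`. -/
def res (inc : E → Finset W) (w : E → ℝ) (S : Finset W) (f : E) : ℝ :=
  if inc f ⊆ S then w f else 0

lemma kill_res (inc : E → Finset W) (w : E → ℝ) (S : Finset W) (e : E) :
    kill inc (res inc w S) e = res inc w (S \ inc e) := by
  funext f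
  unfold kill res
  simp only [subset_sdiff]
  by_cases h1 : Disjoint (inc f) (inc e) <;> by_cases h2 : inc f ⊆ S <;> simp [h1, h2]

lemma res_nonneg (inc : E → Finset W) {w : E → ℝ} (hw : ∀ e, 0 ≤ w e) (S : Finset W) (f : E) :
    0 ≤ res inc w S f := by unfold res; split_ifs; exacts [hw f, le_rfl]

lemma res_le (inc : E → Finset W) {w : E → ℝ} (hw : ∀ e, 0 ≤ w e) (S : Finset W) (f : E) :
    res inc w S f ≤ w f := by unfold res; split_ifs; exacts [le_rfl, hw f]

lemma wdeg_res_le (inc : E → Finset W) {w : E → ℝ} (hw : ∀ e, 0 ≤ w e) (S : Finset W) (v : W) :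
    wdeg inc (res inc w S) v ≤ wdeg inc w v :=
  sum_le_sum fun f _ => mul_le_mul_of_nonneg_right (res_le inc hw S f) (ind_nonneg ..)

lemma wcodeg_res_le (inc : E → Finset W) {w : E → ℝ} (hw : ∀ e, 0 ≤ w e) (S : Finset W) (u v : W) :
    wcodeg inc (res inc w S) u v ≤ wcodeg inc w u v :=
  sum_le_sum fun f _ => mul_le_mul_of_nonneg_right (res_le inc hw S f)
    (mul_nonneg (ind_nonneg ..) (ind_nonneg ..))

/-- One step of the greedy process, with explicit constants. -/
lemma nibble_step (inc : E → Finset W) {w : E → ℝ} (hw : ∀ e, 0 ≤ w e) {r : ℕ} (hr : 2 ≤ r)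
    (hinc : ∀ e, (inc e).card = r) (hd : ∀ v, wdeg inc w v = 1) {γ : ℝ} (hγ0 : 0 ≤ γ)
    (hγ : ∀ u v, u ≠ v → wcodeg inc w u v ≤ γ) {ε c : ℝ} (hε : 0 < ε) (hc : 0 < c) {n : ℝ}
    (hn : 0 < n) (hnγ : 1 / n ≤ γ) {S : Finset W} (hS : ε * n ≤ S.card)
    {y : ℝ} (hyc : c ≤ y) (hy1 : y ≤ 1)
    (hΦ : pot inc (res inc w S) S y ≤ ε * n * c ^ 2 / 4) (bad : Finset E)
    (hbad : ∑ e ∈ bad, w e ≤ n * γ) (hγs : γ ≤ ε * c / (4 * r)) :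
    ∃ e, inc e ⊆ S ∧ e ∉ bad ∧
      pot inc (res inc w (S \ inc e)) (S \ inc e) (y - r * (r - 1) * y / S.card) ≤
        pot inc (res inc w S) S y * (1 + 8 * r ^ 2 / (ε * c) / n)
          + (5 * r ^ 3 + 3 * r ^ 4 / ε + 16 * r ^ 3 / (ε * c)) * γ := by
  have hm : 0 < (S.card : ℝ) := lt_of_lt_of_le (by positivity) hS
  have hy0 : 0 < y := lt_of_lt_of_le hc hyc
  set α := res inc w S with hα
  have hα0 : ∀ e, 0 ≤ α e := res_nonneg inc hw S
  have hαS : ∀ e, α e ≠ 0 → inc e ⊆ S ∧ (inc e).card = r := by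
    intro e he
    refine ⟨?_, hinc e⟩
    by_contra h
    exact he (by rw [hα]; unfold res; rw [if_neg h])
  set Φ := pot inc α S y with hΦd
  have hΦ0 : 0 ≤ Φ := sum_nonneg fun v _ => sq_nonneg _
  have hr2 : (2 : ℝ) ≤ r := by exact_mod_cast hr
  have hXd : r * ∑ e, α e = S.card * y + ∑ v ∈ S, (wdeg inc α v - y) := by
    rw [← sum_wdeg inc α hαS]; simp
  set X := ∑ v ∈ S, (wdeg inc α v - y)
  have hXX : X ^ 2 ≤ S.card * Φ := sq_sum_le_card_mul_sum_sq
  have hX2 : X ^ 2 ≤ (S.card * y / 2) ^ 2 := by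
    calc X ^ 2 ≤ S.card * (ε * n * c ^ 2 / 4) := hXX.trans (by gcongr)
      _ ≤ S.card * (S.card * y ^ 2 / 4) := by gcongr
      _ = _ := by ring
  have hXl : -(S.card * y / 2) ≤ X := (abs_le_of_sq_le_sq' hX2 (by positivity)).1
  have hWl : ε * n * c / (2 * r) ≤ ∑ e, α e := by
    rw [div_le_iff₀ (by positivity)]
    have : ε * n * c ≤ S.card * y := by gcongr
    linarith
  have hW : 0 < ∑ e, α e := lt_of_lt_of_le (by positivity) hWl
  have hβ : 2 * (n * γ) ≤ ∑ e, α e := by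
    refine le_trans ?_ hWl
    calc 2 * (n * γ) ≤ 2 * (n * (ε * c / (4 * r))) := by gcongr
      _ = _ := by field_simp; norm_num
  obtain ⟨e, he, heb, hle⟩ := exists_good_edge inc hα0 (by omega) hαS
    (fun u v h => (wcodeg_res_le inc hw S u v).trans (hγ u v h)) hγ0
    (fun v => (wdeg_res_le inc hw S v).trans (hd v).le) hy0.le hy1 hm hW bad (mul_nonneg hn.le hγ0)
    ((sum_le_sum fun e _ => res_le inc hw S e).trans hbad) hβ
  refine ⟨e, (hαS e he).1, heb, ?_⟩
  rw [hα, kill_res] at hle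
  refine hle.trans ?_
  have h1 : 2 * (2 * ((r - 1) * Φ) + 4 * r ^ 2 * (n * γ)) / (∑ e, α e)
      ≤ Φ * (8 * r ^ 2 / (ε * c) / n) + 16 * r ^ 3 / (ε * c) * γ := by
    calc _ ≤ 2 * (2 * (r * Φ) + 4 * r ^ 2 * (n * γ)) / (ε * n * c / (2 * r)) := by
          have : ((r : ℝ) - 1) * Φ ≤ r * Φ := by gcongr; linarith
          gcongr
      _ = Φ * (8 * r ^ 2 / (ε * c) / n) + 16 * r ^ 3 / (ε * c) * γ := by field_simp; ring
  have h2 : 3 * (r : ℝ) ^ 4 / S.card ≤ 3 * r ^ 4 / ε * γ := by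
    calc 3 * (r : ℝ) ^ 4 / S.card ≤ 3 * r ^ 4 / (ε * n) := by gcongr
      _ = 3 * r ^ 4 / ε * (1 / n) := by field_simp
      _ ≤ _ := by gcongr
  linarith

/-- **Nibble lemma**: a weighted regular uniform hypergraph with small codegrees has an
almost perfect matching. -/
theorem exists_almost_perfect_matching (r : ℕ) (hr : 2 ≤ r) (ε : ℝ) (hε : 0 < ε) :
    ∃ γ₀ : ℝ, 0 < γ₀ ∧ ∀ {W E : Type} [Fintype W] [DecidableEq W] [Fintype E] [DecidableEq E]
      (inc : E → Finset W) (w : E → ℝ), (∀ e, 0 ≤ w e) → (∀ e, (inc e).card = r) →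
      (∀ v, wdeg inc w v = 1) → (∀ u v, u ≠ v → wcodeg inc w u v ≤ γ₀) →
      ∀ Inv : Finset E → Prop, Inv ∅ →
      (∀ M, Inv M → (∀ e ∈ M, ∀ f ∈ M, e ≠ f → Disjoint (inc e) (inc f)) →
        ∃ bad : Finset E, bad.card ≤ card W ∧
        ∀ e, e ∉ bad → (∀ f ∈ M, Disjoint (inc e) (inc f)) → Inv (insert e M)) →
      ∃ M : Finset E, Inv M ∧ (∀ e ∈ M, ∀ f ∈ M, e ≠ f → Disjoint (inc e) (inc f)) ∧
        ((univ \ M.biUnion inc).card : ℝ) ≤ ε * card W := by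
  have hr2 : (2 : ℝ) ≤ r := by exact_mod_cast hr
  set P : ℝ := 2 * (r - 1) / ε with hP
  have hP0 : 0 < P := div_pos (by linarith) hε
  set c := exp (-P) with hc
  have hc0 : 0 < c := exp_pos _
  set A : ℝ := 8 * r ^ 2 / (ε * c) with hA
  have hA0 : 0 < A := by positivity
  set B : ℝ := 5 * r ^ 3 + 3 * r ^ 4 / ε + 16 * r ^ 3 / (ε * c) with hB
  have hB0 : 0 < B := by positivity
  refine ⟨min (min (ε * c ^ 2 / (4 * (B * exp A))) (ε / (2 * r ^ 2))) (ε * c / (4 * r)),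
    by positivity, ?_⟩
  intro W E _ _ _ _ inc w hw hinc hd hγ Inv hInv0 hInvS
  set γ := min (min (ε * c ^ 2 / (4 * (B * exp A))) (ε / (2 * r ^ 2))) (ε * c / (4 * r))
    with hγd
  have hγ0 : 0 < γ := by rw [hγd]; positivity
  set n : ℝ := ((card W : ℕ) : ℝ) with hn
  rcases isEmpty_or_nonempty W with hWe | ⟨⟨v0⟩⟩
  · exact ⟨∅, hInv0, by simp, by simp [hn]⟩
  have hn0 : 0 < n := by rw [hn]; exact_mod_cast card_pos_iff.2 ⟨v0⟩
  have hnγ : 1 / n ≤ γ := by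
    have h1 := sum_acodeg inc w (S := univ) (r := r)
      (fun e _ => ⟨subset_univ _, hinc e⟩) (mem_univ v0)
    rw [hd v0] at h1
    have h2 : ∑ u, acodeg inc w v0 u ≤ ∑ u : W, γ := sum_le_sum fun u _ => by
      unfold acodeg; split_ifs with h; exacts [hγ0.le, hγ _ _ h]
    simp only [sum_const, nsmul_eq_mul, card_univ] at h2
    rw [div_le_iff₀ hn0]
    linarith
  have hnbig : r * (r - 1) / (ε * n) ≤ 1 / 2 := by
    have : 1 / n ≤ ε / (2 * r ^ 2) := hnγ.trans ((min_le_left _ _).trans (min_le_right _ _))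
    calc r * (r - 1) / (ε * n) = (r * (r - 1) / ε) * (1 / n) := by field_simp
      _ ≤ (r * (r - 1) / ε) * (ε / (2 * r ^ 2)) := by
          apply mul_le_mul_of_nonneg_left this
          apply div_nonneg _ hε.le
          exact mul_nonneg (by linarith) (by linarith)
      _ = (r - 1) / (2 * r) := by field_simp
      _ ≤ 1 / 2 := by rw [div_le_div_iff₀ (by positivity) (by positivity)]; linarith
  set t : ℝ := r * (r - 1) / (ε * n) with ht
  have ht0 : 0 ≤ t := div_nonneg (mul_nonneg (by linarith) (by linarith)) (by positivity)
  by_contra hcon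
  push Not at hcon
  have key : ∀ j : ℕ, ∃ M : Finset E, Inv M ∧ (∀ e ∈ M, ∀ f ∈ M, e ≠ f → Disjoint (inc e) (inc f)) ∧
      (univ \ M.biUnion inc).card + r * j = card W ∧
      ∃ y, exp (-(2 * t * j)) ≤ y ∧ y ≤ 1 ∧
        pot inc (res inc w (univ \ M.biUnion inc)) (univ \ M.biUnion inc) y
          ≤ j * (B * γ) * exp (A / n * j) := by
    intro j
    induction j with
    | zero =>
      refine ⟨∅, hInv0, by simp, by simp, 1, by simp, le_rfl, ?_⟩
      have : res inc w (univ \ (∅ : Finset E).biUnion inc) = w := by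
        funext f; simp [res]
      rw [this]
      simp [pot, hd]
    | succ j ih =>
      obtain ⟨M, hIM, hM, hcard, y, hyl, hy1, hΦ⟩ := ih
      set S := univ \ M.biUnion inc with hS
      have hm : ε * n < (S.card : ℝ) := hcon M hIM hM
      have hcard' : (S.card : ℝ) + r * j = n := by rw [hn]; exact_mod_cast hcard
      have hrj : r * j ≤ n := by
        have : (0 : ℝ) ≤ S.card := cast_nonneg _
        linarith
      have hjn : (j : ℝ) ≤ n := by
        have : (0 : ℝ) ≤ j := cast_nonneg _
        nlinarith
      have htj : 2 * t * j ≤ P := by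
        calc 2 * t * j = (2 * (r - 1) / ε) * (r * j / n) := by rw [ht]; field_simp
          _ ≤ (2 * (r - 1) / ε) * 1 := by
              apply mul_le_mul_of_nonneg_left _ hP0.le
              rw [div_le_one hn0]; exact hrj
          _ = P := by rw [hP]; ring
      have hyc : c ≤ y := le_trans (exp_le_exp.2 (by linarith)) hyl
      have hy0 : 0 < y := lt_of_lt_of_le hc0 hyc
      have hexp : exp (A / n * j) ≤ exp A := by
        apply exp_le_exp.2
        rw [div_mul_eq_mul_div, div_le_iff₀ hn0]
        exact mul_le_mul_of_nonneg_left hjn hA0.le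
      have hΦs : pot inc (res inc w S) S y ≤ ε * n * c ^ 2 / 4 := by
        refine hΦ.trans ?_
        calc j * (B * γ) * exp (A / n * j) ≤ n * (B * γ) * exp A := by gcongr
          _ = n * (B * exp A) * γ := by ring
          _ ≤ n * (B * exp A) * (ε * c ^ 2 / (4 * (B * exp A))) := by
              gcongr; exact (min_le_left _ _).trans (min_le_left _ _)
          _ = ε * n * c ^ 2 / 4 := by field_simp
      obtain ⟨bad, hbc, hbI⟩ := hInvS M hIM hM
      have hwγ : ∀ e, w e ≤ γ := by
        intro e
        obtain ⟨u, hu, v, hv, huv⟩ := one_lt_card.1 (by rw [hinc e]; omega : 1 < (inc e).card)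
        refine le_trans ?_ (hγ u v huv)
        unfold wcodeg
        have := single_le_sum (f := fun e => w e * (ind inc e u * ind inc e v))
          (fun e _ => mul_nonneg (hw e) (mul_nonneg (ind_nonneg ..) (ind_nonneg ..))) (mem_univ e)
        simpa [ind, hu, hv] using this
      have hbw : ∑ e ∈ bad, w e ≤ n * γ := by
        calc _ ≤ ∑ e ∈ bad, γ := sum_le_sum fun e _ => hwγ e
          _ = bad.card * γ := by simp
          _ ≤ n * γ := by rw [hn]; gcongr
      obtain ⟨e, heS, heb, he⟩ := nibble_step (S := S) inc hw hr hinc hd hγ0.le hγ hε hc0 hn0 hnγ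
        hm.le hyc hy1 hΦs bad hbw (min_le_right _ _)
      have hSM : S \ inc e = univ \ (insert e M).biUnion inc := by
        rw [hS, biUnion_insert]; ext; simp; tauto
      have hdis : ∀ f ∈ M, Disjoint (inc e) (inc f) := by
        intro f hf
        rw [disjoint_left]
        intro x hx hxf
        have := heS hx
        rw [hS, mem_sdiff] at this
        exact this.2 (mem_biUnion.2 ⟨f, hf, hxf⟩)
      refine ⟨insert e M, hbI e heb hdis, ?_, ?_, y - r * (r - 1) * y / S.card, ?_, ?_, ?_⟩
      · intro f hf g hg hfg
        rw [mem_insert] at hf hg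
        rcases hf with rfl | hf <;> rcases hg with rfl | hg
        · exact absurd rfl hfg
        · exact hdis g hg
        · exact (hdis f hf).symm
        · exact hM f hf g hg hfg
      · rw [← hSM, card_sdiff_of_subset heS, hinc]
        have := card_le_card heS
        rw [hinc] at this
        rw [mul_add]; omega
      · have h1 : r * (r - 1) * y / S.card ≤ t * y := by
          rw [ht, div_mul_eq_mul_div]
          have : 0 ≤ r * (r - 1) * y :=
            mul_nonneg (mul_nonneg (by linarith) (by linarith)) hy0.le
          gcongr
        have h2 : exp (-(2 * t)) ≤ 1 - t := by
          have h3 : exp (-(2 * t)) ≤ 1 / (1 + 2 * t) := by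
            rw [Real.exp_neg, ← one_div]
            apply one_div_le_one_div_of_le (by linarith)
            linarith [Real.add_one_le_exp (2 * t)]
          refine h3.trans ?_
          rw [div_le_iff₀ (by linarith)]
          nlinarith
        have h4 : exp (-(2 * t * (j + 1 : ℕ))) = exp (-(2 * t)) * exp (-(2 * t * j)) := by
          rw [← exp_add]; push_cast; ring_nf
        rw [h4]
        calc _ ≤ (1 - t) * y := by
              apply mul_le_mul h2 hyl (exp_pos _).le; linarith
          _ ≤ _ := by linarith
      · have : 0 ≤ r * (r - 1) * y / S.card :=
          div_nonneg (mul_nonneg (mul_nonneg (by linarith) (by linarith)) hy0.le) (cast_nonneg _)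
        linarith
      · rw [← hSM]
        refine he.trans ?_
        have h1 : 1 + A / n ≤ exp (A / n) := by linarith [Real.add_one_le_exp (A / n)]
        have h2 : exp (A / n * (j + 1 : ℕ)) = exp (A / n * j) * exp (A / n) := by
          rw [← exp_add]; push_cast; ring_nf
        have h3 : 1 ≤ exp (A / n * (j + 1 : ℕ)) := by
          apply Real.one_le_exp; positivity
        have h4 : 0 ≤ pot inc (res inc w S) S y := sum_nonneg fun v _ => sq_nonneg _
        calc pot inc (res inc w S) S y * (1 + A / n) + B * γ
            ≤ (j * (B * γ) * exp (A / n * j)) * exp (A / n) + (B * γ) * 1 := by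
              rw [mul_one]
              gcongr
          _ ≤ (j * (B * γ) * exp (A / n * j)) * exp (A / n)
              + (B * γ) * exp (A / n * (j + 1 : ℕ)) := by
              gcongr
          _ = _ := by rw [h2]; push_cast; ring
  obtain ⟨M, _, _, hcard, _⟩ := key (card W + 1)
  have : card W + 1 ≤ r * (card W + 1) := Nat.le_mul_of_pos_left _ (by omega)
  omega

end Nibble

/-- A matrix close to `D` times the identity in row sums can be inverted with a bound. -/
lemma exists_solution_of_near_scalar {W : Type} [Fintype W] [DecidableEq W] (A : W → W → ℝ)
    {D : ℝ} (hD : 0 < D) (hA : ∀ v, ∑ u, |A v u - if u = v then D else 0| ≤ D / 2)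
    (b : W → ℝ) {B : ℝ} (hb : ∀ v, |b v| ≤ B) :
    ∃ a : W → ℝ, (∀ v, ∑ u, A v u * a u = b v) ∧ ∀ v, |a v| ≤ 2 * B / D := by
  let T : (W → ℝ) →ₗ[ℝ] (W → ℝ) := Matrix.toLin' (Matrix.of A)
  have hT : ∀ a v, T a v = ∑ u, A v u * a u := by
    intro a v; simp [T, Matrix.mulVec, dotProduct]
  have key : ∀ a : W → ℝ, ∀ B : ℝ, (∀ v, |T a v| ≤ B) → ∀ v, |a v| ≤ 2 * B / D := by
    intro a B hB v
    have hne : (univ : Finset W).Nonempty := ⟨v, mem_univ v⟩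
    obtain ⟨v0, -, hv0⟩ := exists_max_image univ (fun v => |a v|) hne
    have h1 : |T a v0 - D * a v0| ≤ D / 2 * |a v0| := by
      have : T a v0 - D * a v0 = ∑ u, (A v0 u - if u = v0 then D else 0) * a u := by
        rw [hT]; simp [sub_mul, sum_sub_distrib]
      rw [this]
      calc _ ≤ ∑ u, |(A v0 u - if u = v0 then D else 0) * a u| := abs_sum_le_sum_abs _ _
        _ ≤ ∑ u, |A v0 u - if u = v0 then D else 0| * |a v0| := by
            refine sum_le_sum fun u _ => ?_
            rw [abs_mul]
            exact mul_le_mul_of_nonneg_left (hv0 u (mem_univ u)) (abs_nonneg _)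
        _ ≤ _ := by
            rw [← sum_mul]
            exact mul_le_mul_of_nonneg_right (hA v0) (abs_nonneg _)
    have h2 : D * |a v0| ≤ D / 2 * |a v0| + B := by
      calc D * |a v0| = |D * a v0| := by rw [abs_mul, abs_of_pos hD]
        _ = |(D * a v0 - T a v0) + T a v0| := by ring_nf
        _ ≤ |D * a v0 - T a v0| + |T a v0| := abs_add_le _ _
        _ ≤ _ := by rw [abs_sub_comm]; exact add_le_add h1 (hB v0)
    refine (hv0 v (mem_univ v)).trans ?_
    rw [le_div_iff₀ hD]
    linarith
  have hinj : Injective T := by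
    rw [← LinearMap.ker_eq_bot, LinearMap.ker_eq_bot']
    intro a ha
    funext v
    have := key a 0 (fun v => by rw [ha]; simp) v
    simpa using this
  obtain ⟨a, ha⟩ := (LinearMap.injective_iff_surjective.1 hinj) b
  refine ⟨a, fun v => by rw [← hT, ha], key a B fun v => by rw [ha]; exact hb v⟩

/-- A nearly regular hypergraph with class structure and nearly constant codegrees carries a
regular weighting. -/
theorem exists_regular_weight {W E J : Type} [Fintype W] [DecidableEq W] [Fintype E]
    [DecidableEq E] [DecidableEq J] (inc : E → Finset W) (cl : W → J) (r r1 L : ℕ)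
    (hr : ∀ e, (inc e).card = r) (hcl : ∀ e v, ((inc e).filter (fun u => cl u = cl v)).card = r1)
    (hL : ∀ v, (univ.filter (fun u => cl u = cl v)).card = L)
    {D η : ℝ} (hD : 0 < D) (hη : r * η ≤ 1 / 4) (hη1 : 0 ≤ η) (hη2 : η ≤ 1 / 2)
    (hdeg : ∀ v, |wdeg inc 1 v - D| ≤ η * D) (κ : J → J → ℝ)
    (hcod : ∀ v, ∑ u, |wcodeg inc 1 v u - κ (cl v) (cl u) - if u = v then D else 0| ≤ D / 2) :
    ∃ w : E → ℝ, (∀ e, 0 ≤ w e) ∧ (∀ v, wdeg inc w v = 1) ∧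
      ∀ u v, wcodeg inc w u v ≤ 6 * wcodeg inc 1 u v / D := by
  rcases isEmpty_or_nonempty W with hWe | ⟨⟨v0⟩⟩
  · exact ⟨fun _ => 0, fun _ => le_rfl, fun v => (hWe.false v).elim, fun v => (hWe.false v).elim⟩
  obtain ⟨a, ha, hab⟩ := exists_solution_of_near_scalar
    (fun v u => wcodeg inc 1 v u - κ (cl v) (cl u)) hD hcod (fun v => D - wdeg inc 1 v)
    (B := η * D) (fun v => by rw [abs_sub_comm]; exact hdeg v)
  have hab' : ∀ v, |a v| ≤ 2 * η := fun v => (hab v).trans (by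
    apply le_of_eq; field_simp)
  set w : E → ℝ := fun e => 1 + ∑ u ∈ inc e, a u with hw
  have hwb : ∀ e, |∑ u ∈ inc e, a u| ≤ 1 / 2 := by
    intro e
    calc _ ≤ ∑ u ∈ inc e, |a u| := abs_sum_le_sum_abs _ _
      _ ≤ ∑ u ∈ inc e, 2 * η := sum_le_sum fun u _ => hab' u
      _ = 2 * (r * η) := by rw [sum_const, hr]; simp; ring
      _ ≤ 1 / 2 := by linarith
  have hw1 : ∀ e, 1 / 2 ≤ w e := fun e => by have := (abs_le.1 (hwb e)).1; simp only [hw]; linarith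
  have hw2 : ∀ e, w e ≤ 3 / 2 := fun e => by have := (abs_le.1 (hwb e)).2; simp only [hw]; linarith
  have hdw : ∀ v, wdeg inc w v = D + ∑ u, κ (cl v) (cl u) * a u := by
    intro v
    have h1 : wdeg inc w v = wdeg inc 1 v + ∑ u, wcodeg inc 1 v u * a u := by
      unfold wdeg wcodeg
      simp_rw [sum_mul]
      rw [sum_comm, ← sum_add_distrib]
      refine sum_congr rfl fun e _ => ?_
      have : ∑ u ∈ inc e, a u = ∑ u, ind inc e u * a u := by
        simp [ind, sum_ite_mem]
      simp only [hw, this, Pi.one_apply, add_mul, one_mul, sum_mul]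
      congr 1
      exact sum_congr rfl fun u _ => by ring
    have h2 := ha v
    simp_rw [sub_mul, sum_sub_distrib] at h2
    rw [h1]; linarith
  have hcls : ∀ u v, cl u = cl v → wdeg inc w u = wdeg inc w v := by
    intro u v h; rw [hdw, hdw, h]
  have hL0 : 0 < L := by
    rw [← hL v0]; exact card_pos.2 ⟨v0, by simp⟩
  have hsum : ∀ v, L * wdeg inc w v = r1 * ∑ e, w e := by
    intro v
    have h1 : ∑ u ∈ univ.filter (fun u => cl u = cl v), wdeg inc w u = L * wdeg inc w v := by
      rw [sum_congr rfl (fun u hu => hcls u v (mem_filter.1 hu).2), sum_const,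
        hL]; simp
    rw [← h1]
    unfold wdeg
    rw [sum_comm, mul_sum]
    refine sum_congr rfl fun e _ => ?_
    rw [← mul_sum, mul_comm]
    congr 1
    have : ∑ u ∈ univ.filter (fun u => cl u = cl v), ind inc e u
        = (((inc e).filter (fun u => cl u = cl v)).card : ℝ) := by
      simp only [ind, sum_boole]
      congr 2; ext; simp [and_comm]
    rw [this, hcl]
  set lam := wdeg inc w v0 with hlam
  have hall : ∀ v, wdeg inc w v = lam := by
    intro v
    have hLr : (0 : ℝ) < L := by exact_mod_cast hL0
    have := (hsum v).trans (hsum v0).symm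
    exact mul_left_cancel₀ hLr.ne' this
  have hlamD : D / 4 ≤ lam := by
    have h1 : wdeg inc 1 v0 / 2 ≤ lam := by
      rw [hlam]; unfold wdeg
      rw [sum_div]
      refine sum_le_sum fun e _ => ?_
      have := mul_le_mul_of_nonneg_right (hw1 e) (ind_nonneg inc e v0)
      simp only [Pi.one_apply]
      linarith
    have h2 := (abs_le.1 (hdeg v0)).1
    nlinarith
  have hlam0 : 0 < lam := by linarith
  refine ⟨fun e => w e / lam, fun e => div_nonneg (by linarith [hw1 e]) hlam0.le, fun v => ?_,
    fun u v => ?_⟩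
  · have : wdeg inc (fun e => w e / lam) v = wdeg inc w v / lam := by
      unfold wdeg; rw [sum_div]; exact sum_congr rfl fun e _ => by ring
    rw [this, hall, div_self hlam0.ne']
  · have h1 : wcodeg inc (fun e => w e / lam) u v ≤ (3 / 2 / (D / 4)) * wcodeg inc 1 u v := by
      unfold wcodeg
      rw [mul_sum]
      refine sum_le_sum fun e _ => ?_
      rw [Pi.one_apply, one_mul]
      apply mul_le_mul_of_nonneg_right _ (mul_nonneg (ind_nonneg ..) (ind_nonneg ..))
      have := hw2 e
      show w e / lam ≤ _
      gcongr
    refine h1.trans (le_of_eq ?_)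
    field_simp; ring

section Forms
variable {I J G Ω : Type} [Fintype I] [DecidableEq I] [Fintype J] [DecidableEq J]
  [Fintype G] [DecidableEq G] [Fintype Ω] [DecidableEq Ω]

/-- Any two of the forms are jointly uniform. -/
abbrev Unif (F : I → Ω → G) (κ : ℕ) : Prop :=
  ∀ i i', i ≠ i' → ∀ g g', (univ.filter fun ω => F i ω = g ∧ F i' ω = g').card = κ

/-- The forms `F i ω` take values in the prescribed sets, and values in the same class are
distinct. -/
def FormsValid (cl : I → J) (F : I → Ω → G) (A : J → Finset G) (ω : Ω) : Prop :=
  (∀ i, F i ω ∈ A (cl i)) ∧ ∀ i i', cl i = cl i' → F i ω = F i' ω → i = i'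

/-- Two parameters have no value in common. -/
def FormsDisj (cl : I → J) (F : I → Ω → G) (ω ω' : Ω) : Prop :=
  ∀ i i', cl i = cl i' → F i ω ≠ F i' ω'

lemma card_fibre (F : I → Ω → G) {κ : ℕ}
    (hF : Unif F κ)
    {i i' : I} (h : i ≠ i') (g : G) (B : Finset G) :
    (univ.filter fun ω => F i ω = g ∧ F i' ω ∈ B).card = B.card * κ := by
  have : (univ.filter fun ω => F i ω = g ∧ F i' ω ∈ B)
      = B.biUnion fun g' => univ.filter fun ω => F i ω = g ∧ F i' ω = g' := by
    ext ω; simp [and_comm]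
  rw [this, card_biUnion]
  · simp [hF i i' h]
  · intro a _ b _ hab
    rw [onFun, disjoint_left]
    intro ω h1 h2
    simp only [mem_filter, mem_univ, true_and] at h1 h2
    exact hab (h1.2.symm.trans h2.2)

lemma card_coincide (F : I → Ω → G) {κ : ℕ}
    (hF : Unif F κ)
    {i i' : I} (h : i ≠ i') :
    (univ.filter fun ω => F i ω = F i' ω).card = card G * κ := by
  have : (univ.filter fun ω => F i ω = F i' ω)
      = univ.biUnion fun g => univ.filter fun ω => F i ω = g ∧ F i' ω = g := by
    ext ω; simp [eq_comm]
  rw [this, card_biUnion]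
  · simp [hF i i' h]
  · intro a _ b _ hab
    rw [onFun, disjoint_left]
    intro ω h1 h2
    simp only [mem_filter, mem_univ, true_and] at h1 h2
    exact hab (h1.1.symm.trans h2.1)

/-- The number of parameters with prescribed value of one form and a coincidence. -/
def coll (F : I → Ω → G) (t : I × I × I) (g : G) : ℕ :=
  (univ.filter fun ω => F t.1 ω = g ∧ F t.2.1 ω = F t.2.2 ω).card

/-- Values with too many coincidences. -/
noncomputable def excValues (F : I → Ω → G) (b : ℝ) : Finset G :=
  univ.filter fun g => ∃ t : I × I × I, t.2.1 ≠ t.2.2 ∧ b < coll F t g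

lemma card_excValues (F : I → Ω → G) {κ : ℕ} (hκ : 0 < κ)
    (hF : Unif F κ)
    {τ : ℝ} (hτ : 0 < τ) :
    ((excValues F (τ * κ * card G)).card : ℝ) ≤ card I ^ 3 / τ := by
  classical
  rcases isEmpty_or_nonempty G with hG | hG
  · have : excValues F (τ * κ * card G) = ∅ := by
      ext g; exact hG.elim g
    rw [this]; simp; positivity
  have hn : (0 : ℝ) < card G := by exact_mod_cast Fintype.card_pos
  set b : ℝ := τ * κ * card G with hb
  have hb0 : 0 < b := by positivity
  have h1 : excValues F b ⊆ univ.biUnion fun t : I × I × I =>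
      univ.filter fun g => t.2.1 ≠ t.2.2 ∧ b < coll F t g := by
    intro g hg
    simp only [excValues, mem_filter, mem_univ, true_and] at hg
    simpa using hg
  have h2 : ∀ t : I × I × I,
      ((univ.filter fun g => t.2.1 ≠ t.2.2 ∧ b < (coll F t g : ℝ)).card : ℝ) ≤ 1 / τ := by
    intro t
    by_cases ht : t.2.1 = t.2.2
    · simp [ht, hτ.le]
    have h3 : ∑ g, coll F t g = card G * κ := by
      rw [← card_coincide F hF ht]
      unfold coll
      rw [← card_biUnion]
      · congr 1; ext ω; simp
      · intro a _ c _ hac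
        rw [onFun, disjoint_left]
        intro ω h1 h2
        simp only [mem_filter, mem_univ, true_and] at h1 h2
        exact hac (h1.1.symm.trans h2.1)
    have h4 : ((univ.filter fun g => t.2.1 ≠ t.2.2 ∧ b < (coll F t g : ℝ)).card : ℝ) * b
        ≤ ∑ g, (coll F t g : ℝ) := by
      calc _ = ∑ g ∈ univ.filter fun g => t.2.1 ≠ t.2.2 ∧ b < (coll F t g : ℝ), b := by simp
        _ ≤ ∑ g ∈ univ.filter fun g => t.2.1 ≠ t.2.2 ∧ b < (coll F t g : ℝ), (coll F t g : ℝ) :=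
            sum_le_sum fun g hg => by
              simp only [mem_filter, mem_univ, true_and] at hg; exact hg.2.le
        _ ≤ _ := sum_le_sum_of_subset_of_nonneg (subset_univ _)
              fun g _ _ => cast_nonneg _
    have h5 : ∑ g, (coll F t g : ℝ) = card G * κ := by exact_mod_cast h3
    rw [h5] at h4
    have : (card G * κ : ℝ) = 1 / τ * b := by rw [hb]; field_simp
    rw [this] at h4
    exact le_of_mul_le_mul_right h4 hb0
  calc ((excValues F b).card : ℝ) ≤ ∑ t : I × I × I,
        ((univ.filter fun g => t.2.1 ≠ t.2.2 ∧ b < (coll F t g : ℝ)).card : ℝ) := by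
        exact_mod_cast (card_le_card h1).trans card_biUnion_le
    _ ≤ ∑ t : I × I × I, 1 / τ := sum_le_sum fun t _ => h2 t
    _ = _ := by simp; ring

/-- The hypergraph of valid parameters: vertices are pairs (class, allowed value). -/
def formInc (cl : I → J) (F : I → Ω → G) (A : J → Finset G)
    (e : {ω : Ω // FormsValid cl F A ω}) : Finset {p : J × G // p.2 ∈ A p.1} :=
  univ.image fun i => ⟨(cl i, F i e.1), e.2.1 i⟩

lemma mem_formInc {cl : I → J} {F : I → Ω → G} {A : J → Finset G}
    {e : {ω : Ω // FormsValid cl F A ω}} {p : {p : J × G // p.2 ∈ A p.1}} :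
    p ∈ formInc cl F A e ↔ ∃ i, cl i = p.1.1 ∧ F i e.1 = p.1.2 := by
  obtain ⟨⟨j, g⟩, h⟩ := p
  simp [formInc]

lemma formInc_inj {cl : I → J} {F : I → Ω → G} {A : J → Finset G}
    (e : {ω : Ω // FormsValid cl F A ω}) : Injective
      (fun i => (⟨(cl i, F i e.1), e.2.1 i⟩ : {p : J × G // p.2 ∈ A p.1})) := by
  intro i i' h
  simp only [Subtype.mk.injEq, Prod.mk.injEq] at h
  exact e.2.2 i i' h.1 h.2

open Classical in
lemma ind_formInc {cl : I → J} {F : I → Ω → G} {A : J → Finset G}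
    (e : {ω : Ω // FormsValid cl F A ω}) (p : {p : J × G // p.2 ∈ A p.1}) :
    ind (formInc cl F A) e p
      = ∑ i ∈ univ.filter (fun i => cl i = p.1.1), if F i e.1 = p.1.2 then (1 : ℝ) else 0 := by
  unfold ind
  split_ifs with h
  · obtain ⟨i, hi, hi'⟩ := mem_formInc.1 h
    rw [sum_eq_single_of_mem i (by simp [hi])]
    · simp [hi']
    · intro b hb hbi
      rw [if_neg]
      intro hb'
      exact hbi (e.2.2 b i ((mem_filter.1 hb).2.trans hi.symm) (hb'.trans hi'.symm))
  · symm
    apply sum_eq_zero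
    intro i hi
    rw [if_neg]
    intro hi'
    exact h (mem_formInc.2 ⟨i, (mem_filter.1 hi).2, hi'⟩)

open Classical in
lemma sum_valid_eq {cl : I → J} {F : I → Ω → G} {A : J → Finset G} (P : Ω → Prop)
    [DecidablePred P] :
    (∑ e : {ω : Ω // FormsValid cl F A ω}, if P e.1 then (1 : ℝ) else 0)
      = ((univ.filter fun ω => FormsValid cl F A ω ∧ P ω).card : ℝ) := by
  rw [sum_boole]
  congr 1
  rw [← card_map (Embedding.subtype _)]
  congr 1
  ext ω
  simp [and_comm]

open Classical in
lemma card_valid_ge {cl : I → J} {F : I → Ω → G} {A : J → Finset G} {κ L : ℕ}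
    (hF : Unif F κ)
    (hI : 2 ≤ card I) (hA : ∀ j, (A j).card = L) {b : ℝ} {i : I} {g : G}
    (hg : g ∈ A (cl i)) (hge : g ∉ excValues F b) (hb : 0 ≤ b) :
    (card G * κ : ℝ) - card I * ((card G - L) * κ)
      - card I ^ 2 * b
      ≤ ((univ.filter fun ω => FormsValid cl F A ω ∧ F i ω = g).card : ℝ) := by
  have : Nontrivial I := Fintype.one_lt_card_iff_nontrivial.1 (by omega)
  obtain ⟨i', hi'⟩ := exists_ne i
  have h0 : (univ.filter fun ω => F i ω = g).card = card G * κ := by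
    have := card_fibre F hF hi'.symm g univ
    simpa using this
  have hLn : L ≤ card G := by rw [← hA (cl i)]; exact card_le_univ _
  have hsub : (univ.filter fun ω => F i ω = g) ⊆
      (univ.filter fun ω => FormsValid cl F A ω ∧ F i ω = g) ∪
      ((univ.biUnion fun i1 : I => univ.filter fun ω => i1 ≠ i ∧ F i ω = g ∧ F i1 ω ∈ (A (cl i1))ᶜ) ∪
      (univ.biUnion fun t : I × I => univ.filter fun ω => t.1 ≠ t.2 ∧ F i ω = g ∧ F t.1 ω = F t.2 ω)) := by
    intro ω hω
    have hω := (mem_filter.1 hω).2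
    by_contra hcon
    simp only [mem_union, mem_filter, mem_univ, true_and, mem_biUnion, not_or, not_exists,
      not_and, mem_compl, not_not] at hcon
    refine hcon.1 ⟨fun i1 => ?_, fun i1 i2 _ h12 => ?_⟩ hω
    · by_cases h1 : i1 = i
      · subst h1; rw [hω]; exact hg
      · exact hcon.2.1 i1 h1 hω
    · by_contra h1
      exact hcon.2.2 (i1, i2) h1 hω h12
  have hc := (card_le_card hsub).trans ((card_union_le _ _).trans
    (Nat.add_le_add_left (card_union_le _ _) _))
  have hc1 : ((univ.biUnion fun i1 : I => univ.filter fun ω => i1 ≠ i ∧ F i ω = g ∧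
      F i1 ω ∈ (A (cl i1))ᶜ).card : ℝ) ≤ card I * ((card G - L) * κ) := by
    have h1 : (univ.biUnion fun i1 : I => univ.filter fun ω => i1 ≠ i ∧ F i ω = g ∧
      F i1 ω ∈ (A (cl i1))ᶜ).card ≤ ∑ i1 : I, (card G - L) * κ := by
      refine card_biUnion_le.trans (sum_le_sum fun i1 _ => ?_)
      by_cases h1 : i1 = i
      · simp [h1]
      · rw [← hA (cl i1), ← card_compl, ← card_fibre F hF (Ne.symm h1) g]
        exact card_le_card fun ω hω => by simpa [h1] using hω
    have h2 : ((∑ i1 : I, (card G - L) * κ : ℕ) : ℝ)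
        = card I * ((card G - L) * κ) := by
      simp [cast_sub hLn]
    rw [← h2]; exact_mod_cast h1
  have hc2 : ((univ.biUnion fun t : I × I => univ.filter fun ω => t.1 ≠ t.2 ∧ F i ω = g ∧
      F t.1 ω = F t.2 ω).card : ℝ) ≤ card I ^ 2 * b := by
    have h1 : ((univ.biUnion fun t : I × I => univ.filter fun ω => t.1 ≠ t.2 ∧ F i ω = g ∧
      F t.1 ω = F t.2 ω).card : ℝ) ≤ ∑ t : I × I, b := by
      refine le_trans (b := ∑ t : I × I, ((univ.filter fun ω => t.1 ≠ t.2 ∧ F i ω = g ∧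
        F t.1 ω = F t.2 ω).card : ℝ)) (by exact_mod_cast card_biUnion_le)
        (sum_le_sum fun t _ => ?_)
      by_cases ht : t.1 = t.2
      · simp [ht, hb]
      · have : ¬ b < coll F (i, t) g := fun h => hge (by
          simp only [excValues, mem_filter, mem_univ, true_and]
          exact ⟨(i, t), ht, h⟩)
        refine le_trans ?_ (not_lt.1 this)
        simp [coll, ht]
    refine h1.trans (le_of_eq ?_)
    simp [sq]
  rw [h0] at hc
  have hc' := (cast_le (α := ℝ)).2 hc
  push_cast at hc'
  linarith

open Classical in
lemma card_valid_le {cl : I → J} {F : I → Ω → G} {A : J → Finset G} {κ : ℕ}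
    (hF : Unif F κ)
    (hI : 2 ≤ card I) (i : I) (g : G) :
    (univ.filter fun ω => FormsValid cl F A ω ∧ F i ω = g).card ≤ card G * κ := by
  have : Nontrivial I := Fintype.one_lt_card_iff_nontrivial.1 (by omega)
  obtain ⟨i', hi'⟩ := exists_ne i
  have h0 := card_fibre F hF hi'.symm g univ
  rw [card_univ] at h0
  rw [← h0]
  exact card_le_card fun ω hω => by
    simp only [mem_filter, mem_univ, true_and, and_true] at hω ⊢; exact hω.2

open Classical in
lemma wdeg_formInc {cl : I → J} {F : I → Ω → G} {A : J → Finset G}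
    (p : {p : J × G // p.2 ∈ A p.1}) :
    wdeg (formInc cl F A) 1 p = ∑ i ∈ univ.filter (fun i => cl i = p.1.1),
      ((univ.filter fun ω => FormsValid cl F A ω ∧ F i ω = p.1.2).card : ℝ) := by
  unfold wdeg
  simp only [ind_formInc, Pi.one_apply, one_mul]
  rw [sum_comm]
  exact sum_congr rfl fun i _ => sum_valid_eq fun ω => F i ω = p.1.2

open Classical in
lemma wcodeg_formInc_le {cl : I → J} {F : I → Ω → G} {A : J → Finset G} {κ : ℕ}
    (hF : Unif F κ)
    {p q : {p : J × G // p.2 ∈ A p.1}} (hpq : p ≠ q) :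
    wcodeg (formInc cl F A) 1 p q ≤ ∑ i ∈ univ.filter (fun i => cl i = p.1.1),
      ∑ i' ∈ univ.filter (fun i => cl i = q.1.1), if i = i' then (0 : ℝ) else κ := by
  unfold wcodeg
  simp only [ind_formInc, Pi.one_apply, one_mul, sum_mul_sum]
  rw [sum_comm]
  refine sum_le_sum fun i hi => ?_
  rw [sum_comm]
  refine sum_le_sum fun i' hi' => ?_
  have h1 : (∑ e : {ω : Ω // FormsValid cl F A ω}, ((if F i e.1 = p.1.2 then (1 : ℝ) else 0) *
      if F i' e.1 = q.1.2 then 1 else 0))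
      = ((univ.filter fun ω => FormsValid cl F A ω ∧ (F i ω = p.1.2 ∧ F i' ω = q.1.2)).card : ℝ) := by
    rw [← sum_valid_eq fun ω => F i ω = p.1.2 ∧ F i' ω = q.1.2]
    refine sum_congr rfl fun e _ => ?_
    by_cases h1 : F i e.1 = p.1.2 <;> by_cases h2 : F i' e.1 = q.1.2 <;> simp [h1, h2]
  rw [h1]
  split_ifs with h
  · subst h
    norm_cast
    rw [Nat.le_zero, card_eq_zero, filter_eq_empty_iff]
    rintro ω - ⟨-, h2, h3⟩
    apply hpq
    ext1
    exact Prod.ext ((mem_filter.1 hi).2.symm.trans (mem_filter.1 hi').2) (h2.symm.trans h3)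
  · rw [← hF i i' h p.1.2 q.1.2]
    norm_cast
    exact card_le_card fun ω hω => by
      simp only [mem_filter, mem_univ, true_and] at hω ⊢; exact hω.2

open Classical in
lemma forms_weight {cl : I → J} {F : I → Ω → G} {A : J → Finset G} {κ r1 L : ℕ} (hκ : 0 < κ)
    (hF : Unif F κ)
    (hI : 2 ≤ card I) (hr1 : 0 < r1)
    (hcl : ∀ j, (univ.filter fun i => cl i = j).card = r1) (hA : ∀ j, (A j).card = L)
    (hL : ((card G : ℝ) - L) * (8 * card I ^ 2) ≤ card G)
    (hge : ∀ j, ∀ g ∈ A j, g ∉ excValues F (1 / (16 * card I ^ 3) * κ * card G))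
    (hn : 0 < card G) :
    ∃ w : {ω : Ω // FormsValid cl F A ω} → ℝ, (∀ e, 0 ≤ w e) ∧
      (∀ v, wdeg (formInc cl F A) w v = 1) ∧
      ∀ u v, u ≠ v → wcodeg (formInc cl F A) w u v ≤ 6 * card I / card G := by
  set n : ℝ := (card G : ℝ) with hn'
  set r : ℝ := (card I : ℝ) with hr'
  have hn0 : 0 < n := by rw [hn']; exact_mod_cast hn
  have hr2 : 2 ≤ r := by rw [hr']; exact_mod_cast hI
  have hκ0 : (0 : ℝ) < κ := by exact_mod_cast hκ
  have hr10 : (0 : ℝ) < r1 := by exact_mod_cast hr1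
  set b : ℝ := 1 / (16 * r ^ 3) * κ * n with hb
  have hb0 : 0 ≤ b := by positivity
  set D : ℝ := r1 * (κ * n) with hD
  have hD0 : 0 < D := by positivity
  have hcardle : ∀ j, ((univ.filter fun i => cl i = j).card : ℝ) = r1 := fun j => by rw [hcl j]
  have hr1r : (r1 : ℝ) ≤ r := by
    rcases (univ_nonempty_iff.2 (card_pos_iff.1 (by omega : 0 < card I)))
      with ⟨i, -⟩
    rw [← hcardle (cl i), hr']
    exact_mod_cast card_le_univ _
  have hdle : ∀ p, wdeg (formInc cl F A) 1 p ≤ D := by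
    intro p
    rw [wdeg_formInc]
    calc _ ≤ ∑ i ∈ univ.filter (fun i => cl i = p.1.1), (n * κ : ℝ) :=
          sum_le_sum fun i _ => by
            rw [hn']; exact_mod_cast card_valid_le hF hI i p.1.2
      _ = D := by rw [sum_const, nsmul_eq_mul, hcardle, hD]; ring
  have hdge : ∀ p, D - 3 / (16 * r) * D ≤ wdeg (formInc cl F A) 1 p := by
    intro p
    rw [wdeg_formInc]
    have h1 : ∀ i ∈ univ.filter (fun i => cl i = p.1.1), n * κ - r * ((n - L) * κ) - r ^ 2 * b ≤
        ((univ.filter fun ω => FormsValid cl F A ω ∧ F i ω = p.1.2).card : ℝ) := by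
      intro i hi
      have hi := (mem_filter.1 hi).2
      exact card_valid_ge hF hI hA (by rw [hi]; exact p.2) (hge _ _ p.2) hb0
    refine le_trans ?_ (sum_le_sum h1)
    rw [sum_const, nsmul_eq_mul, hcardle]
    have h2 : r * ((n - L) * κ) ≤ n * κ / (8 * r) := by
      rw [le_div_iff₀ (by positivity)]
      have := mul_le_mul_of_nonneg_right hL hκ0.le
      nlinarith
    have h3 : r ^ 2 * b = n * κ / (16 * r) := by rw [hb]; field_simp
    have h4 : D - 3 / (16 * r) * D = r1 * (n * κ - n * κ / (8 * r) - n * κ / (16 * r)) := by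
      rw [hD]; field_simp; ring
    rw [h4, h3]
    exact mul_le_mul_of_nonneg_left (by linarith) hr10.le
  have hcardE : ∀ e, (formInc cl F A e).card = card I := fun e => by
    rw [formInc, card_image_of_injective _ (formInc_inj e), card_univ]
  have hcard1 : ∀ j, (univ.filter fun u : {p : J × G // p.2 ∈ A p.1} => u.1.1 = j).card = L := by
    intro j
    rw [← hA j]
    refine card_bij (fun u _ => u.1.2) ?_ ?_ ?_
    · intro u hu
      have := (mem_filter.1 hu).2
      rw [← this]; exact u.2
    · intro u hu u' hu' h
      ext1
      exact Prod.ext ((mem_filter.1 hu).2.trans (mem_filter.1 hu').2.symm) h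
    · intro g hg
      exact ⟨⟨(j, g), hg⟩, by simp, rfl⟩
  obtain ⟨w, hw0, hw1, hw2⟩ := exists_regular_weight (J := J) (formInc cl F A) (fun u => u.1.1)
    (card I) r1 L hcardE (by
      intro e v
      rw [formInc, filter_image, card_image_of_injective _ (formInc_inj e), ← hcl v.1.1])
    (fun v => hcard1 v.1.1) (D := D) (η := 3 / (16 * r)) hD0
    (by rw [← hr']; have : r * (3 / (16 * r)) = 3 / 16 := by field_simp
        rw [this]; norm_num)
    (by positivity)
    (by rw [div_le_iff₀ (by positivity)]; linarith)
    (fun v => by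
      rw [abs_le]; have := hdle v; have := hdge v
      have : 0 ≤ 3 / (16 * r) * D := by positivity
      constructor <;> linarith)
    (fun j j' => ∑ i ∈ univ.filter (fun i => cl i = j),
      ∑ i' ∈ univ.filter (fun i => cl i = j'), if i = i' then (0 : ℝ) else κ)
    (by
      intro v
      set K : {p : J × G // p.2 ∈ A p.1} → ℝ := fun u =>
        ∑ i ∈ univ.filter (fun i => cl i = v.1.1),
        ∑ i' ∈ univ.filter (fun i => cl i = u.1.1), if i = i' then (0 : ℝ) else κ with hK
      have hK0 : ∀ u, 0 ≤ K u := fun u => sum_nonneg fun i _ =>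
        sum_nonneg fun i' _ => by split_ifs <;> linarith
      have h1 : ∀ u, |wcodeg (formInc cl F A) 1 v u - K u - if u = v then D else 0| ≤
          (K u - acodeg (formInc cl F A) 1 v u)
            + if u = v then (D - wdeg (formInc cl F A) 1 v) else 0 := by
        intro u
        by_cases huv : u = v
        · subst huv
          simp only [if_true, acodeg, wcodeg_self]
          rw [abs_le]
          have := hK0 u; have := hdle u
          constructor <;> linarith
        · simp only [huv, if_false, acodeg, Ne.symm huv, sub_zero, add_zero]
          have : wcodeg (formInc cl F A) 1 v u ≤ K u := wcodeg_formInc_le hF (Ne.symm huv)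
          rw [abs_of_nonpos (by linarith)]
          linarith
      refine (sum_le_sum fun u _ => h1 u).trans ?_
      rw [sum_add_distrib, sum_sub_distrib, sum_acodeg (formInc cl F A) 1
        (r := card I) (S := univ) (fun e _ => ⟨subset_univ _, hcardE e⟩)
        (mem_univ v), sum_ite_eq' univ v, if_pos (mem_univ v), ← hr']
      have hKs : ∑ u, K u ≤ (r - 1) * D := by
        have h2 : ∀ i : I, ∑ u : {p : J × G // p.2 ∈ A p.1},
            ∑ i' ∈ univ.filter (fun i => cl i = u.1.1), (if i = i' then (0 : ℝ) else κ)
            ≤ (r - 1) * (n * κ) := by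
          intro i
          have h3 : ∑ u : {p : J × G // p.2 ∈ A p.1},
            ∑ i' ∈ univ.filter (fun i => cl i = u.1.1), (if i = i' then (0 : ℝ) else κ)
            = ∑ i', L * (if i = i' then (0 : ℝ) else κ) := by
            simp_rw [sum_filter]
            rw [sum_comm]
            refine sum_congr rfl fun i' _ => ?_
            rw [← sum_filter, sum_const, nsmul_eq_mul, ← hcard1 (cl i')]
            simp_rw [eq_comm]
          have h4 : ∑ i' : I, (if i = i' then (0 : ℝ) else κ) = (r - 1) * κ := by
            have : ∀ i' : I, (if i = i' then (0 : ℝ) else κ) = κ - if i = i' then (κ : ℝ) else 0 := by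
              intro i'; split_ifs <;> simp
            simp_rw [this]
            rw [sum_sub_distrib, sum_ite_eq]
            simp; ring
          rw [h3, ← mul_sum, h4]
          have h5 : (L : ℝ) ≤ n := by
            rw [hn', ← hA v.1.1]; exact_mod_cast card_le_univ _
          have : 0 ≤ (r - 1) * κ := mul_nonneg (by linarith) hκ0.le
          nlinarith
        rw [hK, sum_comm]
        calc _ ≤ ∑ i ∈ univ.filter (fun i => cl i = v.1.1), (r - 1) * (n * κ) :=
              sum_le_sum fun i _ => h2 i
          _ = _ := by rw [sum_const, nsmul_eq_mul, hcardle, hD]; ring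
      have h6 := hdge v
      have h7 : r * (3 / (16 * r) * D) = 3 / 16 * D := by field_simp
      nlinarith)
  refine ⟨w, hw0, hw1, fun u v huv => (hw2 u v).trans ?_⟩
  have h1 : wcodeg (formInc cl F A) 1 u v ≤ r1 * (r1 * κ) := by
    refine (wcodeg_formInc_le hF huv).trans ?_
    calc _ ≤ ∑ i ∈ univ.filter (fun i => cl i = u.1.1),
        ∑ i' ∈ univ.filter (fun i => cl i = v.1.1), (κ : ℝ) :=
          sum_le_sum fun i _ => sum_le_sum fun i' _ => by
            split_ifs <;> linarith
      _ = _ := by simp [hcl]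
  rw [div_le_div_iff₀ hD0 hn0]
  have h2 : wcodeg (formInc cl F A) 1 u v * n ≤ r * D := by
    calc _ ≤ r1 * (r1 * κ) * n := mul_le_mul_of_nonneg_right h1 hn0.le
      _ = r1 * D := by rw [hD]; ring
      _ ≤ r * D := mul_le_mul_of_nonneg_right hr1r hD0.le
  linarith

end Forms

open Classical in
/-- Packing lemma for families of pairwise jointly uniform forms. -/
theorem forms_packing {I J : Type} [Fintype I] [DecidableEq I] [Fintype J] [DecidableEq J]
    (cl : I → J) {r1 : ℕ} (hr1 : 0 < r1) (hJ : 2 ≤ card J)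
    (hcl : ∀ j, (univ.filter fun i => cl i = j).card = r1) (ε : ℝ) (hε : 0 < ε) :
    ∃ N0 : ℕ, ∀ {G Ω : Type} [Fintype G] [DecidableEq G] [Fintype Ω] [DecidableEq Ω]
      (F : I → Ω → G) (κ : ℕ), 0 < κ →
      (Unif F κ) →
      N0 ≤ card G → ∀ (A : J → Finset G) (m : ℕ), (∀ j, m ≤ (A j).card) →
      ((card G : ℝ) - m) * (16 * card I ^ 2) ≤ card G →
      ∀ Inv : Finset Ω → Prop, Inv ∅ →
      (∀ M, Inv M → (∀ ω ∈ M, FormsValid cl F A ω) →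
        (∀ ω ∈ M, ∀ ω' ∈ M, ω ≠ ω' → FormsDisj cl F ω ω') →
        ∃ bad : Finset Ω, bad.card ≤ card G ∧
          ∀ ω ∉ bad, FormsValid cl F A ω → (∀ ω' ∈ M, FormsDisj cl F ω ω') → Inv (insert ω M)) →
      ∃ M : Finset Ω, Inv M ∧ (∀ ω ∈ M, FormsValid cl F A ω) ∧
        (∀ ω ∈ M, ∀ ω' ∈ M, ω ≠ ω' → FormsDisj cl F ω ω') ∧
        ∀ j, (((A j).filter fun g => ∀ ω ∈ M, ∀ i, cl i = j → F i ω ≠ g).card : ℝ)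
          ≤ (A j).card - m + ε * card G := by
  have hIJ : card I = card J * r1 := by
    rw [← card_univ, card_eq_sum_card_fiberwise (f := cl) (t := univ)
      (fun _ _ => mem_coe.2 (mem_univ _))]
    simp [hcl]
  have hI : 2 ≤ card I := by rw [hIJ]; nlinarith
  set r : ℝ := (card I : ℝ) with hr'
  have hr2 : 2 ≤ r := by rw [hr']; exact_mod_cast hI
  set q : ℝ := (card J : ℝ) with hq'
  have hq2 : 2 ≤ q := by rw [hq']; exact_mod_cast hJ
  obtain ⟨γ₀, hγ₀, hnib⟩ := exists_almost_perfect_matching (card I) hI (ε / (2 * q))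
    (by positivity)
  set c0 : ℕ := 16 * card I ^ 6 with hc0
  set N0 : ℕ := ⌈6 * r / γ₀⌉₊ + ⌈2 * (c0 : ℝ) / ε⌉₊ + 16 * card I ^ 2 * c0 + 1 with hN0
  refine ⟨N0, ?_⟩
  intro G Ω _ _ _ _ F κ hκ hF hn A m hm hmn Inv hInv0 hInvS
  set n : ℝ := (card G : ℝ) with hn'
  have hnN : (N0 : ℝ) ≤ n := by rw [hn']; exact_mod_cast hn
  have hN0' : (N0 : ℝ) = (⌈6 * r / γ₀⌉₊ : ℝ) + ⌈2 * (c0 : ℝ) / ε⌉₊ + 16 * r ^ 2 * c0 + 1 := by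
    rw [hN0]; push_cast; rfl
  have hN1 : 6 * r / γ₀ ≤ n := by
    have := le_ceil (6 * r / γ₀)
    have h2 : (0 : ℝ) ≤ (⌈2 * (c0 : ℝ) / ε⌉₊ : ℝ) := cast_nonneg _
    have h3 : (0 : ℝ) ≤ 16 * r ^ 2 * c0 := by positivity
    linarith
  have hN2 : 2 * (c0 : ℝ) / ε ≤ n := by
    have := le_ceil (2 * (c0 : ℝ) / ε)
    have h2 : (0 : ℝ) ≤ (⌈6 * r / γ₀⌉₊ : ℝ) := cast_nonneg _
    have h3 : (0 : ℝ) ≤ 16 * r ^ 2 * c0 := by positivity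
    linarith
  have hN3 : 16 * r ^ 2 * c0 ≤ n := by
    have h1 : (0 : ℝ) ≤ (⌈2 * (c0 : ℝ) / ε⌉₊ : ℝ) := cast_nonneg _
    have h2 : (0 : ℝ) ≤ (⌈6 * r / γ₀⌉₊ : ℝ) := cast_nonneg _
    linarith
  have hn0 : 0 < n := lt_of_lt_of_le (by positivity) hN1
  have hnpos : 0 < card G := by
    rw [hn'] at hn0; exact_mod_cast hn0
  set b : ℝ := 1 / (16 * r ^ 3) * κ * n with hb
  have hexc : ((excValues F b).card : ℝ) ≤ c0 := by
    have := card_excValues F hκ hF (τ := 1 / (16 * r ^ 3)) (by positivity)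
    refine this.trans (le_of_eq ?_)
    rw [hc0]; push_cast; rw [← hr']; field_simp
  have hexcN : (excValues F b).card ≤ c0 := by exact_mod_cast hexc
  have hex : ∀ j, ∃ A' ⊆ A j \ excValues F b, A'.card = m - c0 := by
    intro j
    refine exists_subset_card_eq ?_
    have := le_card_sdiff (excValues F b) (A j)
    have := hm j
    omega
  choose A' hA'sub hA' using hex
  have hmc : (m : ℝ) - c0 ≤ ((m - c0 : ℕ) : ℝ) := by
    rw [sub_le_iff_le_add]; exact_mod_cast (by omega : m ≤ m - c0 + c0)
  have hLL : (n - ((m - c0 : ℕ) : ℝ)) * (8 * r ^ 2) ≤ n := by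
    have : (n - ((m - c0 : ℕ) : ℝ)) * (8 * r ^ 2) ≤ (n - m + c0) * (8 * r ^ 2) :=
      mul_le_mul_of_nonneg_right (by linarith) (by positivity)
    nlinarith
  obtain ⟨w, hw0, hw1, hw2⟩ := forms_weight (A := A') hκ hF hI hr1 hcl hA' hLL (by
    intro j g hg
    exact (mem_sdiff.1 (hA'sub j hg)).2) hnpos
  have hval : ∀ ω, FormsValid cl F A' ω → FormsValid cl F A ω := fun ω h =>
    ⟨fun i => (mem_sdiff.1 (hA'sub _ (h.1 i))).1, h.2⟩
  have hcardW : card {p : J × G // p.2 ∈ A' p.1} = card J * (m - c0) := by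
    rw [Fintype.card_subtype]
    rw [card_eq_sum_card_fiberwise (f := fun p : J × G => p.1) (t := univ)
      (fun _ _ => mem_coe.2 (mem_univ _))]
    have : ∀ j : J, ((univ.filter fun p : J × G => p.2 ∈ A' p.1).filter fun p => p.1 = j).card
        = m - c0 := by
      intro j
      rw [← hA' j, ← card_map (⟨fun g => (j, g), fun a b h => (ext_iff.1 h).2⟩ : G ↪ J × G)]
      congr 1
      ext ⟨j', g⟩
      simp only [mem_filter, mem_univ, true_and, mem_map]
      constructor
      · rintro ⟨h1, rfl⟩; exact ⟨g, h1, rfl⟩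
      · rintro ⟨g', h1, h2⟩
        obtain ⟨rfl, rfl⟩ := ext_iff.1 h2
        exact ⟨h1, rfl⟩
    simp [this]
  have hdisj : ∀ e f : {ω : Ω // FormsValid cl F A' ω},
      Disjoint (formInc cl F A' e) (formInc cl F A' f) ↔ FormsDisj cl F e.1 f.1 := by
    intro e f
    rw [disjoint_left]
    constructor
    · intro h i i' hii heq
      exact h (mem_formInc (p := ⟨(cl i, F i e.1), e.2.1 i⟩) |>.2 ⟨i, rfl, rfl⟩)
        (mem_formInc.2 ⟨i', hii.symm, heq.symm⟩)
    · intro h p h1 h2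
      obtain ⟨i, hi, hi'⟩ := mem_formInc.1 h1
      obtain ⟨i', hj, hj'⟩ := mem_formInc.1 h2
      exact h i i' (hi.trans hj.symm) (hi'.trans hj'.symm)
  obtain ⟨M, hM1, hM2, hM3⟩ := hnib (formInc cl F A') w hw0
    (fun e => by rw [formInc, card_image_of_injective _ (formInc_inj e), card_univ]) hw1
    (fun u v huv => (hw2 u v huv).trans (by
      rw [div_le_iff₀ hn0]
      rw [div_le_iff₀ hγ₀] at hN1
      linarith))
    (fun M => Inv (M.map (Embedding.subtype _))) (by simpa using hInv0) (by
      intro M hM hMd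
      obtain ⟨bad, hbad1, hbad2⟩ := hInvS _ hM (by
        intro ω hω
        obtain ⟨e, -, rfl⟩ := mem_map.1 hω
        exact hval _ e.2) (by
        intro ω hω ω' hω' hne
        obtain ⟨e, he, rfl⟩ := mem_map.1 hω
        obtain ⟨f, hf, rfl⟩ := mem_map.1 hω'
        exact (hdisj e f).1 (hMd e he f hf fun h => hne (by rw [h])))
      refine ⟨bad.subtype _, ?_, ?_⟩
      · rw [hcardW]
        have h1 : (bad.subtype (FormsValid cl F A')).card ≤ bad.card := by
          rw [card_subtype]; exact card_filter_le _ _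
        refine h1.trans (hbad1.trans ?_)
        have h2 : (n : ℝ) ≤ 2 * ((m - c0 : ℕ) : ℝ) := by
          have : 32 ≤ 8 * r ^ 2 := by nlinarith
          by_contra hcon
          push Not at hcon
          have : 0 < n - ((m - c0 : ℕ) : ℝ) := by linarith
          nlinarith
        have h3 : card G ≤ 2 * (m - c0) := by rw [hn'] at h2; exact_mod_cast h2
        exact h3.trans (Nat.mul_le_mul_right _ hJ)
      · intro e he hed
        rw [map_insert]
        refine hbad2 e.1 (fun h => he (by simpa using h)) (hval _ e.2) ?_
        intro ω' hω'
        obtain ⟨f, hf, rfl⟩ := mem_map.1 hω'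
        exact (hdisj e f).1 (hed f hf))
  refine ⟨M.map (Embedding.subtype _), hM1, ?_, ?_, ?_⟩
  · intro ω hω
    obtain ⟨e, -, rfl⟩ := mem_map.1 hω
    exact hval _ e.2
  · intro ω hω ω' hω' hne
    obtain ⟨e, he, rfl⟩ := mem_map.1 hω
    obtain ⟨f, hf, rfl⟩ := mem_map.1 hω'
    exact (hdisj e f).1 (hM2 e he f hf fun h => hne (by rw [h]))
  · intro j
    set U := (A j).filter fun g => ∀ ω ∈ M.map (Embedding.subtype _), ∀ i, cl i = j →
      F i ω ≠ g with hU
    have hA'A : A' j ⊆ A j := fun g hg => (mem_sdiff.1 (hA'sub j hg)).1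
    have h1 : (U \ (A j \ A' j)).card ≤
        (univ \ M.biUnion (formInc cl F A')).card := by
      refine card_le_card_of_surjOn (fun p => p.1.2) ?_
      intro g hg
      simp only [hU, coe_sdiff, coe_filter, Set.mem_sdiff, mem_ofPred_eq, mem_coe,
        not_and, not_not, mem_map, Embedding.coe_subtype] at hg
      obtain ⟨⟨hgA, hg1⟩, hg2⟩ := hg
      refine ⟨⟨(j, g), hg2 hgA⟩, ?_, rfl⟩
      simp only [coe_sdiff, Set.mem_sdiff, mem_coe, mem_univ, true_and, mem_biUnion, not_exists,
        not_and]
      intro e he hmem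
      obtain ⟨i, hi, hi'⟩ := mem_formInc.1 hmem
      exact hg1 e.1 ⟨e, he, rfl⟩ i hi hi'
    have h2 : U.card ≤ (A j \ A' j).card + (U \ (A j \ A' j)).card := by
      rw [← card_sdiff_add_card_inter U (A j \ A' j), add_comm]
      exact Nat.add_le_add_right (card_le_card inter_subset_right) _
    have h3 : ((A j \ A' j).card : ℝ) ≤ (A j).card - m + c0 := by
      rw [card_sdiff_of_subset hA'A, cast_sub (card_le_card hA'A), hA' j]
      linarith
    have h4 : (U.card : ℝ) ≤ (A j \ A' j).card + (univ \ M.biUnion (formInc cl F A')).card := by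
      exact_mod_cast h2.trans (Nat.add_le_add_left h1 _)
    have h5 : ε / (2 * q) * card {p : J × G // p.2 ∈ A' p.1} ≤ ε * n / 2 := by
      rw [hcardW]; push_cast; rw [← hq']
      have h6 : ((m - c0 : ℕ) : ℝ) ≤ n := by
        rw [hn', ← hA' j]; exact_mod_cast card_le_univ _
      calc ε / (2 * q) * (q * ((m - c0 : ℕ) : ℝ)) = ε * ((m - c0 : ℕ) : ℝ) / 2 := by field_simp
        _ ≤ _ := by gcongr
    rw [div_le_iff₀ hε] at hN2
    linarith

/-- An incomplete piece of a cycle: a path between two placed vertices with `m` free positions,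
or a completely free cycle of length `k`. -/
inductive Box (G : Type) where
  | gap (a b : G) (m : ℕ) : Box G
  | row (k : ℕ) : Box G

section Box
variable {G : Type} [AddCommGroup G]

/-- The multiset of consecutive differences along the path `a, l, b`. -/
def pcol : G → List G → G → Multiset G
  | x, [], y => {y - x}
  | x, v :: l, y => (v - x) ::ₘ pcol v l y

/-- A box can be filled using exactly the given vertices and differences. -/
def BoxFil : Box G → Multiset G → Multiset G → Prop
  | Box.gap a b m, V, C => ∃ l : List G, l.length = m ∧ V = ↑l ∧ C = pcol a l b
  | Box.row k, V, C => ∃ (a : G) (l : List G), l.length + 1 = k ∧ V = ↑(a :: l) ∧ C = pcol a l a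

/-- A multiset of boxes can be filled using exactly the given vertices and differences. -/
inductive Fil : Multiset (Box G) → Multiset G → Multiset G → Prop
  | nil : Fil 0 0 0
  | cons {b : Box G} {B : Multiset (Box G)} {V C V' C' : Multiset G} :
      BoxFil b V C → Fil B V' C' → Fil (b ::ₘ B) (V + V') (C + C')

/-- Number of positions, number of edges and sum of differences of a box. -/
def bal : Box G → ℕ × ℕ × G
  | Box.gap a b m => (m, m + 1, b - a)
  | Box.row k => (k, k, 0)

/-- Total number of positions, number of edges and sum of differences. -/
def Bal (B : Multiset (Box G)) : ℕ × ℕ × G := (B.map bal).sum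

/-- The balance of a pair of multisets. -/
def pay (V C : Multiset G) : ℕ × ℕ × G := (V.card, C.card, C.sum)

lemma Bal_add (B B' : Multiset (Box G)) : Bal (B + B') = Bal B + Bal B' := by simp [Bal]
@[simp] lemma Bal_zero : Bal (0 : Multiset (Box G)) = 0 := by simp [Bal]
@[simp] lemma Bal_singleton (b : Box G) : Bal {b} = bal b := by simp [Bal]
lemma Bal_cons (b : Box G) (B : Multiset (Box G)) : Bal (b ::ₘ B) = bal b + Bal B := by simp [Bal]
lemma pay_add (V C V' C' : Multiset G) : pay (V + V') (C + C') = pay V C + pay V' C' := by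
  simp [pay]
@[simp] lemma pay_zero : pay (0 : Multiset G) 0 = 0 := rfl

/-- `B` reduces to `B'` by using vertices `dV` and differences `dC`. -/
structure Ref (B B' : Multiset (Box G)) (dV dC : Multiset G) : Prop where
  fil : ∀ V C, Fil B' V C → Fil B (V + dV) (C + dC)
  eq : Bal B = Bal B' + pay dV dC

lemma pcol_card (x : G) (l : List G) (y : G) : (pcol x l y).card = l.length + 1 := by
  induction l generalizing x with
  | nil => rfl
  | cons v l ih => simp [pcol, ih]

lemma pcol_sum (x : G) (l : List G) (y : G) : (pcol x l y).sum = y - x := by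
  induction l generalizing x with
  | nil => simp [pcol]
  | cons v l ih => simp [pcol, ih]

lemma pcol_append (x : G) (l : List G) (v : G) (l' : List G) (y : G) :
    pcol x (l ++ v :: l') y = pcol x l v + pcol v l' y := by
  induction l generalizing x with
  | nil => simp [pcol]
  | cons w l ih => simp [pcol, ih]

lemma BoxFil.pay {b : Box G} {V C : Multiset G} (h : BoxFil b V C) : bal b = FGT.pay V C := by
  cases b with
  | gap a b m =>
    obtain ⟨l, hl, rfl, rfl⟩ := h
    simp [bal, FGT.pay, pcol_card, pcol_sum, hl]
  | row k =>
    obtain ⟨a, l, hl, rfl, rfl⟩ := h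
    simp [bal, FGT.pay, pcol_card, pcol_sum, hl]

lemma Fil.pay {B : Multiset (Box G)} {V C : Multiset G} (h : Fil B V C) : Bal B = FGT.pay V C := by
  induction h with
  | nil => simp
  | cons h1 _ ih => rw [Bal_cons, pay_add, ih, h1.pay]

lemma Fil.add {B B' : Multiset (Box G)} {V C V' C' : Multiset G} (h : Fil B V C)
    (h' : Fil B' V' C') : Fil (B + B') (V + V') (C + C') := by
  induction h with
  | nil => simpa
  | cons h1 _ ih =>
    rw [cons_add, add_assoc, add_assoc]
    exact Fil.cons h1 ih

lemma Fil.single {b : Box G} {V C : Multiset G} (h : BoxFil b V C) : Fil {b} V C := by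
  simpa using Fil.cons h Fil.nil

lemma Fil.cons_inv {b : Box G} {B : Multiset (Box G)} {V C : Multiset G} (h : Fil (b ::ₘ B) V C) :
    ∃ V1 C1 V2 C2, BoxFil b V1 C1 ∧ Fil B V2 C2 ∧ V = V1 + V2 ∧ C = C1 + C2 := by
  generalize hX : b ::ₘ B = X at h
  induction h generalizing b B with
  | nil => simp at hX
  | @cons b' B' V C V' C' h1 h2 ih =>
    rcases Multiset.cons_eq_cons.1 hX with ⟨rfl, rfl⟩ | ⟨-, cs, h3, h4⟩
    · exact ⟨_, _, _, _, h1, h2, rfl, rfl⟩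
    · obtain ⟨V1, C1, V2, C2, g1, g2, rfl, rfl⟩ := ih h4.symm
      refine ⟨V1, C1, V + V2, C + C2, g1, ?_, add_left_comm _ _ _, add_left_comm _ _ _⟩
      rw [h3]; exact Fil.cons h1 g2

lemma Fil.zero_inv {V C : Multiset G} (h : Fil 0 V C) : V = 0 ∧ C = 0 := by
  generalize hX : (0 : Multiset (Box G)) = X at h
  cases h with
  | nil => exact ⟨rfl, rfl⟩
  | cons => simp at hX

lemma Fil.add_inv {B B' : Multiset (Box G)} {V C : Multiset G} (h : Fil (B + B') V C) :
    ∃ V1 C1 V2 C2, Fil B V1 C1 ∧ Fil B' V2 C2 ∧ V = V1 + V2 ∧ C = C1 + C2 := by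
  induction B using Multiset.induction generalizing V C with
  | empty => exact ⟨0, 0, V, C, Fil.nil, by simpa using h, by simp, by simp⟩
  | cons b B ih =>
    rw [cons_add] at h
    obtain ⟨V1, C1, V2, C2, g1, g2, rfl, rfl⟩ := h.cons_inv
    obtain ⟨V3, C3, V4, C4, g3, g4, rfl, rfl⟩ := ih g2
    exact ⟨_, _, V4, C4, Fil.cons g1 g3, g4, (add_assoc _ _ _).symm, (add_assoc _ _ _).symm⟩

lemma Ref.refl (B : Multiset (Box G)) : Ref B B 0 0 := ⟨fun V C h => by simpa using h, by simp⟩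

lemma Ref.trans {B B' B'' : Multiset (Box G)} {dV dC dV' dC' : Multiset G} (h : Ref B B' dV dC)
    (h' : Ref B' B'' dV' dC') : Ref B B'' (dV + dV') (dC + dC') := by
  refine ⟨fun V C hF => ?_, ?_⟩
  · have := h.fil _ _ (h'.fil V C hF)
    rwa [add_assoc, add_assoc, add_comm dV', add_comm dC'] at this
  · rw [h.eq, h'.eq, pay_add, add_assoc, add_comm (pay dV' dC')]

lemma Ref.add {B B' D D' : Multiset (Box G)} {dV dC dV' dC' : Multiset G} (h : Ref B B' dV dC)
    (h' : Ref D D' dV' dC') : Ref (B + D) (B' + D') (dV + dV') (dC + dC') := by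
  refine ⟨fun V C hF => ?_, ?_⟩
  · obtain ⟨V1, C1, V2, C2, g1, g2, rfl, rfl⟩ := hF.add_inv
    rw [add_add_add_comm, add_add_add_comm C1]
    exact (h.fil _ _ g1).add (h'.fil _ _ g2)
  · rw [Bal_add, Bal_add, h.eq, h'.eq, pay_add, add_add_add_comm]

lemma Ref.add_right {B B' : Multiset (Box G)} {dV dC : Multiset G} (h : Ref B B' dV dC)
    (D : Multiset (Box G)) : Ref (B + D) (B' + D) dV dC := by
  simpa using h.add (Ref.refl D)

lemma Ref.of_fil {B : Multiset (Box G)} {V C : Multiset G} (h : Fil B V C) : Ref B 0 V C :=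
  ⟨fun V' C' h' => by obtain ⟨rfl, rfl⟩ := h'.zero_inv; simpa using h, by simpa using h.pay⟩

lemma Ref.row (a : G) (k : ℕ) : Ref {Box.row (k + 1)} {Box.gap a a k} {a} 0 := by
  refine ⟨fun V C h => ?_, ?_⟩
  · obtain ⟨V1, C1, V2, C2, h1, h2, rfl, rfl⟩ := Fil.cons_inv (B := 0) (by simpa using h)
    obtain ⟨rfl, rfl⟩ := h2.zero_inv
    obtain ⟨l, hl, rfl, rfl⟩ := h1
    refine Fil.single ⟨a, l, by rw [hl], ?_, by simp⟩
    rw [add_zero, add_comm]; rfl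
  · simp [bal, pay]

lemma Ref.split (a v b : G) (m1 m2 : ℕ) :
    Ref {Box.gap a b (m1 + 1 + m2)} ({Box.gap a v m1} + {Box.gap v b m2}) {v} 0 := by
  refine ⟨fun V C h => ?_, ?_⟩
  · obtain ⟨V1, C1, V2, C2, h1, h2, rfl, rfl⟩ := h.add_inv
    obtain ⟨V3, C3, V4, C4, h3, h4, rfl, rfl⟩ := Fil.cons_inv (B := 0) (by simpa using h1)
    obtain ⟨rfl, rfl⟩ := h4.zero_inv
    obtain ⟨V5, C5, V6, C6, h5, h6, rfl, rfl⟩ := Fil.cons_inv (B := 0) (by simpa using h2)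
    obtain ⟨rfl, rfl⟩ := h6.zero_inv
    obtain ⟨l, hl, rfl, rfl⟩ := h3
    obtain ⟨l', hl', rfl, rfl⟩ := h5
    refine Fil.single ⟨l ++ v :: l', by simp [hl, hl']; omega, ?_, by simp [pcol_append]⟩
    rw [← coe_add, ← cons_coe, ← singleton_add]
    simp only [add_zero]
    abel
  · rw [Bal_add, Bal_singleton, Bal_singleton, Bal_singleton]
    refine Prod.ext ?_ (Prod.ext ?_ ?_)
    · simp [bal, pay]; omega
    · simp [bal, pay]; omega
    · simp [bal, pay]

lemma Ref.close (a b : G) : Ref {Box.gap a b 0} 0 0 {b - a} :=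
  Ref.of_fil (Fil.single ⟨[], rfl, rfl, rfl⟩)

lemma Ref.path (a : G) (l : List G) (b : G) : Ref {Box.gap a b l.length} 0 (l : Multiset G) (pcol a l b) :=
  Ref.of_fil (Fil.single ⟨l, rfl, rfl, rfl⟩)

/-- Filling from a full reduction. -/
lemma Fil_of_rows {k l : ℕ} {V C : Multiset G} (h : Fil (replicate l (Box.row k)) V C) :
    ∃ L : List (G × List G), L.length = l ∧ (∀ p ∈ L, p.2.length + 1 = k) ∧
      V = (L.map fun p => ((p.1 :: p.2 : List G) : Multiset G)).sum ∧
      C = (L.map fun p => pcol p.1 p.2 p.1).sum := by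
  induction l generalizing V C with
  | zero =>
    obtain ⟨rfl, rfl⟩ := Fil.zero_inv (by simpa using h)
    exact ⟨[], by simp⟩
  | succ l ih =>
    rw [replicate_succ] at h
    obtain ⟨V1, C1, V2, C2, ⟨a, l, hl, rfl, rfl⟩, h2, rfl, rfl⟩ := h.cons_inv
    obtain ⟨L, hL, hL2, rfl, rfl⟩ := ih h2
    exact ⟨(a, l) :: L, by simp [hL], by simpa [hl] using hL2, by simp, by simp⟩

end Box

section Assemble
variable {G : Type} [AddCommGroup G] [DecidableEq G]

lemma pcol_eq_zipWith (a : G) (l : List G) (b : G) :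
    pcol a l b = (List.zipWith (fun y x => y - x) (l ++ [b]) (a :: l) : Multiset G) := by
  induction l generalizing a with
  | nil => simp [pcol]
  | cons v l ih => simp [pcol, ih]

lemma map_formPerm (a : G) (l : List G) (h : (a :: l).Nodup) :
    (a :: l).map (a :: l).formPerm = l ++ [a] := by
  apply List.ext_getElem
  · simp
  · intro i h1 h2
    rw [List.getElem_map, List.formPerm_apply_getElem _ h]
    simp only [List.length_map, length_cons] at h1
    rcases Nat.lt_succ_iff_lt_or_eq.1 h1 with hi | hi
    · have : (i + 1) % (a :: l).length = i + 1 := mod_eq_of_lt (by simpa using hi)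
      simp only [this]
      simp [hi]
    · subst hi
      simp

lemma map_formPerm_sub (a : G) (l : List G) (h : (a :: l).Nodup) :
    (((a :: l).map fun x => (a :: l).formPerm x - x : List G) : Multiset G) = pcol a l a := by
  rw [pcol_eq_zipWith, ← map_formPerm a l h]
  congr 1
  rw [List.zipWith_map_left, List.zipWith_self]

lemma perm_of_lists {k : ℕ} (hk : 2 ≤ k) [Fintype G] (L : List (G × List G))
    (hL : ∀ p ∈ L, p.2.length + 1 = k)
    (hnd : (L.flatMap fun p => p.1 :: p.2).Nodup) :
    ∃ φ : Equiv.Perm G, φ.cycleType = replicate L.length k ∧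
      (∀ x, x ∉ (L.flatMap fun p => p.1 :: p.2) → φ x = x) ∧
      (((L.flatMap fun p => p.1 :: p.2).map fun x => φ x - x : List G) : Multiset G)
        = (L.map fun p => pcol p.1 p.2 p.1).sum := by
  induction L with
  | nil => exact ⟨1, by simp⟩
  | cons p L ih =>
    obtain ⟨a, l⟩ := p
    rw [flatMap_cons, nodup_append] at hnd
    obtain ⟨hnd1, hnd2, hdisj⟩ := hnd
    obtain ⟨φ, h1, h2, h3⟩ := ih (fun p hp => hL p (List.mem_cons_of_mem _ hp)) hnd2
    have hlen : l.length + 1 = k := hL (a, l) (by simp)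
    have hfix : ∀ x ∉ a :: l, (a :: l).formPerm x = x := fun x hx =>
      List.formPerm_apply_of_notMem hx
    have hdp : Equiv.Perm.Disjoint (a :: l).formPerm φ := by
      intro x
      by_cases hx : x ∈ a :: l
      · right; exact h2 x fun hx' => hdisj x hx x hx' rfl
      · left; exact hfix x hx
    have hmem : ∀ x ∈ (L.flatMap fun p => p.1 :: p.2), φ x ∈ (L.flatMap fun p => p.1 :: p.2) := by
      intro x hx
      by_contra hcon
      have := h2 _ hcon
      have := φ.injective this
      exact hcon (by rwa [this])
    refine ⟨(a :: l).formPerm * φ, ?_, ?_, ?_⟩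
    · have hcyc : (a :: l).formPerm.IsCycle :=
        List.isCycle_formPerm hnd1 (by simp; omega)
      rw [hdp.cycleType_mul, h1, hcyc.cycleType, length_cons, replicate_succ,
        List.support_formPerm_of_nodup _ hnd1 (by intro x hx; simp at hx; obtain ⟨-, rfl⟩ := hx; simp at hlen; omega),
        List.toFinset_card_of_nodup hnd1, length_cons, hlen]
      simp
    · intro x hx
      rw [flatMap_cons, mem_append, not_or] at hx
      rw [Equiv.Perm.mul_apply, h2 x hx.2, hfix x hx.1]
    · rw [flatMap_cons, map_append, ← coe_add, List.map_cons (l := L), List.sum_cons,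
        ← h3, ← map_formPerm_sub a l hnd1]
      congr 2
      · apply List.map_congr_left
        intro x hx
        rw [Equiv.Perm.mul_apply, h2 x fun hx' => hdisj x hx x hx' rfl]
      · apply List.map_congr_left
        intro x hx
        rw [Equiv.Perm.mul_apply, hfix (φ x) fun hx' => hdisj _ hx' _ (hmem x hx) rfl]

/-- A complete filling of rows by the nonzero vertices and nonzero differences gives an
orthomorphism. -/
theorem exists_perm_of_fil [Fintype G] {k l : ℕ} (hk : 2 ≤ k)
    (h : Fil (replicate l (Box.row k)) ((univ : Finset G).erase 0).val
      ((univ : Finset G).erase 0).val) :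
    HasOrth G l k := by
  obtain ⟨L, rfl, hL, hV, hC⟩ := Fil_of_rows h
  have hV' : ((univ : Finset G).erase 0).val = ((L.flatMap fun p => p.1 :: p.2 : List G) : Multiset G) := by
    rw [hV]
    clear hV hC hL h
    induction L with
    | nil => rfl
    | cons p L ih => rw [List.map_cons, List.sum_cons, ih, flatMap_cons, ← coe_add]
  have hnd : (L.flatMap fun p => p.1 :: p.2).Nodup := by
    rw [← coe_nodup, ← hV']; exact (univ.erase 0).nodup
  obtain ⟨φ, h1, h2, h3⟩ := perm_of_lists hk L hL hnd
  have h0 : φ 0 = 0 := h2 0 (by rw [← Multiset.mem_coe, ← hV']; exact notMem_erase 0 univ)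
  refine ⟨φ, ?_, h0, h1⟩
  rw [← hC, ← map_coe, ← hV'] at h3
  have h4 : (univ : Finset G).val.map (fun x => φ x - x) = univ.val := by
    rw [← insert_erase (mem_univ (0 : G)),
      insert_val_of_notMem (notMem_erase 0 univ), map_cons, h3, h0, sub_zero]
  rw [← Finite.injective_iff_bijective]
  have h5 : ((univ : Finset G).val.map (fun x => φ x - x)).Nodup := by rw [h4]; exact univ.nodup
  intro x y hxy
  exact Multiset.inj_on_of_nodup_map h5 x (by simp) y (by simp) hxy

end Assemble

lemma pow_self_le_factorial (a : ℕ) : (a : ℝ) ^ a ≤ 3 ^ a * a.factorial := by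
  have h := Real.pow_div_factorial_le_exp (a : ℝ) (by positivity) a
  have h2 : exp (a : ℝ) ≤ 3 ^ a := by
    rw [← Real.exp_one_pow]
    exact pow_le_pow_left₀ (by positivity) (by linarith [Real.exp_one_lt_d9]) a
  rw [div_le_iff₀ (by positivity)] at h
  nlinarith [show (0:ℝ) < a.factorial by positivity]

lemma card_maps_into {P Q : Type} [Fintype P] [DecidableEq P] [Fintype Q] [DecidableEq Q] (D : ℕ)
    (A : Finset P) (B : Finset Q) :
    ((univ : Finset (P × Fin D → Q)).filter fun f => ∀ x ∈ A, ∀ d, f (x, d) ∈ B).card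
      = B.card ^ (A.card * D) * (card Q) ^ ((card P - A.card) * D) := by
  have : ((univ : Finset (P × Fin D → Q)).filter fun f => ∀ x ∈ A, ∀ d, f (x, d) ∈ B)
      = Fintype.piFinset (fun y : P × Fin D => if y.1 ∈ A then B else univ) := by
    ext f
    simp only [mem_filter, mem_univ, true_and, Fintype.mem_piFinset, Prod.forall]
    refine ⟨fun h x d => ?_, fun h x hx d => ?_⟩
    · by_cases hx : x ∈ A <;> simp [hx, h]
    · simpa [hx] using h x d
  rw [this, Fintype.card_piFinset]
  rw [Fintype.prod_prod_type]
  have h1 : ∀ x : P, ∏ _d : Fin D, (if x ∈ A then B else univ).card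
      = if x ∈ A then B.card ^ D else (card Q) ^ D := by
    intro x; split_ifs <;> simp
  simp_rw [h1]
  rw [prod_ite, prod_const, prod_const, ← pow_mul, ← pow_mul, mul_comm D, mul_comm D]
  congr 3
  · simp
  · rw [filter_not, card_sdiff_of_subset (filter_subset _ _)]; simp

lemma exists_expanding {P Q : Type} [Fintype P] [DecidableEq P] [Fintype Q] [DecidableEq Q]
    (hPQ : card P ≤ 2 * card Q) (hQ : 0 < card Q) :
    ∃ f : P × Fin 12 → Q, ∀ A : Finset P, 5 * A.card ≤ 3 * card Q →
      A.card ≤ (A.biUnion fun x => univ.image fun d => f (x, d)).card := by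
  classical
  set q := card Q with hq
  set p := card P with hp
  let bad : ℕ → Finset (P × Fin 12 → Q) := fun a =>
    (powersetCard a (univ : Finset P)).biUnion fun A =>
      (powersetCard a (univ : Finset Q)).biUnion fun B =>
        univ.filter fun f => ∀ x ∈ A, ∀ d, f (x, d) ∈ B
  have hbad : ∀ a : ℕ, 1 ≤ a → 5 * a ≤ 3 * q → ((bad a).card : ℝ) ≤ (1/3)^a * q ^ (p * 12) := by
    intro a ha1 ha
    by_cases hap : p < a
    · have : bad a = ∅ := by
        simp only [bad]
        rw [powersetCard_eq_empty.2 (by simpa [hp] using hap)]; simp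
      rw [this]; simp
    push Not at hap
    have h1 : (bad a).card ≤ p.choose a * (q.choose a * (a ^ (a * 12) * q ^ ((p - a) * 12))) := by
      refine (card_biUnion_le_card_mul _ _ (q.choose a * (a ^ (a * 12) * q ^ ((p - a) * 12))) ?_).trans ?_
      · intro A hA
        refine (card_biUnion_le_card_mul _ _ (a ^ (a * 12) * q ^ ((p - a) * 12)) ?_).trans ?_
        · intro B hB
          rw [mem_powersetCard] at hA hB
          rw [card_maps_into, hA.2, hB.2]
        · rw [card_powersetCard, card_univ]
      · rw [card_powersetCard, card_univ]
    have hqR : (0:ℝ) < q := by exact_mod_cast hQ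
    have haR : (0:ℝ) < a := by exact_mod_cast ha1
    have hfa := pow_self_le_factorial a
    have c1 : (p.choose a : ℝ) * (a:ℝ)^a ≤ (6 * q) ^ a := by
      have := Nat.choose_le_pow_div (α := ℝ) a p
      rw [le_div_iff₀ (by positivity)] at this
      calc (p.choose a : ℝ) * (a:ℝ)^a ≤ p.choose a * (3 ^ a * a.factorial) := by gcongr
        _ = 3 ^ a * (p.choose a * a.factorial) := by ring
        _ ≤ 3 ^ a * (p:ℝ) ^ a := by gcongr
        _ ≤ 3 ^ a * (2 * q:ℝ) ^ a := by
            gcongr; exact_mod_cast hPQ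
        _ = _ := by rw [← mul_pow]; ring
    have c2 : (q.choose a : ℝ) * (a:ℝ)^a ≤ (3 * q) ^ a := by
      have := Nat.choose_le_pow_div (α := ℝ) a q
      rw [le_div_iff₀ (by positivity)] at this
      calc (q.choose a : ℝ) * (a:ℝ)^a ≤ q.choose a * (3 ^ a * a.factorial) := by gcongr
        _ = 3 ^ a * (q.choose a * a.factorial) := by ring
        _ ≤ 3 ^ a * (q:ℝ) ^ a := by gcongr
        _ = _ := by rw [← mul_pow]
    have c3 : (18:ℝ) * (a:ℝ)^10 ≤ (1/3) * q ^ 10 := by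
      have : (a:ℝ) ≤ 3/5 * q := by
        have : (5 * a : ℝ) ≤ 3 * q := by exact_mod_cast ha
        linarith
      calc (18:ℝ) * (a:ℝ)^10 ≤ 18 * (3/5*(q:ℝ))^10 := by gcongr
        _ = 18 * (3/5)^10 * (q:ℝ)^10 := by ring
        _ ≤ _ := by gcongr; norm_num
    have c4 : ((18:ℝ) * (a:ℝ)^10)^a ≤ ((1/3) * q ^ 10)^a := pow_le_pow_left₀ (by positivity) c3 a
    have e1 : (q:ℝ) ^ (p*12) = q^(a*12) * q^((p-a)*12) := by
      rw [← pow_add]; congr 1; zify [hap]; ring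
    calc ((bad a).card : ℝ) ≤ p.choose a * (q.choose a * (a ^ (a * 12) * q ^ ((p - a) * 12))) := by
          exact_mod_cast h1
      _ = ((p.choose a : ℝ) * (a:ℝ)^a) * ((q.choose a : ℝ) * (a:ℝ)^a) * ((a:ℝ)^10)^a * q ^ ((p - a) * 12) := by
          ring
      _ ≤ ((6 * q) ^ a) * ((3*q)^a) * ((a:ℝ)^10)^a * q ^ ((p - a) * 12) := by gcongr
      _ = ((18:ℝ) * (a:ℝ)^10)^a * (q^2)^a * q ^ ((p - a) * 12) := by
          rw [← mul_pow, ← mul_pow, ← mul_pow]; ring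
      _ ≤ ((1/3) * q ^ 10)^a * (q^2)^a * q ^ ((p - a) * 12) := by gcongr
      _ = (1/3)^a * q ^ (p * 12) := by rw [e1]; ring
  set K := 3 * q / 5
  have htot : ((Icc 1 K).biUnion bad).card < card (P × Fin 12 → Q) := by
    have h0 : (0:ℝ) < (q:ℝ) ^ (p*12) := by positivity
    have h2 : ∀ K : ℕ, ∑ a ∈ Icc 1 K, ((1:ℝ)/3)^a ≤ (1 - (1/3)^K)/2 := by
      intro K
      induction K with
      | zero => simp
      | succ K ih =>
        rw [sum_Icc_succ_top (by omega), pow_succ]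
        linarith
    have : (((Icc 1 K).biUnion bad).card : ℝ) < q ^ (p*12) := by
      calc (((Icc 1 K).biUnion bad).card : ℝ) ≤ ∑ a ∈ Icc 1 K, ((bad a).card : ℝ) := by
            exact_mod_cast card_biUnion_le
        _ ≤ ∑ a ∈ Icc 1 K, (1/3)^a * (q:ℝ) ^ (p * 12) := by
            refine sum_le_sum fun a ha => ?_
            rw [mem_Icc] at ha
            exact hbad a ha.1 (by omega)
        _ = (∑ a ∈ Icc 1 K, (1/3:ℝ)^a) * (q:ℝ) ^ (p * 12) := by rw [sum_mul]
        _ ≤ (1 - (1/3)^K)/2 * (q:ℝ) ^ (p * 12) := by gcongr; exact h2 K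
        _ < _ := by
          have : (0:ℝ) < (1/3)^K := by positivity
          nlinarith
    rw [card_fun, card_prod, card_fin]
    exact_mod_cast this
  obtain ⟨f, hf⟩ : ∃ f, f ∉ (Icc 1 K).biUnion bad := by
    by_contra hcon
    push Not at hcon
    have : (Icc 1 K).biUnion bad = univ := eq_univ_iff_forall.2 hcon
    rw [this, card_univ] at htot
    exact lt_irrefl _ htot
  refine ⟨f, fun A hA => ?_⟩
  by_contra hlt
  push Not at hlt
  apply hf
  obtain ⟨B, hB1, hB2⟩ := exists_superset_card_eq (s := A.biUnion fun x => univ.image fun d => f (x, d))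
    (n := A.card) hlt.le (by omega)
  rw [mem_biUnion]
  refine ⟨A.card, mem_Icc.2 ⟨by omega, by omega⟩, ?_⟩
  simp only [bad, mem_biUnion, mem_powersetCard]
  refine ⟨A, ⟨subset_univ _, rfl⟩, B, ⟨subset_univ _, hB2⟩, ?_⟩
  simp only [mem_filter, mem_univ, true_and]
  intro x hx d
  exact hB1 (mem_biUnion.2 ⟨x, hx, mem_image_of_mem _ (mem_univ d)⟩)

/-- Robustly matchable bipartite graphs with bounded average degree. -/
theorem exists_robust_matching {Y X Z : Type} [Fintype Y] [DecidableEq Y] [Fintype X]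
    [DecidableEq X] [Fintype Z] [DecidableEq Z] {m u : ℕ} (hm : 1 ≤ m) (hu : 2 * u ≤ m)
    (hY : card Y = m) (hX : card X = 10 * m) (hZ : card Z = 11 * m - u) :
    ∃ N : Z → Finset (Y ⊕ X), ∑ z, (N z).card ≤ 300 * m ∧ ∀ U : Finset Y, U.card = u →
      ∃ e : Z → Y ⊕ X, Injective e ∧ (∀ z, e z ∈ N z) ∧
        ∀ p, (∃ z, e z = p) ↔ p ∉ U.map Embedding.inl := by
  classical
  obtain ⟨f, hf⟩ := exists_expanding (P := Y ⊕ X) (Q := Z) (by simp [hY, hX, hZ]; omega) (by omega)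
  obtain ⟨g, hg⟩ := exists_expanding (P := Z) (Q := X) (by omega) (by omega)
  let N1 : Z → Finset (Y ⊕ X) := fun z => univ.filter fun p => ∃ d, f (p, d) = z
  let N2 : Z → Finset (Y ⊕ X) := fun z => univ.image fun d => Sum.inr (g (z, d))
  refine ⟨fun z => N1 z ∪ N2 z, ?_, ?_⟩
  · have h1 : ∑ z, (N1 z).card ≤ 12 * (11 * m) := by
      have : ∑ z, (N1 z).card ≤ ∑ z, ((univ : Finset ((Y ⊕ X) × Fin 12)).filter fun x => f x = z).card := by
        refine sum_le_sum fun z _ => ?_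
        have : N1 z ⊆ ((univ : Finset ((Y ⊕ X) × Fin 12)).filter fun x => f x = z).image fst := by
          intro p hp
          simp only [N1, mem_filter, mem_univ, true_and] at hp
          obtain ⟨d, hd⟩ := hp
          exact mem_image.2 ⟨(p, d), by simp [hd], rfl⟩
        exact (card_le_card this).trans card_image_le
      refine this.trans ?_
      rw [← card_eq_sum_card_fiberwise (fun _ _ => mem_coe.2 (mem_univ _))]
      simp [hY, hX]; omega
    have h2 : ∑ z, (N2 z).card ≤ (11 * m) * 12 := by
      calc ∑ z, (N2 z).card ≤ ∑ z : Z, 12 := sum_le_sum fun z _ => by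
            simpa using (card_image_le (s := (univ : Finset (Fin 12))) (f := fun d => (Sum.inr (g (z, d)) : Y ⊕ X)))
        _ ≤ _ := by simp [hZ]
    calc ∑ z, (N1 z ∪ N2 z).card ≤ ∑ z, ((N1 z).card + (N2 z).card) :=
          sum_le_sum fun z _ => card_union_le _ _
      _ ≤ 300 * m := by rw [sum_add_distrib]; omega
  · intro U hU
    set U' : Finset (Y ⊕ X) := U.map Embedding.inl
    have hU' : U'.card = u := by simp [U', hU]
    have hall : ∀ A : Finset Z, A.card ≤ (A.biUnion fun z => (N1 z ∪ N2 z) \ U').card := by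
      intro A
      by_cases hA : A.card ≤ 6 * m
      · refine (hg A (by omega)).trans ?_
        refine card_le_card_of_injOn (fun x => Sum.inr x) ?_ (Sum.inr_injective.injOn)
        intro x hx
        simp only [coe_biUnion, Set.mem_iUnion, coe_image, Set.mem_image, mem_coe] at hx ⊢
        obtain ⟨z, hz, d, -, hd⟩ := hx
        refine ⟨z, hz, ?_⟩
        simp only [mem_sdiff, mem_union]
        refine ⟨Or.inr ?_, by simp [U']⟩
        exact mem_image.2 ⟨d, mem_univ _, by rw [hd]⟩
      · by_contra hlt
        push Not at hlt
        set S := A.biUnion fun z => (N1 z ∪ N2 z) \ U' with hS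
        set B := (univ \ U') \ S with hB
        have hSU : S ⊆ univ \ U' := by
          intro p hp
          rw [hS, mem_biUnion] at hp
          obtain ⟨z, -, hz⟩ := hp
          exact mem_sdiff.2 ⟨mem_univ _, (mem_sdiff.1 hz).2⟩
        have hBc : B.card = 11 * m - u - S.card := by
          rw [hB, card_sdiff_of_subset hSU, card_sdiff_of_subset (subset_univ _), hU']
          simp [hY, hX]; congr 2; omega
        have hAle : A.card ≤ 11 * m - u := by rw [← hZ]; exact card_le_univ A
        obtain ⟨B', hB'1, hB'2⟩ := exists_subset_card_eq (s := B) (n := 11 * m - u - A.card + 1) (by omega)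
        have h5 := hf B' (by omega)
        have h6 : (B'.biUnion fun x => univ.image fun d => f (x, d)) ⊆ univ \ A := by
          intro z hz
          simp only [mem_biUnion, mem_image, mem_univ, true_and] at hz
          obtain ⟨p, hp, d, hd⟩ := hz
          simp only [mem_sdiff, mem_univ, true_and]
          intro hzA
          have hpB := hB'1 hp
          rw [hB, mem_sdiff] at hpB
          apply hpB.2
          rw [hS, mem_biUnion]
          refine ⟨z, hzA, mem_sdiff.2 ⟨mem_union_left _ ?_, (mem_sdiff.1 hpB.1).2⟩⟩
          simp only [N1, mem_filter, mem_univ, true_and]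
          exact ⟨d, hd⟩
        have h7 := card_le_card h6
        rw [card_sdiff_of_subset (subset_univ _), card_univ, hZ] at h7
        omega
    obtain ⟨e, he1, he2⟩ := (all_card_le_biUnion_card_iff_exists_injective _).1 hall
    refine ⟨e, he1, fun z => (mem_sdiff.1 (he2 z)).1, ?_⟩
    have him : univ.image e = univ \ U' := by
      apply eq_of_subset_of_card_le
      · intro p hp
        obtain ⟨z, -, rfl⟩ := mem_image.1 hp
        exact mem_sdiff.2 ⟨mem_univ _, (mem_sdiff.1 (he2 z)).2⟩
      · rw [card_image_of_injective _ he1, card_sdiff_of_subset (subset_univ _), hU']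
        simp [hY, hX, hZ]; omega
    intro p
    have := Finset.ext_iff.1 him p
    simpa using this

section RandSub
variable {W α I : Type} [Fintype W] [DecidableEq W] [DecidableEq α] [Fintype I] [DecidableEq I]

/-- Conditional probability that `e` is contained in a random set of density `p` whose trace on `D`
is `A`. -/
noncomputable def cprob (p : ℝ) (D A e : Finset W) : ℝ :=
  if e ∩ D ⊆ A then p ^ (e \ D).card else 0

lemma cprob_insert_of_notMem (p : ℝ) (D A e : Finset W) (w : W) (hw : w ∉ e) :
    cprob p (insert w D) A e = cprob p D A e ∧
      cprob p (insert w D) (insert w A) e = cprob p D A e := by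
  have h1 : e ∩ insert w D = e ∩ D := by
    rw [inter_insert_of_notMem hw]
  have h2 : e \ insert w D = e \ D := by
    ext x; simp only [mem_sdiff, mem_insert]
    constructor
    · rintro ⟨hx, hx2⟩; exact ⟨hx, fun h => hx2 (Or.inr h)⟩
    · rintro ⟨hx, hx2⟩
      exact ⟨hx, by rintro (rfl | h); exacts [hw hx, hx2 h]⟩
  have h3 : e ∩ D ⊆ insert w A ↔ e ∩ D ⊆ A := by
    refine subset_insert_iff_of_notMem ?_
    simp [hw]
  simp [cprob, h1, h2, h3]

lemma cprob_insert_of_mem (p : ℝ) (D A e : Finset W) (w : W) (hw : w ∈ e) (hD : w ∉ D)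
    (hA : A ⊆ D) :
    cprob p (insert w D) A e = 0 ∧ p * cprob p (insert w D) (insert w A) e = cprob p D A e := by
  have hwA : w ∉ A := fun h => hD (hA h)
  constructor
  · rw [cprob, if_neg]
    intro h
    exact hwA (h (mem_inter.2 ⟨hw, mem_insert_self _ _⟩))
  · have h1 : e ∩ insert w D ⊆ insert w A ↔ e ∩ D ⊆ A := by
      rw [inter_insert_of_mem hw]
      refine ⟨fun h x hx => ?_, fun h => insert_subset_insert _ h⟩
      have := h (mem_insert_of_mem hx)
      rcases mem_insert.1 this with rfl | h'
      · exact absurd (mem_inter.1 hx).2 hD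
      · exact h'
    have h2 : (e \ D).card = (e \ insert w D).card + 1 := by
      rw [sdiff_insert, card_erase_add_one]
      exact mem_sdiff.2 ⟨hw, hD⟩
    simp only [cprob, h1]
    split_ifs
    · rw [h2, pow_succ, mul_comm]
    · simp

lemma exists_random_subset (p : ℝ) (hp : 0 < p) (hp1 : p ≤ 1) (h : ℕ) (K : ℝ) (hK : 0 ≤ K)
    (e : I → α → Finset W) (S : I → Finset α)
    (hdis : ∀ i, ∀ a ∈ S i, ∀ b ∈ S i, a ≠ b → Disjoint (e i a) (e i b))
    (hcard : ∀ i, ∀ a ∈ S i, (e i a).card ≤ h) (hS : ∀ i, K ≤ (S i).card)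
    (hI : card I * exp (-(p ^ h * K / 4)) ≤ 1 / 4) :
    ∃ A : Finset W, (A.card : ℝ) ≤ 2 * p * card W ∧
      ∀ i, p ^ h * K / 4 ≤ ((S i).filter fun a => e i a ⊆ A).card := by
  classical
  set t : ℝ := p ^ h * K / 4 with ht
  have ht0 : 0 ≤ t := by positivity
  let Φ : I → Finset W → Finset W → ℝ := fun i D A => ∏ a ∈ S i, (1 - cprob p D A (e i a) / 2)
  have hΦavg : ∀ i D A w, w ∉ D → A ⊆ D →
      p * Φ i (insert w D) (insert w A) + (1 - p) * Φ i (insert w D) A = Φ i D A := by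
    intro i D A w hw hA
    by_cases hex : ∃ a ∈ S i, w ∈ e i a
    · obtain ⟨a, ha, hwa⟩ := hex
      have hoth : ∀ b ∈ (S i).erase a, w ∉ e i b := fun b hb hwb =>
        (disjoint_left.1 (hdis i b (mem_of_mem_erase hb) a ha (ne_of_mem_erase hb)) hwb hwa)
      simp only [Φ]
      rw [← mul_prod_erase _ _ ha, ← mul_prod_erase _ _ ha, ← mul_prod_erase _ _ ha]
      rw [prod_congr rfl (fun b hb => by
        rw [(cprob_insert_of_notMem p D A (e i b) w (hoth b hb)).2])]
      have : ∏ b ∈ (S i).erase a, (1 - cprob p (insert w D) A (e i b) / 2)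
          = ∏ b ∈ (S i).erase a, (1 - cprob p D A (e i b) / 2) :=
        prod_congr rfl (fun b hb => by
          rw [(cprob_insert_of_notMem p D A (e i b) w (hoth b hb)).1])
      rw [this]
      obtain ⟨c1, c2⟩ := cprob_insert_of_mem p D A (e i a) w hwa hw hA
      rw [c1, ← c2]; ring
    · push Not at hex
      have h1 : Φ i (insert w D) (insert w A) = Φ i D A :=
        prod_congr rfl (fun b hb => by
          rw [(cprob_insert_of_notMem p D A (e i b) w (hex b hb)).2])
      have h2 : Φ i (insert w D) A = Φ i D A :=
        prod_congr rfl (fun b hb => by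
          rw [(cprob_insert_of_notMem p D A (e i b) w (hex b hb)).1])
      rw [h1, h2]; ring
  let T : Finset W → Finset W → ℝ := fun D A =>
    ∑ i, (2:ℝ) ^ t * Φ i D A + (A.card + p * (card W - D.card)) / (2 * p * card W)
  have hstep : ∀ D : Finset W, ∃ A, A ⊆ D ∧ T D A ≤ T ∅ ∅ := by
    intro D
    induction D using Finset.induction_on with
    | empty => exact ⟨∅, subset_rfl, le_rfl⟩
    | insert w D hw ih =>
      obtain ⟨A, hA, hT⟩ := ih
      have havg : p * T (insert w D) (insert w A) + (1 - p) * T (insert w D) A = T D A := by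
        simp only [T]
        rw [card_insert_of_notMem hw, card_insert_of_notMem (fun h => hw (hA h))]
        have : ∑ i, (2:ℝ) ^ t * Φ i D A = p * ∑ i, (2:ℝ) ^ t * Φ i (insert w D) (insert w A)
            + (1 - p) * ∑ i, (2:ℝ) ^ t * Φ i (insert w D) A := by
          rw [mul_sum, mul_sum, ← sum_add_distrib]
          refine sum_congr rfl fun i _ => ?_
          rw [← hΦavg i D A w hw hA]; ring
        rw [this]; push_cast; ring
      by_cases hc : T (insert w D) (insert w A) ≤ T D A
      · exact ⟨_, insert_subset_insert _ hA, hc.trans hT⟩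
      · refine ⟨A, hA.trans (subset_insert _ _), le_trans ?_ hT⟩
        push Not at hc
        rcases hp1.lt_or_eq with h1 | h1
        · nlinarith
        · rw [h1] at havg; linarith
  obtain ⟨A, -, hA⟩ := hstep univ
  have hcp : ∀ i, ∀ a, cprob p univ A (e i a) = if e i a ⊆ A then 1 else 0 := by
    intro i a
    have h0 : e i a \ univ = ∅ := by ext x; simp
    simp [cprob, h0]
  have hΦend : ∀ i, Φ i univ A = (1/2) ^ ((S i).filter fun a => e i a ⊆ A).card := by
    intro i
    simp only [Φ, hcp]
    rw [← prod_const, prod_filter]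
    refine prod_congr rfl fun a _ => ?_
    split_ifs <;> norm_num
  have hΦ0 : ∀ i, (2:ℝ) ^ t * Φ i ∅ ∅ ≤ exp (-t) := by
    intro i
    have h1 : Φ i ∅ ∅ ≤ ∏ a ∈ S i, exp (-(p ^ h / 2)) := by
      refine prod_le_prod (fun a ha => ?_) (fun a ha => ?_)
      · have : p ^ (e i a).card ≤ 1 := pow_le_one₀ hp.le hp1
        simp [cprob]; linarith
      · have : p ^ h ≤ p ^ (e i a).card := pow_le_pow_of_le_one hp.le hp1 (hcard i a ha)
        have h2 := Real.add_one_le_exp (-(p ^ h / 2))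
        simp [cprob]; linarith
    rw [prod_const, ← Real.exp_nat_mul] at h1
    have h3 : (2:ℝ) ^ t ≤ exp t := by
      rw [← Real.exp_one_rpow]
      exact Real.rpow_le_rpow (by norm_num) (by linarith [Real.exp_one_gt_d9]) ht0
    calc (2:ℝ) ^ t * Φ i ∅ ∅ ≤ exp t * exp ((S i).card * (-(p ^ h / 2))) := by
          refine mul_le_mul h3 h1 ?_ (Real.exp_nonneg _)
          refine prod_nonneg fun a ha => ?_
          have : p ^ (e i a).card ≤ 1 := pow_le_one₀ hp.le hp1
          simp [cprob]; linarith
      _ = exp (t + (S i).card * (-(p ^ h / 2))) := by rw [exp_add]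
      _ ≤ exp (-t) := by
          apply exp_le_exp.2
          have := hS i
          have h5 : 0 < p ^ h := by positivity
          rw [ht]; nlinarith
  rcases isEmpty_or_nonempty W with hW | hW
  · refine ⟨∅, by simp, fun i => ?_⟩
    have hsub : ∀ a, e i a ⊆ (∅ : Finset W) := fun a x _ => hW.elim x
    simp only [hsub, filter_true]
    refine le_trans ?_ (hS i)
    have : p ^ h ≤ 1 := pow_le_one₀ hp.le hp1
    rw [ht]; nlinarith
  have hWc : (0:ℝ) < card W := by exact_mod_cast Fintype.card_pos
  have hT0 : T ∅ ∅ < 1 := by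
    have h1 : ∑ i, (2:ℝ) ^ t * Φ i ∅ ∅ ≤ 1/4 := by
      calc ∑ i, (2:ℝ) ^ t * Φ i ∅ ∅ ≤ ∑ i : I, exp (-t) := sum_le_sum fun i _ => hΦ0 i
        _ ≤ 1/4 := by simpa using hI
    have h2 : ((0:ℝ) + p * (card W - 0)) / (2 * p * card W) = 1/2 := by
      field_simp; ring
    simp only [T, card_empty, Nat.cast_zero]
    rw [h2]; linarith
  have hT1 := lt_of_le_of_lt hA hT0
  simp only [T, card_univ, sub_self, mul_zero, add_zero] at hT1
  have hnn : ∀ i, 0 ≤ (2:ℝ) ^ t * Φ i univ A := fun i => by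
    rw [hΦend]; positivity
  refine ⟨A, ?_, fun i => ?_⟩
  · have h1 : (A.card : ℝ) / (2 * p * card W) ≤ 1 := by
      have := sum_nonneg (fun i (_ : i ∈ (univ : Finset I)) => hnn i)
      linarith
    rwa [div_le_one (by positivity)] at h1
  · have h1 : (2:ℝ) ^ t * Φ i univ A < 1 := by
      have h2 := single_le_sum (fun i (_ : i ∈ (univ : Finset I)) => hnn i) (mem_univ i)
      have h3 : (0:ℝ) ≤ A.card / (2 * p * card W) := by positivity
      linarith
    rw [hΦend] at h1
    by_contra hcon
    push Not at hcon
    set X := ((S i).filter fun a => e i a ⊆ A).card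
    have : (2:ℝ) ^ t * (1/2) ^ X = (2:ℝ) ^ (t - X) := by
      rw [Real.rpow_sub (by norm_num), Real.rpow_natCast]; simp [div_eq_mul_inv]
    rw [this] at h1
    have := Real.one_le_rpow (x := 2) (z := t - X) (by norm_num) (by linarith)
    linarith
end RandSub

/-- Disjointification: bounded conflict degree gives a large independent subset. -/
lemma exists_independent {α : Type} [DecidableEq α] (A : Finset α) (r : α → α → Prop)
    [DecidableRel r] (hr : ∀ a b, r a b → r b a) (d : ℕ)
    (hd : ∀ a ∈ A, (A.filter fun b => r a b).card ≤ d) :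
    ∃ B ⊆ A, (∀ a ∈ B, ∀ b ∈ B, a ≠ b → ¬ r a b) ∧ A.card ≤ (d + 1) * B.card := by
  induction A using strongInduction with
  | H A ih =>
    rcases A.eq_empty_or_nonempty with rfl | ⟨a, ha⟩
    · exact ⟨∅, subset_rfl, by simp, by simp⟩
    set A' := (A.erase a).filter fun b => ¬ r a b
    have hA' : A' ⊆ A := (filter_subset _ _).trans (erase_subset _ _)
    have haA' : a ∉ A' := by simp [A']
    obtain ⟨B, hB1, hB2, hB3⟩ := ih A' (ssubset_iff_of_subset hA' |>.2 ⟨a, ha, haA'⟩)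
      (fun b hb => (card_le_card (filter_subset_filter _ hA')).trans (hd b (hA' hb)))
    refine ⟨insert a B, insert_subset ha (hB1.trans hA'), ?_, ?_⟩
    · intro x hx y hy hxy
      rcases mem_insert.1 hx with hx1 | hx1 <;> rcases mem_insert.1 hy with hy1 | hy1
      · exact absurd (hx1.trans hy1.symm) hxy
      · rw [hx1]; exact (mem_filter.1 (hB1 hy1)).2
      · rw [hy1]; exact fun h => (mem_filter.1 (hB1 hx1)).2 (hr _ _ h)
      · exact hB2 x hx1 y hy1 hxy
    · rw [card_insert_of_notMem (fun h => haA' (hB1 h))]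
      have h1 : A ⊆ insert a (A' ∪ A.filter fun b => r a b) := by
        intro b hb
        simp only [A', mem_insert, mem_union, mem_filter, mem_erase]
        tauto
      have h2 := (card_le_card h1).trans ((card_insert_le _ _).trans (Nat.add_le_add_right (card_union_le _ _) 1))
      have h3 := hd a ha
      nlinarith

section Res
variable {G : Type} [AddCommGroup G] [Fintype G] [DecidableEq G]

/-- An affine form in one variable: the first entry says whether it describes a vertex, the second
whether the variable enters with positive sign. -/
abbrev Fm (G : Type) := Bool × Bool × G

/-- The value of an affine form. -/
def Fm.val (f : Fm G) (a : G) : G := if f.2.1 then f.2.2 + a else f.2.2 - a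

lemma Fm.val_inj (f : Fm G) : Injective f.val := by
  intro a b h
  unfold Fm.val at h
  split_ifs at h
  · exact add_left_cancel h
  · exact sub_right_injective h

/-- Few elements have double `κ`. -/
def Sml (κ : G) : Prop := 100 * (univ.filter fun c : G => c + c = κ).card ≤ card G

instance (κ : G) : Decidable (Sml κ) := by unfold Sml; infer_instance

/-- Reservoirs of vertices and differences. -/
structure Res (s : G) (E : Finset G) (δ : ℝ) (RV Rc : Finset G) : Prop where
  zero : (0 : G) ∉ RV
  partner : ∀ c ∈ Rc, s - c ∈ Rc
  two : ∀ c ∈ Rc, c ≠ s - c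
  avoid : ∀ c ∈ Rc, c ∉ E
  pick' : ∀ (L : Fin 5 → Fm G) (κ : G) (κ' : Fin 5 → G), δ * card G ≤
    ((univ : Finset G).filter fun a => a + a ≠ κ ∧ (∀ i, Sml (κ' i) → a + a ≠ κ' i) ∧
      ∀ i, Fm.val (L i) a ∈ if (L i).1 then RV else Rc).card

/-- The footprint of a form. -/
def Fm.foot (s : G) (f : Fm G) (a : G) : Finset (G ⊕ G) :=
  if f.1 then {Sum.inl (f.val a)} else {Sum.inr (f.val a), Sum.inr (s - f.val a)}

lemma Fm.foot_card (s : G) (f : Fm G) (a : G) : (f.foot s a).card ≤ 2 := by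
  unfold Fm.foot
  split_ifs
  · simp
  · exact card_le_two

lemma Fm.foot_conflict (s : G) (f : Fm G) (w : G ⊕ G) :
    ((univ : Finset G).filter fun a => w ∈ f.foot s a).card ≤ 2 := by
  unfold Fm.foot
  cases hf : f.1 with
  | true =>
    refine (card_le_one.2 ?_).trans one_le_two
    intro a ha b hb
    simp at ha hb
    exact f.val_inj (Sum.inl_injective (ha.symm.trans hb))
  | false =>
    have : ((univ : Finset G).filter fun a => w ∈ if (false : Bool) = true then ({Sum.inl (f.val a)} : Finset (G ⊕ G)) else {Sum.inr (f.val a), Sum.inr (s - f.val a)})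
        ⊆ (univ.filter fun a => w = Sum.inr (f.val a)) ∪ (univ.filter fun a => w = Sum.inr (s - f.val a)) := by
      intro a ha
      simpa using ha
    refine (card_le_card this).trans ((card_union_le _ _).trans ?_)
    have h1 : (univ.filter fun a => w = Sum.inr (f.val a)).card ≤ 1 := card_le_one.2 (by
      intro a ha b hb
      simp at ha hb
      exact f.val_inj (Sum.inr_injective (ha.symm.trans hb)))
    have h2 : (univ.filter fun a => w = Sum.inr (s - f.val a)).card ≤ 1 := card_le_one.2 (by
      intro a ha b hb
      simp at ha hb
      exact f.val_inj (sub_right_injective (Sum.inr_injective (ha.symm.trans hb))))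
    omega

lemma Fm.card_val_mem (f : Fm G) (S : Finset G) :
    ((univ : Finset G).filter fun a => f.val a ∈ S).card ≤ S.card :=
  card_le_card_of_injOn f.val (fun a ha => by simpa using ha) f.val_inj.injOn

theorem exists_res (p : ℝ) (hp : 0 < p) (hp1 : p ≤ 1) :
    ∃ δ > 0, ∃ N0 : ℕ, ∀ {G : Type} [AddCommGroup G] [Fintype G] [DecidableEq G] (s : G)
      (E : Finset G), N0 ≤ card G → 200 * E.card ≤ card G →
      100 * (univ.filter fun c : G => c + c = s).card ≤ card G →
      Half G →
      ∃ RV Rc : Finset G, Res s E δ RV Rc ∧ (RV.card : ℝ) ≤ 4 * p * card G ∧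
        (Rc.card : ℝ) ≤ 4 * p * card G := by
  have hlim : Filter.Tendsto (fun n : ℕ => (4^5 : ℝ) * ((n:ℝ)^11 * exp (-(p^10/2000/4 * n))))
      Filter.atTop (nhds 0) := by
    have h1 := Real.tendsto_pow_mul_exp_neg_atTop_nhds_zero 11
    have hc : 0 < p^10/2000/4 := by positivity
    have h2 : Filter.Tendsto (fun n : ℕ => (p^10/2000/4) * (n:ℝ)) Filter.atTop Filter.atTop :=
      Filter.Tendsto.const_mul_atTop hc tendsto_natCast_atTop_atTop
    have h3 := (h1.comp h2).const_mul ((4^5 : ℝ) / (p^10/2000/4)^11)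
    rw [mul_zero] at h3
    refine h3.congr fun n => ?_
    simp only [comp]
    rw [mul_pow]
    field_simp
  have hev := hlim.eventually (Iio_mem_nhds (show (0:ℝ) < 1/4 by norm_num))
  obtain ⟨N0, hN0⟩ := Filter.eventually_atTop.1 hev
  refine ⟨p^10/2000, by positivity, max N0 400, ?_⟩
  intro G _ _ _ s E hn hE hs hκ
  set n := card G with hn'
  have hn1 : N0 ≤ n := (le_max_left _ _).trans hn
  have hn2 : 400 ≤ n := (le_max_right _ _).trans hn
  have hnR : (400:ℝ) ≤ n := by exact_mod_cast hn2
  -- valid parameters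
  let A : (Fin 5 → Fm G) × G × (Fin 5 → G) → Finset G := fun i => univ.filter fun a => a + a ≠ i.2.1 ∧ (∀ j, Sml (i.2.2 j) → a + a ≠ i.2.2 j) ∧
    ∀ j, if (i.1 j).1 then (i.1 j).val a ≠ 0 else
      ((i.1 j).val a ∉ E ∧ s - (i.1 j).val a ∉ E ∧ (i.1 j).val a + (i.1 j).val a ≠ s)
  have hA : ∀ i, n ≤ 4 * (A i).card := by
    intro i
    let B : Fin 5 → Finset G := fun j =>
      (univ.filter fun a => (i.1 j).val a ∈ ({0} : Finset G) ∪ E ∪ E.image (fun e => s - e) ∪ (univ.filter fun c => c + c = s))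
    have hB : ∀ j, (B j).card ≤ 1 + E.card + E.card + (univ.filter fun c : G => c + c = s).card := by
      intro j
      refine (Fm.card_val_mem _ _).trans ?_
      refine (card_union_le _ _).trans (Nat.add_le_add_right ((card_union_le _ _).trans ?_) _)
      refine Nat.add_le_add ((card_union_le _ _).trans ?_) card_image_le
      simp
    let B' : Fin 5 → Finset G := fun j => if Sml (i.2.2 j) then univ.filter fun a => a + a = i.2.2 j else ∅
    have hB' : ∀ j, 100 * (B' j).card ≤ n := by
      intro j
      by_cases h : Sml (i.2.2 j)
      · simp only [B', if_pos h]; exact h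
      · simp [B', h]
    have hsub : (univ : Finset G) ⊆ A i ∪ ((univ.filter fun c : G => c + c = i.2.1) ∪ (univ.biUnion B ∪ univ.biUnion B')) := by
      intro a _
      by_contra hcon
      simp only [mem_union, mem_filter, mem_univ, true_and, mem_biUnion, not_or, not_exists, A, B,
        mem_singleton, mem_image] at hcon
      obtain ⟨h1, h2, h3, h8⟩ := hcon
      apply h1
      refine ⟨h2, fun j hj => ?_, fun j => ?_⟩
      · have := h8 j
        simp only [B', if_pos hj, mem_filter, mem_univ, true_and] at this
        exact this
      obtain ⟨⟨⟨h4, h5⟩, h6⟩, h7⟩ := h3 j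
      split_ifs
      · exact h4
      · exact ⟨h5, fun h => h6 _ ⟨h, sub_sub_cancel _ _⟩, h7⟩
    have h1 := (card_le_card hsub).trans ((card_union_le _ _).trans (Nat.add_le_add_left (card_union_le _ _) _))
    have h2 : (univ.biUnion B).card ≤ 5 * (1 + E.card + E.card + (univ.filter fun c : G => c + c = s).card) := by
      refine (card_biUnion_le_card_mul _ _ _ (fun j _ => hB j)).trans ?_
      simp
    have h4 : (univ.biUnion B').card ≤ 5 * (n / 100) := by
      refine (card_biUnion_le_card_mul _ _ (n / 100) (fun j _ => by have := hB' j; omega)).trans ?_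
      simp
    have h5 := card_union_le (univ.biUnion B) (univ.biUnion B')
    rw [card_univ] at h1
    have := hκ i.2.1
    omega
  let ft : (Fin 5 → Fm G) × G × (Fin 5 → G) → G → Finset (G ⊕ G) := fun i a => univ.biUnion fun j => (i.1 j).foot s a
  have hft : ∀ i a, (ft i a).card ≤ 10 := by
    intro i a
    refine (card_biUnion_le_card_mul _ _ 2 (fun j _ => Fm.foot_card _ _ _)).trans ?_
    simp
  have hconf : ∀ i a, ((A i).filter fun b => ¬ Disjoint (ft i a) (ft i b)).card ≤ 100 := by
    intro i a
    have : ((A i).filter fun b => ¬ Disjoint (ft i a) (ft i b)) ⊆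
        (ft i a).biUnion fun w => univ.biUnion fun j => univ.filter fun b => w ∈ (i.1 j).foot s b := by
      intro b hb
      obtain ⟨w, hw1, hw2⟩ := not_disjoint_iff.1 (mem_filter.1 hb).2
      simp only [ft, mem_biUnion] at hw2
      obtain ⟨j, -, hj⟩ := hw2
      simp only [mem_biUnion, mem_filter, mem_univ, true_and]
      exact ⟨w, hw1, j, hj⟩
    refine (card_le_card this).trans ((card_biUnion_le_card_mul _ _ 10 fun w _ => ?_).trans ?_)
    · refine (card_biUnion_le_card_mul _ _ 2 (fun j _ => Fm.foot_conflict _ _ _)).trans ?_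
      simp
    · have := hft i a; omega
  choose S hSA hSd hSc using fun i => exists_independent (A i)
    (fun a b => ¬ Disjoint (ft i a) (ft i b)) (fun a b h h' => h h'.symm) 100
    (fun a _ => hconf i a)
  have hSK : ∀ i, (n:ℝ)/500 ≤ (S i).card := by
    intro i
    have h1 := hA i
    have h2 := hSc i
    have h3 : n ≤ 4 * (101 * (S i).card) := by omega
    have h4 : (n:ℝ) ≤ 404 * (S i).card := by
      have : (n:ℝ) ≤ ((4 * (101 * (S i).card) : ℕ) : ℝ) := by exact_mod_cast h3
      push_cast at this; linarith
    linarith [show (0:ℝ) ≤ (S i).card from by positivity]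
  have hNn : (4^5 : ℝ) * ((n:ℝ)^11 * exp (-(p^10/2000/4 * n))) < 1/4 := hN0 n hn1
  obtain ⟨R, hR1, hR2⟩ := exists_random_subset (W := G ⊕ G) (α := G) (I := (Fin 5 → Fm G) × G × (Fin 5 → G))
    p hp hp1 10 (n/500) (by positivity) ft S
    (fun i a ha b hb hab => by simpa using hSd i a ha b hb hab)
    (fun i a _ => hft i a) hSK (by
      have : card ((Fin 5 → Fm G) × G × (Fin 5 → G)) = 4^5 * n^11 := by
        simp [Fm, ← hn']; ring
      rw [this]
      push_cast
      have h6 : p ^ 10 * (n/500) / 4 = p^10/2000/4 * n * 4 := by ring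
      refine le_trans ?_ hNn.le
      rw [mul_assoc]
      have : exp (-(p ^ 10 * ((n:ℝ)/500) / 4)) ≤ exp (-(p^10/2000/4 * n)) := by
        apply exp_le_exp.2
        rw [h6]
        have : 0 ≤ p^10/2000/4 * (n:ℝ) := by positivity
        linarith
      gcongr
      norm_num)
  rw [Fintype.card_sum] at hR1
  let RV : Finset G := univ.filter fun x => x ≠ 0 ∧ Sum.inl x ∈ R
  let Rc : Finset G := univ.filter fun c => Sum.inr c ∈ R ∧ Sum.inr (s - c) ∈ R ∧ c ∉ E ∧ s - c ∉ E ∧ c + c ≠ s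
  refine ⟨RV, Rc, ⟨by simp [RV], ?_, ?_, ?_, ?_⟩, ?_, ?_⟩
  · intro c hc
    simp only [Rc, mem_filter, mem_univ, true_and, sub_sub_cancel] at hc ⊢
    obtain ⟨h1, h2, h3, h4, h5⟩ := hc
    refine ⟨h2, h1, h4, h3, fun h => h5 ?_⟩
    calc c + c = (s + s) - ((s - c) + (s - c)) := by abel
      _ = s := by rw [h]; abel
  · intro c hc h
    simp only [Rc, mem_filter, mem_univ, true_and] at hc
    exact hc.2.2.2.2 (eq_sub_iff_add_eq.1 h)
  · intro c hc
    simp only [Rc, mem_filter, mem_univ, true_and] at hc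
    exact hc.2.2.1
  · intro L κ κ'
    have h1 := hR2 (L, κ, κ')
    have h2 : (((S (L, κ, κ')).filter fun a => ft (L, κ, κ') a ⊆ R).card : ℝ) ≤
      ((univ : Finset G).filter fun a => a + a ≠ κ ∧ (∀ i, Sml (κ' i) → a + a ≠ κ' i) ∧
      ∀ i, Fm.val (L i) a ∈ if (L i).1 then RV else Rc).card := by
      norm_cast
      refine card_le_card fun a ha => ?_
      rw [mem_filter] at ha
      have hAa := hSA _ ha.1
      simp only [A, mem_filter, mem_univ, true_and] at hAa ⊢
      refine ⟨hAa.1, hAa.2.1, fun i => ?_⟩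
      have hi := hAa.2.2 i
      have hf : (L i).foot s a ⊆ R := (subset_biUnion_of_mem (fun j => (L j).foot s a) (mem_univ i)).trans ha.2
      unfold Fm.foot at hf
      split_ifs at hi hf ⊢
      · simp only [RV, mem_filter, mem_univ, true_and]
        exact ⟨hi, hf (mem_singleton_self _)⟩
      · simp only [Rc, mem_filter, mem_univ, true_and]
        exact ⟨hf (by simp), hf (by simp), hi.1, hi.2.1, hi.2.2⟩
    refine le_trans (le_of_eq ?_) (h1.trans h2)
    ring
  · have : (RV.card : ℝ) ≤ R.card := by
      exact_mod_cast card_le_card_of_injOn Sum.inl (fun x hx => by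
        simp [RV] at hx; exact hx.2) Sum.inl_injective.injOn
    push_cast at hR1
    rw [← hn'] at hR1
    linarith
  · have : (Rc.card : ℝ) ≤ R.card := by
      exact_mod_cast card_le_card_of_injOn Sum.inr (fun x hx => by
        simp [Rc] at hx; exact hx.1) Sum.inr_injective.injOn
    push_cast at hR1
    rw [← hn'] at hR1
    linarith

lemma Res.pick {s : G} {E : Finset G} {δ : ℝ} {RV Rc : Finset G} (h : Res s E δ RV Rc)
    (L : List (Fm G)) (hL : L.length ≤ 5) (κ : G) (K : List G) (hK : K.length ≤ 5) (hKE : ∀ x ∈ K, Sml x)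
    (B UV UC : Finset G)
    (hc : ((B.card + 5 * (UV.card + UC.card) : ℕ) : ℝ) < δ * card G) :
    ∃ a, a ∉ B ∧ a + a ≠ κ ∧ (∀ x ∈ K, a + a ≠ x) ∧
      ∀ f ∈ L, f.val a ∈ if f.1 then RV \ UV else Rc \ UC := by
  let L' : Fin 5 → Fm G := fun i => L.getD i (true, true, 0)
  let K' : Fin 5 → G := fun i => K.getD i 0
  have h1 := h.pick' L' κ K'
  set T := ((univ : Finset G).filter fun a => a + a ≠ κ ∧ (∀ i, Sml (K' i) → a + a ≠ K' i) ∧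
      ∀ i, Fm.val (L' i) a ∈ if (L' i).1 then RV else Rc)
  set X := B ∪ univ.biUnion fun i => univ.filter fun a => (L' i).val a ∈ UV ∪ UC
  have hX : X.card ≤ B.card + 5 * (UV.card + UC.card) := by
    refine (card_union_le _ _).trans (Nat.add_le_add_left ?_ _)
    refine (card_biUnion_le_card_mul _ _ (UV.card + UC.card) (fun j _ => ?_)).trans ?_
    · exact (Fm.card_val_mem _ _).trans (card_union_le _ _)
    · simp
  have hlt : X.card < T.card := by
    have : (X.card : ℝ) < T.card := lt_of_le_of_lt (by exact_mod_cast hX) (hc.trans_le h1)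
    exact_mod_cast this
  obtain ⟨a, haT, haX⟩ := exists_mem_notMem_of_card_lt_card hlt
  simp only [T, X, mem_filter, mem_univ, true_and, mem_union, mem_biUnion, not_or, not_exists] at haT haX
  refine ⟨a, haX.1, haT.1, fun x hx => ?_, fun f hf => ?_⟩
  · obtain ⟨i, hi, rfl⟩ := List.getElem_of_mem hx
    have e : K' ⟨i, by omega⟩ = K[i] := by simp [K', List.getD_eq_getElem?_getD, hi]
    have := haT.2.1 ⟨i, by omega⟩
    rw [e] at this
    exact this (hKE _ hx)
  obtain ⟨i, hi, rfl⟩ := List.getElem_of_mem hf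
  have e : L' ⟨i, by omega⟩ = L[i] := by simp [L', List.getD_eq_getElem?_getD, hi]
  have h2 := haT.2.2 ⟨i, by omega⟩
  have h3 := haX.2 ⟨i, by omega⟩
  rw [e] at h2 h3
  split_ifs at h2 ⊢
  · exact mem_sdiff.2 ⟨h2, h3.1⟩
  · exact mem_sdiff.2 ⟨h2, h3.2⟩

/-- An integer vector with a sufficient condition for being unimodular. -/
def Uni {r : ℕ} (c : Fin r → ℤ) : Prop :=
  (∃ i, c i = 1 ∨ c i = -1) ∨ ∃ i j, c i + c j = 1 ∨ c i + c j = -1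

instance {r : ℕ} (c : Fin r → ℤ) : Decidable (Uni c) := by unfold Uni; infer_instance

lemma Uni.exists_dual {r : ℕ} {c : Fin r → ℤ} (h : Uni c) : ∃ u : Fin r → ℤ, ∑ i, c i * u i = 1 := by
  rcases h with ⟨i, h⟩ | ⟨i, j, h⟩
  · refine ⟨Pi.single i (c i), ?_⟩
    rw [sum_eq_single i]
    · rcases h with h | h <;> simp [h]
    · intro b _ hb; simp [Pi.single_eq_of_ne hb]
    · simp
  · refine ⟨Pi.single i (c i + c j) + Pi.single j (c i + c j), ?_⟩
    simp only [Pi.add_apply, mul_add, sum_add_distrib]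
    rw [sum_eq_single i, sum_eq_single j]
    · simp only [Pi.single_eq_same]
      rcases h with h | h <;> rw [h] <;> linarith
    · intro b _ hb; simp [Pi.single_eq_of_ne hb]
    · simp
    · intro b _ hb; simp [Pi.single_eq_of_ne hb]
    · simp

/-- The homomorphism given by an integer vector. -/
def lin {r : ℕ} (c : Fin r → ℤ) : (Fin r → G) →+ G where
  toFun x := ∑ i, c i • x i
  map_zero' := by simp
  map_add' x y := by simp [sum_add_distrib]

lemma lin_surjective {r : ℕ} {c : Fin r → ℤ} (h : Uni c) :
    Surjective (lin c : (Fin r → G) →+ G) := by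
  obtain ⟨u, hu⟩ := h.exists_dual
  intro g
  refine ⟨fun i => u i • g, ?_⟩
  simp only [lin, AddMonoidHom.coe_mk, ZeroHom.coe_mk, ← mul_smul]
  rw [← sum_smul, hu, one_smul]

lemma card_fiber_of_surjective {H : Type} [AddCommGroup H] [Fintype H] (φ : H →+ G)
    (hφ : Surjective φ) (g : G) :
    card G * ((univ : Finset H).filter fun x => φ x = g).card = card H := by
  classical
  have h1 : ∀ g', ((univ : Finset H).filter fun x => φ x = g').card
      = ((univ : Finset H).filter fun x => φ x = g).card := fun g' =>
    AddMonoidHom.card_fiber_eq_of_mem_range φ (hφ g') (hφ g)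
  have h2 := card_eq_sum_card_fiberwise (f := φ) (s := univ) (t := univ)
    (fun _ _ => mem_coe.2 (mem_univ _))
  simp only [h1, sum_const, card_univ, smul_eq_mul] at h2
  exact h2.symm

lemma exists_generic_aux {r : ℕ} (Bad : Finset ((Fin r → ℤ) × G)) (hB : ∀ b ∈ Bad, Uni b.1)
    (hc : 2 * Bad.card < card G) (S : Finset (Fin r → G))
    (hS : 2 * S.card ≤ card G ^ r) :
    ∃ x, x ∉ S ∧ ∀ b ∈ Bad, lin b.1 x ≠ b.2 := by
  classical
  set n := card G
  set X := Bad.biUnion fun b => (univ : Finset (Fin r → G)).filter fun x => lin b.1 x = b.2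
  have hn : 0 < n := by omega
  have hX : n * X.card ≤ Bad.card * n ^ r := by
    calc n * X.card ≤ n * ∑ b ∈ Bad, ((univ : Finset (Fin r → G)).filter fun x => lin b.1 x = b.2).card :=
          Nat.mul_le_mul_left _ card_biUnion_le
      _ = ∑ b ∈ Bad, n ^ r := by
          rw [mul_sum]
          refine sum_congr rfl fun b hb => ?_
          rw [card_fiber_of_surjective _ (lin_surjective (hB b hb))]; simp [n]
      _ = _ := by simp
  have hpos : 0 < n ^ r := by positivity
  have hX2 : 2 * X.card < n ^ r := by
    by_contra hcon
    push Not at hcon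
    have : n * n ^ r ≤ 2 * (Bad.card * n ^ r) := by nlinarith
    have h2 : 2 * Bad.card * n ^ r < n * n ^ r := Nat.mul_lt_mul_of_pos_right hc hpos
    linarith
  have hlt : (S ∪ X).card < (univ : Finset (Fin r → G)).card := by
    have := card_union_le S X
    simp only [card_univ, card_fun, card_fin]
    change _ < n ^ r
    omega
  obtain ⟨x, -, hx⟩ := exists_mem_notMem_of_card_lt_card hlt
  simp only [mem_union, not_or] at hx
  refine ⟨x, hx.1, fun b hb h => hx.2 ?_⟩
  exact mem_biUnion.2 ⟨b, hb, by simp [h]⟩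

/-- An affine form in several variables. -/
abbrev LF (r : ℕ) (G : Type) := (Fin r → ℤ) × G

/-- Evaluation of an affine form. -/
def ev {r : ℕ} (x : Fin r → G) (f : LF r G) : G := lin f.1 x + f.2

/-- Two affine forms rarely (or never) coincide; `S` is an exceptional set. -/
def Apart {r : ℕ} (S : Finset (Fin r → G)) (f g : LF r G) : Prop :=
  Uni (f.1 - g.1) ∨ (f.1 = g.1 ∧ f.2 ≠ g.2) ∨ ∀ x, x ∉ S → ev x f ≠ ev x g

theorem exists_generic {r : ℕ} (LV LC : List (LF r G)) (S : Finset (Fin r → G))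
    (hS : 2 * S.card ≤ card G ^ r)
    (uV : ∀ f ∈ LV, Uni f.1) (uC : ∀ f ∈ LC, Uni f.1)
    (pV : LV.Pairwise (Apart S)) (pC : LC.Pairwise (Apart S)) (FV FC : Finset G)
    (hn : 2 * (LV.length * FV.card + LC.length * FC.card + LV.length ^ 2 + LC.length ^ 2)
      < card G) :
    ∃ x, (LV.map (ev x)).Nodup ∧ (LC.map (ev x)).Nodup ∧ (∀ v ∈ LV.map (ev x), v ∉ FV) ∧
      (∀ v ∈ LC.map (ev x), v ∉ FC) := by
  classical
  let av : List (LF r G) → Finset G → Finset ((Fin r → ℤ) × G) := fun L F =>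
    (L.toFinset ×ˢ F).image fun p => (p.1.1, p.2 - p.1.2)
  let pr : List (LF r G) → Finset ((Fin r → ℤ) × G) := fun L =>
    ((L.toFinset ×ˢ L.toFinset).filter fun p => Uni (p.1.1 - p.2.1)).image
      fun p => (p.1.1 - p.2.1, p.2.2 - p.1.2)
  have hav : ∀ L F, (av L F).card ≤ L.length * F.card := fun L F =>
    card_image_le.trans (by rw [card_product]; exact Nat.mul_le_mul_right _ (List.toFinset_card_le L))
  have hpr : ∀ L, (pr L).card ≤ L.length ^ 2 := fun L =>
    card_image_le.trans ((card_filter_le _ _).trans (by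
      rw [card_product, sq]
      exact Nat.mul_le_mul (List.toFinset_card_le L) (List.toFinset_card_le L)))
  obtain ⟨x, hxS, hx⟩ := exists_generic_aux (av LV FV ∪ av LC FC ∪ pr LV ∪ pr LC) (by
      intro b hb
      simp only [av, pr, mem_union, mem_image, mem_product, mem_filter, mem_toFinset] at hb
      rcases hb with ((⟨p, hp, rfl⟩ | ⟨p, hp, rfl⟩) | ⟨p, hp, rfl⟩) | ⟨p, hp, rfl⟩
      · exact (show Uni p.1.1 from uV p.1 hp.1)
      · exact (show Uni p.1.1 from uC p.1 hp.1)
      · exact hp.2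
      · exact hp.2) (by
      have h1 := card_union_le (av LV FV ∪ av LC FC ∪ pr LV) (pr LC)
      have h2 := card_union_le (av LV FV ∪ av LC FC) (pr LV)
      have h3 := card_union_le (av LV FV) (av LC FC)
      have := hav LV FV; have := hav LC FC; have := hpr LV; have := hpr LC
      omega) S hS
  have key : ∀ L, (∀ b ∈ pr L, lin b.1 x ≠ b.2) → L.Pairwise (Apart S) → (L.map (ev x)).Nodup := by
    intro L hL hp
    rw [List.Nodup, List.pairwise_map]
    refine List.Pairwise.imp_of_mem ?_ hp
    intro f g hf hg hfg
    rcases hfg with h | ⟨h1, h2⟩ | h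
    · have := hL (f.1 - g.1, g.2 - f.2) (mem_image.2 ⟨(f, g), by simp [hf, hg, h], rfl⟩)
      intro he
      apply this
      have h3 : lin (f.1 - g.1) x = lin f.1 x - lin g.1 x := by
        simp [lin, sub_smul, sum_sub_distrib]
      rw [h3]
      unfold ev at he
      grind
    · unfold ev
      rw [h1]
      exact fun h => h2 (add_left_cancel h)
    · exact h x hxS
  have key2 : ∀ L F, (∀ b ∈ av L F, lin b.1 x ≠ b.2) → ∀ v ∈ L.map (ev x), v ∉ F := by
    intro L F hL v hv hvF
    obtain ⟨f, hf, rfl⟩ := List.mem_map.1 hv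
    refine hL (f.1, ev x f - f.2) (mem_image.2 ⟨(f, ev x f), by simp [hf, hvF], rfl⟩) ?_
    simp [ev]
  refine ⟨x, key LV (fun b hb => hx b ?_) pV, key LC (fun b hb => hx b ?_) pC,
    key2 LV FV (fun b hb => hx b ?_), key2 LC FC (fun b hb => hx b ?_)⟩ <;> simp [hb]

lemma card_lin_double {r : ℕ} (c : Fin r → ℤ) (hc : Uni c) (κ : G) (t : ℕ)
    (h : t * (univ.filter fun g : G => g + g = κ).card ≤ card G) :
    t * ((univ : Finset (Fin r → G)).filter fun x => lin c x + lin c x = κ).card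
      ≤ card G ^ r := by
  classical
  set n := card G
  have hn : 0 < n := card_pos_iff.2 ⟨0⟩
  have h1 : ((univ : Finset (Fin r → G)).filter fun x => lin c x + lin c x = κ)
      = (univ.filter fun g : G => g + g = κ).biUnion fun g => univ.filter fun x => lin c x = g := by
    ext x; simp
  have h2 : n * ((univ : Finset (Fin r → G)).filter fun x => lin c x + lin c x = κ).card
      ≤ (univ.filter fun g : G => g + g = κ).card * n ^ r := by
    rw [h1]
    refine (Nat.mul_le_mul_left _ card_biUnion_le).trans ?_
    rw [mul_sum, sum_congr rfl fun g hg => card_fiber_of_surjective _ (lin_surjective hc) g]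
    simp [n]
  have hpos : 0 < n ^ r := by positivity
  have h3 : n * (t * ((univ : Finset (Fin r → G)).filter fun x => lin c x + lin c x = κ).card) ≤ n * n ^ r := by
    calc n * (t * ((univ : Finset (Fin r → G)).filter fun x => lin c x + lin c x = κ).card)
        = t * (n * ((univ : Finset (Fin r → G)).filter fun x => lin c x + lin c x = κ).card) := by ring
      _ ≤ t * ((univ.filter fun g : G => g + g = κ).card * n ^ r) := Nat.mul_le_mul_left _ h2
      _ = (t * (univ.filter fun g : G => g + g = κ).card) * n ^ r := by ring
      _ ≤ n * n ^ r := Nat.mul_le_mul_right _ h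
  exact Nat.le_of_mul_le_mul_left h3 hn

/-- A gadget: windows (gaps with one free position) together with vertices and differences. -/
@[ext] structure Gd (G : Type) where
  ws : Multiset (G × G)
  oV : Multiset G
  oC : Multiset G

instance : Add (Gd G) := ⟨fun g h => ⟨g.ws + h.ws, g.oV + h.oV, g.oC + h.oC⟩⟩
instance : Zero (Gd G) := ⟨⟨0, 0, 0⟩⟩
@[simp] lemma Gd.add_ws (g h : Gd G) : (g + h).ws = g.ws + h.ws := rfl
@[simp] lemma Gd.add_oV (g h : Gd G) : (g + h).oV = g.oV + h.oV := rfl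
@[simp] lemma Gd.add_oC (g h : Gd G) : (g + h).oC = g.oC + h.oC := rfl
@[simp] lemma Gd.zero_ws : (0 : Gd G).ws = 0 := rfl
@[simp] lemma Gd.zero_oV : (0 : Gd G).oV = 0 := rfl
@[simp] lemma Gd.zero_oC : (0 : Gd G).oC = 0 := rfl

/-- All vertices occurring in a gadget. -/
def Gd.vs (g : Gd G) : Multiset G := g.ws.map fst + g.ws.map snd + g.oV

/-- All differences of a gadget, including those that close its windows to triangles. -/
def Gd.cs (g : Gd G) : Multiset G := g.oC + g.ws.map fun p => p.1 - p.2

lemma Gd.vs_add (g h : Gd G) : (g + h).vs = g.vs + h.vs := by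
  simp only [Gd.vs, Gd.add_ws, Gd.add_oV, Multiset.map_add]; abel

lemma Gd.cs_add (g h : Gd G) : (g + h).cs = g.cs + h.cs := by
  simp only [Gd.cs, Gd.add_ws, Gd.add_oC, Multiset.map_add]; abel

/-- The gadget has no repetitions and avoids given sets. -/
structure Fresh (g : Gd G) (FV FC : Finset G) : Prop where
  ndV : g.vs.Nodup
  ndC : g.cs.Nodup
  avV : ∀ v ∈ g.vs, v ∉ FV
  avC : ∀ c ∈ g.cs, c ∉ FC

lemma Fresh.add {g h : Gd G} {FV FC : Finset G} (hg : Fresh g FV FC)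
    (hh : Fresh h (FV ∪ g.vs.toFinset) (FC ∪ g.cs.toFinset)) : Fresh (g + h) FV FC := by
  refine ⟨?_, ?_, ?_, ?_⟩
  · rw [Gd.vs_add]
    refine nodup_add.2 ⟨hg.ndV, hh.ndV, ?_⟩
    rw [Multiset.disjoint_left]
    intro a ha ha'
    have := hh.avV a ha'
    simp [ha] at this
  · rw [Gd.cs_add]
    refine nodup_add.2 ⟨hg.ndC, hh.ndC, ?_⟩
    rw [Multiset.disjoint_left]
    intro a ha ha'
    have := hh.avC a ha'
    simp [ha] at this
  · intro v hv
    rw [Gd.vs_add, mem_add] at hv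
    rcases hv with hv | hv
    · exact hg.avV v hv
    · exact fun h => hh.avV v hv (mem_union_left _ h)
  · intro v hv
    rw [Gd.cs_add, mem_add] at hv
    rcases hv with hv | hv
    · exact hg.avC v hv
    · exact fun h => hh.avC v hv (mem_union_left _ h)

lemma Fresh.mono {g : Gd G} {FV FC FV' FC' : Finset G} (hg : Fresh g FV FC) (h : FV' ⊆ FV)
    (h' : FC' ⊆ FC) : Fresh g FV' FC' :=
  ⟨hg.ndV, hg.ndC, fun v hv hm => hg.avV v hv (h hm), fun v hv hm => hg.avC v hv (h' hm)⟩

/-- The gaps given by the windows. -/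
def wins (W : Multiset (G × G)) : Multiset (Box G) := W.map fun p => Box.gap p.1 p.2 1

lemma wins_add (W W' : Multiset (G × G)) : wins (W + W') = wins W + wins W' := by simp [wins]

/-- The gadget can be completed using additionally the given vertices and differences. -/
def Abs (g : Gd G) (dV dC : Multiset G) : Prop := Fil (wins g.ws) (g.oV + dV) (g.oC + dC)

lemma Abs.add {g h : Gd G} {V C V' C' : Multiset G} (hg : Abs g V C) (hh : Abs h V' C') :
    Abs (g + h) (V + V') (C + C') := by
  unfold Abs at *
  have := Fil.add hg hh
  simp only [Gd.add_ws, wins_add, Gd.add_oV, Gd.add_oC]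
  convert this using 1 <;> abel

lemma win_fil {a b v x y : G} (hx : x = v - a) (hy : y = b - v) :
    Fil {Box.gap a b 1} {v} ({x} + {y}) := by
  subst hx hy
  exact Fil.single ⟨[v], rfl, rfl, rfl⟩

/-- A gadget with a given property can be found avoiding any small sets. -/
def Ex (DV DC : Finset G) (K : ℕ) (P : Gd G → Prop) : Prop :=
  ∀ FV FC : Finset G, FV.Nonempty → FC.Nonempty → DV ⊆ FV → DC ⊆ FC →
    K * (FV.card + FC.card) ≤ card G →
    ∃ g, P g ∧ Fresh g FV FC ∧ g.vs.card + g.cs.card ≤ K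

lemma Ex.mono {DV DC DV' DC' : Finset G} {K : ℕ} {P Q : Gd G → Prop} (h : Ex DV DC K P)
    (hV : DV ⊆ DV') (hC : DC ⊆ DC') (hPQ : ∀ g, P g → Q g) : Ex DV' DC' K Q := by
  intro FV FC h1 h2 h3 h4 h5
  obtain ⟨g, hg, hf, hs⟩ := h FV FC h1 h2 (hV.trans h3) (hC.trans h4) h5
  exact ⟨g, hPQ g hg, hf, hs⟩

lemma Ex.bind {DV DC : Finset G} {K1 K2 : ℕ} {P1 P : Gd G → Prop} (h : Ex DV DC K1 P1)
    (h2 : ∀ g, P1 g → Fresh g DV DC →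
      Ex (DV ∪ g.vs.toFinset) (DC ∪ g.cs.toFinset) K2 fun g' => P (g + g')) :
    Ex DV DC (K1 + K2 * (2 * K1 + 1)) P := by
  intro FV FC hV hC hDV hDC hn
  have e1 : 1 ≤ FV.card := card_pos.2 hV
  have e2 : 1 ≤ FC.card := card_pos.2 hC
  obtain ⟨g, hg, hf, hs⟩ := h FV FC hV hC hDV hDC (by nlinarith)
  have a1 := card_union_le FV g.vs.toFinset
  have a2 := card_union_le FC g.cs.toFinset
  have a3 := toFinset_card_le g.vs
  have a4 := toFinset_card_le g.cs
  obtain ⟨g', hg', hf', hs'⟩ := h2 g hg (hf.mono hDV hDC) (FV ∪ g.vs.toFinset)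
    (FC ∪ g.cs.toFinset) (hV.mono subset_union_left) (hC.mono subset_union_left)
    (union_subset_union_left hDV) (union_subset_union_left hDC) (by
      have : (FV ∪ g.vs.toFinset).card + (FC ∪ g.cs.toFinset).card ≤ (2 * K1 + 1) * (FV.card + FC.card) := by
        nlinarith
      calc _ ≤ K2 * ((2 * K1 + 1) * (FV.card + FC.card)) := Nat.mul_le_mul_left _ this
        _ ≤ _ := by nlinarith)
  refine ⟨g + g', hg', hf.add hf', ?_⟩
  rw [Gd.vs_add, Gd.cs_add, card_add, card_add]
  nlinarith

lemma two_sub_lin {r : ℕ} (c : Fin r → ℤ) (x : Fin r → G) (f g : LF r G) (h : f.1 - g.1 = 2 • c)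
    (he : ev x f = ev x g) : lin c x + lin c x = g.2 - f.2 := by
  unfold ev at he
  have h3 : lin (f.1 - g.1) x = lin f.1 x - lin g.1 x := by
    simp [lin, sub_smul, sum_sub_distrib]
  have h4 : lin (2 • c) x = lin c x + lin c x := by
    simp only [lin, AddMonoidHom.coe_mk, ZeroHom.coe_mk, ← sum_add_distrib]
    refine sum_congr rfl fun i _ => ?_
    simp [two_mul, add_smul]
  rw [h, h4] at h3
  rw [h3]
  grind

/-- The list has no repetitions and avoids the set. -/
def Good (L : List G) (F : Finset G) : Prop := L.Nodup ∧ ∀ v ∈ L, v ∉ F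

lemma Fresh.of_good {g : Gd G} {FV FC : Finset G} {LV LC : List G} (hV : Good LV FV) (hC : Good LC FC)
    (e1 : g.vs = ↑LV) (e2 : g.cs = ↑LC) : Fresh g FV FC := by
  refine ⟨?_, ?_, ?_, ?_⟩
  · rw [e1]; exact hV.1
  · rw [e2]; exact hC.1
  · rw [e1]; exact hV.2
  · rw [e2]; exact hC.2

/-- Combination of size constants. -/
def kb (a b : ℕ) : ℕ := a + b * (2 * a + 1)

lemma Ex.two {DV DC : Finset G} {K1 K2 : ℕ} {P1 P2 : Gd G → Prop} (h1 : Ex DV DC K1 P1)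
    (h2 : Ex DV DC K2 P2) : Ex DV DC (kb K1 K2) fun g => ∃ g1 g2, g = g1 + g2 ∧ P1 g1 ∧ P2 g2 :=
  h1.bind fun g hg _ => h2.mono subset_union_left subset_union_left fun g' hg' => ⟨g, g', rfl, hg, hg'⟩

lemma Ex.pick {DV DC : Finset G} {r : ℕ} (P : Gd G → Prop) (LV LC : List (LF r G))
    (uV : ∀ f ∈ LV, Uni f.1) (uC : ∀ f ∈ LC, Uni f.1) (S : Finset (Fin r → G))
    (hS : 2 * S.card ≤ card G ^ r) (pV : LV.Pairwise (Apart S)) (pC : LC.Pairwise (Apart S))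
    (hlV : LV.length ≤ 12) (hlC : LC.length ≤ 12)
    (h : ∀ x : Fin r → G, ∃ g, P g ∧ g.vs = ↑(LV.map (ev x)) ∧ g.cs = ↑(LC.map (ev x))) :
    Ex DV DC 700 P := by
  intro FV FC hV hC hDV hDC hn
  have e1 : 1 ≤ FV.card := card_pos.2 hV
  have e2 : 1 ≤ FC.card := card_pos.2 hC
  obtain ⟨x, ndV, ndC, avV, avC⟩ := exists_generic LV LC S hS uV uC pV pC FV FC (by nlinarith)
  obtain ⟨g, hg, q1, q2⟩ := h x
  refine ⟨g, hg, .of_good ⟨ndV, avV⟩ ⟨ndC, avC⟩ q1 q2, ?_⟩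
  rw [q1, q2]; simp; omega

/-- Switcher between two vertices. -/
lemma exists_vertexSwitch (h2 : Half G)
    (DV DC : Finset G) (v v' : G) :
    Ex DV DC 700 fun g => Abs g {v} 0 ∧ Abs g {v'} 0 := by
  refine Ex.pick (r := 3) _
    [(![1,0,0], 0), (![0,1,0], 0), (![-1,0,1], v), (![0,-1,1], v'), (![0,0,1], (0 : G))]
    [(![-1,0,0], v), (![-1,0,1], 0), (![0,-1,1], 0), (![0,-1,0], v'), (![2,0,-1], -v), (![0,2,-1], -v')]
    (by simp only [forall_mem_cons]; (repeat' apply And.intro) <;> first | decide | simp)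
    (by simp only [forall_mem_cons]; (repeat' apply And.intro) <;> first | decide | simp)
    (univ.filter fun x => lin ![1,-1,0] x + lin ![1,-1,0] x = -v' - -v)
    (card_lin_double _ (by decide) _ 2 (h2 _)) ?_ ?_ (by simp) (by simp) ?_
  · simp only [pairwise_cons, forall_mem_cons]
    (repeat' apply And.intro) <;> first | exact Or.inl (by dsimp only; decide) | simp
  · simp only [pairwise_cons, forall_mem_cons]
    (repeat' apply And.intro) <;> first
        | exact Or.inl (by dsimp only; decide)
        | (refine Or.inr (Or.inr ?_); intro x hx he
           exact hx (mem_filter.2 ⟨mem_univ _, two_sub_lin ![1,-1,0] x _ _ (by dsimp only; decide) he⟩))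
        | simp
  intro x
  obtain ⟨a1, ha1⟩ : ∃ a, a = x 0 := ⟨_, rfl⟩
  obtain ⟨a2, ha2⟩ : ∃ a, a = x 1 := ⟨_, rfl⟩
  obtain ⟨w, hw⟩ : ∃ a, a = x 2 := ⟨_, rfl⟩
  refine ⟨⟨↑[(a1, v + w - a1), (a2, w + v' - a2)], ↑[w], ↑[v - a1, w - a1, w - a2, v' - a2]⟩,
    ⟨?_, ?_⟩, ?_, ?_⟩
  · have f1 := win_fil (a := a1) (b := v + w - a1) (v := v) (x := v - a1) (y := w - a1) (by abel) (by abel)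
    have f2 := win_fil (a := a2) (b := w + v' - a2) (v := w) (x := w - a2) (y := v' - a2) (by abel) (by abel)
    have := f1.add f2
    unfold Abs wins
    convert this using 1
    all_goals simp only [← cons_coe, ← singleton_add, coe_nil, Multiset.map_add, map_singleton, Multiset.map_zero]
    all_goals abel
  · have f1 := win_fil (a := a1) (b := v + w - a1) (v := w) (x := w - a1) (y := v - a1) (by abel) (by abel)
    have f2 := win_fil (a := a2) (b := w + v' - a2) (v := v') (x := v' - a2) (y := w - a2) (by abel) (by abel)
    have := f1.add f2
    unfold Abs wins
    convert this using 1
    all_goals simp only [← cons_coe, ← singleton_add, coe_nil, Multiset.map_add, map_singleton, Multiset.map_zero]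
    all_goals abel
  · change ofList [a1, a2, v + w - a1, w + v' - a2, w] = _
    congr 1
    simp only [List.map_cons, map_nil, ev, lin, AddMonoidHom.coe_mk, ZeroHom.coe_mk, Fin.sum_univ_three,
      Matrix.cons_val, ← ha1, ← ha2, ← hw, List.cons.injEq, zero_smul, one_smul, neg_smul, two_smul]
    (repeat' apply And.intro) <;> first | exact True.intro | abel
  · change ofList [v - a1, w - a1, w - a2, v' - a2, a1 - (v + w - a1), a2 - (w + v' - a2)] = _
    congr 1
    simp only [List.map_cons, map_nil, ev, lin, AddMonoidHom.coe_mk, ZeroHom.coe_mk, Fin.sum_univ_three,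
      Matrix.cons_val, ← ha1, ← ha2, ← hw, List.cons.injEq, zero_smul, one_smul, neg_smul, two_smul]
    (repeat' apply And.intro) <;> first | exact True.intro | abel

/-- Base of a switcher between two pairs of differences. -/
lemma exists_pairSwitch_base (D : Finset G)
    (hD : Thin D)
    (DV DC : Finset G) {y y' z z' : G} (hs : y + y' = z + z') (hyz : y ≠ z)
    (hy : y ∉ insert 0 D) (hy' : y' ∉ insert 0 D) (hz : z ∉ insert 0 D) (hz' : z' ∉ insert 0 D) :
    Ex DV DC 700 fun g => ∃ a1 t1 a2 t2 a3 : G, g =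
      ⟨↑[(a1, a1 + t1), (a2, a2 + t2), (a3, a3 + t1 + t2 - (y + y'))],
        ↑[a1 + y, a1 + z, a2 + y', a2 + z', a3 + t1 - y, a3 + t1 - z],
        ↑[t1 - y, t1 - z, t2 - y', t2 - z']⟩ := by
  simp only [mem_insert, not_or] at hy hy' hz hz'
  have hyz' : y' ≠ z' := by grind
  set dbl : (Fin 5 → ℤ) → G → Finset (Fin 5 → G) := fun c κ => univ.filter fun x => lin c x + lin c x = κ with hdbl
  have hd : ∀ c κ, Uni c → κ ∉ D → 16 * (dbl c κ).card ≤ card G ^ 5 := fun c κ hc hκ =>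
    card_lin_double c hc κ 16 (hD κ hκ)
  set S := dbl ![0,1,0,0,0] y ∪ dbl ![0,1,0,0,0] z ∪ dbl ![0,0,0,1,0] y' ∪ dbl ![0,0,0,1,0] z' with hS
  refine Ex.pick (r := 5) _
    [(![1,0,0,0,0], 0), (![0,0,1,0,0], 0), (![0,0,0,0,1], 0), (![1,1,0,0,0], 0), (![0,0,1,1,0], 0),
      (![0,1,0,1,1], -(y + y')), (![1,0,0,0,0], y), (![1,0,0,0,0], z), (![0,0,1,0,0], y'),
      (![0,0,1,0,0], z'), (![0,1,0,0,1], -y), (![0,1,0,0,1], -z)]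
    [(![0,1,0,0,0], -y), (![0,1,0,0,0], -z), (![0,0,0,1,0], -y'), (![0,0,0,1,0], -z'),
      (![0,-1,0,0,0], 0), (![0,0,0,-1,0], 0), (![0,-1,0,-1,0], y + y')]
    (by simp only [forall_mem_cons]; (repeat' apply And.intro) <;> first | decide | simp)
    (by simp only [forall_mem_cons]; (repeat' apply And.intro) <;> first | decide | simp)
    S ?_ ?_ ?_ (by simp) (by simp) ?_
  · have := card_union_le (dbl ![0,1,0,0,0] y ∪ dbl ![0,1,0,0,0] z ∪ dbl ![0,0,0,1,0] y') (dbl ![0,0,0,1,0] z')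
    have := card_union_le (dbl ![0,1,0,0,0] y ∪ dbl ![0,1,0,0,0] z) (dbl ![0,0,0,1,0] y')
    have := card_union_le (dbl ![0,1,0,0,0] y) (dbl ![0,1,0,0,0] z)
    have := hd ![0,1,0,0,0] y (by decide) hy.2
    have := hd ![0,1,0,0,0] z (by decide) hz.2
    have := hd ![0,0,0,1,0] y' (by decide) hy'.2
    have := hd ![0,0,0,1,0] z' (by decide) hz'.2
    rw [hS]
    omega
  · simp only [pairwise_cons, forall_mem_cons]
    (repeat' apply And.intro) <;> first
      | exact Or.inl (by dsimp only; decide)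
      | (refine Or.inr (Or.inl ⟨rfl, ?_⟩); dsimp only; grind)
      | simp
  · simp only [pairwise_cons, forall_mem_cons]
    (repeat' apply And.intro) <;> first
      | exact Or.inl (by dsimp only; decide)
      | (refine Or.inr (Or.inl ⟨rfl, ?_⟩); dsimp only; grind)
      | (refine Or.inr (Or.inr ?_); intro x hx he
         refine hx ?_
         have he2 := two_sub_lin ![0,1,0,0,0] x _ _ (by dsimp only; decide) he
         simp only [hS, hdbl, mem_union, mem_filter, mem_univ, true_and, he2]; simp)
      | (refine Or.inr (Or.inr ?_); intro x hx he
         refine hx ?_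
         have he2 := two_sub_lin ![0,0,0,1,0] x _ _ (by dsimp only; decide) he
         simp only [hS, hdbl, mem_union, mem_filter, mem_univ, true_and, he2]; simp)
      | simp
  · intro x
    refine ⟨_, ⟨x 0, x 1, x 2, x 3, x 4, rfl⟩, ?_, ?_⟩
    · change ofList [x 0, x 2, x 4, x 0 + x 1, x 2 + x 3, x 4 + x 1 + x 3 - (y + y'), x 0 + y,
        x 0 + z, x 2 + y', x 2 + z', x 4 + x 1 - y, x 4 + x 1 - z] = _
      congr 1
      simp only [List.map_cons, map_nil, ev, lin, AddMonoidHom.coe_mk, ZeroHom.coe_mk, Fin.sum_univ_five,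
        Matrix.cons_val, List.cons.injEq, zero_smul, one_smul, neg_smul, two_smul]
      (repeat' apply And.intro) <;> first | exact True.intro | abel
    · change ofList [x 1 - y, x 1 - z, x 3 - y', x 3 - z', x 0 - (x 0 + x 1), x 2 - (x 2 + x 3),
        x 4 - (x 4 + x 1 + x 3 - (y + y'))] = _
      congr 1
      simp only [List.map_cons, map_nil, ev, lin, AddMonoidHom.coe_mk, ZeroHom.coe_mk, Fin.sum_univ_five,
        Matrix.cons_val, List.cons.injEq, zero_smul, one_smul, neg_smul, two_smul]
      (repeat' apply And.intro) <;> first | exact True.intro | abel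

lemma Abs.of_eq {g : Gd G} {V C : Multiset G} {B : Multiset (Box G)} {V' C' : Multiset G} (h : Fil B V' C')
    (e1 : wins g.ws = B) (e2 : g.oV + V = V') (e3 : g.oC + C = C') : Abs g V C := by
  unfold Abs; rw [e1, e2, e3]; exact h

/-- Size constant of a switcher between two pairs. -/
def kPS : ℕ := 700 + kb 700 (kb 700 700) * (2 * 700 + 1)

/-- Switcher between two pairs of differences. -/
lemma exists_pairSwitch (h2 : Half G)
    (D : Finset G)
    (hD : Thin D)
    (DV DC : Finset G) {y y' z z' : G} (hs : y + y' = z + z') (hyz : y ≠ z)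
    (hy : y ∉ insert 0 D) (hy' : y' ∉ insert 0 D) (hz : z ∉ insert 0 D) (hz' : z' ∉ insert 0 D) :
    Ex DV DC kPS fun g => Abs g 0 ({y} + {y'}) ∧ Abs g 0 ({z} + {z'}) := by
  refine (exists_pairSwitch_base D hD DV DC hs hyz hy hy' hz hz').bind ?_
  rintro _ ⟨a1, t1, a2, t2, a3, rfl⟩ -
  refine ((exists_vertexSwitch h2 _ _ (a1 + y) (a1 + z)).two
    ((exists_vertexSwitch h2 _ _ (a2 + y') (a2 + z')).two
      (exists_vertexSwitch h2 _ _ (a3 + t1 - y) (a3 + t1 - z)))).mono subset_rfl subset_rfl ?_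
  rintro _ ⟨g1, _, rfl, ⟨p1, q1⟩, g2, g3, rfl, ⟨p2, q2⟩, p3, q3⟩
  constructor
  · have f1 := win_fil (a := a1) (b := a1 + t1) (v := a1 + y) (x := y) (y := t1 - y) (by abel) (by abel)
    have f2 := win_fil (a := a2) (b := a2 + t2) (v := a2 + y') (x := y') (y := t2 - y') (by abel) (by abel)
    have f3 := win_fil (a := a3) (b := a3 + t1 + t2 - (y + y')) (v := a3 + t1 - z) (x := t1 - z) (y := t2 - z')
      (by abel) (by rw [hs]; abel)
    have := ((f1.add f2).add f3).add (q1.add (q2.add p3))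
    refine Abs.of_eq this ?_ ?_ ?_
    all_goals simp only [wins, ← cons_coe, ← singleton_add, coe_nil, Multiset.map_add, map_singleton, Multiset.map_zero, Gd.add_ws, Gd.add_oV, Gd.add_oC]
    all_goals abel
  · have f1 := win_fil (a := a1) (b := a1 + t1) (v := a1 + z) (x := z) (y := t1 - z) (by abel) (by abel)
    have f2 := win_fil (a := a2) (b := a2 + t2) (v := a2 + z') (x := z') (y := t2 - z') (by abel) (by abel)
    have f3 := win_fil (a := a3) (b := a3 + t1 + t2 - (y + y')) (v := a3 + t1 - y) (x := t1 - y) (y := t2 - y')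
      (by abel) (by abel)
    have := ((f1.add f2).add f3).add (p1.add (p2.add q3))
    refine Abs.of_eq this ?_ ?_ ?_
    all_goals simp only [wins, ← cons_coe, ← singleton_add, coe_nil, Multiset.map_add, map_singleton, Multiset.map_zero, Gd.add_ws, Gd.add_oV, Gd.add_oC]
    all_goals abel

/-- Absorber for exactly one of three vertices. -/
lemma exists_vertexNode (h2 : Half G)
    (D : Finset G)
    (hD : Thin D)
    (DV DC : Finset G) (hDC : insert 0 D ⊆ DC) {v1 v2 v3 : G} (h12 : v1 ≠ v2) (h13 : v1 ≠ v3) (h23 : v2 ≠ v3) :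
    Ex DV DC (700 + kb kPS kPS * (2 * 700 + 1)) fun g => Abs g {v1} 0 ∧ Abs g {v2} 0 ∧ Abs g {v3} 0 := by
  have base : Ex DV DC 700 fun g => ∃ a b : G, g = ⟨↑[(a, b)], 0, ↑[v1 - a, b - v1, v2 - a, b - v2, v3 - a, b - v3]⟩ := by
    refine Ex.pick (r := 2) _
      [(![1,0], 0), (![0,1], (0:G))]
      [(![-1,0], v1), (![0,1], -v1), (![-1,0], v2), (![0,1], -v2), (![-1,0], v3), (![0,1], -v3), (![1,-1], 0)]
      (by simp only [forall_mem_cons]; (repeat' apply And.intro) <;> first | decide | simp)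
      (by simp only [forall_mem_cons]; (repeat' apply And.intro) <;> first | decide | simp)
      ∅ (by simp) ?_ ?_ (by simp) (by simp) ?_
    · simp only [pairwise_cons, forall_mem_cons]
      (repeat' apply And.intro) <;> first
        | exact Or.inl (by dsimp only; decide)
        | simp
    · simp only [pairwise_cons, forall_mem_cons]
      (repeat' apply And.intro) <;> first
        | exact Or.inl (by dsimp only; decide)
        | (refine Or.inr (Or.inl ⟨rfl, ?_⟩); dsimp only; grind)
        | simp
    · intro x
      refine ⟨_, ⟨x 0, x 1, rfl⟩, ?_, ?_⟩
      · change ofList [x 0, x 1] = _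
        congr 1
        simp only [List.map_cons, map_nil, ev, lin, AddMonoidHom.coe_mk, ZeroHom.coe_mk, Fin.sum_univ_two,
          Matrix.cons_val, List.cons.injEq, zero_smul, one_smul, neg_smul, two_smul]
        (repeat' apply And.intro) <;> first | exact True.intro | abel
      · change ofList [v1 - x 0, x 1 - v1, v2 - x 0, x 1 - v2, v3 - x 0, x 1 - v3, x 0 - x 1] = _
        congr 1
        simp only [List.map_cons, map_nil, ev, lin, AddMonoidHom.coe_mk, ZeroHom.coe_mk, Fin.sum_univ_two,
          Matrix.cons_val, List.cons.injEq, zero_smul, one_smul, neg_smul, two_smul]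
        (repeat' apply And.intro) <;> first | exact True.intro | abel
  refine base.bind ?_
  rintro _ ⟨a, b, rfl⟩ hf
  have hav : ∀ c ∈ [v1 - a, b - v1, v2 - a, b - v2, v3 - a, b - v3], c ∉ insert 0 D := by
    intro c hc h
    exact hf.avC c (mem_add.2 (Or.inl hc)) (hDC h)
  simp only [forall_mem_cons] at hav
  obtain ⟨w1, w2, w3, w4, w5, w6, -⟩ := hav
  refine ((exists_pairSwitch h2 D hD _ _ (y := v1 - a) (y' := b - v1) (z := v2 - a) (z' := b - v2) (by abel)
      (by grind) w1 w2 w3 w4).two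
    (exists_pairSwitch h2 D hD _ _ (y := v2 - a) (y' := b - v2) (z := v3 - a) (z' := b - v3) (by abel)
      (by grind) w3 w4 w5 w6)).mono subset_rfl subset_rfl ?_
  rintro _ ⟨g1, g2, rfl, ⟨p1, q1⟩, p2, q2⟩
  refine ⟨?_, ?_, ?_⟩
  · have f1 := win_fil (a := a) (b := b) (v := v1) rfl rfl
    refine Abs.of_eq (f1.add (q1.add q2)) ?_ ?_ ?_
    all_goals simp only [wins, ← cons_coe, ← singleton_add, coe_nil, Multiset.map_add, map_singleton, Multiset.map_zero, Gd.add_ws, Gd.add_oV, Gd.add_oC]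
    all_goals abel
  · have f1 := win_fil (a := a) (b := b) (v := v2) rfl rfl
    refine Abs.of_eq (f1.add (p1.add q2)) ?_ ?_ ?_
    all_goals simp only [wins, ← cons_coe, ← singleton_add, coe_nil, Multiset.map_add, map_singleton, Multiset.map_zero, Gd.add_ws, Gd.add_oV, Gd.add_oC]
    all_goals abel
  · have f1 := win_fil (a := a) (b := b) (v := v3) rfl rfl
    refine Abs.of_eq (f1.add (p1.add p2)) ?_ ?_ ?_
    all_goals simp only [wins, ← cons_coe, ← singleton_add, coe_nil, Multiset.map_add, map_singleton, Multiset.map_zero, Gd.add_ws, Gd.add_oV, Gd.add_oC]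
    all_goals abel

/-- Size constant of an absorber of one of three pairs. -/
def kP3 : ℕ := 700 + kb (kb 700 700) (kb (kb 700 700) (kb kPS kPS)) * (2 * 700 + 1)

/-- Absorber for exactly one of three pairs of differences. -/
lemma exists_pairNode (h2 : Half G)
    (D : Finset G)
    (hD : Thin D)
    (s : G) (DV DC : Finset G) (hDC : insert 0 D ⊆ DC) {c1 c2 c3 : G}
    (h12 : c1 ≠ c2) (h13 : c1 ≠ c3) (h23 : c2 ≠ c3)
    (w1 : c1 ∉ insert 0 D) (w2 : c2 ∉ insert 0 D) (w3 : c3 ∉ insert 0 D)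
    (w1' : s - c1 ∉ insert 0 D) (w2' : s - c2 ∉ insert 0 D) (w3' : s - c3 ∉ insert 0 D) :
    Ex DV DC kP3 fun g => Abs g 0 ({c1} + {s - c1}) ∧ Abs g 0 ({c2} + {s - c2}) ∧
      Abs g 0 ({c3} + {s - c3}) := by
  simp only [mem_insert, not_or] at w1 w2 w3 w1' w2' w3'
  have base : Ex DV DC 700 fun g => ∃ a1 t1 a2 t2 : G, g = ⟨↑[(a1, a1 + t1), (a2, a2 + t2)],
      ↑[a1 + c1, a1 + c2, a1 + c3, a2 + s - c1, a2 + s - c2, a2 + s - c3],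
      ↑[t1 - c1, t1 - c2, t1 - c3, t2 - s + c1, t2 - s + c2, t2 - s + c3]⟩ := by
    set dbl : (Fin 4 → ℤ) → G → Finset (Fin 4 → G) := fun c κ => univ.filter fun x => lin c x + lin c x = κ with hdbl
    have hd : ∀ c κ, Uni c → κ ∉ D → 16 * (dbl c κ).card ≤ card G ^ 4 := fun c κ hc hκ =>
      card_lin_double c hc κ 16 (hD κ hκ)
    set S := dbl ![0,1,0,0] c1 ∪ dbl ![0,1,0,0] c2 ∪ dbl ![0,1,0,0] c3 ∪ dbl ![0,0,0,1] (s - c1) ∪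
      dbl ![0,0,0,1] (s - c2) ∪ dbl ![0,0,0,1] (s - c3) with hS
    refine Ex.pick (r := 4) _
      [(![1,0,0,0], 0), (![0,0,1,0], 0), (![1,1,0,0], 0), (![0,0,1,1], 0), (![1,0,0,0], c1), (![1,0,0,0], c2),
        (![1,0,0,0], c3), (![0,0,1,0], s - c1), (![0,0,1,0], s - c2), (![0,0,1,0], s - c3)]
      [(![0,1,0,0], -c1), (![0,1,0,0], -c2), (![0,1,0,0], -c3), (![0,0,0,1], -(s - c1)), (![0,0,0,1], -(s - c2)),
        (![0,0,0,1], -(s - c3)), (![0,-1,0,0], 0), (![0,0,0,-1], 0)]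
      (by simp only [forall_mem_cons]; (repeat' apply And.intro) <;> first | decide | simp)
      (by simp only [forall_mem_cons]; (repeat' apply And.intro) <;> first | decide | simp)
      S ?_ ?_ ?_ (by simp) (by simp) ?_
    · have l1 := card_union_le (dbl ![0,1,0,0] c1 ∪ dbl ![0,1,0,0] c2 ∪ dbl ![0,1,0,0] c3 ∪ dbl ![0,0,0,1] (s - c1) ∪
        dbl ![0,0,0,1] (s - c2)) (dbl ![0,0,0,1] (s - c3))
      have l2 := card_union_le (dbl ![0,1,0,0] c1 ∪ dbl ![0,1,0,0] c2 ∪ dbl ![0,1,0,0] c3 ∪ dbl ![0,0,0,1] (s - c1))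
        (dbl ![0,0,0,1] (s - c2))
      have l3 := card_union_le (dbl ![0,1,0,0] c1 ∪ dbl ![0,1,0,0] c2 ∪ dbl ![0,1,0,0] c3) (dbl ![0,0,0,1] (s - c1))
      have l4 := card_union_le (dbl ![0,1,0,0] c1 ∪ dbl ![0,1,0,0] c2) (dbl ![0,1,0,0] c3)
      have l5 := card_union_le (dbl ![0,1,0,0] c1) (dbl ![0,1,0,0] c2)
      have := hd ![0,1,0,0] c1 (by decide) w1.2
      have := hd ![0,1,0,0] c2 (by decide) w2.2
      have := hd ![0,1,0,0] c3 (by decide) w3.2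
      have := hd ![0,0,0,1] _ (by decide) w1'.2
      have := hd ![0,0,0,1] _ (by decide) w2'.2
      have := hd ![0,0,0,1] _ (by decide) w3'.2
      rw [hS]
      omega
    · simp only [pairwise_cons, forall_mem_cons]
      (repeat' apply And.intro) <;> first
        | exact Or.inl (by dsimp only; decide)
        | (refine Or.inr (Or.inl ⟨rfl, ?_⟩); dsimp only; grind)
        | simp
    · simp only [pairwise_cons, forall_mem_cons]
      (repeat' apply And.intro) <;> first
        | exact Or.inl (by dsimp only; decide)
        | (refine Or.inr (Or.inl ⟨rfl, ?_⟩); dsimp only; grind)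
        | (refine Or.inr (Or.inr ?_); intro x hx he
           refine hx ?_
           have he2 := two_sub_lin ![0,1,0,0] x _ _ (by dsimp only; decide) he
           simp only [hS, hdbl, mem_union, mem_filter, mem_univ, true_and, he2]; simp)
        | (refine Or.inr (Or.inr ?_); intro x hx he
           refine hx ?_
           have he2 := two_sub_lin ![0,0,0,1] x _ _ (by dsimp only; decide) he
           simp only [hS, hdbl, mem_union, mem_filter, mem_univ, true_and, he2]; simp)
        | simp
    · intro x
      refine ⟨_, ⟨x 0, x 1, x 2, x 3, rfl⟩, ?_, ?_⟩
      · change ofList [x 0, x 2, x 0 + x 1, x 2 + x 3, x 0 + c1, x 0 + c2, x 0 + c3, x 2 + s - c1,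
          x 2 + s - c2, x 2 + s - c3] = _
        congr 1
        simp only [List.map_cons, map_nil, ev, lin, AddMonoidHom.coe_mk, ZeroHom.coe_mk, Fin.sum_univ_four,
          Matrix.cons_val, List.cons.injEq, zero_smul, one_smul, neg_smul, two_smul]
        (repeat' apply And.intro) <;> first | exact True.intro | abel
      · change ofList [x 1 - c1, x 1 - c2, x 1 - c3, x 3 - s + c1, x 3 - s + c2, x 3 - s + c3,
          x 0 - (x 0 + x 1), x 2 - (x 2 + x 3)] = _
        congr 1
        simp only [List.map_cons, map_nil, ev, lin, AddMonoidHom.coe_mk, ZeroHom.coe_mk, Fin.sum_univ_four,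
          Matrix.cons_val, List.cons.injEq, zero_smul, one_smul, neg_smul, two_smul]
        (repeat' apply And.intro) <;> first | exact True.intro | abel
  refine base.bind ?_
  rintro _ ⟨a1, t1, a2, t2, rfl⟩ hf
  have hav : ∀ c ∈ [t1 - c1, t1 - c2, t1 - c3, t2 - s + c1, t2 - s + c2, t2 - s + c3], c ∉ insert 0 D := by
    intro c hc h
    exact hf.avC c (mem_add.2 (Or.inl hc)) (hDC h)
  simp only [forall_mem_cons] at hav
  obtain ⟨u1, u2, u3, u4, u5, u6, -⟩ := hav
  refine (((exists_vertexSwitch h2 _ _ (a1 + c1) (a1 + c2)).two (exists_vertexSwitch h2 _ _ (a1 + c2) (a1 + c3))).two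
    (((exists_vertexSwitch h2 _ _ (a2 + s - c1) (a2 + s - c2)).two
        (exists_vertexSwitch h2 _ _ (a2 + s - c2) (a2 + s - c3))).two
      ((exists_pairSwitch h2 D hD _ _ (y := t1 - c1) (y' := t2 - s + c1) (z := t1 - c2) (z' := t2 - s + c2) (by abel)
        (by grind) u1 u4 u2 u5).two
       (exists_pairSwitch h2 D hD _ _ (y := t1 - c2) (y' := t2 - s + c2) (z := t1 - c3) (z' := t2 - s + c3) (by abel)
        (by grind) u2 u5 u3 u6)))).mono subset_rfl subset_rfl ?_
  rintro _ ⟨_, _, rfl, ⟨g1, g2, rfl, ⟨p1, q1⟩, p2, q2⟩, _, _, rfl, ⟨g3, g4, rfl, ⟨p3, q3⟩, p4, q4⟩,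
    g5, g6, rfl, ⟨p5, q5⟩, p6, q6⟩
  refine ⟨?_, ?_, ?_⟩
  · have f1 := win_fil (a := a1) (b := a1 + t1) (v := a1 + c1) (x := c1) (y := t1 - c1) (by abel) (by abel)
    have f2 := win_fil (a := a2) (b := a2 + t2) (v := a2 + s - c1) (x := s - c1) (y := t2 - s + c1) (by abel) (by abel)
    refine Abs.of_eq ((f1.add f2).add ((q1.add q2).add ((q3.add q4).add (q5.add q6)))) ?_ ?_ ?_
    all_goals simp only [wins, ← cons_coe, ← singleton_add, coe_nil, Multiset.map_add, map_singleton, Multiset.map_zero, Gd.add_ws, Gd.add_oV, Gd.add_oC]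
    all_goals abel
  · have f1 := win_fil (a := a1) (b := a1 + t1) (v := a1 + c2) (x := c2) (y := t1 - c2) (by abel) (by abel)
    have f2 := win_fil (a := a2) (b := a2 + t2) (v := a2 + s - c2) (x := s - c2) (y := t2 - s + c2) (by abel) (by abel)
    refine Abs.of_eq ((f1.add f2).add ((p1.add q2).add ((p3.add q4).add (p5.add q6)))) ?_ ?_ ?_
    all_goals simp only [wins, ← cons_coe, ← singleton_add, coe_nil, Multiset.map_add, map_singleton, Multiset.map_zero, Gd.add_ws, Gd.add_oV, Gd.add_oC]
    all_goals abel
  · have f1 := win_fil (a := a1) (b := a1 + t1) (v := a1 + c3) (x := c3) (y := t1 - c3) (by abel) (by abel)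
    have f2 := win_fil (a := a2) (b := a2 + t2) (v := a2 + s - c3) (x := s - c3) (y := t2 - s + c3) (by abel) (by abel)
    refine Abs.of_eq ((f1.add f2).add ((p1.add p2).add ((p3.add p4).add (p5.add p6)))) ?_ ?_ ?_
    all_goals simp only [wins, ← cons_coe, ← singleton_add, coe_nil, Multiset.map_add, map_singleton, Multiset.map_zero, Gd.add_ws, Gd.add_oV, Gd.add_oC]
    all_goals abel

lemma exists_dummy (s : G) (F : Finset G) (hF : 2 * F.card < card G) : ∃ d, d ∉ F ∧ s - d ∉ F := by
  have : (F ∪ F.image fun x => s - x).card < (univ : Finset G).card := by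
    have := card_union_le F (F.image fun x => s - x)
    have := card_image_le (s := F) (f := fun x => s - x)
    rw [card_univ]; omega
  obtain ⟨d, -, hd⟩ := exists_mem_notMem_of_card_lt_card this
  simp only [mem_union, mem_image, not_or, not_exists, not_and] at hd
  exact ⟨d, hd.1, fun h => hd.2 _ h (by abel)⟩

/-- Size constant of an absorber of one of three vertices. -/
def kV3 : ℕ := 700 + kb kPS kPS * (2 * 700 + 1)

/-- A gadget consisting of `d` units with a given property can be found avoiding any small sets. -/
def ExL (DV DC : Finset G) (K d : ℕ) (P : Gd G → Prop) : Prop :=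
  ∀ FV FC : Finset G, FV.Nonempty → FC.Nonempty → DV ⊆ FV → DC ⊆ FC →
    K * (FV.card + FC.card + K * d) ≤ card G →
    ∃ g, P g ∧ Fresh g FV FC ∧ g.vs.card + g.cs.card ≤ K * d

lemma Ex.unit {DV DC : Finset G} {K1 K : ℕ} {P : Gd G → Prop} (h : Ex DV DC K1 P) (hK : K1 ≤ K) :
    ExL DV DC K 1 P := by
  intro FV FC h1 h2 h3 h4 h5
  obtain ⟨g, hg, hf, hs⟩ := h FV FC h1 h2 h3 h4 (by nlinarith)
  exact ⟨g, hg, hf, by omega⟩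

lemma ExL.mono {DV DC DV' DC' : Finset G} {K K' d d' : ℕ} {P Q : Gd G → Prop} (h : ExL DV DC K d P)
    (hV : DV ⊆ DV') (hC : DC ⊆ DC') (hK : K ≤ K') (hd : d ≤ d') (hPQ : ∀ g, P g → Q g) :
    ExL DV' DC' K' d' Q := by
  intro FV FC h1 h2 h3 h4 h5
  have e : K * d ≤ K' * d' := Nat.mul_le_mul hK hd
  obtain ⟨g, hg, hf, hs⟩ := h FV FC h1 h2 (hV.trans h3) (hC.trans h4)
    (le_trans (Nat.mul_le_mul hK (by omega)) h5)
  exact ⟨g, hPQ g hg, hf, hs.trans e⟩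

lemma ExL.zero {DV DC : Finset G} {K : ℕ} {P : Gd G → Prop} (h : P 0) : ExL DV DC K 0 P := by
  intro FV FC _ _ _ _ _
  exact ⟨0, h, ⟨by simp [Gd.vs], by simp [Gd.cs], by simp [Gd.vs], by simp [Gd.cs]⟩, by simp [Gd.vs, Gd.cs]⟩

lemma ExL.bind {DV DC : Finset G} {K d1 d2 : ℕ} {P1 P : Gd G → Prop} (h : ExL DV DC K d1 P1)
    (h2 : ∀ g, P1 g → Fresh g DV DC →
      ExL (DV ∪ g.vs.toFinset) (DC ∪ g.cs.toFinset) K d2 fun g' => P (g + g')) :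
    ExL DV DC K (d1 + d2) P := by
  intro FV FC hV hC hDV hDC hn
  obtain ⟨g, hg, hf, hs⟩ := h FV FC hV hC hDV hDC
    (le_trans (Nat.mul_le_mul_left _ (by rw [mul_add]; omega)) hn)
  have a1 := card_union_le FV g.vs.toFinset
  have a2 := card_union_le FC g.cs.toFinset
  have a3 := toFinset_card_le g.vs
  have a4 := toFinset_card_le g.cs
  obtain ⟨g', hg', hf', hs'⟩ := h2 g hg (hf.mono hDV hDC) (FV ∪ g.vs.toFinset)
    (FC ∪ g.cs.toFinset) (hV.mono subset_union_left) (hC.mono subset_union_left)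
    (union_subset_union_left hDV) (union_subset_union_left hDC) (by
      refine le_trans (Nat.mul_le_mul_left _ ?_) hn
      rw [mul_add]; omega)
  refine ⟨g + g', hg', hf.add hf', ?_⟩
  rw [Gd.vs_add, Gd.cs_add, card_add, card_add, mul_add]
  omega

lemma ExL.two {DV DC : Finset G} {K d1 d2 : ℕ} {P1 P2 : Gd G → Prop} (h1 : ExL DV DC K d1 P1)
    (h2 : ExL DV DC K d2 P2) : ExL DV DC K (d1 + d2) fun g => ∃ g1 g2, g = g1 + g2 ∧ P1 g1 ∧ P2 g2 :=
  h1.bind fun g hg _ => h2.mono subset_union_left subset_union_left le_rfl le_rfl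
    fun g' hg' => ⟨g, g', rfl, hg, hg'⟩

/-- Absorber for exactly one vertex of a list. -/
lemma exists_vertexChoice (h2 : Half G)
    (D : Finset G)
    (hD : Thin D)
    (d : ℕ) (L : List G) (hL : L.length = d) (nd : L.Nodup) (DV DC : Finset G) (hDC : insert 0 D ⊆ DC)
    (hDV : L.toFinset ⊆ DV) :
    ExL DV DC kV3 (2 * d) fun g => ∀ v ∈ L, Abs g {v} 0 := by
  induction d generalizing L DV DC with
  | zero =>
    rw [List.length_eq_zero_iff] at hL
    subst hL
    exact ExL.zero (by simp)
  | succ d ih =>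
    match L, hL with
    | [x], hL =>
      refine ExL.mono (d := 1) (K := kV3) (Ex.unit ?_ le_rfl) subset_rfl subset_rfl le_rfl (by simp at hL; omega) fun g hg => hg
      intro FV FC h1 h1' h3 h4 h5
      have e1 : 1 ≤ FV.card := card_pos.2 h1
      have e2 : 1 ≤ FC.card := card_pos.2 h1'
      have hK : 700 ≤ kV3 := by unfold kV3; omega
      have hn : 700 ≤ card G := by nlinarith
      obtain ⟨d1, hd1, -⟩ := exists_dummy 0 {x} (by simp; omega)
      obtain ⟨d2, hd2, -⟩ := exists_dummy 0 {x, d1} (by have := card_le_two (a := x) (b := d1); omega)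
      simp only [mem_insert, mem_singleton, not_or] at hd1 hd2
      obtain ⟨g, hg, hr⟩ := exists_vertexNode h2 D hD DV DC hDC (Ne.symm hd1) (Ne.symm hd2.1) (Ne.symm hd2.2)
        FV FC h1 h1' h3 h4 h5
      exact ⟨g, by simpa using hg.1, hr⟩
    | x :: y :: l, hL =>
      refine ExL.mono (K := kV3) (d := 1 + (1 + 2 * d)) ?_ subset_rfl subset_rfl le_rfl (by omega) fun g hg => hg
      have base : Ex DV DC 700 fun g => ∃ z : G, g = ⟨0, {z}, 0⟩ := by
        refine Ex.pick (r := 1) _ [(![1], 0)] []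
          (by simp only [forall_mem_cons]; (repeat' apply And.intro) <;> first | decide | simp) (by simp)
          ∅ (by simp) (by simp) (by simp) (by simp) (by simp) ?_
        intro x
        exact ⟨_, ⟨x 0, rfl⟩, by simp [Gd.vs, ev, lin], by simp [Gd.cs]⟩
      refine (base.unit (K := kV3) (by unfold kV3; omega)).bind ?_
      rintro _ ⟨z, rfl⟩ hf
      have hz : z ∉ DV := hf.avV z (by simp [Gd.vs])
      have hzl : ∀ v ∈ x :: y :: l, z ≠ v := fun v hv h => hz (hDV (by simpa [h] using hv))
      simp only [forall_mem_cons] at hzl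
      simp only [nodup_cons, mem_cons, not_or] at nd
      refine ((exists_vertexNode h2 D hD _ _ (hDC.trans subset_union_left) nd.1.1 (Ne.symm hzl.1)
        (Ne.symm hzl.2.1)).unit le_rfl |>.two (ih (z :: l) (by simpa using hL) (by
          rw [nodup_cons]; exact ⟨fun h => hzl.2.2 z h rfl, nd.2.2⟩) _ _ (hDC.trans subset_union_left)
          ?_)).mono subset_rfl subset_rfl le_rfl le_rfl ?_
      · intro v hv
        simp only [List.toFinset_cons, mem_insert, mem_toFinset] at hv
        rcases hv with rfl | hv
        · exact mem_union_right _ (by simp [Gd.vs])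
        · exact mem_union_left _ (hDV (by simp [hv]))
      · rintro _ ⟨g1, g2, rfl, ⟨n1, n2, n3⟩, hg⟩ v hv
        have e0 : ∀ V : Multiset G, Abs (g1 + g2) ({z} + V) 0 → Abs (⟨0, {z}, 0⟩ + (g1 + g2)) V 0 := by
          intro V h
          refine Abs.of_eq h ?_ ?_ ?_
          · simp
          · simp only [Gd.add_oV]; abel
          · simp
        apply e0
        simp only [mem_cons] at hv
        rcases hv with rfl | rfl | hv
        · rw [add_comm]; simpa using n1.add (hg z (by simp))
        · rw [add_comm]; simpa using n2.add (hg z (by simp))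
        · simpa using n3.add (hg v (by simp [hv]))

/-- Absorber for exactly one pair of a list. -/
lemma exists_pairChoice (h2 : Half G)
    (D : Finset G)
    (hD : Thin D) (s : G)
    (d : ℕ) (L : List G) (hL : L.length = d) (nd : L.Nodup) (hw : ∀ c ∈ L, c ∉ insert 0 D ∧ s - c ∉ insert 0 D)
    (DV DC : Finset G) (hDC : insert 0 D ⊆ DC) (hDL : L.toFinset ⊆ DC) :
    ExL DV DC kP3 (2 * d) fun g => ∀ c ∈ L, Abs g 0 ({c} + {s - c}) := by
  induction d generalizing L DV DC with
  | zero =>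
    rw [List.length_eq_zero_iff] at hL
    subst hL
    exact ExL.zero (by simp)
  | succ d ih =>
    match L, hL with
    | [x], hL =>
      refine ExL.mono (d := 1) (K := kP3) (Ex.unit ?_ le_rfl) subset_rfl subset_rfl le_rfl (by simp at hL; omega) fun g hg => hg
      intro FV FC h1 h1' h3 h4 h5
      have e1 : 1 ≤ FV.card := card_pos.2 h1
      have e2 : 1 ≤ FC.card := card_pos.2 h1'
      have hK : 700 ≤ kP3 := by unfold kP3; omega
      have hn : 700 * (FV.card + FC.card) ≤ card G := by nlinarith
      obtain ⟨d1, hd1, hd1'⟩ := exists_dummy s FC (by omega)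
      obtain ⟨d2, hd2, hd2'⟩ := exists_dummy s (insert d1 FC) (by have := card_insert_le d1 FC; omega)
      simp only [mem_insert, not_or] at hd2 hd2'
      have hx : x ∈ FC := h4 (hDL (by simp))
      have hs : ∀ z, z ∉ FC → z ∉ insert 0 D := fun z hz h => hz (h4 (hDC h))
      obtain ⟨g, hg, hr⟩ := exists_pairNode h2 D hD s DV DC hDC (c1 := x) (c2 := d1) (c3 := d2)
        (fun h => hd1 (h ▸ hx)) (fun h => hd2.2 (h ▸ hx)) (Ne.symm hd2.1) (hw x (by simp)).1
        (hs _ hd1) (hs _ hd2.2) (hw x (by simp)).2 (hs _ hd1') (hs _ hd2'.2)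
        FV FC h1 h1' h3 h4 h5
      exact ⟨g, by simpa using hg.1, hr⟩
    | x :: y :: l, hL =>
      refine ExL.mono (K := kP3) (d := 1 + (1 + 2 * d)) ?_ subset_rfl subset_rfl le_rfl (by omega) fun g hg => hg
      have base : Ex DV DC 700 fun g => ∃ z : G, g = ⟨0, 0, {z} + {s - z}⟩ := by
        refine Ex.pick (r := 1) _ [] [(![1], 0), (![-1], s)] (by simp)
          (by simp only [forall_mem_cons]; (repeat' apply And.intro) <;> first | decide | simp)
          (univ.filter fun x => lin ![1] x + lin ![1] x = s - 0) (card_lin_double _ (by decide) _ 2 (h2 _))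
          (by simp) ?_ (by simp) (by simp) ?_
        · simp only [pairwise_cons, forall_mem_cons]
          (repeat' apply And.intro) <;> first
            | (refine Or.inr (Or.inr ?_); intro x hx he
               exact hx (mem_filter.2 ⟨mem_univ _, two_sub_lin ![1] x _ _ (by dsimp only; decide) he⟩))
            | simp
        intro x
        refine ⟨_, ⟨x 0, rfl⟩, by simp [Gd.vs], ?_⟩
        simp only [Gd.cs, Multiset.map_zero, add_zero]
        change ofList [x 0, s - x 0] = _
        congr 1
        simp [ev, lin]; abel
      refine (base.unit (K := kP3) (by unfold kP3; omega)).bind ?_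
      rintro _ ⟨z, rfl⟩ hf
      have hz : z ∉ DC := hf.avC z (by simp [Gd.cs])
      have hz' : s - z ∉ DC := hf.avC (s - z) (by simp [Gd.cs])
      have hzl : ∀ v ∈ x :: y :: l, z ≠ v := fun v hv h => hz (hDL (by simpa [h] using hv))
      simp only [forall_mem_cons] at hzl hw
      simp only [nodup_cons, mem_cons, not_or] at nd
      have hzw : z ∉ insert 0 D ∧ s - z ∉ insert 0 D := ⟨fun h => hz (hDC h), fun h => hz' (hDC h)⟩
      refine ((exists_pairNode h2 D hD s _ _ (hDC.trans subset_union_left) nd.1.1 (Ne.symm hzl.1)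
        (Ne.symm hzl.2.1) hw.1.1 hw.2.1.1 hzw.1 hw.1.2 hw.2.1.2 hzw.2).unit le_rfl |>.two
        (ih (z :: l) (by simpa using hL) (by
          rw [nodup_cons]; exact ⟨fun h => hzl.2.2 z h rfl, nd.2.2⟩) (by
          simp only [forall_mem_cons]; exact ⟨hzw, hw.2.2⟩) _ _ (hDC.trans subset_union_left)
          ?_)).mono subset_rfl subset_rfl le_rfl le_rfl ?_
      · intro v hv
        simp only [List.toFinset_cons, mem_insert, mem_toFinset] at hv
        rcases hv with rfl | hv
        · exact mem_union_right _ (by simp [Gd.cs])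
        · exact mem_union_left _ (hDL (by simp [hv]))
      · rintro _ ⟨g1, g2, rfl, ⟨n1, n2, n3⟩, hg⟩ v hv
        have e0 : ∀ V : Multiset G, Abs (g1 + g2) 0 (({z} + {s - z}) + V) →
            Abs (⟨0, 0, {z} + {s - z}⟩ + (g1 + g2)) 0 V := by
          intro V h
          refine Abs.of_eq h ?_ ?_ ?_
          · simp
          · simp
          · simp only [Gd.add_oC]; abel
        apply e0
        simp only [mem_cons] at hv
        rcases hv with rfl | rfl | hv
        · rw [add_comm]; simpa using n1.add (hg z (by simp))
        · rw [add_comm]; simpa using n2.add (hg z (by simp))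
        · simpa using n3.add (hg v (by simp [hv]))

/-- Absorber consisting of choice gadgets for a family of lists of vertices. -/
lemma exists_vertexChoices (h2 : Half G)
    (D : Finset G)
    (hD : Thin D)
    {Z : Type} [DecidableEq Z] (N : Z → Finset G) (DV DC : Finset G) (hDC : insert 0 D ⊆ DC)
    (S : Finset Z) (hDV : ∀ z ∈ S, N z ⊆ DV) :
    ExL DV DC kV3 (2 * ∑ z ∈ S, (N z).card) fun g =>
      ∀ f : Z → G, (∀ z ∈ S, f z ∈ N z) → Abs g (S.val.map f) 0 := by
  induction S using Finset.induction_on with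
  | empty => exact ExL.zero fun f _ => Fil.nil
  | insert z S hz ih =>
    rw [sum_insert hz, mul_add]
    refine ((exists_vertexChoice h2 D hD _ (N z).toList rfl (nodup_toList _) DV DC hDC
      (by simpa using hDV z (by simp))).two (ih fun z' hz' => hDV z' (by simp [hz']))).mono subset_rfl
        subset_rfl le_rfl (by simp) ?_
    rintro _ ⟨g1, g2, rfl, h1, h2⟩ f hf
    have := (h1 (f z) (by simpa using hf z (by simp))).add (h2 f fun z' hz' => hf z' (by simp [hz']))
    simpa [insert_val_of_notMem hz] using this

/-- Absorber consisting of choice gadgets for a family of lists of pairs. -/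
lemma exists_pairChoices (h2 : Half G)
    (D : Finset G)
    (hD : Thin D) (s : G)
    {Z : Type} [DecidableEq Z] (N : Z → Finset G) (DV DC : Finset G) (hDC : insert 0 D ⊆ DC)
    (S : Finset Z) (hDV : ∀ z ∈ S, N z ⊆ DC)
    (hw : ∀ z ∈ S, ∀ c ∈ N z, c ∉ insert 0 D ∧ s - c ∉ insert 0 D) :
    ExL DV DC kP3 (2 * ∑ z ∈ S, (N z).card) fun g =>
      ∀ f : Z → G, (∀ z ∈ S, f z ∈ N z) → Abs g 0 (S.val.map f + S.val.map fun z => s - f z) := by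
  induction S using Finset.induction_on with
  | empty => exact ExL.zero fun f _ => Fil.nil
  | insert z S hz ih =>
    rw [sum_insert hz, mul_add]
    refine ((exists_pairChoice h2 D hD s _ (N z).toList rfl (nodup_toList _)
      (fun c hc => hw z (by simp) c (by simpa using hc)) DV DC hDC
      (by simpa using hDV z (by simp))).two (ih (fun z' hz' => hDV z' (by simp [hz']))
        fun z' hz' => hw z' (by simp [hz']))).mono subset_rfl subset_rfl le_rfl (by simp) ?_
    rintro _ ⟨g1, g2, rfl, h1, h2⟩ f hf
    have := (h1 (f z) (by simpa using hf z (by simp))).add (h2 f fun z' hz' => hf z' (by simp [hz']))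
    refine Abs.of_eq this (by simp) (by simp) ?_
    simp only [insert_val_of_notMem hz, map_cons, Multiset.map_add, map_singleton, Gd.add_oC, ← singleton_add]
    abel

/-- Extra vertices can be chosen freely. -/
lemma exists_extraVertices (DV DC : Finset G) (K : ℕ) (hK : 2 ≤ K) (d : ℕ) :
    ExL DV DC K d fun g => ∃ X : Finset G, X.card = d ∧ Disjoint X DV ∧ g = ⟨0, X.val, 0⟩ := by
  intro FV FC h1 h2 h3 h4 h5
  have e1 : 1 ≤ FV.card := card_pos.2 h1
  have e2 : 1 ≤ FC.card := card_pos.2 h2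
  have : d ≤ K * d := by nlinarith
  obtain ⟨X, hX, hd⟩ := exists_subset_card_eq (s := univ \ FV) (n := d)
    (by rw [card_sdiff_of_subset (subset_univ _), card_univ]
        have : FV.card + d ≤ card G := by nlinarith
        omega)
  have hXF : ∀ v ∈ X, v ∉ FV := fun v hv => (mem_sdiff.1 (hX hv)).2
  refine ⟨_, ⟨X, hd, ?_, rfl⟩, ⟨?_, ?_, ?_, ?_⟩, ?_⟩
  · exact disjoint_left.2 fun v hv hv' => hXF v hv (h3 hv')
  · simpa [Gd.vs] using X.nodup
  · simp [Gd.cs]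
  · simpa [Gd.vs] using hXF
  · simp [Gd.cs]
  · simp [Gd.vs, Gd.cs]; omega

/-- Extra pairs can be chosen freely. -/
lemma exists_extraPairs (h2 : Half G)
    (s : G) (DV DC : Finset G) (d : ℕ) :
    ExL DV DC 700 d fun g => ∃ X : Finset G, X.card = d ∧ (∀ c ∈ X, c ∉ DC ∧ s - c ∉ DC) ∧
      g = ⟨0, 0, X.val + X.val.map fun c => s - c⟩ := by
  induction d generalizing DV DC with
  | zero => exact ExL.zero ⟨∅, by simp, by simp, rfl⟩
  | succ d ih =>
    have base : Ex DV DC 700 fun g => ∃ z : G, g = ⟨0, 0, {z} + {s - z}⟩ := by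
      refine Ex.pick (r := 1) _ [] [(![1], 0), (![-1], s)] (by simp)
        (by simp only [forall_mem_cons]; (repeat' apply And.intro) <;> first | decide | simp)
        (univ.filter fun x => lin ![1] x + lin ![1] x = s - 0) (card_lin_double _ (by decide) _ 2 (h2 _))
        (by simp) ?_ (by simp) (by simp) ?_
      · simp only [pairwise_cons, forall_mem_cons]
        (repeat' apply And.intro) <;> first
          | (refine Or.inr (Or.inr ?_); intro x hx he
             exact hx (mem_filter.2 ⟨mem_univ _, two_sub_lin ![1] x _ _ (by dsimp only; decide) he⟩))
          | simp
      intro x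
      refine ⟨_, ⟨x 0, rfl⟩, by simp [Gd.vs], ?_⟩
      simp only [Gd.cs, Multiset.map_zero, add_zero]
      change ofList [x 0, s - x 0] = _
      congr 1
      simp [ev, lin]; abel
    rw [add_comm]
    refine (base.unit (K := 700) le_rfl).bind ?_
    rintro _ ⟨z, rfl⟩ hf
    have hz : z ∉ DC := hf.avC z (by simp [Gd.cs])
    have hz' : s - z ∉ DC := hf.avC (s - z) (by simp [Gd.cs])
    refine (ih _ _).mono subset_rfl subset_rfl le_rfl le_rfl ?_
    rintro _ ⟨X, hX, hX2, rfl⟩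
    have hzX : z ∉ X := fun h => (hX2 z h).1 (mem_union_right _ (by simp [Gd.cs]))
    refine ⟨insert z X, by rw [card_insert_of_notMem hzX, hX, add_comm], ?_, ?_⟩
    · intro c hc
      rcases mem_insert.1 hc with rfl | hc
      · exact ⟨hz, hz'⟩
      · exact ⟨fun h => (hX2 c hc).1 (mem_union_left _ h), fun h => (hX2 c hc).2 (mem_union_left _ h)⟩
    · ext1
      · simp
      · simp
      · simp only [insert_val_of_notMem hzX, map_cons, Multiset.map_add, map_singleton, Gd.add_oC, ← singleton_add]
        abel

/-- A robust matching graph on two disjoint finite subsets. -/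
lemma exists_robust_family {G : Type} [DecidableEq G] {m u : ℕ} (hm : 1 ≤ m) (hu : 2 * u ≤ m) (Y X : Finset G)
    (hY : Y.card = m) (hX : X.card = 10 * m) (hXY : Disjoint X Y) :
    ∃ N : Fin (11 * m - u) → Finset G, (∀ z, N z ⊆ Y ∪ X) ∧ ∑ z, (N z).card ≤ 300 * m ∧
      ∀ U ⊆ Y, U.card = u → ∃ e : Fin (11 * m - u) → G, (∀ z, e z ∈ N z) ∧
        (univ : Finset (Fin (11 * m - u))).val.map e = (Y \ U).val + X.val := by
  classical
  obtain ⟨N, hN, h⟩ := exists_robust_matching (Y := Y) (X := X) (Z := Fin (11 * m - u)) hm hu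
    (by simpa using hY) (by simpa using hX) (by simp)
  let q : Y ⊕ X → G := Sum.elim (fun y => (y : G)) (fun x => (x : G))
  refine ⟨fun z => (N z).image q, ?_, ?_, ?_⟩
  · intro z g hg
    obtain ⟨p, -, rfl⟩ := mem_image.1 hg
    rcases p with p | p
    · exact mem_union_left _ p.2
    · exact mem_union_right _ p.2
  · exact (sum_le_sum fun z _ => card_image_le).trans hN
  · intro U hU hc
    obtain ⟨e, he, heN, heU⟩ := h (U.subtype (· ∈ Y)) (by
      rw [card_subtype, filter_true_of_mem fun x hx => hU hx, hc])
    refine ⟨q ∘ e, fun z => mem_image_of_mem _ (heN z), ?_⟩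
    have hq : Injective q := by
      rintro (a | a) (b | b) hab <;> simp only [q, Sum.elim_inl, Sum.elim_inr] at hab
      · exact congrArg _ (Subtype.ext hab)
      · exact absurd (hab ▸ b.2 : (a : G) ∈ X) fun h => disjoint_left.1 hXY h a.2
      · exact absurd (hab ▸ a.2 : (b : G) ∈ X) fun h => disjoint_left.1 hXY h b.2
      · exact congrArg _ (Subtype.ext hab)
    have hd : Disjoint (Y \ U) X := (hXY.mono_right sdiff_subset).symm
    rw [← disjUnion_val (h := hd), ← image_val_of_injOn (hq.comp he).injOn]
    congr 1
    ext g
    simp only [mem_image, mem_univ, true_and, disjUnion_eq_union, mem_union, mem_sdiff, comp]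
    constructor
    · rintro ⟨z, rfl⟩
      have := (heU (e z)).1 ⟨z, rfl⟩
      rcases hez : e z with p | p
      · rw [hez] at this
        left
        refine ⟨p.2, fun hp => this ?_⟩
        exact mem_map.2 ⟨p, mem_subtype.2 hp, rfl⟩
      · exact Or.inr p.2
    · rintro (⟨h1, h2⟩ | h1)
      · obtain ⟨z, hz⟩ := (heU (Sum.inl ⟨g, h1⟩)).2 (by
          intro hp
          obtain ⟨p, hp, hpe⟩ := mem_map.1 hp
          have : p = ⟨g, h1⟩ := Sum.inl_injective hpe
          subst this
          exact h2 (mem_subtype.1 hp))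
        exact ⟨z, by rw [hz]; rfl⟩
      · obtain ⟨z, hz⟩ := (heU (Sum.inr ⟨g, h1⟩)).2 (by
          intro hp
          obtain ⟨p, hp, hpe⟩ := mem_map.1 hp
          cases hpe)
        exact ⟨z, by rw [hz]; rfl⟩

/-- Absorber for the complements of the subsets of given size of a set of vertices. -/
lemma exists_vertexAbsorber (h2 : Half G)
    (D : Finset G)
    (hD : Thin D)
    {m u : ℕ} (hm : 1 ≤ m) (hu : 2 * u ≤ m) (R : Finset G) (hR : R.card = m)
    (DV DC : Finset G) (hDC : insert 0 D ⊆ DC) (hDV : R ⊆ DV) :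
    ExL DV DC kV3 (610 * m) fun g => ∀ U ⊆ R, U.card = u → Abs g (R \ U).val 0 := by
  refine ((exists_extraVertices DV DC kV3 (by unfold kV3; omega) (10 * m)).bind
    (d2 := 600 * m) ?_).mono subset_rfl subset_rfl le_rfl (by omega) fun g hg => hg
  rintro _ ⟨X, hX, hd, rfl⟩ hf
  obtain ⟨N, hN1, hN2, hN3⟩ := exists_robust_family hm hu R X hR hX (hd.mono_right hDV)
  refine (exists_vertexChoices h2 D hD N _ _ (hDC.trans subset_union_left) univ ?_).mono subset_rfl subset_rfl
    le_rfl (by omega) ?_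
  · intro z _
    refine (hN1 z).trans (union_subset (hDV.trans subset_union_left) ?_)
    exact Subset.trans (by simp [Gd.vs]) subset_union_right
  · intro g hg U hU hc
    obtain ⟨e, he, heq⟩ := hN3 U hU hc
    refine Abs.of_eq (hg e fun z _ => he z) (by simp) ?_ (by simp)
    rw [heq]
    simp only [Gd.add_oV]
    abel

/-- Absorber for the complements of the subsets of given size of a set of pairs. -/
lemma exists_pairAbsorber (h2 : Half G)
    (D : Finset G)
    (hD : Thin D) (s : G)
    {m u : ℕ} (hm : 1 ≤ m) (hu : 2 * u ≤ m) (R : Finset G) (hR : R.card = m)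
    (hw : ∀ c ∈ R, c ∉ insert 0 D ∧ s - c ∉ insert 0 D)
    (DV DC : Finset G) (hDC : insert 0 D ⊆ DC) (hDR : R ⊆ DC) :
    ExL DV DC kP3 (610 * m) fun g => ∀ U ⊆ R, U.card = u →
      Abs g 0 ((R \ U).val + (R \ U).val.map fun c => s - c) := by
  refine (((exists_extraPairs h2 s DV DC (10 * m)).mono subset_rfl subset_rfl (K' := kP3)
    (by unfold kP3; omega) le_rfl fun g hg => hg).bind
    (d2 := 600 * m) ?_).mono subset_rfl subset_rfl le_rfl (by omega) fun g hg => hg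
  rintro _ ⟨X, hX, hd, rfl⟩ hf
  have hXR : Disjoint X R := disjoint_left.2 fun c hc hc' => (hd c hc).1 (hDR hc')
  obtain ⟨N, hN1, hN2, hN3⟩ := exists_robust_family hm hu R X hR hX hXR
  refine (exists_pairChoices h2 D hD s N _ _ (hDC.trans subset_union_left) univ ?_ ?_).mono subset_rfl subset_rfl
    le_rfl (by omega) ?_
  · intro z _
    refine (hN1 z).trans (union_subset (hDR.trans subset_union_left) ?_)
    refine Subset.trans ?_ subset_union_right
    intro c hc
    simp only [Gd.cs, Multiset.map_zero, add_zero, Multiset.mem_toFinset, mem_add]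
    exact Or.inl hc
  · intro z _ c hc
    rcases mem_union.1 (hN1 z hc) with h | h
    · exact hw c h
    · exact ⟨fun h' => (hd c h).1 (hDC h'), fun h' => (hd c h).2 (hDC h')⟩
  · intro g hg U hU hc
    obtain ⟨e, he, heq⟩ := hN3 U hU hc
    refine Abs.of_eq (hg e fun z _ => he z) (by simp) (by simp) ?_
    have h1 : map (fun z => s - e z) univ.val = (map e univ.val).map fun c => s - c := by
      rw [map_map]; rfl
    rw [h1, heq]
    simp only [Gd.add_oC, Multiset.map_add]
    abel
section Solve

/-- A state of the completion process: `U` and `P` are the used vertices and differences of the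
reservoirs and the differences in `Q` have to be used. -/
structure Ctx (s : G) (E RV Rc : Finset G) (β : ℕ) (H : Multiset (Box G)) (U P Q : Finset G) : Prop where
  hU : U ⊆ RV
  hP : P ⊆ Rc
  cl : ∀ c ∈ P, s - c ∈ P
  disj : Disjoint Q (Rc \ P)
  zero : ∀ c ∈ Q, c ∉ E
  bU : U.card + (Bal H).1 ≤ β
  bP : P.card + (Bal H).2.1 ≤ β + Q.card
  bQ : Q.card + 2 * (Bal H).1 ≤ β
  bal : ∃ r : ℤ, ((Bal H).2.1 : ℤ) = Q.card + 2 * r ∧ (Bal H).2.2 = Q.val.sum + r • s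

/-- The state can be completed. -/
def Win (s : G) (RV Rc : Finset G) (H : Multiset (Box G)) (U P Q : Finset G) : Prop :=
  ∃ V N : Finset G, V ⊆ RV \ U ∧ N ⊆ Rc \ P ∧ (∀ c ∈ N, s - c ∈ N) ∧ Fil H V.val (Q.val + N.val)

/-- Every state with the given boxes and differences can be completed. -/
def Sol (s : G) (E RV Rc : Finset G) (β : ℕ) (H : Multiset (Box G)) (M : Multiset G) : Prop :=
  ∀ U P Q : Finset G, Q.val = M → Ctx s E RV Rc β H U P Q → Win s RV Rc H U P Q

/-- A list of differences together with their partners. -/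
def prs (s : G) (X : List G) : List G := X ++ X.map fun x => s - x

lemma prs_sum (s : G) (X : List G) : ((prs s X : List G) : Multiset G).sum = (X.length : ℤ) • s := by
  induction X with
  | nil => simp [prs]
  | cons x X ih =>
    simp only [prs, sum_coe, List.sum_append, List.map_cons, List.sum_cons, length_cons,
      cast_add, Nat.cast_one, add_smul, one_smul] at ih ⊢
    rw [← ih]; abel

lemma prs_closed (s : G) (X : List G) : ∀ c ∈ prs s X, s - c ∈ prs s X := by
  intro c hc
  simp only [prs, mem_append, List.mem_map] at hc ⊢
  rcases hc with hc | ⟨x, hx, rfl⟩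
  · exact Or.inr ⟨c, hc, rfl⟩
  · exact Or.inl (by simpa using hx)

variable {s : G} {E E' : Finset G} {δ : ℝ} {RV Rc : Finset G} {β : ℕ}

/-- One step of the completion process. -/
lemma Ctx.step (hr : Res s E' δ RV Rc) (hE : E ⊆ E') {H H' : Multiset (Box G)} {U P Q : Finset G}
    (h : Ctx s E RV Rc β H U P Q) (LV X : List G)
    (hLV : LV.Nodup) (hLV' : ∀ v ∈ LV, v ∈ RV \ U) (hX : (prs s X).Nodup) (hX' : ∀ x ∈ X, x ∈ Rc \ P)
    {C1 : Multiset G} (ref : Ref H H' LV C1) {M : Multiset G} (hM : C1 + M = Q.val + (prs s X : List G))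
    (hc : M.card ≤ Q.card + 2 * LV.length) (k : Sol s E RV Rc β H' M) : Win s RV Rc H U P Q := by
  have hXR : ∀ x ∈ prs s X, x ∈ Rc \ P := by
    intro x hx
    simp only [prs, mem_append, List.mem_map] at hx
    rcases hx with hx | ⟨y, hy, rfl⟩
    · exact hX' x hx
    · obtain ⟨h1, h2⟩ := mem_sdiff.1 (hX' y hy)
      exact mem_sdiff.2 ⟨hr.partner _ h1, fun h3 => h2 (by simpa using h.cl _ h3)⟩
  have hnd : (Q.val + (prs s X : List G)).Nodup := by
    rw [nodup_add]
    refine ⟨Q.nodup, hX, Multiset.disjoint_left.2 fun hc hc' => ?_⟩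
    exact disjoint_left.1 h.disj hc (hXR _ (by simpa using hc'))
  have hMnd : M.Nodup := nodup_of_le (by rw [← hM]; exact Multiset.le_add_left _ _) hnd
  have hMmem : ∀ c ∈ M, c ∈ Q ∨ c ∈ prs s X := by
    intro c hc
    have : c ∈ Q.val + (prs s X : List G) := by rw [← hM]; exact mem_add.2 (Or.inr hc)
    simpa using this
  let Q' : Finset G := ⟨M, hMnd⟩
  let N : Finset G := ⟨(prs s X : List G), hX⟩
  let V1 : Finset G := ⟨(LV : Multiset G), hLV⟩
  have hV1 : V1.card = LV.length := rfl
  have hN : N.card = 2 * X.length := by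
    change (prs s X).length = _
    simp [prs]; omega
  have hUV : Disjoint U V1 := disjoint_right.2 fun v hv => (mem_sdiff.1 (hLV' v hv)).2
  have hPN : Disjoint P N := disjoint_right.2 fun v hv => (mem_sdiff.1 (hXR v hv)).2
  have hM1 := congrArg Multiset.card hM
  have hM2 := congrArg Multiset.sum hM
  have e1 := congrArg fst ref.eq
  have e2 := congrArg (fun x => x.2.1) ref.eq
  have e3 := congrArg (fun x => x.2.2) ref.eq
  simp only [pay, fst_add, snd_add, coe_card] at e1 e2 e3
  rw [card_add, card_add, coe_card, card_val] at hM1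
  rw [sum_add, sum_add, prs_sum] at hM2
  have hpl : (prs s X).length = 2 * X.length := hN
  have hQ' : Q'.card = M.card := rfl
  have ctx : Ctx s E RV Rc β H' (U ∪ V1) (P ∪ N) Q' := by
    refine ⟨union_subset h.hU fun v hv => (mem_sdiff.1 (hLV' v hv)).1,
      union_subset h.hP fun v hv => (mem_sdiff.1 (hXR v hv)).1, ?_, ?_, ?_, ?_, ?_, ?_, ?_⟩
    · intro c hc
      rcases mem_union.1 hc with hc | hc
      · exact mem_union_left _ (h.cl c hc)
      · exact mem_union_right _ (prs_closed s X c hc)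
    · refine disjoint_left.2 fun c hc hc' => ?_
      simp only [mem_sdiff, mem_union, not_or] at hc'
      rcases hMmem c hc with h1 | h1
      · exact disjoint_left.1 h.disj h1 (mem_sdiff.2 ⟨hc'.1, hc'.2.1⟩)
      · exact hc'.2.2 h1
    · intro c hc hcE
      rcases hMmem c hc with h1 | h1
      · exact h.zero c h1 hcE
      · exact hr.avoid _ (mem_sdiff.1 (hXR c h1)).1 (hE hcE)
    · rw [card_union_of_disjoint hUV, hV1]
      have := h.bU; omega
    · rw [card_union_of_disjoint hPN, hN, hQ']
      have := h.bP; omega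
    · rw [hQ']
      have := h.bQ; omega
    · obtain ⟨r, r1, r2⟩ := h.bal
      refine ⟨r - X.length, ?_, ?_⟩
      · rw [hQ']; push_cast [e2] at r1; omega
      · change _ = M.sum + _
        rw [sub_smul]
        rw [e3] at r2
        have : (Bal H').2.2 = Q.val.sum + r • s - C1.sum := by rw [← r2]; abel
        rw [this, sub_eq_iff_eq_add]
        have h4 : Q.val.sum = C1.sum + M.sum - (X.length : ℤ) • s := by rw [hM2]; abel
        rw [h4]; abel
  obtain ⟨V, N', w1, w2, w3, w4⟩ := k (U ∪ V1) (P ∪ N) Q' rfl ctx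
  have hVd : Disjoint V V1 := disjoint_left.2 fun v hv hv' => (mem_sdiff.1 (w1 hv)).2 (mem_union_right _ hv')
  have hNd : Disjoint N N' := disjoint_right.2 fun v hv hv' => (mem_sdiff.1 (w2 hv)).2 (mem_union_right _ hv')
  refine ⟨V.disjUnion V1 hVd, N.disjUnion N' hNd, ?_, ?_, ?_, ?_⟩
  · intro v hv
    rcases mem_disjUnion.1 hv with hv | hv
    · have := mem_sdiff.1 (w1 hv)
      exact mem_sdiff.2 ⟨this.1, fun h => this.2 (mem_union_left _ h)⟩
    · exact hLV' v hv
  · intro v hv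
    rcases mem_disjUnion.1 hv with hv | hv
    · exact hXR v hv
    · have := mem_sdiff.1 (w2 hv)
      exact mem_sdiff.2 ⟨this.1, fun h => this.2 (mem_union_left _ h)⟩
  · intro v hv
    rw [mem_disjUnion] at hv ⊢
    exact hv.imp (prs_closed s X v) (w3 v)
  · have := ref.fil _ _ w4
    rw [disjUnion_val, disjUnion_val]
    convert this using 1
    change Q.val + ((prs s X : List G) + N'.val) = M + N'.val + C1
    rw [← add_assoc, ← hM]; abel

lemma Ctx.pick (hr : Res s E' δ RV Rc) {K : ℕ} (hβ : (((K + 15) * (β + 1) : ℕ) : ℝ) < δ * card G)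
    {H : Multiset (Box G)} {U P Q : Finset G}
    (h : Ctx s E RV Rc β H U P Q) (L : List (Fm G)) (hL : L.length ≤ 5) (κ : G)
    (L' : List G) (hL' : L'.length ≤ 5) (hLE : ∀ x ∈ L', Sml x) (B : Finset G) (hB : B.card ≤ K * (β + 1)) :
    ∃ a, a ∉ B ∧ a + a ≠ κ ∧ (∀ x ∈ L', a + a ≠ x) ∧ ∀ f ∈ L, f.val a ∈ if f.1 then RV \ U else Rc \ P := by
  refine hr.pick L hL κ L' hL' hLE B U P (lt_of_le_of_lt ?_ hβ)
  have h1 := h.bU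
  have h2 := h.bP
  have h3 := h.bQ
  have : B.card + 5 * (U.card + P.card) ≤ (K + 15) * (β + 1) := by rw [add_mul]; omega
  exact_mod_cast this

lemma Ref.extend (a e b : G) (m : ℕ) : Ref {Box.gap a b (m + 1)} {Box.gap (a + e) b m} {a + e} {e} := by
  have h := (Ref.split a (a + e) b 0 m).trans ((Ref.close a (a + e)).add_right _)
  rw [show 0 + 1 + m = m + 1 by omega] at h
  simpa using h

lemma prs_one (s : G) {e : G} (h : e ≠ s - e) : (prs s [e]).Nodup := by
  simpa [prs] using h

variable (hr : Res s E' δ RV Rc) (hE : E ⊆ E') (h0 : (0 : G) ∈ E) {K : ℕ}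
  (hβ : (((K + 15) * (β + 1) : ℕ) : ℝ) < δ * card G)
include hr hE h0 hβ

lemma Sol.one {a b : G} {m : ℕ} {H : Multiset (Box G)} {M : Multiset G} (B : Finset G)
    (hB : B.card ≤ K * (β + 1))
    (k : ∀ e ∉ B, Sol s E RV Rc β ({Box.gap (a + e) b m} + H) (M + {s - e})) :
    Sol s E RV Rc β ({Box.gap a b (m + 1)} + H) M := by
  rintro U P Q rfl h
  obtain ⟨e, he, -, -, hf⟩ := h.pick hr hβ [(true, true, a), (false, true, 0)] (by simp) 0 [] (by simp) (by simp) B hB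
  simp only [forall_mem_cons, Fm.val] at hf
  simp only [if_true, zero_add, Bool.false_eq_true, if_false] at hf
  refine h.step hr hE [a + e] [e] (by simp) (by simpa using hf.1) (prs_one s (hr.two _ (mem_sdiff.1 hf.2.1).1))
    (by simpa using hf.2.1) ((Ref.extend a e b m).add_right H) (M := Q.val + {s - e}) ?_ (by simp) (k e he)
  simp only [prs, List.map_cons, map_nil, cons_append, nil_append, ← cons_coe, ← singleton_add, coe_nil]
  abel

lemma Sol.two {a b c : G} {m : ℕ} {H : Multiset (Box G)} {M : Multiset G} (B : Finset G)
    (hB : B.card ≤ K * (β + 1))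
    (k : ∀ e ∉ B, Sol s E RV Rc β ({Box.gap (a + e + c) b m} + H) (M + {s - e})) :
    Sol s E RV Rc β ({Box.gap a b (m + 2)} + H) ({c} + M) := by
  rintro U P Q hQ h
  have hc0 : c ≠ 0 := by
    rintro rfl; exact h.zero 0 (by rw [← mem_val, hQ]; simp) h0
  obtain ⟨e, he, -, -, hf⟩ := h.pick hr hβ [(true, true, a), (true, true, a + c), (false, true, 0)] (by simp) 0 [] (by simp) (by simp) B hB
  simp only [forall_mem_cons, Fm.val] at hf
  simp only [if_true, zero_add, Bool.false_eq_true, if_false] at hf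
  refine h.step hr hE [a + e, a + e + c] [e] (by simpa using hc0)
    (by simp only [forall_mem_cons]; exact ⟨hf.1, by convert hf.2.1 using 1 ; abel, by simp⟩)
    (prs_one s (hr.two _ (mem_sdiff.1 hf.2.2.1).1))
    (by simpa using hf.2.2.1) (((Ref.extend a e b (m + 1)).trans (Ref.extend _ c b m)).add_right H)
    (M := M + {s - e}) ?_ ?_ (k e he)
  · rw [hQ]
    simp only [prs, List.map_cons, map_nil, cons_append, nil_append, ← cons_coe, ← singleton_add, coe_nil]
    abel
  · rw [← card_val, hQ]; simp only [card_add, Multiset.card_singleton, length_cons, length_nil]; omega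

lemma Sol.three {a b c x : G} {m : ℕ} {H : Multiset (Box G)} {M : Multiset G} (B : Finset G)
    (hB : B.card ≤ K * (β + 1)) (hcx : x + c ≠ 0)
    (k : ∀ e ∉ B, Sol s E RV Rc β ({Box.gap (a + e + x + c) b m} + H) (M + {s - e})) :
    Sol s E RV Rc β ({Box.gap a b (m + 3)} + H) ({x} + {c} + M) := by
  rintro U P Q hQ h
  have hc0 : c ≠ 0 := by
    rintro rfl; exact h.zero 0 (by rw [← mem_val, hQ]; simp) h0
  have hx0 : x ≠ 0 := by
    rintro rfl; exact h.zero 0 (by rw [← mem_val, hQ]; simp) h0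
  obtain ⟨e, he, -, -, hf⟩ := h.pick hr hβ [(true, true, a), (true, true, a + x), (true, true, a + x + c),
    (false, true, 0)] (by simp) 0 [] (by simp) (by simp) B hB
  simp only [forall_mem_cons, Fm.val] at hf
  simp only [if_true, zero_add, Bool.false_eq_true, if_false] at hf
  refine h.step hr hE [a + e, a + e + x, a + e + x + c] [e]
    (by simp only [nodup_cons, mem_cons, not_or]; grind)
    (by simp only [forall_mem_cons]
        exact ⟨hf.1, by convert hf.2.1 using 1 ; abel, by convert hf.2.2.1 using 1 ; abel, by simp⟩)
    (prs_one s (hr.two _ (mem_sdiff.1 hf.2.2.2.1).1))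
    (by simpa using hf.2.2.2.1) ((((Ref.extend a e b (m + 2)).trans (Ref.extend _ x b (m + 1))).trans
      (Ref.extend _ c b m)).add_right H)
    (M := M + {s - e}) ?_ ?_ (k e he)
  · rw [hQ]
    simp only [prs, List.map_cons, map_nil, cons_append, nil_append, ← cons_coe, ← singleton_add, coe_nil]
    abel
  · rw [← card_val, hQ]; simp only [card_add, Multiset.card_singleton, length_cons, length_nil]; omega

lemma Sol.window {a b : G} (hab : a ≠ b) {H : Multiset (Box G)} {M : Multiset G}
    (k : ∀ M' : Multiset G, M.card ≤ M'.card → M'.card ≤ M.card + 2 → Sol s E RV Rc β H M') :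
    Sol s E RV Rc β ({Box.gap a b 1} + H) M := by
  rintro U P Q rfl h
  obtain ⟨u, -, hu, -, hf⟩ := h.pick hr hβ [(true, true, 0), (false, true, -a), (false, false, b)] (by simp)
    (a + b) [] (by simp) (by simp) ∅ (by simp)
  simp only [forall_mem_cons, Fm.val] at hf
  simp only [if_true, zero_add, Bool.false_eq_true, if_false] at hf
  have hf1 : u - a ∈ Rc \ P := by convert hf.2.1 using 1 ; abel
  have ref : Ref ({Box.gap a b 1} + H) H ([u] : List G) ({u - a} + {b - u}) := by
    have := (Ref.path a [u] b).add_right H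
    simpa [pcol] using this
  by_cases hs : b - a = s
  · refine h.step hr hE [u] [u - a] (by simp) (by simpa using hf.1) (prs_one s (hr.two _ (mem_sdiff.1 hf1).1))
      (by simpa using hf1) ref (M := Q.val) ?_ (by simp) (k _ (by simp) (by simp))
    rw [add_comm]
    congr 1
    simp only [prs, List.map_cons, map_nil, cons_append, nil_append, ← cons_coe, ← singleton_add, coe_nil]
    rw [← hs, add_zero]
    congr 2; abel
  · refine h.step hr hE [u] [u - a, b - u] (by simp) (by simpa using hf.1) ?_ ?_ ref
      (M := Q.val + {s - (u - a)} + {s - (b - u)}) ?_ (by simp) (k _ (by simp; omega) (by simp))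
    · have t1 := hr.two _ (mem_sdiff.1 hf1).1
      have t2 := hr.two _ (mem_sdiff.1 hf.2.2.1).1
      simp only [prs, List.map_cons, map_nil, cons_append, nil_append, nodup_cons, mem_cons, not_or]
      simp only [not_mem_nil, not_false_eq_true, and_true, nodup_nil]
      refine ⟨⟨?_, t1, ?_⟩, ⟨?_, t2⟩, ?_⟩ <;> grind
    · simp only [forall_mem_cons]; exact ⟨hf1, hf.2.2.1, by simp⟩
    · simp only [prs, List.map_cons, map_nil, cons_append, nil_append, ← cons_coe, ← singleton_add, coe_nil]
      abel

lemma Sol.windows (S : Multiset (G × G)) (hS : ∀ p ∈ S, p.1 ≠ p.2) {H : Multiset (Box G)} {M : Multiset G}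
    (k : ∀ M' : Multiset G, M'.card ≤ M.card + 2 * S.card → Sol s E RV Rc β H M') :
    Sol s E RV Rc β (wins S + H) M := by
  induction S using Multiset.induction generalizing M with
  | empty => simpa [wins] using k M (by simp)
  | cons p S ih =>
    have e : wins (p ::ₘ S) + H = {Box.gap p.1 p.2 1} + (wins S + H) := by
      simp [wins]
    rw [e]
    refine Sol.window hr hE h0 hβ (hS p (by simp)) fun M' _ hM' => ih (fun q hq => hS q (by simp [hq])) fun M'' hM'' => k _ ?_
    simp; omega

lemma Sol.gap (hK : 1 ≤ K) {a b : G} {m : ℕ} (hab : a ≠ b ∨ 1 ≤ m) {H : Multiset (Box G)} {M : Multiset G}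
    (k : ∀ M' : Multiset G, M.card + m ≤ M'.card → M'.card ≤ M.card + m + 2 → Sol s E RV Rc β H M') :
    Sol s E RV Rc β ({Box.gap a b (m + 1)} + H) M := by
  induction m generalizing a M with
  | zero => exact Sol.window hr hE h0 hβ (by simpa using hab) fun M' hM hM' => k _ (by omega) (by omega)
  | succ m ih =>
    refine Sol.one hr hE h0 hβ {b - a} (by simp; nlinarith) fun e he => ih (Or.inl ?_) fun M' hM hM' => k M' (by simp at hM; omega) (by simp at hM'; omega)
    rintro rfl
    simp at he

omit hr hE h0 hβ in
lemma exists_pair_sum_ne {M : Multiset G} (hM : M.Nodup) (h3 : 3 ≤ M.card) (σ : G) :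
    ∃ x c M', M = {x} + {c} + M' ∧ x + c ≠ σ := by
  obtain ⟨x, hx⟩ := card_pos_iff_exists_mem.1 (by omega : 0 < M.card)
  obtain ⟨M, rfl⟩ := exists_cons_of_mem hx
  simp only [card_cons] at h3
  obtain ⟨y, hy⟩ := card_pos_iff_exists_mem.1 (by omega : 0 < M.card)
  obtain ⟨M, rfl⟩ := exists_cons_of_mem hy
  simp only [card_cons] at h3
  obtain ⟨z, hz⟩ := card_pos_iff_exists_mem.1 (by omega : 0 < M.card)
  obtain ⟨M, rfl⟩ := exists_cons_of_mem hz
  simp only [Multiset.nodup_cons, Multiset.mem_cons, not_or] at hM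
  by_cases h : x + y = σ
  · refine ⟨x, z, y ::ₘ M, ?_, fun h' => hM.2.1.1 (add_left_cancel (h.trans h'.symm))⟩
    simp only [← singleton_add]; abel
  · refine ⟨x, y, z ::ₘ M, ?_, h⟩
    simp only [← singleton_add]; abel

lemma Sol.long (hK : 1 ≤ K) {a b : G} {m : ℕ} (hm : 2 ≤ m) {H : Multiset (Box G)} {M : Multiset G}
    (k : ∀ M' : Multiset G, (M'.card + m / 3 ≤ M.card + 6 ∨ M'.card ≤ 10) → Sol s E RV Rc β H M') :
    Sol s E RV Rc β ({Box.gap a b m} + H) M := by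
  induction m using Nat.strong_induction_on generalizing a M with
  | _ m ih =>
    by_cases h4 : m ≤ 4
    · obtain ⟨m, rfl⟩ : ∃ m', m = m' + 1 := ⟨m - 1, by omega⟩
      exact Sol.gap hr hE h0 hβ hK (Or.inr (by omega)) fun M' _ hM' => k M' (by omega)
    by_cases hM3 : 3 ≤ M.card
    · intro U P Q hQ h
      obtain ⟨x, c, M', rfl, hxc⟩ := exists_pair_sum_ne (hQ ▸ Q.nodup) hM3 0
      obtain ⟨m, rfl⟩ : ∃ m', m = m' + 3 := ⟨m - 3, by omega⟩
      refine Sol.three hr hE h0 hβ ∅ (by simp) hxc (fun e _ => ih m (by omega) (by omega) fun M'' hM'' => k M'' ?_) U P Q hQ h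
      simp at hM'' ⊢; omega
    by_cases hM0 : M.card = 0
    · obtain ⟨m, rfl⟩ : ∃ m', m = m' + 1 := ⟨m - 1, by omega⟩
      refine Sol.one hr hE h0 hβ ∅ (by simp) (fun e _ => ih m (by omega) (by omega) fun M'' hM'' => k M'' ?_)
      simp at hM'' ⊢; omega
    · obtain ⟨c, hc⟩ := card_pos_iff_exists_mem.1 (by omega : 0 < M.card)
      obtain ⟨M, rfl⟩ := exists_cons_of_mem hc
      obtain ⟨m, rfl⟩ : ∃ m', m = m' + 2 := ⟨m - 2, by omega⟩
      rw [← singleton_add]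
      refine Sol.two hr hE h0 hβ ∅ (by simp) (fun e _ => ih m (by omega) (by omega) fun M'' hM'' => k M'' ?_)
      simp at hM3 hM'' ⊢; omega

lemma Sol.final {a b c x : G} (hcx : c + x ≠ 0) : Sol s E RV Rc β {Box.gap a b 3} ({c} + {x}) := by
  rintro U P Q hQ h
  have hc0 : c ≠ 0 := by
    rintro rfl; exact h.zero 0 (by rw [← mem_val, hQ]; simp) h0
  have hx0 : x ≠ 0 := by
    rintro rfl; exact h.zero 0 (by rw [← mem_val, hQ]; simp) h0
  obtain ⟨r, r1, r2⟩ := h.bal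
  have hQc : Q.card = 2 := by rw [← card_val, hQ]; simp
  simp only [Bal_singleton, FGT.bal, hQc] at r1 r2
  have hr1 : r = 1 := by push_cast at r1; omega
  subst hr1
  rw [hQ] at r2
  simp only [sum_add, Multiset.sum_singleton, one_smul] at r2
  obtain ⟨e, -, -, -, hf⟩ := h.pick hr hβ [(true, true, a), (true, true, a + c), (true, true, a + c + x),
    (false, true, 0)] (by simp) 0 [] (by simp) (by simp) ∅ (by simp)
  simp only [forall_mem_cons, Fm.val] at hf
  simp only [if_true, zero_add, Bool.false_eq_true, if_false] at hf
  refine h.step hr hE [a + e, a + e + c, a + e + c + x] [e]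
    (by simp only [nodup_cons, mem_cons, not_or]; grind)
    (by simp only [forall_mem_cons]
        exact ⟨hf.1, by convert hf.2.1 using 1 ; abel, by convert hf.2.2.1 using 1 ; abel, by simp⟩)
    (prs_one s (hr.two _ (mem_sdiff.1 hf.2.2.2.1).1))
    (by simpa using hf.2.2.2.1) (Ref.path a [a + e, a + e + c, a + e + c + x] b) (M := 0) ?_ (by simp) ?_
  · rw [hQ]
    simp only [pcol, prs, List.map_cons, map_nil, cons_append, nil_append, ← cons_coe, ← singleton_add, coe_nil]
    have e1 : a + e - a = e := by abel
    have e2 : a + e + c - (a + e) = c := by abel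
    have e3 : a + e + c + x - (a + e + c) = x := by abel
    have e4 : b - (a + e + c + x) = s - e := by grind
    rw [e1, e2, e3, e4]
    abel
  · intro U P Q hQ h
    refine ⟨∅, ∅, by simp, by simp, by simp, ?_⟩
    rw [hQ]; exact Fil.nil

lemma Sol.last_odd (hK : 1 ≤ K) {a b c x : G} (hcx : c + x ≠ 0) (j : ℕ) :
    Sol s E RV Rc β {Box.gap a b (3 + 2 * j)} ({c} + {x}) := by
  induction j generalizing a c x with
  | zero => exact Sol.final hr hE h0 hβ hcx
  | succ j ih =>
    have := Sol.two hr hE h0 hβ (a := a) (b := b) (c := c) (m := 3 + 2 * j) (H := 0) (M := {x}) {s + x}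
      (by simp; nlinarith) fun e he => by
        rw [add_zero]
        refine ih ?_
        simp only [mem_singleton] at he
        grind
    rwa [add_zero] at this

lemma Sol.last (hK : 1 ≤ K) {a b : G} {m : ℕ} {M : Multiset G}
    (hM : 3 * M.card + 6 ≤ m ∨ (M.card = 1 ∧ 6 ≤ m) ∨ (M.card = 2 ∧ 5 ≤ m)) :
    Sol s E RV Rc β {Box.gap a b m} M := by
  induction m using Nat.strong_induction_on generalizing a M with
  | _ m ih =>
    intro U P Q hQ h
    obtain ⟨r, r1, -⟩ := h.bal
    have hQc : Q.card = M.card := by rw [← card_val, hQ]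
    simp only [Bal_singleton, FGT.bal, hQc] at r1
    by_cases h3 : 3 ≤ M.card
    · obtain ⟨x, c, M', rfl, hxc⟩ := exists_pair_sum_ne (hQ ▸ Q.nodup) h3 0
      obtain ⟨m, rfl⟩ : ∃ m', m = m' + 3 := ⟨m - 3, by omega⟩
      have := Sol.three hr hE h0 hβ (a := a) (b := b) (m := m) (H := 0) (M := M') ∅ (by simp) hxc fun e _ => by
        rw [add_zero]
        exact ih m (by omega) (by simp only [card_add, Multiset.card_singleton] at hM h3 ⊢; omega)
      rw [add_zero] at this
      exact this U P Q hQ h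
    by_cases h2 : M.card = 2
    · obtain ⟨c, x, rfl⟩ := Multiset.card_eq_two.1 h2
      obtain ⟨j, rfl⟩ : ∃ j, m = 3 + 2 * j + 2 := by
        simp only [insert_eq_cons, card_cons, Multiset.card_singleton] at hM r1
        push_cast at r1
        exact ⟨(m - 5) / 2, by omega⟩
      have := Sol.two hr hE h0 hβ (a := a) (b := b) (c := c) (m := 3 + 2 * j) (H := 0) (M := {x}) {s + x}
        (by simp; nlinarith) fun e he => by
          rw [add_zero]
          refine Sol.last_odd hr hE h0 hβ hK ?_ j
          simp only [mem_singleton] at he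
          grind
      rw [add_zero] at this
      exact this U P Q hQ h
    obtain ⟨m, rfl⟩ : ∃ m', m = m' + 1 := ⟨m - 1, by omega⟩
    have := Sol.one hr hE h0 hβ (a := a) (b := b) (m := m) (H := 0) (M := M) ∅ (by simp) fun e _ => by
        rw [add_zero]
        exact ih m (by omega) (by push_cast at r1; simp only [card_add, Multiset.card_singleton]; omega)
    rw [add_zero] at this
    exact this U P Q hQ h

/-- Boxes with at least one long gap can be completed. -/
lemma solve_large (hK : 1 ≤ K) (S : Multiset (G × G)) (hS : ∀ p ∈ S, p.1 ≠ p.2) (L : Multiset (G × G × ℕ))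
    (hL : ∀ p ∈ L, 60 ≤ p.2.2) (hL0 : L ≠ 0) (M : Multiset G)
    (hM : 3 * M.card + 6 * S.card + 18 * L.card + 20 * L.card ≤ (L.map fun p => p.2.2).sum) :
    Sol s E RV Rc β (wins S + L.map fun p => Box.gap p.1 p.2.1 p.2.2) M := by
  refine Sol.windows hr hE h0 hβ S hS fun M' hM' => ?_
  have key : ∀ (L : Multiset (G × G × ℕ)), (∀ p ∈ L, 60 ≤ p.2.2) → L ≠ 0 → ∀ M : Multiset G,
      (3 * M.card + 38 * L.card ≤ (L.map fun p => p.2.2).sum ∨ M.card ≤ 10) →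
      Sol s E RV Rc β (L.map fun p => Box.gap p.1 p.2.1 p.2.2) M := by
    intro L
    induction L using Multiset.induction with
    | empty => intro _ h; exact absurd rfl h
    | cons p L ih =>
      intro hL _ M hM
      have hp := hL p (by simp)
      by_cases hL0 : L = 0
      · subst hL0
        simp only [map_cons, Multiset.map_zero, sum_cons, sum_zero, card_cons,
          card_zero] at hM ⊢
        exact Sol.last hr hE h0 hβ hK (by omega)
      · rw [map_cons, ← singleton_add]
        refine Sol.long hr hE h0 hβ hK (by omega) fun M' hM' => ih (fun q hq => hL q (by simp [hq])) hL0 M' ?_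
        simp only [map_cons, sum_cons, card_cons] at hM
        omega
  exact key L hL hL0 M' (Or.inl (by omega))
end Solve

section Pad
variable {s : G} {E E' : Finset G} {δ : ℝ} {RV Rc : Finset G} {β : ℕ}

lemma prs_append_coe (s : G) (X Y : List G) :
    ((prs s (X ++ Y) : List G) : Multiset G) = (prs s X : List G) + (prs s Y : List G) := by
  simp only [prs, ← coe_add, map_append]
  abel

lemma prs_append_nodup {s : G} {X Y : List G} (hX : (prs s X).Nodup) (hY : (prs s Y).Nodup)
    (h : ∀ c ∈ prs s X, c ∉ prs s Y) : (prs s (X ++ Y)).Nodup := by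
  rw [← coe_nodup, prs_append_coe, nodup_add]
  exact ⟨hX, hY, Multiset.disjoint_left.2 fun hc hc' => h _ hc hc'⟩

lemma mem_prs {s : G} {X : List G} {c : G} : c ∈ prs s X ↔ c ∈ X ∨ s - c ∈ X := by
  simp only [prs, mem_append, List.mem_map]
  refine or_congr Iff.rfl ⟨?_, fun h => ⟨_, h, by simp⟩⟩
  rintro ⟨x, hx, rfl⟩
  simpa using hx

lemma prs_card (s : G) (X : List G) : (prs s X).toFinset.card ≤ 2 * X.length :=
  (List.toFinset_card_le _).trans (by simp [prs]; omega)

lemma pcol_shift (v a : G) (l : List G) (b : G) : pcol (v + a) (l.map fun x => v + x) (v + b) = pcol a l b := by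
  induction l generalizing a with
  | nil => simp [pcol]
  | cons x l ih => simp only [List.map_cons, pcol, ih]; simp

/-- A path realising the difference `c`, up to a multiple of `s`, together with pairs. -/
lemma Ctx.pad_path (hr : Res s E' δ RV Rc) {K : ℕ} (hβ : (((K + 15) * (β + 1) : ℕ) : ℝ) < δ * card G)
    {H : Multiset (Box G)} {U P Q : Finset G} (h : Ctx s E RV Rc β H U P Q) (c : G)
    (hc : ∀ i : ℕ, c + i • s ≠ 0) (j : ℕ) (a : G) (BV BC : Finset G)
    (hb : 2 * (BV.card + BC.card + 4 * j) ≤ K * (β + 1)) :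
    ∃ l es : List G, l.length = 2 * j ∧ l.Nodup ∧ (∀ v ∈ l, v ∈ RV \ U ∧ v ∉ BV) ∧ (prs s es).Nodup ∧
      es.length = j ∧ (∀ e ∈ es, e ∈ Rc \ P) ∧ (∀ e ∈ prs s es, e ∉ BC) ∧
      Ref {Box.gap a (a + c + j • s) (2 * j)} 0 l ({c} + (prs s es : List G)) := by
  induction j generalizing a BV BC with
  | zero =>
    refine ⟨[], [], rfl, by simp, by simp, by simp [prs], rfl, by simp, by simp [prs], ?_⟩
    simpa [prs] using Ref.close a (a + c)
  | succ j ih =>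
    obtain ⟨e, he, -, -, hf⟩ := h.pick hr hβ [(true, true, a), (true, true, a + c + j • s), (false, true, 0)]
      (by simp) 0 [] (by simp) (by simp)
      ((BV.image fun v => v - a) ∪ (BV.image fun v => v - (a + c + j • s)) ∪ BC ∪ (BC.image fun x => s - x)) (by
        have h1 := card_union_le ((BV.image fun v => v - a) ∪ (BV.image fun v => v - (a + c + j • s)) ∪ BC) (BC.image fun x => s - x)
        have h2 := card_union_le ((BV.image fun v => v - a) ∪ (BV.image fun v => v - (a + c + j • s))) BC
        have h3 := card_union_le (BV.image fun v => v - a) (BV.image fun v => v - (a + c + j • s))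
        have h4 := card_image_le (s := BV) (f := fun v => v - a)
        have h5 := card_image_le (s := BV) (f := fun v => v - (a + c + j • s))
        have h6 := card_image_le (s := BC) (f := fun x => s - x)
        omega)
    simp only [forall_mem_cons, Fm.val] at hf
    simp only [if_true, zero_add, Bool.false_eq_true, if_false] at hf
    obtain ⟨hf1, hf2, hf3, -⟩ := hf
    simp only [mem_union, mem_image, not_or, not_exists, not_and] at he
    obtain ⟨⟨⟨he1, he2⟩, he3⟩, he4⟩ := he
    have hee := hr.two _ (mem_sdiff.1 hf3).1
    obtain ⟨l, es, h1, h2, h3, h4, h4', h5, h6, h7⟩ := ih (a + e) (insert (a + e) (insert (a + c + j • s + e) BV))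
      (insert e (insert (s - e) BC)) (by
        have := card_insert_le (a + e) (insert (a + c + j • s + e) BV)
        have := card_insert_le (a + c + j • s + e) BV
        have := card_insert_le e (insert (s - e) BC)
        have := card_insert_le (s - e) BC
        omega)
    refine ⟨[a + e, a + c + j • s + e] ++ l, [e] ++ es, by simp [h1]; omega, ?_, ?_, ?_, by simp [h4'], ?_, ?_, ?_⟩
    · rw [nodup_append]
      refine ⟨?_, h2, ?_⟩
      · have := hc j
        simp only [nodup_cons, List.mem_singleton, not_mem_nil, not_false_eq_true, nodup_nil, and_true]
        intro h8
        apply this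
        grind
      · intro v hv w hw hvw
        subst hvw
        have := (h3 v hw).2
        simp only [mem_insert, not_or] at this
        simp only [mem_cons, not_mem_nil, or_false] at hv
        grind
    · intro v hv
      simp only [mem_append, mem_cons, not_mem_nil, or_false] at hv
      rcases hv with (rfl | rfl) | hv
      · exact ⟨hf1, fun h8 => he1 _ h8 (by abel)⟩
      · exact ⟨hf2, fun h8 => he2 _ h8 (by abel)⟩
      · have := h3 v hv
        simp only [mem_insert, not_or] at this
        exact ⟨this.1, this.2.2.2⟩
    · refine prs_append_nodup (prs_one s hee) h4 fun x hx hx' => ?_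
      have := h6 x hx'
      simp only [mem_insert, not_or] at this
      rw [mem_prs] at hx
      simp only [List.mem_singleton] at hx
      grind
    · intro x hx
      simp only [mem_append, List.mem_singleton] at hx
      rcases hx with rfl | hx
      · exact hf3
      · exact h5 x hx
    · intro x hx hxB
      have hx' : x ∈ prs s [e] ∨ x ∈ prs s es := by
        simp only [mem_prs, mem_append] at hx ⊢; tauto
      rcases hx' with hx' | hx'
      · rw [mem_prs] at hx'
        simp only [List.mem_singleton] at hx'
        rcases hx' with rfl | hx'
        · exact he3 hxB
        · exact he4 x hxB hx'
      · have := h6 x hx'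
        simp only [mem_insert, not_or] at this
        exact this.2.2 hxB
    · have r1 := Ref.split a (a + e) (a + c + (j + 1) • s) 0 (2 * j + 1)
      have r2 := (Ref.close a (a + e)).add_right {Box.gap (a + e) (a + c + (j + 1) • s) (2 * j + 1)}
      have r3 := Ref.split (a + e) (a + c + j • s + e) (a + c + (j + 1) • s) (2 * j) 0
      have r4 := Ref.close (a + c + j • s + e) (a + c + (j + 1) • s)
      have e1 : a + e + c + j • s = a + c + j • s + e := by abel
      rw [e1] at h7
      have r5 := h7.add r4
      have := (r1.trans r2).trans ((by simpa using r3 : Ref (0 + {Box.gap (a + e) (a + c + (j + 1) • s) (2 * j + 1)}) _ _ _).trans r5)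
      rw [show 0 + 1 + (2 * j + 1) = 2 * (j + 1) by omega] at this
      convert this using 1
      · simp
      · rw [← coe_add]
        simp only [← cons_coe, ← singleton_add, coe_nil]
        abel
      · rw [prs_append_coe]
        have e2 : a + e - a = e := by abel
        have e3 : a + c + (j + 1) • s - (a + c + j • s + e) = s - e := by rw [add_smul, one_smul]; abel
        rw [e2, e3]
        simp only [prs, List.map_cons, map_nil, cons_append, nil_append, ← cons_coe, ← singleton_add, coe_nil]
        abel

/-- The differences of a row with given offsets. -/
def rcol (s : G) (j : ℕ) (p : G × List G) : Multiset G := {p.1 - j • s} + pcol p.1 p.2 0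

/-- A full row of given shape. -/
lemma Ctx.row (hr : Res s E' δ RV Rc) {K : ℕ} (hβ : (((K + 15) * (β + 1) : ℕ) : ℝ) < δ * card G)
    {H : Multiset (Box G)} {U P Q : Finset G} (h : Ctx s E RV Rc β H U P Q) (w : G) (ws : List G) (j : ℕ)
    (hws : ws.length ≤ 3) (hnd : (0 :: w :: ws).Nodup)
    (hc : ∀ i : ℕ, (w - j • s) + i • s ≠ 0) (BV BC : Finset G)
    (hb : 5 * (BV.card + 5 + BC.card + 4 * j) ≤ K * (β + 1)) :
    ∃ l es : List G, l.length = ws.length + 2 + 2 * j ∧ l.Nodup ∧ (∀ v ∈ l, v ∈ RV \ U ∧ v ∉ BV) ∧ (prs s es).Nodup ∧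
      es.length = j ∧ (∀ e ∈ es, e ∈ Rc \ P) ∧ (∀ e ∈ prs s es, e ∉ BC) ∧
      Ref {Box.row (ws.length + 2 + 2 * j)} 0 (l : Multiset G) (rcol s j (w, ws) + ((prs s es : List G) : Multiset G)) := by
  obtain ⟨v, hv, -, -, hf⟩ := h.pick hr hβ ((0 :: w :: ws).map fun x => (true, true, x))
    (by simp; omega) 0 [] (by simp) (by simp) ((0 :: w :: ws).toFinset.biUnion fun x => BV.image fun v => v - x) (by
      refine (card_biUnion_le_card_mul _ _ BV.card fun x _ => card_image_le).trans ?_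
      have : (0 :: w :: ws).toFinset.card ≤ 5 := (List.toFinset_card_le _).trans (by simp; omega)
      nlinarith)
  simp only [List.mem_map, Fm.val] at hf
  have hf' : ∀ x ∈ 0 :: w :: ws, x + v ∈ RV \ U := by
    intro x hx
    simpa using hf _ ⟨x, hx, rfl⟩
  have hv' : ∀ x ∈ 0 :: w :: ws, x + v ∉ BV := by
    intro x hx hB
    apply hv
    rw [mem_biUnion]
    exact ⟨x, by simpa using hx, mem_image.2 ⟨_, hB, by abel⟩⟩
  let base := (0 :: w :: ws).map fun x => x + v
  have hbnd : base.Nodup := hnd.map (add_left_injective v)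
  obtain ⟨l, es, h1, h2, h3, h4, h4', h5, h6, h7⟩ := h.pad_path hr hβ (w - j • s) hc j v (BV ∪ base.toFinset) BC (by
    have := card_union_le BV base.toFinset
    have : base.toFinset.card ≤ 5 := (List.toFinset_card_le _).trans (by simp [base]; omega)
    omega)
  refine ⟨base ++ l, es, by simp [base, h1]; omega, ?_, ?_, h4, h4', h5, h6, ?_⟩
  · rw [nodup_append]
    refine ⟨hbnd, h2, ?_⟩
    rintro x hx y hy rfl
    have := (h3 x hy).2
    simp only [mem_union, mem_toFinset, not_or] at this
    exact this.2 hx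
  · intro x hx
    rcases mem_append.1 hx with hx | hx
    · obtain ⟨y, hy, rfl⟩ := List.mem_map.1 hx
      exact ⟨hf' y hy, hv' y hy⟩
    · have := h3 x hx
      simp only [mem_union, not_or] at this
      exact ⟨this.1, this.2.1⟩
  · have e1 : v + (w - j • s) + j • s = v + w := by abel
    rw [e1] at h7
    have r1 := Ref.row v (2 * j + 1 + ws.length)
    have r2 := Ref.split v (v + w) v (2 * j) ws.length
    have r3 := Ref.path (v + w) (ws.map fun x => v + x) v
    rw [List.length_map] at r3
    have := r1.trans (r2.trans (h7.add r3))
    rw [show 2 * j + 1 + ws.length + 1 = ws.length + 2 + 2 * j by omega] at this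
    convert this using 1
    · simp
    · simp only [base, List.map_cons, ← cons_coe, ← singleton_add, zero_add, ← coe_add]
      rw [add_comm w v, show (fun x => x + v) = (fun x => v + x) from funext fun x => add_comm _ _]
      abel
    · have := pcol_shift v w ws 0
      rw [add_zero] at this
      rw [this, rcol]
      abel

/-- Several rows of given shapes. -/
lemma Ctx.rows (hr : Res s E' δ RV Rc) {K : ℕ} (hβ : (((K + 15) * (β + 1) : ℕ) : ℝ) < δ * card G)
    {H : Multiset (Box G)} {U P Q : Finset G} (h : Ctx s E RV Rc β H U P Q) (m j : ℕ) (hm : m ≤ 3)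
    (ls : List (G × List G)) (hls : ∀ p ∈ ls, p.2.length = m ∧ (0 :: p.1 :: p.2).Nodup ∧
      ∀ i : ℕ, (p.1 - j • s) + i • s ≠ 0) (BV BC : Finset G)
    (hb : 5 * (BV.card + BC.card + (10 + 4 * j) * ls.length) ≤ K * (β + 1)) :
    ∃ l es : List G, l.length = ls.length * (m + 2 + 2 * j) ∧ l.Nodup ∧ (∀ v ∈ l, v ∈ RV \ U ∧ v ∉ BV) ∧
      (prs s es).Nodup ∧ (∀ e ∈ es, e ∈ Rc \ P) ∧ (∀ e ∈ prs s es, e ∉ BC) ∧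
      Ref (replicate ls.length (Box.row (m + 2 + 2 * j))) 0 (l : Multiset G)
        ((ls.map (rcol s j)).sum + ((prs s es : List G) : Multiset G)) := by
  induction ls generalizing BV BC with
  | nil =>
    refine ⟨[], [], by simp, by simp, by simp, by simp [prs], by simp, by simp [prs], ?_⟩
    simpa [prs] using Ref.refl (0 : Multiset (Box G))
  | cons p ls ih =>
    obtain ⟨q1, q2, q3⟩ := hls p (by simp)
    rw [length_cons, Nat.mul_succ] at hb
    obtain ⟨l, es, h1, h2, h3, h4, h4', h5, h6, h7⟩ := h.row hr hβ p.1 p.2 j (by omega) q2 q3 BV BC (by omega)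
    obtain ⟨l', es', g1, g2, g3, g4, g5, g6, g7⟩ := ih (fun p hp => hls p (by simp [hp])) (BV ∪ l.toFinset)
      (BC ∪ (prs s es).toFinset) (by
        have := card_union_le BV l.toFinset
        have := card_union_le BC (prs s es).toFinset
        have := List.toFinset_card_le l
        have := prs_card s es
        omega)
    rw [q1] at h1 h7
    refine ⟨l ++ l', es ++ es', by rw [List.length_append, h1, g1, length_cons]; ring, ?_, ?_, ?_, ?_, ?_, ?_⟩
    · rw [nodup_append]
      refine ⟨h2, g2, ?_⟩
      rintro x hx y hy rfl
      have := (g3 x hy).2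
      simp only [mem_union, mem_toFinset, not_or] at this
      exact this.2 hx
    · intro x hx
      rcases mem_append.1 hx with hx | hx
      · exact h3 x hx
      · have := g3 x hx
        simp only [mem_union, not_or] at this
        exact ⟨this.1, this.2.1⟩
    · refine prs_append_nodup h4 g4 fun c hc hc' => ?_
      have := g6 c hc'
      simp only [mem_union, mem_toFinset, not_or] at this
      exact this.2 hc
    · intro e he
      exact (mem_append.1 he).elim (h5 e) (g5 e)
    · intro x hx
      have hx' : x ∈ prs s es ∨ x ∈ prs s es' := by
        simp only [mem_prs, mem_append] at hx ⊢; tauto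
      rcases hx' with hx' | hx'
      · exact h6 x hx'
      · have := g6 x hx'
        simp only [mem_union, not_or] at this
        exact this.1
    · have := h7.add g7
      rw [length_cons, replicate_succ, ← singleton_add]
      convert this using 1
      · simp
      · simp
      · rw [prs_append_coe, List.map_cons, List.sum_cons]
        abel

/-- A step filling several rows. -/
lemma Ctx.step_rows (hr : Res s E' δ RV Rc) (hE : E ⊆ E') {K : ℕ}
    (hβ : (((K + 15) * (β + 1) : ℕ) : ℝ) < δ * card G)
    {H : Multiset (Box G)} {U P Q : Finset G} {m j : ℕ} (ls : List (G × List G))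
    (h : Ctx s E RV Rc β (replicate ls.length (Box.row (m + 2 + 2 * j)) + H) U P Q) (hm : m ≤ 3)
    (hls : ∀ p ∈ ls, p.2.length = m ∧ (0 :: p.1 :: p.2).Nodup ∧ ∀ i : ℕ, (p.1 - j • s) + i • s ≠ 0)
    (X : List G) (hX : (prs s X).Nodup) (hX' : ∀ x ∈ X, x ∈ Rc \ P)
    (hb : 5 * (2 * X.length + (10 + 4 * j) * ls.length) ≤ K * (β + 1))
    {M : Multiset G} (hM : (ls.map (rcol s j)).sum + M = Q.val + (prs s X : List G))
    (hc : M.card ≤ Q.card + 2 * ls.length) (k : Sol s E RV Rc β H M) :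
    Win s RV Rc (replicate ls.length (Box.row (m + 2 + 2 * j)) + H) U P Q := by
  obtain ⟨l, es, h1, h2, h3, h4, h5, h6, h7⟩ := h.rows hr hβ m j hm ls hls ∅ (prs s X).toFinset (by
    have := prs_card s X
    rw [card_empty]
    omega)
  refine h.step hr hE l (X ++ es) h2 (fun v hv => (h3 v hv).1) (prs_append_nodup hX h4 fun c hc hc' => ?_) ?_
    (by simpa using h7.add_right H) (M := M) ?_ ?_ k
  · exact h6 c hc' (by simpa using hc)
  · intro x hx
    exact (mem_append.1 hx).elim (hX' x) (h5 x)
  · rw [prs_append_coe, ← add_assoc, ← hM]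
    abel
  · rw [h1]
    have : ls.length * 1 ≤ ls.length * (m + 2 + 2 * j) := Nat.mul_le_mul_left _ (by omega)
    omega
end Pad

section SolveSmall
variable {s : G} {E : Finset G} {δ : ℝ} {RV Rc : Finset G} {β : ℕ}

/-- The shape of a row with three given differences. -/
def shp3 (τ c d : G) : G × List G := (c + τ, [c + τ + d])

/-- The shape of a row with four given differences. -/
def shp4 (τ c d e : G) : G × List G := (c + τ, [c + τ + d, c + τ + d + e])

lemma rcol_shp3 {j : ℕ} {τ : G} (hτ : τ = j • s) (h2 : τ + τ = 0) (c d : G) :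
    rcol s j (shp3 τ c d) = {c} + {d} + {τ - c - d} := by
  have e1 : c + τ - j • s = c := by rw [← hτ]; abel
  have e2 : c + τ + d - (c + τ) = d := by abel
  have e3 : 0 - (c + τ + d) = τ - c - d := by grind
  simp only [rcol, shp3, pcol, e1, e2, e3, ← singleton_add]
  abel

lemma rcol_shp4 {j : ℕ} {τ : G} (hτ : τ = j • s) (h2 : τ + τ = 0) (c d e : G) :
    rcol s j (shp4 τ c d e) = {c} + {d} + {e} + {τ - c - d - e} := by
  have e1 : c + τ - j • s = c := by rw [← hτ]; abel
  have e2 : c + τ + d - (c + τ) = d := by abel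
  have e3 : c + τ + d + e - (c + τ + d) = e := by abel
  have e4 : 0 - (c + τ + d + e) = τ - c - d - e := by grind
  simp only [rcol, shp4, pcol, e1, e2, e3, e4, ← singleton_add]
  abel

lemma prs_nodup {X : List G} (h1 : ∀ x ∈ X, x ≠ s - x) (h2 : X.Pairwise fun x y => x ≠ y ∧ x ≠ s - y) :
    (prs s X).Nodup := by
  rw [prs, nodup_append]
  refine ⟨h2.imp fun h => h.1, List.Nodup.map sub_right_injective (h2.imp fun h => h.1), ?_⟩
  rintro x hx _ hy rfl
  obtain ⟨y, hy, e⟩ := List.mem_map.1 hy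
  by_cases hxy : x = y
  · subst hxy
    exact h1 x hx e.symm
  · have hs : Std.Symm fun x y : G => x ≠ y ∧ x ≠ s - y :=
      ⟨fun x y h => ⟨h.1.symm, fun h' => h.2 (by rw [h']; abel)⟩⟩
    exact (h2.forall hx hy hxy).2 e.symm

/-- The setting for rows of bounded length. -/
structure Mach (s : G) (E RV Rc : Finset G) (δ : ℝ) (K j : ℕ) (τ : G) (β : ℕ) (T : AddSubgroup G) : Prop where
  hr : Res s E δ RV Rc
  hβ : (((K + 15) * (β + 1) : ℕ) : ℝ) < δ * card G
  hT : ∀ x, x ∈ E ↔ x ∈ T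
  hs : s ∈ T
  s2 : s + s = 0
  hτ : τ = j • s
  sml : ∀ x y, y ∉ E → Sml (y + (x + x))
  hK : 300 + 60 * j + 3 * E.card ≤ K

namespace Mach
variable {K j : ℕ} {τ : G} {T : AddSubgroup G} (mc : Mach s E RV Rc δ K j τ β T)
include mc

lemma zero_mem : (0 : G) ∈ E := (mc.hT 0).2 T.zero_mem
lemma t2 : τ + τ = 0 := by rw [mc.hτ, ← smul_add, mc.s2, smul_zero]
lemma mem_t : τ ∈ E := (mc.hT _).2 (mc.hτ ▸ T.nsmul_mem mc.hs j)
lemma mem_s : s ∈ E := (mc.hT _).2 mc.hs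
lemma add_mem {x y : G} (hx : x ∈ E) (hy : y ∈ E) : x + y ∈ E :=
  (mc.hT _).2 (T.add_mem ((mc.hT _).1 hx) ((mc.hT _).1 hy))
lemma sub_mem {x y : G} (hx : x ∈ E) (hy : y ∈ E) : x - y ∈ E :=
  (mc.hT _).2 (T.sub_mem ((mc.hT _).1 hx) ((mc.hT _).1 hy))
lemma ne_of_not_mem {x y : G} (hx : x ∉ E) (hy : y ∈ E) : x ≠ y := fun h => hx (h ▸ hy)

lemma row_ok {c : G} (hc : c ∉ E) (i : ℕ) : (c + τ - j • s) + i • s ≠ 0 := by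
  rw [← mc.hτ]
  intro h
  refine hc ?_
  have : c = 0 - i • s := by rw [← h]; abel
  rw [this]
  exact mc.sub_mem mc.zero_mem ((mc.hT _).2 (T.nsmul_mem mc.hs i))

lemma shp3_ok {c d : G} (hc : c ∉ E) (hd : d ≠ 0) (he : c + d ≠ τ) :
    (shp3 τ c d).2.length = 1 ∧ (0 :: (shp3 τ c d).1 :: (shp3 τ c d).2).Nodup ∧
      ∀ i : ℕ, ((shp3 τ c d).1 - j • s) + i • s ≠ 0 := by
  refine ⟨rfl, ?_, mc.row_ok hc⟩
  have t2 := mc.t2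
  have h1 : c ≠ τ := mc.ne_of_not_mem hc mc.mem_t
  simp only [shp3, nodup_cons, mem_cons, not_mem_nil, or_false, not_or, not_false_eq_true,
    nodup_nil, and_true]
  refine ⟨⟨?_, ?_⟩, ?_⟩ <;> grind

lemma shp4_ok {c d e : G} (hc : c ∉ E) (hd : d ≠ 0) (he : e ≠ 0) (hf : c + d + e ≠ τ)
    (hcd : c + d ≠ τ) (hde : d + e ≠ 0) :
    (shp4 τ c d e).2.length = 2 ∧ (0 :: (shp4 τ c d e).1 :: (shp4 τ c d e).2).Nodup ∧
      ∀ i : ℕ, ((shp4 τ c d e).1 - j • s) + i • s ≠ 0 := by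
  refine ⟨rfl, ?_, mc.row_ok hc⟩
  have t2 := mc.t2
  have h1 : c ≠ τ := mc.ne_of_not_mem hc mc.mem_t
  simp only [shp4, nodup_cons, mem_cons, not_mem_nil, or_false, not_or, not_false_eq_true,
    nodup_nil, and_true]
  refine ⟨⟨?_, ?_, ?_⟩, ⟨?_, ?_⟩, ?_⟩ <;> grind

lemma shift {H : Multiset (Box G)} {M : Multiset G} {x z : G} (hxz : x + z ≠ 0) (B : Finset G)
    (hB : B.card ≤ K) (k : ∀ a ∉ B, Sol s E RV Rc β H ({x + a + s + τ} + {z - a + τ} + M)) :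
    Sol s E RV Rc β (replicate 2 (Box.row (1 + 2 + 2 * j)) + H) ({x} + {z} + M) := by
  rintro U P Q hQ h
  have s2 := mc.s2
  have t2 := mc.t2
  have hx : x ∉ E := h.zero x (by rw [← mem_val, hQ]; simp)
  have hz : z ∉ E := h.zero z (by rw [← mem_val, hQ]; simp)
  have hKβ : K ≤ K * (β + 1) := le_mul_of_pos_right _ (by omega)
  obtain ⟨a, ha, hκ, hL, hf⟩ := h.pick mc.hr mc.hβ [(false, true, 0), (false, false, τ - x), (false, true, τ - z - s)]
    (by simp) (s + z - x) [τ - x, z + τ] (by simp) (by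
      intro y hy
      simp only [mem_cons, not_mem_nil, or_false] at hy
      rcases hy with rfl | rfl
      · have := mc.sml 0 (τ - x) fun h' => hx (by have := mc.sub_mem mc.mem_t h'; simpa using this)
        simpa using this
      · have := mc.sml 0 (z + τ) fun h' => hz (by have := mc.sub_mem h' mc.mem_t; simpa using this)
        simpa using this) B (hB.trans hKβ)
  simp only [forall_mem_cons, Fm.val] at hf hL
  simp only [if_true, zero_add, Bool.false_eq_true, if_false] at hf
  obtain ⟨hf1, hf2, hf3, -⟩ := hf
  obtain ⟨hL1, hL2, -⟩ := hL
  have rm : ∀ c ∈ Rc \ P, c ∉ E ∧ c ≠ s - c := fun c hc =>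
    ⟨mc.hr.avoid _ (mem_sdiff.1 hc).1, mc.hr.two _ (mem_sdiff.1 hc).1⟩
  have g1 := rm _ hf1
  have g2 := rm _ hf2
  have g3 := rm _ hf3
  have n1 := mc.ne_of_not_mem hx (mc.add_mem mc.mem_t mc.mem_s)
  have n2 := mc.ne_of_not_mem hz (mc.add_mem mc.mem_t mc.mem_s)
  have z1 := mc.ne_of_not_mem g1.1 mc.zero_mem
  have z2 := mc.ne_of_not_mem g2.1 mc.zero_mem
  have z3 := mc.ne_of_not_mem g3.1 mc.zero_mem
  have z4 := mc.ne_of_not_mem g1.1 mc.mem_s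
  have hKj := mc.hK
  refine h.step_rows (m := 1) (j := j) mc.hr subset_rfl mc.hβ [shp3 τ x a, shp3 τ z (s - a)] (by omega) ?_
    [a, τ - x - a, τ - z - s + a] ?_ ?_ ?_ (M := {x + a + s + τ} + {z - a + τ} + M) ?_ ?_ (k a ha)
  · simp only [forall_mem_cons]
    exact ⟨mc.shp3_ok hx z1 fun h => z2 (by rw [← h]; abel), mc.shp3_ok hz (fun h => z4 (by linear_combination (norm := module) -h))
      fun h => z3 (by rw [← h]; abel), by simp⟩
  · refine prs_nodup (by simpa only [forall_mem_cons] using ⟨g1.2, g2.2, g3.2, by simp⟩) ?_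
    simp only [pairwise_cons, forall_mem_cons]
    exact ⟨⟨⟨fun h => hL1 (by linear_combination (norm := module) h), fun h => n1 (by linear_combination (norm := module) -h - s2)⟩,
        ⟨fun h => n2 (by linear_combination (norm := module) h - s2), fun h => hL2 (by linear_combination (norm := module) h + s2 - t2)⟩, by simp⟩,
      ⟨⟨fun h => hκ (by linear_combination (norm := module) -h), fun h => hxz (by linear_combination (norm := module) -h - s2 + t2)⟩, by simp⟩, by simp⟩
  · simp only [forall_mem_cons]
    exact ⟨hf1, hf2, hf3, by simp⟩
  · simp only [length_cons, length_nil]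
    refine le_trans ?_ hKβ
    omega
  · have e1 : τ - z - (s - a) = τ - z - s + a := by abel
    have e2 : s - (τ - x - a) = x + a + s + τ := by grind
    have e3 : s - (τ - z - s + a) = z - a + τ := by grind
    rw [hQ]
    simp only [List.map_cons, map_nil, List.sum_cons, sum_nil, rcol_shp3 mc.hτ mc.t2, prs,
      cons_append, nil_append, ← cons_coe, ← singleton_add, coe_nil, e1, e2, e3]
    abel
  · have := congrArg Multiset.card hQ
    simp only [card_add, Multiset.card_singleton, card_val, length_cons, length_nil] at this ⊢
    omega
lemma sml_of_not_mem {x : G} (hx : x ∉ E) : Sml x := by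
  simpa using mc.sml 0 x hx

lemma sub_not_mem {x y : G} (hx : x ∉ E) (hy : y ∈ E) : y - x ∉ E := fun h =>
  hx (by have := mc.sub_mem hy h; simpa using this)

lemma reduce {H : Multiset (Box G)} {M : Multiset G} {x y z : G} (hxy : x + y ∉ E) (hxz : x + z ≠ 0)
    (hxyz : x + y + z ∉ E) (k : ∀ a, Sol s E RV Rc β H ({x + y + a} + ({z - a + τ} + M))) :
    Sol s E RV Rc β (replicate 3 (Box.row (1 + 2 + 2 * j)) + H) ({x} + {z} + ({y} + M)) := by
  rintro U P Q hQ h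
  have s2 := mc.s2
  have t2 := mc.t2
  have hx : x ∉ E := h.zero x (by rw [← mem_val, hQ]; simp)
  have hy : y ∉ E := h.zero y (by rw [← mem_val, hQ]; simp)
  have hz : z ∉ E := h.zero z (by rw [← mem_val, hQ]; simp)
  have hKβ : K ≤ K * (β + 1) := le_mul_of_pos_right _ (by omega)
  obtain ⟨a, ha, hκ, hL, hf⟩ := h.pick mc.hr mc.hβ
    [(false, true, 0), (false, false, τ - x), (false, true, τ - z - s), (false, false, s - x - y)]
    (by simp) (s + z - x) [τ - x, z + τ, s - (x + y), τ - y + (-x + -x), τ - (x + y + z) + (z + z)] (by simp) (by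
      simp only [forall_mem_cons]
      refine ⟨mc.sml_of_not_mem (mc.sub_not_mem hx mc.mem_t), mc.sml_of_not_mem ?_,
        mc.sml_of_not_mem (mc.sub_not_mem hxy mc.mem_s), mc.sml _ _ (mc.sub_not_mem hy mc.mem_t),
        mc.sml _ _ (mc.sub_not_mem hxyz mc.mem_t), by simp⟩
      exact fun h' => hz (by have := mc.sub_mem h' mc.mem_t; simpa using this)) ∅ (by simp)
  simp only [forall_mem_cons, Fm.val] at hf hL
  simp only [if_true, zero_add, Bool.false_eq_true, if_false] at hf
  obtain ⟨hf1, hf2, hf3, hf4, -⟩ := hf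
  obtain ⟨hL1, hL2, hL3, hL4, hL5, -⟩ := hL
  have rm : ∀ c ∈ Rc \ P, c ∉ E ∧ c ≠ s - c := fun c hc =>
    ⟨mc.hr.avoid _ (mem_sdiff.1 hc).1, mc.hr.two _ (mem_sdiff.1 hc).1⟩
  have g1 := rm _ hf1
  have g2 := rm _ hf2
  have g3 := rm _ hf3
  have g4 := rm _ hf4
  have mst := mc.add_mem mc.mem_t mc.mem_s
  have n1 := mc.ne_of_not_mem hx mst
  have n2 := mc.ne_of_not_mem hz mst
  have n3 := mc.ne_of_not_mem hy mst
  have n4 := mc.ne_of_not_mem hxyz mst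
  have n5 := mc.ne_of_not_mem hxy mc.zero_mem
  have n6 := mc.ne_of_not_mem hy mc.zero_mem
  have z1 := mc.ne_of_not_mem g1.1 mc.zero_mem
  have z2 := mc.ne_of_not_mem g2.1 mc.zero_mem
  have z3 := mc.ne_of_not_mem g3.1 mc.zero_mem
  have z5 := mc.ne_of_not_mem g4.1 mc.zero_mem
  have z4 := mc.ne_of_not_mem g1.1 mc.mem_s
  have hx1 : x + a + s + τ ∉ E := fun h' => g2.1 (by
    have := mc.sub_mem mc.mem_s h'
    convert this using 1
    linear_combination (norm := module) t2)
  have hKj := mc.hK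
  refine h.step_rows (m := 1) (j := j) mc.hr subset_rfl mc.hβ [shp3 τ x a, shp3 τ (x + a + s + τ) y, shp3 τ z (s - a)] (by omega) ?_
    [a, τ - x - a, τ - z - s + a, s - x - y - a] ?_ ?_ ?_ (M := {x + y + a} + ({z - a + τ} + M)) ?_ ?_ (k a)
  · simp only [forall_mem_cons]
    exact ⟨mc.shp3_ok hx z1 fun h => z2 (by rw [← h]; abel),
      mc.shp3_ok hx1 n6 fun h => z5 (by linear_combination (norm := module) -h + s2),
      mc.shp3_ok hz (fun h => z4 (by linear_combination (norm := module) -h))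
      fun h => z3 (by rw [← h]; abel), by simp⟩
  · refine prs_nodup (by simpa only [forall_mem_cons] using ⟨g1.2, g2.2, g3.2, g4.2, by simp⟩) ?_
    simp only [pairwise_cons, forall_mem_cons]
    exact ⟨⟨⟨fun h => hL1 (by linear_combination (norm := module) h), fun h => n1 (by linear_combination (norm := module) -h - s2)⟩,
        ⟨fun h => n2 (by linear_combination (norm := module) h - s2), fun h => hL2 (by linear_combination (norm := module) h + s2 - t2)⟩,
        ⟨fun h => hL3 (by linear_combination (norm := module) h), fun h => n5 (by linear_combination (norm := module) -h)⟩, by simp⟩,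
      ⟨⟨fun h => hκ (by linear_combination (norm := module) -h), fun h => hxz (by linear_combination (norm := module) -h - s2 + t2)⟩,
       ⟨fun h => n3 (by linear_combination (norm := module) h - t2), fun h => hL4 (by linear_combination (norm := module) -h)⟩, by simp⟩,
      ⟨⟨fun h => hL5 (by linear_combination (norm := module) h + s2 - t2), fun h => n4 (by linear_combination (norm := module) -h - s2)⟩, by simp⟩, by simp⟩
  · simp only [forall_mem_cons]
    exact ⟨hf1, hf2, hf3, hf4, by simp⟩
  · simp only [length_cons, length_nil]
    refine le_trans ?_ hKβ
    omega
  · have e1 : τ - z - (s - a) = τ - z - s + a := by abel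
    have e2 : s - (τ - x - a) = x + a + s + τ := by linear_combination (norm := module) -t2
    have e3 : s - (τ - z - s + a) = z - a + τ := by linear_combination (norm := module) s2 - t2
    have e4 : s - (s - x - y - a) = x + y + a := by abel
    have e5 : τ - (x + a + s + τ) - y = s - x - y - a := by linear_combination (norm := module) -s2
    rw [hQ]
    simp only [List.map_cons, map_nil, List.sum_cons, sum_nil, rcol_shp3 mc.hτ mc.t2, prs,
      cons_append, nil_append, ← cons_coe, ← singleton_add, coe_nil, e1, e2, e3, e4, e5]
    abel
  · have := congrArg Multiset.card hQ
    simp only [card_add, Multiset.card_singleton, card_val, length_cons, length_nil] at this ⊢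
    omega

lemma shift_even {H : Multiset (Box G)} {M : Multiset G} {x y : G} (hxy : x + y ≠ τ + s) (B : Finset G)
    (hB : B.card + 2 ≤ K) (k : ∀ a ∉ B, Sol s E RV Rc β H ({s - a} + ({x + y + a + s + τ} + M))) :
    Sol s E RV Rc β ({Box.row (2 + 2 + 2 * j)} + H) ({x} + {y} + M) := by
  rintro U P Q hQ h
  have s2 := mc.s2
  have t2 := mc.t2
  have hx : x ∉ E := h.zero x (by rw [← mem_val, hQ]; simp)
  have hy : y ∉ E := h.zero y (by rw [← mem_val, hQ]; simp)
  have hKβ : K ≤ K * (β + 1) := le_mul_of_pos_right _ (by omega)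
  obtain ⟨a, ha, hκ, -, hf⟩ := h.pick mc.hr mc.hβ
    [(false, true, 0), (false, false, τ - x - y)] (by simp) (τ - x - y) [] (by simp) (by simp) ({τ - x, τ - y} ∪ B)
    ((card_union_le _ _).trans ((Nat.add_le_add_right card_le_two _).trans (by omega)))
  simp only [forall_mem_cons, Fm.val] at hf
  simp only [if_true, zero_add, Bool.false_eq_true, if_false] at hf
  obtain ⟨hf1, hf2, -⟩ := hf
  simp only [mem_union, mem_insert, mem_singleton, not_or] at ha
  obtain ⟨⟨ha1, ha2⟩, ha⟩ := ha
  have rm : ∀ c ∈ Rc \ P, c ∉ E ∧ c ≠ s - c := fun c hc =>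
    ⟨mc.hr.avoid _ (mem_sdiff.1 hc).1, mc.hr.two _ (mem_sdiff.1 hc).1⟩
  have g1 := rm _ hf1
  have g2 := rm _ hf2
  have n1 := mc.ne_of_not_mem hx mc.zero_mem
  have n2 := mc.ne_of_not_mem hy mc.zero_mem
  have z2 := mc.ne_of_not_mem g2.1 mc.zero_mem
  have hKj := mc.hK
  refine h.step_rows (m := 2) (j := j) mc.hr subset_rfl mc.hβ [shp4 τ a x (τ - x - y - a)] (by omega) ?_
    [a, τ - x - y - a] ?_ ?_ ?_ (M := {s - a} + ({x + y + a + s + τ} + M)) ?_ ?_ (k a ha)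
  · simp only [forall_mem_cons]
    exact ⟨mc.shp4_ok g1.1 n1 z2 (fun h => n2 (by linear_combination (norm := module) -h))
      (fun h => ha1 (by linear_combination (norm := module) h)) (fun h => ha2 (by linear_combination (norm := module) -h)), by simp⟩
  · refine prs_nodup (by simpa only [forall_mem_cons] using ⟨g1.2, g2.2, by simp⟩) ?_
    simp only [pairwise_cons, forall_mem_cons]
    exact ⟨⟨⟨fun h => hκ (by linear_combination (norm := module) h), fun h => hxy (by linear_combination (norm := module) -h - s2)⟩, by simp⟩,
      by simp⟩
  · simp only [forall_mem_cons]
    exact ⟨hf1, hf2, by simp⟩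
  · simp only [length_cons, length_nil]
    refine le_trans ?_ hKβ
    omega
  · have e1 : τ - a - x - (τ - x - y - a) = y := by abel
    have e2 : s - (τ - x - y - a) = x + y + a + s + τ := by linear_combination (norm := module) -t2
    rw [hQ]
    simp only [List.map_cons, map_nil, List.sum_cons, sum_nil, rcol_shp4 mc.hτ mc.t2, prs,
      cons_append, nil_append, ← cons_coe, ← singleton_add, coe_nil, e1, e2]
    abel
  · have := congrArg Multiset.card hQ
    simp only [card_add, Multiset.card_singleton, card_val, length_cons, length_nil] at this ⊢
    omega

lemma merge {H : Multiset (Box G)} {M : Multiset G} {x w y z : G} (hxw : x + w ∉ E) (hyz : y + z ≠ τ + s)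
    (hxwyz : x + w + y + z ∉ E)
    (k : ∀ M' : Multiset G, M'.card = M.card + 2 → Sol s E RV Rc β H M') :
    Sol s E RV Rc β (replicate 2 (Box.row (2 + 2 + 2 * j)) + H) ({x} + ({y} + {z} + ({w} + M))) := by
  rintro U P Q hQ h
  have s2 := mc.s2
  have t2 := mc.t2
  have hx : x ∉ E := h.zero x (by rw [← mem_val, hQ]; simp)
  have hy : y ∉ E := h.zero y (by rw [← mem_val, hQ]; simp)
  have hw : w ∉ E := h.zero w (by rw [← mem_val, hQ]; simp)
  have hz : z ∉ E := h.zero z (by rw [← mem_val, hQ]; simp)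
  have hKβ : K ≤ K * (β + 1) := le_mul_of_pos_right _ (by omega)
  have hKj := mc.hK
  obtain ⟨a, ha, hκ, hL, hf⟩ := h.pick mc.hr mc.hβ
    [(false, true, 0), (false, false, τ - x - w), (false, true, τ - s - y - z)] (by simp) (τ + y + z)
    [τ - (x + w), s - (x + w + y + z) + ((y + z) + (y + z))] (by simp) (by
      simp only [forall_mem_cons]
      exact ⟨mc.sml_of_not_mem (mc.sub_not_mem hxw mc.mem_t), mc.sml _ _ (mc.sub_not_mem hxwyz mc.mem_s), by simp⟩)
      {τ - x, τ - w, s + y + τ, z + τ + s}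
    (card_le_four.trans (by omega))
  simp only [forall_mem_cons, Fm.val] at hf hL
  simp only [if_true, zero_add, Bool.false_eq_true, if_false] at hf
  obtain ⟨hf1, hf2, hf3, -⟩ := hf
  obtain ⟨hL1, hL2, -⟩ := hL
  simp only [mem_insert, mem_singleton, not_or] at ha
  obtain ⟨ha1, ha2, ha3, ha4⟩ := ha
  have e0 : τ - s - y - z + a = τ - s + a - y - z := by abel
  rw [e0] at hf3
  have rm : ∀ c ∈ Rc \ P, c ∉ E ∧ c ≠ s - c := fun c hc =>
    ⟨mc.hr.avoid _ (mem_sdiff.1 hc).1, mc.hr.two _ (mem_sdiff.1 hc).1⟩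
  have g1 := rm _ hf1
  have g2 := rm _ hf2
  have g3 := rm _ hf3
  have n1 := mc.ne_of_not_mem hx mc.zero_mem
  have n2 := mc.ne_of_not_mem hy mc.zero_mem
  have n3 := mc.ne_of_not_mem hw mc.zero_mem
  have n4 := mc.ne_of_not_mem hz mc.zero_mem
  have n5 := mc.ne_of_not_mem hxw (mc.add_mem mc.mem_t mc.mem_s)
  have n6 := mc.ne_of_not_mem hxwyz mc.zero_mem
  have z2 := mc.ne_of_not_mem g2.1 mc.zero_mem
  have z3 := mc.ne_of_not_mem g3.1 mc.zero_mem
  have gs : s - a ∉ E := mc.sub_not_mem g1.1 mc.mem_s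
  refine h.step_rows (m := 2) (j := j) mc.hr subset_rfl mc.hβ
    [shp4 τ a x (τ - x - w - a), shp4 τ (s - a) y (τ - s + a - y - z)] (by omega) ?_
    [a, τ - x - w - a, τ - s + a - y - z] ?_ ?_ ?_
    (M := {s - (τ - x - w - a)} + ({s - (τ - s + a - y - z)} + M)) ?_ ?_ (k _ (by simp))
  · simp only [forall_mem_cons]
    exact ⟨mc.shp4_ok g1.1 n1 z2 (fun h => n3 (by linear_combination (norm := module) -h))
      (fun h => ha1 (by linear_combination (norm := module) h)) (fun h => ha2 (by linear_combination (norm := module) -h)),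
      mc.shp4_ok gs n2 z3 (fun h => n4 (by linear_combination (norm := module) -h))
      (fun h => ha3 (by linear_combination (norm := module) -h - t2)) (fun h => ha4 (by linear_combination (norm := module) h - t2)), by simp⟩
  · refine prs_nodup (by simpa only [forall_mem_cons] using ⟨g1.2, g2.2, g3.2, by simp⟩) ?_
    simp only [pairwise_cons, forall_mem_cons]
    exact ⟨⟨⟨fun h => hL1 (by linear_combination (norm := module) h), fun h => n5 (by linear_combination (norm := module) -h - s2)⟩,
        ⟨fun h => hyz (by linear_combination (norm := module) h - s2), fun h => hκ (by linear_combination (norm := module) h + s2 - t2)⟩, by simp⟩,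
      ⟨⟨fun h => hL2 (by linear_combination (norm := module) -h), fun h => n6 (by linear_combination (norm := module) -h - s2 + t2)⟩, by simp⟩,
      by simp⟩
  · simp only [forall_mem_cons]
    exact ⟨hf1, hf2, hf3, by simp⟩
  · simp only [length_cons, length_nil]
    refine le_trans ?_ hKβ
    omega
  · have e1 : τ - a - x - (τ - x - w - a) = w := by abel
    have e2 : τ - (s - a) - y - (τ - s + a - y - z) = z := by abel
    rw [hQ]
    simp only [List.map_cons, map_nil, List.sum_cons, sum_nil, rcol_shp4 mc.hτ mc.t2, prs,
      cons_append, nil_append, ← cons_coe, ← singleton_add, coe_nil, e1, e2]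
    abel
  · have := congrArg Multiset.card hQ
    simp only [card_add, Multiset.card_singleton, card_val, length_cons, length_nil] at this ⊢
    omega
lemma last_odd {x y z : G} :
    Sol s E RV Rc β {Box.row (1 + 2 + 2 * j)} ({x} + {y} + {z}) := by
  rintro U P Q hQ h
  have s2 := mc.s2
  have t2 := mc.t2
  have hKj := mc.hK
  have hx : x ∉ E := h.zero x (by rw [← mem_val, hQ]; simp)
  have hy := mc.ne_of_not_mem (h.zero y (by rw [← mem_val, hQ]; simp)) mc.zero_mem
  have hz := mc.ne_of_not_mem (h.zero z (by rw [← mem_val, hQ]; simp)) mc.zero_mem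
  have hKβ : K ≤ K * (β + 1) := le_mul_of_pos_right _ (by omega)
  obtain ⟨r, h1, h2⟩ := h.bal
  rw [← card_val, hQ] at h1
  rw [hQ] at h2
  simp [Bal, bal] at h1 h2
  obtain rfl : r = j := by omega
  have h3 : τ - x - y = z := by
    rw [natCast_zsmul, ← mc.hτ] at h2
    linear_combination (norm := module) h2 + t2
  subst h3
  have := h.step_rows (m := 1) (j := j) (H := 0) mc.hr subset_rfl mc.hβ [shp3 τ x y] (by omega)
    (by simpa only [forall_mem_cons] using ⟨mc.shp3_ok hx hy fun h => hz (by rw [← h]; abel), by simp⟩)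
    [] (by simp [prs]) (by simp) (by simp only [length_cons, length_nil]; exact le_trans (by omega) hKβ)
    (M := 0) (by
      rw [hQ]
      simp only [List.map_cons, map_nil, List.sum_cons, sum_nil, rcol_shp3 mc.hτ mc.t2, prs,
        nil_append, coe_nil, add_zero])
    (by simp) (by
      rintro U P Q hQ h
      exact ⟨∅, ∅, by simp, by simp, by simp, by simpa [hQ] using Fil.nil⟩)
  simpa using this

lemma last_even_aux {x y z w : G} (h1 : x + y ≠ τ) (h2 : y + z ≠ 0) :
    Sol s E RV Rc β {Box.row (2 + 2 + 2 * j)} ({x} + {y} + {z} + {w}) := by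
  rintro U P Q hQ h
  have s2 := mc.s2
  have t2 := mc.t2
  have hKj := mc.hK
  have hx : x ∉ E := h.zero x (by rw [← mem_val, hQ]; simp)
  have hy := mc.ne_of_not_mem (h.zero y (by rw [← mem_val, hQ]; simp)) mc.zero_mem
  have hz := mc.ne_of_not_mem (h.zero z (by rw [← mem_val, hQ]; simp)) mc.zero_mem
  have hw := mc.ne_of_not_mem (h.zero w (by rw [← mem_val, hQ]; simp)) mc.zero_mem
  have hKβ : K ≤ K * (β + 1) := le_mul_of_pos_right _ (by omega)
  obtain ⟨r, h3, h4⟩ := h.bal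
  rw [← card_val, hQ] at h3
  rw [hQ] at h4
  simp [Bal, bal] at h3 h4
  obtain rfl : r = j := by omega
  have h5 : τ - x - y - z = w := by
    rw [natCast_zsmul, ← mc.hτ] at h4
    linear_combination (norm := module) h4 + t2
  subst h5
  have := h.step_rows (m := 2) (j := j) (H := 0) mc.hr subset_rfl mc.hβ [shp4 τ x y z] (by omega)
    (by simpa only [forall_mem_cons] using ⟨mc.shp4_ok hx hy hz (fun h => hw (by rw [← h]; abel)) h1 h2, by simp⟩)
    [] (by simp [prs]) (by simp) (by simp only [length_cons, length_nil]; exact le_trans (by omega) hKβ)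
    (M := 0) (by
      rw [hQ]
      simp only [List.map_cons, map_nil, List.sum_cons, sum_nil, rcol_shp4 mc.hτ mc.t2, prs,
        nil_append, coe_nil, add_zero])
    (by simp) (by
      rintro U P Q hQ h
      exact ⟨∅, ∅, by simp, by simp, by simp, by simpa [hQ] using Fil.nil⟩)
  simpa using this

lemma last_even {M : Multiset G} (hM : M.card = 4) : Sol s E RV Rc β {Box.row (2 + 2 + 2 * j)} M := by
  rintro U P Q hQ h
  have hn : M.Nodup := hQ ▸ Q.nodup
  obtain ⟨y, hy⟩ := card_pos_iff_exists_mem.1 (by omega : 0 < M.card)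
  obtain ⟨M, rfl⟩ := exists_cons_of_mem hy
  obtain ⟨a, b, c, rfl⟩ := Multiset.card_eq_three.1 (by simpa using hM : M.card = 3)
  simp only [Multiset.nodup_cons, Multiset.mem_cons, insert_eq_cons, Multiset.mem_singleton,
    not_or, Multiset.nodup_singleton, and_true] at hn
  obtain ⟨-, ⟨hab, hac⟩, hbc⟩ := hn
  have key : ∀ x z w : G, x + y ≠ τ → y + z ≠ 0 →
      y ::ₘ ({a, b, c} : Multiset G) = {x} + {y} + {z} + {w} → Win s RV Rc {Box.row (2 + 2 + 2 * j)} U P Q := by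
    intro x z w h1 h2 e
    exact mc.last_even_aux h1 h2 U P Q (hQ.trans e) h
  have hc : ∀ x z w : G, z ≠ w → x + y ≠ τ → y ::ₘ ({a, b, c} : Multiset G) = {x} + {y} + {z} + {w} →
      Win s RV Rc {Box.row (2 + 2 + 2 * j)} U P Q := by
    intro x z w hzw h1 e
    by_cases h2 : y + z = 0
    · exact key x w z h1 (fun h3 => hzw (add_left_cancel (h2.trans h3.symm))) (by rw [e]; abel)
    · exact key x z w h1 h2 e
  by_cases h1 : a + y = τ
  · refine hc b a c hac (fun h2 => hab (add_right_cancel (h1.trans h2.symm))) ?_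
    simp only [insert_eq_cons, ← singleton_add]; abel
  · refine hc a b c hbc h1 ?_
    simp only [insert_eq_cons, ← singleton_add]; abel

lemma odd {ρ : ℕ} {M : Multiset G} (h3 : 3 ≤ M.card) (hρ : 5 * M.card < ρ + 15) :
    Sol s E RV Rc β (replicate ρ (Box.row (1 + 2 + 2 * j))) M := by
  induction ρ using Nat.strong_induction_on generalizing M with
  | _ ρ ih =>
    rintro U P Q hQ h
    have hM : M.Nodup := hQ ▸ Q.nodup
    have hKj := mc.hK
    have hME : ∀ x ∈ M, x ∉ E := fun x hx => h.zero x (by rwa [← mem_val, hQ])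
    obtain ⟨x, z, M, rfl, hxz⟩ := exists_pair_sum_ne hM h3 0
    simp only [card_add, Multiset.card_singleton] at h3 hρ
    by_cases h1 : M.card = 1
    · obtain ⟨y, rfl⟩ := Multiset.card_eq_one.1 h1
      by_cases hρ1 : ρ = 1
      · subst hρ1
        exact mc.last_odd U P Q hQ (by simpa using h)
      have hb : ρ ≠ 2 := by
        rintro rfl
        obtain ⟨r, hb, -⟩ := h.bal
        rw [← card_val, hQ] at hb
        simp [Bal, bal, replicate_succ] at hb
        omega
      obtain ⟨ρ, rfl⟩ : ∃ ρ', ρ = 2 + ρ' := ⟨ρ - 2, by omega⟩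
      rw [replicate_add] at h ⊢
      exact mc.shift hxz ∅ (by simp) (fun a _ => ih ρ (by omega) (by simp) (by simp; omega)) U P Q hQ h
    · obtain ⟨y, hy⟩ := card_pos_iff_exists_mem.1 (by omega : 0 < M.card)
      obtain ⟨M, rfl⟩ := exists_cons_of_mem hy
      simp only [card_cons] at h1 hρ
      obtain ⟨w, hw⟩ := card_pos_iff_exists_mem.1 (by omega : 0 < M.card)
      obtain ⟨M, rfl⟩ := exists_cons_of_mem hw
      simp only [card_cons] at h1 hρ
      obtain ⟨ρ, rfl⟩ : ∃ ρ', ρ = 2 + (3 + ρ') := ⟨ρ - 5, by omega⟩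
      rw [replicate_add] at h ⊢
      refine mc.shift hxz (E.image (fun e => e - (x + s + τ + y)) ∪ E.image (fun e => e - (x + s + τ + y + w)) ∪ {0 - (x + s + τ + w)}) ?_ (fun a ha => ?_) U P Q hQ h
      · refine (card_union_le _ _).trans ((Nat.add_le_add_right (card_union_le _ _) _).trans ?_)
        have := card_image_le (s := E) (f := fun e => e - (x + s + τ + y))
        have := card_image_le (s := E) (f := fun e => e - (x + s + τ + y + w))
        rw [card_singleton]
        omega
      · simp only [mem_union, mem_image, mem_singleton, not_or, not_exists, not_and] at ha
        obtain ⟨⟨ha1, ha2⟩, ha3⟩ := ha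
        rw [replicate_add]
        have e : ({x + a + s + τ} + {z - a + τ} + (y ::ₘ w ::ₘ M) : Multiset G) =
            {x + a + s + τ} + {w} + ({y} + ({z - a + τ} + M)) := by
          simp only [← singleton_add]; abel
        rw [e]
        refine mc.reduce (fun h => ha1 _ h (by abel)) (fun h => ha3 ?_) (fun h => ha2 _ h (by abel))
          fun b => ih ρ (by omega) (by simp) (by simp; omega)
        linear_combination (norm := module) h

lemma even {ρ : ℕ} {M : Multiset G} (h4 : 4 ≤ M.card) (hρ : 3 * M.card ≤ ρ + 11) :
    Sol s E RV Rc β (replicate ρ (Box.row (2 + 2 + 2 * j))) M := by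
  induction ρ using Nat.strong_induction_on generalizing M with
  | _ ρ ih =>
    rintro U P Q hQ h
    have hM : M.Nodup := hQ ▸ Q.nodup
    have hKj := mc.hK
    obtain ⟨x, u, M', rfl, hxu⟩ := exists_pair_sum_ne hM (by omega) (τ + s)
    simp only [card_add, Multiset.card_singleton] at h4 hρ
    have hb : Even M'.card := by
      obtain ⟨r, hb, -⟩ := h.bal
      rw [← card_val, hQ] at hb
      have e : ((Bal (replicate ρ (Box.row (2 + 2 + 2 * j)) : Multiset (Box G))).2.1 : ℤ) = ρ * (4 + 2 * j) := by
        have : ∀ ρ : ℕ, (Bal (replicate ρ (Box.row (2 + 2 + 2 * j)) : Multiset (Box G))).2.1 = ρ * (4 + 2 * j) := by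
          intro ρ
          induction ρ with
          | zero => simp [Bal]
          | succ ρ ih =>
            rw [replicate_succ, Bal_cons, snd_add, fst_add, ih]
            simp only [bal]; ring
        rw [this]; push_cast; ring
      rw [e] at hb
      simp only [card_add, Multiset.card_singleton] at hb
      push_cast at hb
      rw [← Int.even_coe_nat]
      exact ⟨ρ * (2 + j) - 1 - r, by linear_combination -hb⟩
    by_cases h2 : M'.card = 2
    · by_cases hρ1 : ρ = 1
      · subst hρ1
        exact mc.last_even (by simp; omega) U P Q hQ (by simpa using h)
      obtain ⟨ρ, rfl⟩ : ∃ ρ', ρ = 1 + ρ' := ⟨ρ - 1, by omega⟩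
      rw [replicate_add, replicate_one] at h ⊢
      exact mc.shift_even hxu ∅ (by simp; omega) (fun a _ => ih ρ (by omega) (by simp; omega) (by simp; omega)) U P Q hQ h
    · have h4' : 4 ≤ M'.card := by
        obtain ⟨t, ht⟩ := hb
        omega
      have hM' : M'.Nodup := (nodup_add.1 hM).2.1
      obtain ⟨y, z, M, rfl, hyz⟩ := exists_pair_sum_ne hM' (by omega) (τ + s)
      simp only [card_add, Multiset.card_singleton] at h4' hρ
      obtain ⟨w, hw⟩ := card_pos_iff_exists_mem.1 (by omega : 0 < M.card)
      obtain ⟨M, rfl⟩ := exists_cons_of_mem hw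
      simp only [card_cons] at h4' hρ
      obtain ⟨ρ, rfl⟩ : ∃ ρ', ρ = 1 + (2 + ρ') := ⟨ρ - 3, by omega⟩
      rw [replicate_add, replicate_one] at h ⊢
      refine mc.shift_even hxu (E.image (fun e => s + w - e) ∪ E.image (fun e => s + w + y + z - e)) ?_ (fun a ha => ?_) U P Q hQ h
      · have := card_image_le (s := E) (f := fun e => s + w - e)
        have := card_image_le (s := E) (f := fun e => s + w + y + z - e)
        have := card_union_le (E.image (fun e => s + w - e)) (E.image (fun e => s + w + y + z - e))
        omega
      · simp only [mem_union, mem_image, not_or, not_exists, not_and] at ha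
        rw [replicate_add]
        have e : ({s - a} + ({x + u + a + s + τ} + ({y} + {z} + w ::ₘ M)) : Multiset G) =
            {s - a} + ({y} + {z} + ({w} + ({x + u + a + s + τ} + M))) := by
          simp only [← singleton_add]; abel
        rw [e]
        exact mc.merge (fun h => ha.1 _ h (by abel)) hyz (fun h => ha.2 _ h (by abel))
          fun M' hM' => ih ρ (by omega) (by simp at hM'; omega) (by simp at hM'; omega)
lemma opened {k : ℕ} (hk : 3 ≤ k) {H : Multiset (Box G)} {M : Multiset G}
    (c : ∀ M' : Multiset G, M.card + (k - 2) ≤ M'.card → M'.card ≤ M.card + k → Sol s E RV Rc β H M') :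
    Sol s E RV Rc β ({Box.row k} + H) M := by
  rintro U P Q rfl h
  obtain ⟨k, rfl⟩ : ∃ k', k = k' + 3 := ⟨k - 3, by omega⟩
  obtain ⟨v, -, -, -, hf⟩ := h.pick mc.hr mc.hβ [(true, true, 0)] (by simp) 0 [] (by simp) (by simp) ∅ (by simp)
  simp only [forall_mem_cons, Fm.val] at hf
  simp only [if_true, zero_add] at hf
  refine h.step mc.hr subset_rfl [v] [] (by simp) (by simpa using hf.1) (by simp [prs]) (by simp)
    ((Ref.row v (k + 2)).add_right H) (M := Q.val) (by simp [prs]) (by simp) ?_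
  exact Sol.gap mc.hr subset_rfl mc.zero_mem mc.hβ (by have := mc.hK; omega) (Or.inr (by omega))
    fun M' h1 h2 => c M' (by omega) (by omega)

lemma fill {k : ℕ} (hk : 3 ≤ k) (n : ℕ) {H : Multiset (Box G)} {M : Multiset G}
    (c : ∀ M' : Multiset G, M.card + n * (k - 2) ≤ M'.card → M'.card ≤ M.card + n * k → Sol s E RV Rc β H M') :
    Sol s E RV Rc β (replicate n (Box.row k) + H) M := by
  induction n generalizing M with
  | zero => simpa using c M (by simp) (by simp)
  | succ n ih =>
    rw [replicate_succ, cons_add, ← singleton_add]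
    refine mc.opened hk fun M' h1 h2 => ih fun M'' h3 h4 => c M'' ?_ ?_ <;> rw [Nat.succ_mul] <;> omega

lemma leftover {k : ℕ} (hk : 3 ≤ k) (Y : Multiset G) {H : Multiset (Box G)} {M : Multiset G}
    (c : ∀ M' : Multiset G, M.card ≤ M'.card → M'.card ≤ M.card + Y.card * k → Sol s E RV Rc β H M') :
    Sol s E RV Rc β (Y.map (fun y => Box.gap y y (k - 1)) + H) M := by
  induction Y using Multiset.induction generalizing M with
  | empty => simpa using c M (by simp) (by simp)
  | cons y Y ih =>
    obtain ⟨k, rfl⟩ : ∃ k', k = k' + 3 := ⟨k - 3, by omega⟩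
    rw [map_cons, cons_add, ← singleton_add]
    refine Sol.gap (m := k + 1) mc.hr subset_rfl mc.zero_mem mc.hβ (by have := mc.hK; omega) (Or.inr (by omega))
      fun M' h1 h2 => ih fun M'' h3 h4 => c M'' (by omega) ?_
    rw [card_cons, Nat.succ_mul]
    omega

lemma rows {k ρ : ℕ} (hk : k = 3 + 2 * j ∨ k = 4 + 2 * j) {M : Multiset G} (h4 : 4 ≤ M.card)
    (hρ : 5 * M.card ≤ ρ + 11) : Sol s E RV Rc β (replicate ρ (Box.row k)) M := by
  rcases hk with rfl | rfl
  · exact mc.odd (by omega) (by omega)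
  · exact mc.even (by omega) (by omega)

lemma solve {k ρ : ℕ} (hk : k = 3 + 2 * j ∨ k = 4 + 2 * j) (Y : Multiset G) {M : Multiset G}
    (hρ : 5 * (M.card + (Y.card + 4) * k) ≤ ρ) :
    Sol s E RV Rc β (Y.map (fun y => Box.gap y y (k - 1)) + replicate ρ (Box.row k)) M := by
  obtain ⟨ρ, rfl⟩ : ∃ ρ', ρ = 4 + ρ' := ⟨ρ - 4, by
    have : 4 * 3 ≤ (Y.card + 4) * k := Nat.mul_le_mul (by omega) (by omega)
    omega⟩
  rw [replicate_add]
  refine mc.leftover (by omega) Y fun M' h1 h2 => mc.fill (by omega) 4 fun M'' h3 h4 => mc.rows hk (by omega) ?_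
  have : (Y.card + 4) * k = Y.card * k + 4 * k := by ring
  omega
end Mach
end SolveSmall

section Glue

/-- The reservoirs together with absorbers for them. -/
structure Kit (s : G) (E : Finset G) (δ : ℝ) (RV Rc R : Finset G) (g g' : Gd G) (AV AC : Finset G) (p : ℕ) : Prop where
  res : Res s E δ RV Rc
  half : Rc.val = R.val + R.val.map fun c => s - c
  absV : ∀ U ⊆ RV, U.card = 2 * p → Abs g (RV \ U).val 0
  absC : ∀ U ⊆ R, U.card = p → Abs g' 0 ((R \ U).val + (R \ U).val.map fun c => s - c)
  leV : 2 * p ≤ RV.card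
  leC : p ≤ R.card
  coverV : AV.val + (g + g').oV + RV.val = (univ.erase (0 : G)).val
  coverC : AC.val + (g + g').oC + Rc.val = (univ.erase (0 : G)).val

variable {s : G} {E E' : Finset G} {δ : ℝ} {RV Rc R : Finset G} {g g' : Gd G} {AV AC : Finset G} {p : ℕ}

lemma Kit.bal_wins (h : Kit s E δ RV Rc R g g' AV AC p) :
    Bal (wins (g + g').ws) + (2 * p, 2 * p, (p : ℕ) • s) = pay ((g + g').oV + RV.val) ((g + g').oC + Rc.val) := by
  obtain ⟨U, hU, hUc⟩ := exists_subset_card_eq h.leV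
  obtain ⟨U', hU', hUc'⟩ := exists_subset_card_eq h.leC
  have h1 := ((h.absV U hU hUc).add (h.absC U' hU' hUc')).pay
  have e1 : RV.val = (RV \ U).val + U.val := by
    rw [sdiff_val, Multiset.sub_add_cancel (val_le_iff.2 hU)]
  have e2 : R.val = (R \ U').val + U'.val := by
    rw [sdiff_val, Multiset.sub_add_cancel (val_le_iff.2 hU')]
  have e3 : (U'.val.map fun c => s - c).sum = p • s - U'.val.sum := by
    rw [Multiset.sum_map_sub, Multiset.map_const', sum_replicate, card_val, hUc', map_id']
  rw [h1, h.half, e1, e2]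
  simp only [pay, card_add, sum_add, Multiset.card_map, Multiset.map_add, e3, card_val, hUc, hUc',
    card_zero, sum_zero]
  refine Prod.ext ?_ (Prod.ext ?_ ?_)
  · simp only [fst_add]; omega
  · simp only [fst_add, snd_add]; omega
  · simp only [snd_add]; abel

lemma Kit.finish (h : Kit s E' δ RV Rc R g g' AV AC p) (hE : E ⊆ E') {k l : ℕ} (hk : 2 ≤ k)
    (hsum : ∑ x : G, x = 0) (hl : l * k + 1 = card G) {rest : Multiset (Box G)} {C1 : Multiset G} {Q : Finset G}
    (ref : Ref (replicate l (Box.row k)) (wins (g + g').ws + rest) AV.val C1)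
    (hC : C1 + Q.val = AC.val) (hQ : ∀ c ∈ Q, c ∉ E) {β : ℕ} (hβ : 4 * p + Q.card ≤ β)
    (sol : Sol s E RV Rc β rest Q.val) :
    HasOrth G l k := by
  have hb := h.bal_wins
  have e0 : Bal (replicate l (Box.row k : Box G)) = (l * k, l * k, 0) := by
    simp [Bal, bal]
  have hrc : (univ.erase (0 : G)).card = l * k := by rw [card_erase_of_mem (mem_univ _), card_univ]; omega
  have hrs : (univ.erase (0 : G)).val.sum = 0 := by
    have : (univ.erase (0 : G)).val.sum = ∑ x ∈ univ.erase (0 : G), x := by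
      rw [Finset.sum, map_id']
    rw [this, sum_erase (univ : Finset G) (f := fun x => x) rfl, hsum]
  have c1 := congrArg Multiset.card h.coverV
  have c2 := congrArg Multiset.card h.coverC
  have c3 := congrArg Multiset.sum h.coverC
  have c4 := congrArg Multiset.card hC
  have c5 := congrArg Multiset.sum hC
  have he := ref.eq
  rw [e0, Bal_add] at he
  simp only [card_add, sum_add, card_val, hrc, hrs] at c1 c2 c3 c4 c5
  have hbal : Bal rest = (2 * p, Q.card + 2 * p, Q.val.sum + p • s) := by
    generalize Bal (wins (g + g').ws) = w at hb he
    generalize Bal rest = r at he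
    obtain ⟨w1, w2, w3⟩ := w
    obtain ⟨r1, r2, r3⟩ := r
    simp only [pay, Prod.mk_add_mk, Prod.mk.injEq, card_add, sum_add, card_val] at he hb
    obtain ⟨b1, b2, b3⟩ := hb
    obtain ⟨a1, a2, a3⟩ := he
    refine Prod.ext (by simp only; omega) (Prod.ext (by simp only; omega) ?_)
    simp only
    linear_combination (norm := module) -a3 - c5 - c3 - b3
  have ndC : (AC.val + (g + g').oC + Rc.val).Nodup := by rw [h.coverC]; exact nodup _
  have ctx : Ctx s E RV Rc β rest ∅ ∅ Q := by
    refine ⟨empty_subset _, empty_subset _, by simp, ?_, hQ, ?_, ?_, ?_, ⟨p, ?_, ?_⟩⟩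
    · rw [sdiff_empty, disjoint_left]
      intro c hc hc'
      refine Multiset.disjoint_left.1 (nodup_add.1 ndC).2.2 (mem_add.2 (Or.inl ?_)) hc'
      rw [← hC]
      exact mem_add.2 (Or.inr hc)
    · rw [hbal, card_empty]; simp only; omega
    · rw [hbal, card_empty]; simp only; omega
    · rw [hbal]; simp only; omega
    · rw [hbal]; push_cast; ring
    · rw [hbal, natCast_zsmul]
  obtain ⟨V, N, hV, hN, hNc, hfil⟩ := sol ∅ ∅ Q rfl ctx
  rw [sdiff_empty] at hV hN
  set U := R.filter (· ∈ N) with hU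
  have hNU : N.val = U.val + U.val.map fun c => s - c := by
    have e1 : N.val = Rc.val.filter (· ∈ N) := by
      have : N = Rc.filter (· ∈ N) := by
        ext c; simp only [mem_filter]; exact ⟨fun hc => ⟨hN hc, hc⟩, fun hc => hc.2⟩
      conv_lhs => rw [this]
      rfl
    have e2 : ∀ c, s - c ∈ N ↔ c ∈ N := fun c => ⟨fun hc => by simpa using hNc _ hc, hNc c⟩
    rw [e1, h.half, Multiset.filter_add, Multiset.filter_map, hU, filter_val]
    simp only [comp_def, e2]
  have hpay := hfil.pay
  rw [hbal] at hpay
  simp only [pay, Prod.mk.injEq, card_add, card_val] at hpay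
  obtain ⟨p1, p2, -⟩ := hpay
  have hNc2 := congrArg Multiset.card hNU
  simp only [card_add, Multiset.card_map, card_val] at hNc2
  have hab := (h.absV V hV p1.symm).add (h.absC U (filter_subset _ _) (by omega))
  have hall := ref.fil _ _ (Fil.add hab hfil)
  have e1 : RV.val = (RV \ V).val + V.val := by
    rw [sdiff_val, Multiset.sub_add_cancel (val_le_iff.2 hV)]
  have e2 : R.val = (R \ U).val + U.val := by
    rw [sdiff_val, Multiset.sub_add_cancel (val_le_iff.2 (filter_subset _ _))]
  refine exists_perm_of_fil hk (k := k) (l := l) ?_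
  convert hall using 1
  · rw [← h.coverV, e1]; abel
  · rw [← h.coverC, h.half, ← hC, hNU, e2, Multiset.map_add]; abel
lemma exists_half {s : G} (X : Finset G) (hX : ∀ c ∈ X, s - c ∈ X) (h2 : ∀ c ∈ X, c ≠ s - c) :
    ∃ R : Finset G, X.val = R.val + R.val.map fun c => s - c := by
  induction X using strongInduction with
  | _ X ih =>
    rcases X.eq_empty_or_nonempty with rfl | ⟨c, hc⟩
    · exact ⟨∅, rfl⟩
    have hc' := hX c hc
    have hne := h2 c hc
    obtain ⟨R, hR⟩ := ih ((X.erase c).erase (s - c))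
      (_root_.ssubset_of_subset_of_ssubset (erase_subset _ _) (erase_ssubset hc)) (by
        intro d hd
        simp only [mem_erase] at hd ⊢
        refine ⟨fun h => hd.2.1 (sub_right_injective h), fun h => hd.1 (by rw [← h]; abel), hX _ hd.2.2⟩)
      (fun d hd => h2 d (mem_of_mem_erase (mem_of_mem_erase hd)))
    have hcR : c ∉ R := fun h => by
      have : c ∈ ((X.erase c).erase (s - c)).val := by rw [hR]; exact mem_add.2 (Or.inl h)
      exact (mem_erase.1 (mem_erase.1 this).2).1 rfl
    refine ⟨insert c R, ?_⟩
    have e : X.val = c ::ₘ (s - c) ::ₘ ((X.erase c).erase (s - c)).val := by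
      rw [erase_val, cons_erase (mem_erase.2 ⟨hne.symm, hc'⟩), erase_val, cons_erase hc]
    rw [e, hR, insert_val_of_notMem hcR, map_cons]
    simp only [← singleton_add]
    abel

/-- The windows of the gadgets are available for embedding. -/
structure Wnd (E : Finset G) (W : Multiset (G × G)) (AV AC : Finset G) : Prop where
  nd : (W.map fst + W.map snd).Nodup
  mem : ∀ v ∈ W.map fst + W.map snd, v ∈ AV
  ndC : (W.map fun p => p.1 - p.2).Nodup
  memC : ∀ c ∈ W.map fun p => p.1 - p.2, c ∈ AC ∧ c ∉ E

lemma exists_rest {O : Multiset G} {R : Finset G} (hO : O.Nodup) (hOR : ∀ v ∈ O, v ∉ R) (h0 : (0 : G) ∉ O)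
    (h0' : (0 : G) ∉ R) : ∃ A : Finset G, A.val + O + R.val = (univ.erase (0 : G)).val ∧
      ∀ v, v ∈ A ↔ v ≠ 0 ∧ v ∉ O ∧ v ∉ R := by
  have h1 : (O + R.val).Nodup := nodup_add.2 ⟨hO, R.nodup, Multiset.disjoint_left.2 fun {v} hv hv' => hOR v hv hv'⟩
  have h2 : O + R.val ≤ (univ.erase (0 : G)).val := by
    refine (Multiset.le_iff_subset h1).2 fun v hv => ?_
    refine mem_erase.2 ⟨?_, mem_univ _⟩
    rintro rfl
    exact (mem_add.1 hv).elim h0 h0'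
  refine ⟨⟨(univ.erase (0 : G)).val - (O + R.val), nodup_of_le (Multiset.sub_le_self _ _) (nodup _)⟩, ?_, fun v => ?_⟩
  · rw [add_assoc]; exact Multiset.sub_add_cancel h2
  · change v ∈ (univ.erase (0 : G)).val - (O + R.val) ↔ _
    rw [Multiset.mem_sub_of_nodup (nodup _)]
    simp only [mem_val, mem_erase, mem_univ, and_true, mem_add, not_or]

set_option maxHeartbeats 1600000 in
theorem exists_kit (η : ℝ) (hη : 0 < η) :
    ∃ δ > 0, ∀ μ : ℝ, 0 < μ → 4 * μ ≤ δ → ∃ N0 : ℕ, ∀ {G : Type} [AddCommGroup G] [Fintype G] [DecidableEq G]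
      (s : G) (E D : Finset G), N0 ≤ card G → E.card ≤ 1000 → insert 0 D ⊆ E → (∀ c ∉ E, s - c ∉ E) →
      100 * (univ.filter fun c : G => c + c = s).card ≤ card G →
      Half G →
      Thin D →
      ∃ (RV Rc R : Finset G) (g g' : Gd G) (AV AC : Finset G),
        Kit s E δ RV Rc R g g' AV AC ⌊μ * card G⌋₊ ∧ Wnd E (g + g').ws AV AC ∧
        (∀ c ∈ E, c ≠ 0 → c ∈ AC) ∧
        ((g + g').ws.card : ℝ) ≤ η * card G ∧ (1 - η) * card G ≤ AV.card ∧
        (1 - η) * card G ≤ AC.card := by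
  set K : ℕ := max kV3 kP3 with hK
  have hKpos : (0 : ℝ) < (K : ℝ) + 1 := by positivity
  set ζ : ℝ := min 1 η with hζ
  have hζ0 : 0 < ζ := lt_min one_pos hη
  set ρ : ℝ := ζ / (10000 * ((K : ℝ) + 1) ^ 2) with hρ
  have hρ0 : 0 < ρ := by positivity
  have hρK : 10000 * ((K : ℝ) + 1) ^ 2 * ρ = ζ := by rw [hρ]; field_simp
  have hρ1 : ρ ≤ 1 := by
    have : ζ ≤ 1 := min_le_left _ _
    have h1 : (1 : ℝ) ≤ 10000 * ((K : ℝ) + 1) ^ 2 := by nlinarith [(cast_nonneg K : (0 : ℝ) ≤ K)]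
    nlinarith
  obtain ⟨δ, hδ, N1, hres⟩ := exists_res ρ hρ0 hρ1
  refine ⟨δ, hδ, fun μ hμ hμδ => ⟨max (max N1 200000) (max ⌈2002 * ((K : ℝ) + 1) / ζ⌉₊ ⌈1 / μ⌉₊), ?_⟩⟩
  intro G _ _ _ s E D hn hE hDE hsE hs h2 hD
  simp only [max_le_iff] at hn
  obtain ⟨⟨hn1, hn2⟩, hn3, hn4⟩ := hn
  obtain ⟨RV, Rc, hr, hRV, hRc⟩ := hres s E hn1 (by omega) hs h2
  obtain ⟨R, hR⟩ := exists_half Rc hr.partner hr.two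
  set n : ℝ := (card G : ℝ) with hnn
  have hn3' : 2002 * ((K : ℝ) + 1) ≤ ζ * n := by
    have := (ceil_le.1 hn3); rw [div_le_iff₀ hζ0] at this; linarith
  have hn4' : 1 ≤ μ * n := by
    have := (ceil_le.1 hn4); rw [div_le_iff₀ hμ] at this; linarith
  have hn0 : 0 ≤ n := cast_nonneg _
  set p := ⌊μ * n⌋₊ with hp
  have hp1 : 1 ≤ p := Nat.le_floor (by simpa using hn4')
  have hp2 : (p : ℝ) ≤ μ * n := floor_le (by positivity)
  have hRV' : δ * n ≤ RV.card := by
    refine (hr.pick' (fun _ => (true, true, 0)) 0 (fun _ => 0)).trans (cast_le.2 (card_le_card fun a ha => ?_))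
    simpa [Fm.val] using (mem_filter.1 ha).2.2.2 0
  have hRc' : δ * n ≤ Rc.card := by
    refine (hr.pick' (fun _ => (false, true, 0)) 0 (fun _ => 0)).trans (cast_le.2 (card_le_card fun a ha => ?_))
    simpa [Fm.val] using (mem_filter.1 ha).2.2.2 0
  have hcR := congrArg Multiset.card hR
  simp only [card_add, Multiset.card_map, card_val] at hcR
  have hpRV : 2 * (2 * p) ≤ RV.card := by
    have : ((2 * (2 * p) : ℕ) : ℝ) ≤ RV.card := by push_cast; nlinarith
    exact_mod_cast this
  have hpRc : 4 * p ≤ Rc.card := by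
    have : ((4 * p : ℕ) : ℝ) ≤ Rc.card := by push_cast; nlinarith
    exact_mod_cast this
  have hsub : R ⊆ Rc := fun c hc => by
    rw [← mem_val, hR]; exact mem_add.2 (Or.inl hc)
  have h0E : (0 : G) ∈ E := hDE (mem_insert_self _ _)
  have hTK : ((K : ℝ) + 1) * (8 * ρ * n + 1001 + 4880 * (K : ℝ) * ρ * n) ≤ ζ * n := by
    have e1 : ((K : ℝ) + 1) * (8 * ρ * n + 4880 * (K : ℝ) * ρ * n) ≤ ζ / 2 * n := by
      have : ((K : ℝ) + 1) * (8 + 4880 * (K : ℝ)) ≤ 5000 * ((K : ℝ) + 1) ^ 2 := by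
        nlinarith [(cast_nonneg K : (0 : ℝ) ≤ K)]
      calc ((K : ℝ) + 1) * (8 * ρ * n + 4880 * (K : ℝ) * ρ * n) = ((K : ℝ) + 1) * (8 + 4880 * (K : ℝ)) * (ρ * n) := by ring
        _ ≤ 5000 * ((K : ℝ) + 1) ^ 2 * (ρ * n) := by gcongr
        _ = ζ / 2 * n := by rw [← hρK]; ring
    linarith
  have hRm : (R.card : ℝ) ≤ 4 * ρ * n := le_trans (by exact_mod_cast card_le_card hsub) hRc
  have hFV : ((insert 0 RV : Finset G).card : ℝ) ≤ 4 * ρ * n + 1 := by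
    have : ((insert 0 RV : Finset G).card : ℝ) ≤ RV.card + 1 := by exact_mod_cast card_insert_le _ _
    linarith
  have hFC : ((E ∪ Rc).card : ℝ) ≤ 4 * ρ * n + 1000 := by
    have : ((E ∪ Rc).card : ℝ) ≤ E.card + Rc.card := by exact_mod_cast card_union_le _ _
    have : (E.card : ℝ) ≤ 1000 := by exact_mod_cast hE
    linarith
  have hζ1 : ζ ≤ 1 := min_le_left _ _
  have hK0 : (0 : ℝ) ≤ K := cast_nonneg K
  have hcvt : ∀ a b m : ℕ, (a : ℝ) + b ≤ 8 * ρ * n + 1001 + 2440 * (K : ℝ) * ρ * n → (m : ℝ) ≤ 4 * ρ * n →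
      K * (a + b + K * (610 * m)) ≤ card G := by
    intro a b m hab hm
    have : ((K * (a + b + K * (610 * m)) : ℕ) : ℝ) ≤ card G := by
      push_cast
      calc (K : ℝ) * (a + b + K * (610 * m))
          ≤ ((K : ℝ) + 1) * (8 * ρ * n + 1001 + 2440 * (K : ℝ) * ρ * n + K * (610 * (4 * ρ * n))) := by gcongr; linarith
        _ = ((K : ℝ) + 1) * (8 * ρ * n + 1001 + 4880 * (K : ℝ) * ρ * n) := by ring
        _ ≤ ζ * n := hTK
        _ ≤ n := by nlinarith
    exact_mod_cast this
  have hKρ : 0 ≤ (K : ℝ) * ρ * n := by positivity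
  have hgcR : ∀ (g : Gd G) (m : ℕ), g.vs.card + g.cs.card ≤ K * (610 * m) → (m : ℝ) ≤ 4 * ρ * n →
      (g.vs.card : ℝ) + g.cs.card ≤ 2440 * (K : ℝ) * ρ * n := by
    intro g m h hm
    have h' : ((g.vs.card + g.cs.card : ℕ) : ℝ) ≤ ((K * (610 * m) : ℕ) : ℝ) := cast_le.2 h
    push_cast at h'
    have : (K : ℝ) * (610 * m) ≤ K * (610 * (4 * ρ * n)) := by gcongr
    linarith
  obtain ⟨g, hg, hgF, hgc⟩ := (exists_vertexAbsorber h2 D hD (m := RV.card) (u := 2 * p) (by omega) hpRV RV rfl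
    (insert 0 RV) (E ∪ Rc) (hDE.trans subset_union_left) (subset_insert _ _)).mono subset_rfl subset_rfl
    (K' := K) (le_max_left _ _) le_rfl (fun g hg => hg)
    (insert 0 RV) (E ∪ Rc) (insert_nonempty _ _) ⟨0, mem_union_left _ h0E⟩ subset_rfl subset_rfl
    (hcvt _ _ _ (by linarith) hRV)
  have hgb := hgcR g _ hgc hRV
  obtain ⟨g', hg', hgF', hgc'⟩ := (exists_pairAbsorber h2 D hD s (m := R.card) (u := p) (by omega) (by omega) R rfl
    (fun c hc => ⟨fun h => hr.avoid c (hsub hc) (hDE h), fun h => hr.avoid _ (hr.partner _ (hsub hc)) (hDE h)⟩)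
    (insert 0 RV) (E ∪ Rc) (hDE.trans subset_union_left) (hsub.trans subset_union_right)).mono subset_rfl subset_rfl
    (K' := K) (le_max_right _ _) le_rfl (fun g hg => hg)
    (insert 0 RV ∪ g.vs.toFinset) (E ∪ Rc ∪ g.cs.toFinset) (by simp) ⟨0, by simp [h0E]⟩ subset_union_left subset_union_left
    (hcvt _ _ _ (by
      have e1 : ((insert 0 RV ∪ g.vs.toFinset).card : ℝ) ≤ (insert 0 RV).card + g.vs.card := by
        exact_mod_cast (card_union_le _ _).trans (Nat.add_le_add_left (toFinset_card_le _) _)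
      have e2 : ((E ∪ Rc ∪ g.cs.toFinset).card : ℝ) ≤ (E ∪ Rc).card + g.cs.card := by
        exact_mod_cast (card_union_le _ _).trans (Nat.add_le_add_left (toFinset_card_le _) _)
      linarith) hRm)
  have hgb' := hgcR g' _ hgc' hRm
  have hF := hgF.add hgF'
  have hvE : (g + g').vs = (g + g').ws.map fst + (g + g').ws.map snd + (g + g').oV := rfl
  have hcE : (g + g').cs = (g + g').oC + (g + g').ws.map fun p => p.1 - p.2 := rfl
  have hvc : (((g + g').vs.card : ℕ) : ℝ) = g.vs.card + g'.vs.card := by rw [Gd.vs_add]; simp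
  have hcc : (((g + g').cs.card : ℕ) : ℝ) = g.cs.card + g'.cs.card := by rw [Gd.cs_add]; simp
  obtain ⟨ndV, ndC, avV, avC⟩ := hF
  generalize hww : (g + g').ws = W at *
  generalize hoV : (g + g').oV = oV at *
  generalize hoC : (g + g').oC = oC at *
  generalize hvs : (g + g').vs = vs at *
  generalize hcs : (g + g').cs = cs at *
  subst hvE hcE
  obtain ⟨nV1, nV2, nV3⟩ := nodup_add.1 ndV
  obtain ⟨nC1, nC2, nC3⟩ := nodup_add.1 ndC
  rw [Multiset.disjoint_left] at nV3 nC3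
  have avV' : ∀ v ∈ oV, v ∉ insert 0 RV := fun v hv => avV v (mem_add.2 (Or.inr hv))
  have avC' : ∀ v ∈ oC, v ∉ E ∪ Rc := fun v hv => avC v (mem_add.2 (Or.inl hv))
  obtain ⟨AV, hAV, hAV'⟩ := exists_rest nV2 (R := RV) (fun v hv h => avV' v hv (mem_insert_of_mem h))
    (fun h => avV' 0 h (mem_insert_self _ _)) hr.zero
  obtain ⟨AC, hAC, hAC'⟩ := exists_rest nC1 (R := Rc) (fun v hv h => avC' v hv (mem_union_right _ h))
    (fun h => avC' 0 h (mem_union_left _ h0E)) (fun h => hr.avoid 0 h h0E)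
  have hcV := congrArg Multiset.card hAV
  have hcC := congrArg Multiset.card hAC
  simp only [card_add, card_val, card_erase_of_mem (mem_univ (0 : G)), card_univ] at hcV hcC
  simp only [card_add, Multiset.card_map, cast_add] at hvc hcc
  have hKn : 8 * ρ * n + 1001 + 4880 * (K : ℝ) * ρ * n ≤ η * n := by
    have : ζ * n ≤ η * n := by gcongr; exact min_le_right _ _
    have h1 : 0 ≤ 8 * ρ * n + 1001 + 4880 * (K : ℝ) * ρ * n := by positivity
    nlinarith
  have hn' : (AV.card : ℝ) + oV.card + RV.card + 1 = n := by
    rw [hnn]; exact_mod_cast (by omega : AV.card + oV.card + RV.card + 1 = card G)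
  have hn'' : (AC.card : ℝ) + oC.card + Rc.card + 1 = n := by
    rw [hnn]; exact_mod_cast (by omega : AC.card + oC.card + Rc.card + 1 = card G)
  have hwp : (0 : ℝ) ≤ W.card := cast_nonneg _
  have hop : (0 : ℝ) ≤ oV.card := cast_nonneg _
  have hop' : (0 : ℝ) ≤ oC.card := cast_nonneg _
  refine ⟨RV, Rc, R, g, g', AV, AC, ⟨hr, hR, hg, hg', by omega, by omega, by rw [hoV]; exact hAV,
    by rw [hoC]; exact hAC⟩, ?_, ?_, ?_, ?_, ?_⟩
  · rw [hww]
    refine ⟨nV1, fun v hv => (hAV' v).2 ⟨?_, fun h => nV3 hv h, ?_⟩, nC2, fun c hc => ⟨(hAC' c).2 ⟨?_, fun h => nC3 h hc, ?_⟩, ?_⟩⟩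
    · rintro rfl; exact avV 0 (mem_add.2 (Or.inl hv)) (mem_insert_self _ _)
    · exact fun h => avV v (mem_add.2 (Or.inl hv)) (mem_insert_of_mem h)
    · rintro rfl; exact avC 0 (mem_add.2 (Or.inr hc)) (mem_union_left _ h0E)
    · exact fun h => avC c (mem_add.2 (Or.inr hc)) (mem_union_right _ h)
    · exact fun h => avC c (mem_add.2 (Or.inr hc)) (mem_union_left _ h)
  · exact fun c hc h0 => (hAC' c).2 ⟨h0, fun h => avC' c h (mem_union_left _ hc), fun h => hr.avoid c h hc⟩
  · rw [hww]; linarith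
  · linarith
  · linarith
end Glue

lemma Ref.cast {B B' D D' : Multiset (Box G)} {V V' C C' : Multiset G} (h : Ref B B' V C) (e1 : B = D)
    (e2 : B' = D') (e3 : V = V') (e4 : C = C') : Ref D D' V' C' := by
  subst e1 e2 e3 e4; exact h

lemma val_union {α : Type} [DecidableEq α] {s t : Finset α} (h : Disjoint s t) : (s ∪ t).val = s.val + t.val := by
  rw [← disjUnion_eq_union s t h]; rfl

/-- Connecting two vertices by a short path avoiding few vertices and differences. -/
lemma exists_conn (h2 : Half G) (m : ℕ) :
    ∀ (a b : G) (FV FC : Finset G), 2 * FV.card + 4 * FC.card + 6 * m < card G →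
    ∃ (L UC : Finset G) (l : List G), l.length = m + 1 ∧ (l : Multiset G) = L.val ∧ pcol a l b = UC.val ∧
      Disjoint L FV ∧ Disjoint UC FC := by
  induction m with
  | zero =>
    intro a b FV FC h
    have := h2 (a + b)
    obtain ⟨v, -, hv⟩ := exists_mem_notMem_of_card_lt_card (s := FV ∪ FC.image (fun c => a + c) ∪ FC.image (fun c => b - c)
      ∪ univ.filter fun c : G => c + c = a + b) (t := univ) (by
        have e1 := card_union_le (FV ∪ FC.image (fun c => a + c) ∪ FC.image (fun c => b - c)) (univ.filter fun c : G => c + c = a + b)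
        have e2 := card_union_le (FV ∪ FC.image (fun c => a + c)) (FC.image (fun c => b - c))
        have e3 := card_union_le FV (FC.image (fun c => a + c))
        have e4 : (FC.image (fun c => a + c)).card ≤ FC.card := card_image_le
        have e5 : (FC.image (fun c => b - c)).card ≤ FC.card := card_image_le
        rw [card_univ]; omega)
    simp only [mem_union, mem_image, mem_filter, mem_univ, true_and, not_or, not_exists, not_and] at hv
    obtain ⟨⟨⟨hv1, hv2⟩, hv3⟩, hv4⟩ := hv
    have hne : v - a ≠ b - v := fun h => hv4 (by linear_combination (norm := module) h)
    refine ⟨{v}, {v - a, b - v}, [v], rfl, rfl, ?_, ?_, ?_⟩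
    · rw [insert_val_of_notMem (by simpa using hne)]; rfl
    · simpa using hv1
    · rw [disjoint_left]; intro c hc hc'
      simp only [mem_insert, mem_singleton] at hc
      rcases hc with rfl | rfl
      · exact hv2 _ hc' (by abel)
      · exact hv3 _ hc' (by abel)
  | succ m ih =>
    intro a b FV FC h
    obtain ⟨v, -, hv⟩ := exists_mem_notMem_of_card_lt_card (s := FV ∪ FC.image (fun c => a + c)) (t := univ) (by
        have e3 := card_union_le FV (FC.image (fun c => a + c))
        have e4 : (FC.image (fun c => a + c)).card ≤ FC.card := card_image_le
        rw [card_univ]; omega)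
    simp only [mem_union, mem_image, not_or, not_exists, not_and] at hv
    obtain ⟨L, UC, l, h1, h2, h3, h4, h5⟩ := ih v b (insert v FV) (insert (v - a) FC) (by
      have := card_insert_le v FV
      have := card_insert_le (v - a) FC
      omega)
    rw [disjoint_insert_right] at h4 h5
    refine ⟨insert v L, insert (v - a) UC, v :: l, by simp [h1], ?_, ?_, ?_, ?_⟩
    · rw [insert_val_of_notMem h4.1, ← h2]; rfl
    · rw [insert_val_of_notMem h5.1, ← h3]; rfl
    · exact disjoint_insert_left.2 ⟨hv.1, h4.2⟩
    · exact disjoint_insert_left.2 ⟨fun h => hv.2 _ h (by abel), h5.2⟩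

lemma Ref.cyc (a : G) (l : List G) {k : ℕ} (hk : l.length + 1 = k) :
    Ref {Box.row k} 0 ((a :: l : List G) : Multiset G) (pcol a l a) := by
  subst hk
  exact ((Ref.row a l.length).trans (Ref.path a l a)).cast rfl rfl rfl (by simp)

lemma Ref.window (a b : G) (l : List G) {k : ℕ} (hk : l.length + 3 = k) :
    Ref {Box.row k} {Box.gap a b 1} ({a} + {b} + (l : Multiset G)) (pcol b l a) := by
  subst hk
  have h := (Ref.row a (l.length + 2)).trans (((Ref.split a b a 1 l.length).trans
    ((Ref.refl {Box.gap a b 1}).add (Ref.path b l a))).cast (by congr 2; omega) rfl rfl rfl)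
  exact h.cast rfl (by simp) (by simp) (by simp)

/-- Each window is placed in a row of its own. -/
lemma exists_windowRows (h2 : Half G) {k : ℕ}
    (hk : 4 ≤ k) (W : Multiset (G × G)) (FV FC : Finset G)
    (h : 2 * FV.card + 4 * FC.card + 6 * (k * W.card) < card G) :
    ∃ L UC : Finset G, Ref (replicate W.card (Box.row k)) (wins W)
      (W.map fst + W.map snd + L.val) UC.val ∧ Disjoint L FV ∧ Disjoint UC FC := by
  induction W using Multiset.induction generalizing FV FC with
  | empty => exact ⟨∅, ∅, by simpa [wins] using Ref.refl (G := G) 0, by simp, by simp⟩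
  | cons p W ih =>
    rw [card_cons, mul_add, mul_one] at h
    obtain ⟨L1, U1, l, hl, e1, e2, h3, h4⟩ := exists_conn h2 (k - 4) p.2 p.1 FV FC (by omega)
    have c1 : L1.card = k - 3 := by rw [← card_val, ← e1, coe_card, hl]; omega
    have c2 : U1.card = k - 2 := by rw [← card_val, ← e2, pcol_card, hl]; omega
    obtain ⟨L, UC, href, h5, h6⟩ := ih (FV ∪ L1) (FC ∪ U1) (by
      have := card_union_le FV L1
      have := card_union_le FC U1
      omega)
    rw [disjoint_union_right] at h5 h6
    refine ⟨L1 ∪ L, U1 ∪ UC, ?_, disjoint_union_left.2 ⟨h3, h5.1⟩, disjoint_union_left.2 ⟨h4, h6.1⟩⟩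
    rw [val_union h5.2.symm, val_union h6.2.symm, ← e1, ← e2]
    refine ((Ref.window p.1 p.2 l (k := k) (by omega)).add href).cast ?_ ?_ ?_ ?_
    · rw [card_cons, replicate_succ]; rfl
    · simp [wins]
    · simp only [map_cons]; simp only [← singleton_add]; abel
    · rfl

lemma triangleRows (W : Multiset (G × G)) :
    Ref (replicate W.card (Box.row 3)) (wins W)
      (W.map fst + W.map snd) (W.map fun p => p.1 - p.2) := by
  induction W using Multiset.induction with
  | empty => simpa [wins] using Ref.refl (G := G) 0
  | cons p W ih =>
    refine ((Ref.window p.1 p.2 [] (k := 3) rfl).add ih).cast ?_ ?_ ?_ ?_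
    · rw [card_cons, replicate_succ]; rfl
    · simp [wins]
    · simp only [map_cons]; simp only [← singleton_add, coe_nil]; abel
    · simp [pcol]

lemma bal_wins_card (W : Multiset (G × G)) : (Bal (wins W)).1 = W.card ∧ (Bal (wins W)).2.1 = 2 * W.card := by
  induction W using Multiset.induction with
  | empty => simp [wins]
  | cons p W ih =>
    have : wins (p ::ₘ W) = Box.gap p.1 p.2 1 ::ₘ wins W := by simp [wins]
    rw [this, Bal_cons]
    simp only [bal, fst_add, snd_add, ih, card_cons]
    constructor <;> ring

/-- The windows and the special differences are placed in rows of their own. -/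
lemma exists_start (h2 : Half G) {k : ℕ}
    (hk : 3 ≤ k) {E : Finset G} {W : Multiset (G × G)} {AV AC : Finset G} (hW : Wnd E W AV AC) (h0 : (0 : G) ∈ E)
    (hEC : ∀ c ∈ E, c ≠ 0 → c ∈ AC)
    (hn : 2 * (card G - AV.card) + 4 * (card G - AC.card) + 10 * k * (W.card + E.card + 1) < card G) :
    ∃ (r : ℕ) (UV UC : Finset G), Ref (replicate r (Box.row k)) (wins W) UV.val UC.val ∧
      UV ⊆ AV ∧ UC ⊆ AC ∧ E.erase 0 ⊆ UC ∧ r ≤ W.card + E.card := by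
  have hcV : (univ \ AV).card = card G - AV.card := card_univ_sdiff AV
  have hcC : (univ \ AC).card = card G - AC.card := card_univ_sdiff AC
  set Wv : Finset G := ⟨_, hW.nd⟩ with hWv
  have hWvc : Wv.card = 2 * W.card := by
    simp only [hWv, card_mk, card_add, Multiset.card_map]; ring
  have base : ∃ UV UC : Finset G, Ref (replicate W.card (Box.row k)) (wins W) UV.val UC.val ∧
      UV ⊆ AV ∧ UC ⊆ AC ∧ Disjoint UC E := by
    rcases eq_or_lt_of_le hk with rfl | hk4
    · refine ⟨Wv, ⟨_, hW.ndC⟩, triangleRows W, fun v hv => hW.mem v hv, fun c hc => (hW.memC c hc).1, ?_⟩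
      exact disjoint_left.2 fun c hc => (hW.memC c hc).2
    · obtain ⟨L, UC, h1, h3, h4⟩ := exists_windowRows h2 hk4 W (univ \ AV ∪ Wv) (univ \ AC ∪ E) (by
        have := card_union_le (univ \ AV) Wv
        have := card_union_le (univ \ AC) E
        have : 10 * k * (W.card + E.card + 1) = 10 * (k * W.card) + 10 * (k * E.card) + 10 * k := by ring
        have : 4 * E.card ≤ k * E.card := Nat.mul_le_mul_right _ hk4
        have : 4 * W.card ≤ k * W.card := Nat.mul_le_mul_right _ hk4
        omega)
      rw [disjoint_union_right] at h3 h4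
      have e : Disjoint Wv L := h3.2.symm
      refine ⟨Wv ∪ L, UC, by rw [val_union e]; exact h1, union_subset (fun v hv => hW.mem v hv) ?_, ?_, h4.2⟩
      · exact fun v hv => by have := disjoint_left.1 h3.1 hv; simpa using this
      · exact fun v hv => by have := disjoint_left.1 h4.1 hv; simpa using this
  have key : ∀ S ⊆ E.erase 0, ∃ UV UC : Finset G, Ref (replicate (W.card + S.card) (Box.row k)) (wins W) UV.val UC.val ∧
      UV ⊆ AV ∧ UC ⊆ AC ∧ UC ∩ E = S := by
    intro S
    induction S using Finset.induction with
    | empty =>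
      intro _
      obtain ⟨UV, UC, h1, h3, h4, h5⟩ := base
      exact ⟨UV, UC, h1, h3, h4, disjoint_iff_inter_eq_empty.1 h5⟩
    | insert e S heS ih =>
      intro hS
      obtain ⟨UV, UC, h1, h3, h4, h5⟩ := ih ((subset_insert _ _).trans hS)
      have he := mem_erase.1 (hS (mem_insert_self _ _))
      have hcS : S.card + 2 ≤ E.card + 1 := by
        have := card_le_card hS
        rw [card_insert_of_notMem heS, card_erase_of_mem h0] at this
        have := card_pos.2 ⟨0, h0⟩
        omega
      have hb := h1.eq
      have hbr : Bal (replicate (W.card + S.card) (Box.row k : Box G)) = ((W.card + S.card) * k, (W.card + S.card) * k, 0) := by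
        simp [Bal, bal]
      have hbw := bal_wins_card W
      rw [hbr] at hb
      have hb1 := congrArg fst hb
      have hb2 := congrArg (fun x => x.2.1) hb
      simp only [fst_add, snd_add, hbw.1, hbw.2, pay, card_val] at hb1 hb2
      have hk' : 10 * k * (W.card + E.card + 1) = 10 * ((W.card + E.card + 1) * k) := by ring
      have hle : (W.card + S.card + 2) * k ≤ (W.card + E.card + 1) * k := Nat.mul_le_mul_right _ (by omega)
      have hle2 : (W.card + S.card + 2) * k = (W.card + S.card) * k + 2 * k := by ring
      have hle3 : 3 * (W.card + E.card + 1) ≤ (W.card + E.card + 1) * k := by rw [mul_comm]; exact Nat.mul_le_mul_left _ hk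
      obtain ⟨v, -, hv⟩ := exists_mem_notMem_of_card_lt_card (s := (univ \ AV ∪ UV) ∪ (univ \ AV ∪ UV).image (fun c => c - e))
        (t := univ) (by
          have e3 := card_union_le (univ \ AV ∪ UV) ((univ \ AV ∪ UV).image (fun c => c - e))
          have e4 : ((univ \ AV ∪ UV).image (fun c => c - e)).card ≤ (univ \ AV ∪ UV).card := card_image_le
          have e5 := card_union_le (univ \ AV) UV
          rw [card_univ]; omega)
      rw [mem_union, not_or] at hv
      have hv2 : v + e ∉ univ \ AV ∪ UV := fun h => hv.2 (mem_image.2 ⟨_, h, by abel⟩)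
      obtain ⟨L, U, l, hl, e1, e2, h6, h7⟩ := exists_conn h2 (k - 3) (v + e) v (univ \ AV ∪ UV ∪ {v, v + e}) (univ \ AC ∪ UC ∪ E) (by
        have e5 := card_union_le (univ \ AV ∪ UV) {v, v + e}
        have e6 := card_union_le (univ \ AV) UV
        have e7 := card_union_le (univ \ AC ∪ UC) E
        have e8 := card_union_le (univ \ AC) UC
        have e9 : ({v, v + e} : Finset G).card ≤ 2 := card_le_two
        omega)
      rw [disjoint_union_right, disjoint_union_right] at h6 h7
      simp only [disjoint_insert_right, disjoint_singleton_right] at h6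
      simp only [mem_union, not_or, mem_sdiff, mem_univ, true_and, not_not] at hv hv2
      have hvL : Disjoint UV (insert v (insert (v + e) L)) := by
        simp only [disjoint_insert_right]
        exact ⟨hv.1.2, hv2.2, h6.1.2.symm⟩
      have heU : e ∉ UC := fun h => heS (by rw [← h5]; exact mem_inter.2 ⟨h, he.2⟩)
      have heU' : e ∉ U := fun h => disjoint_left.1 h7.2 h he.2
      have hUU : Disjoint UC (insert e U) := disjoint_insert_right.2 ⟨heU, h7.1.2.symm⟩
      refine ⟨UV ∪ insert v (insert (v + e) L), UC ∪ insert e U, ?_, ?_, ?_, ?_⟩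
      · rw [val_union hvL, val_union hUU, insert_val_of_notMem heU', insert_val_of_notMem (by
          rw [mem_insert, not_or]; exact ⟨fun h => he.1 (by simpa using h.symm), h6.2.1⟩), insert_val_of_notMem h6.2.2,
          ← e1, ← e2, card_insert_of_notMem heS]
        refine (h1.add (Ref.cyc v ((v + e) :: l) (k := k) (by simp; omega))).cast ?_ (by simp) rfl ?_
        · rw [← add_assoc, replicate_succ, add_comm, singleton_add]
        · simp [pcol]
      · refine union_subset h3 ?_
        intro x hx
        simp only [mem_insert] at hx
        rcases hx with rfl | rfl | hx
        · exact hv.1.1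
        · exact hv2.1
        · have := disjoint_left.1 h6.1.1 hx; simpa using this
      · refine union_subset h4 ?_
        intro x hx
        simp only [mem_insert] at hx
        rcases hx with rfl | hx
        · exact hEC _ he.2 he.1
        · have := disjoint_left.1 h7.1.1 hx; simpa using this
      · rw [union_inter_distrib_right, h5, insert_inter_of_mem he.2, disjoint_iff_inter_eq_empty.1 h7.2]
        ext; simp
  obtain ⟨UV, UC, h1, h3, h4, h5⟩ := key _ subset_rfl
  refine ⟨_, UV, UC, h1, h3, h4, ?_, ?_⟩
  · rw [← h5]; exact inter_subset_left
  · exact Nat.add_le_add_left (card_le_card (erase_subset _ _)) _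

/-- Vertices and differences of a cyclic arrangement. -/
def cycF (m : ℕ) (i : Fin (m + 1) × Bool) (ω : Fin (m + 1) → G) : G :=
  if i.2 then ω i.1 else ω (i.1 + 1) - ω i.1

lemma cycF_surj {m : ℕ} (hm : 2 ≤ m) {i i' : Fin (m + 1) × Bool} (h : i ≠ i') (g g' : G) :
    ∃ ω, cycF m i ω = g ∧ cycF m i' ω = g' := by
  have h1 : ∀ x : Fin (m + 1), x + 1 ≠ x := by
    intro x hx
    have : (1 : Fin (m + 1)) = 0 := by simpa using hx
    rw [Fin.ext_iff] at this
    simp [mod_eq_of_lt (show 1 < m + 1 by omega)] at this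
  have h11 : ∀ x : Fin (m + 1), x + 1 + 1 ≠ x := by
    intro x hx
    have : (1 + 1 : Fin (m + 1)) = 0 := by rw [add_assoc] at hx; simpa using hx
    rw [Fin.ext_iff, Fin.val_add] at this
    simp [mod_eq_of_lt (show 1 < m + 1 by omega), mod_eq_of_lt (show 1 + 1 < m + 1 by omega)] at this
  have mixed : ∀ (j i : Fin (m + 1)) (g g' : G), ∃ ω : Fin (m + 1) → G, ω j = g ∧ ω (i + 1) - ω i = g' := by
    intro j i g g'
    by_cases hj : j = i + 1
    · subst hj
      exact ⟨fun x => if x = i then g - g' else g, by simp [h1], by simp [h1]⟩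
    · exact ⟨fun x => if x = i + 1 then g + g' else g, by simp [hj], by simp [(h1 i).symm]⟩
  obtain ⟨a, b⟩ := i
  obtain ⟨a', b'⟩ := i'
  cases b <;> cases b' <;> simp only [cycF, Bool.false_eq_true, if_true, if_false]
  · have hne : a ≠ a' := fun hh => h (by rw [hh])
    have hne' : a + 1 ≠ a' + 1 := fun hh => hne (add_right_cancel hh)
    by_cases hc : a = a' + 1
    · have hc' : a' ≠ a + 1 := fun hh => h11 a' (by rw [← hc, ← hh])
      refine ⟨fun x => (if x = a + 1 then g + g' else 0) + (if x = a' + 1 then g' else 0), ?_, ?_⟩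
      · simp [hc, show m ≠ 0 by omega]
      · simp [hne'.symm, hc', (h1 a').symm]
    · refine ⟨fun x => (if x = a + 1 then g else 0) + (if x = a' + 1 then (if a' = a + 1 then g' + g else g') else 0), ?_, ?_⟩
      · simp [hne', (h1 a).symm, hc]
      · by_cases hc' : a' = a + 1
        · simp [hc', (h1 _).symm, h1]
        · simp [hne'.symm, hc', (h1 a').symm]
  · obtain ⟨ω, h1, h2⟩ := mixed a' a g' g; exact ⟨ω, h2, h1⟩
  · exact mixed a a' g g'
  · have hne : a ≠ a' := fun hh => h (by rw [hh])
    exact ⟨fun x => if x = a then g else g', by simp, by simp [hne.symm]⟩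

lemma cycF_card {m : ℕ} (hm : 2 ≤ m) {i i' : Fin (m + 1) × Bool} (h : i ≠ i') (g g' : G) :
    (univ.filter fun ω : Fin (m + 1) → G => cycF m i ω = g ∧ cycF m i' ω = g').card = card G ^ (m - 1) := by
  have hadd : ∀ (i : Fin (m + 1) × Bool) (ω ω' : Fin (m + 1) → G), cycF m i (ω + ω') = cycF m i ω + cycF m i ω' := by
    intro i ω ω'
    unfold cycF
    split_ifs
    · rfl
    · simp only [Pi.add_apply]; abel
  have hsub : ∀ (i : Fin (m + 1) × Bool) (ω ω' : Fin (m + 1) → G), cycF m i (ω - ω') = cycF m i ω - cycF m i ω' := by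
    intro i ω ω'
    unfold cycF
    split_ifs
    · rfl
    · simp only [Pi.sub_apply]; abel
  have heq : ∀ g g' : G, (univ.filter fun ω : Fin (m + 1) → G => cycF m i ω = g ∧ cycF m i' ω = g').card =
      (univ.filter fun ω : Fin (m + 1) → G => cycF m i ω = 0 ∧ cycF m i' ω = 0).card := by
    intro g g'
    obtain ⟨ω0, h1, h2⟩ := cycF_surj hm h g g'
    refine card_bij' (fun ω _ => ω - ω0) (fun ω _ => ω + ω0) ?_ ?_ ?_ ?_
    · intro ω hω; simp only [mem_filter, mem_univ, true_and] at hω ⊢; rw [hsub, hsub, h1, h2, hω.1, hω.2]; simp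
    · intro ω hω; simp only [mem_filter, mem_univ, true_and] at hω ⊢; rw [hadd, hadd, h1, h2, hω.1, hω.2]; simp
    · intro ω _; simp
    · intro ω _; simp
  rw [heq]
  have ht : card (Fin (m + 1) → G) = ∑ p : G × G, (univ.filter fun ω : Fin (m + 1) → G => (cycF m i ω, cycF m i' ω) = p).card :=
    card_eq_sum_card_fiberwise (fun _ _ => mem_coe.2 (mem_univ _))
  simp only [ext_iff, heq] at ht
  rw [sum_const, card_univ, card_prod, card_fun, card_fin, smul_eq_mul] at ht
  have hpos : 0 < card G := Fintype.card_pos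
  have e : card G ^ (m + 1) = card G * card G * card G ^ (m - 1) := by
    obtain ⟨m, rfl⟩ : ∃ t, m = t + 1 := ⟨m - 1, by omega⟩
    simp only [Nat.add_sub_cancel]; ring
  rw [e] at ht
  exact (Nat.eq_of_mul_eq_mul_left (by positivity) ht).symm

lemma pcol_ofFn (m : ℕ) : ∀ (f : ℕ → G),
    pcol (f 0) ((List.range m).map fun i => f (i + 1)) (f (m + 1)) = (range (m + 1)).map fun i => f (i + 1) - f i := by
  induction m with
  | zero => intro f; rfl
  | succ m ih =>
    intro f
    rw [List.range_succ, map_append, List.map_singleton, pcol_append, ih, Multiset.range_succ (m + 1), map_cons]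
    simp only [pcol]
    rw [← singleton_add]; abel

lemma cyc_ref (m : ℕ) (ω : Fin (m + 1) → G) : Ref {Box.row (m + 1)} 0 (univ.val.map ω)
    ((univ : Finset (Fin (m + 1))).val.map fun i => ω (i + 1) - ω i) := by
  have h := Ref.cyc (k := m + 1) (ω (Fin.ofNat (m + 1) 0)) ((List.range m).map fun i => ω (Fin.ofNat (m + 1) (i + 1))) (by simp)
  have e := pcol_ofFn m fun i => ω (Fin.ofNat (m + 1) i)
  have e0 : Fin.ofNat (m + 1) (m + 1) = Fin.ofNat (m + 1) 0 := by simp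
  have eu : (univ : Finset (Fin (m + 1))).val = (range (m + 1)).map (Fin.ofNat (m + 1)) := by
    refine (Nodup.ext (nodup _) ?_).2 ?_
    · refine Nodup.map_on ?_ (Multiset.nodup_range _)
      intro a ha b hb hab
      rw [Multiset.mem_range] at ha hb
      simpa [Fin.ext_iff, mod_eq_of_lt ha, mod_eq_of_lt hb] using hab
    · intro a
      simp only [mem_val, mem_univ, Multiset.mem_map, Multiset.mem_range, true_iff]
      exact ⟨a, a.2, by simp⟩
  refine h.cast rfl rfl ?_ ?_
  · rw [eu, map_map]
    change ((_ :: _ : List G) : Multiset G) = ((List.range (m + 1)).map _ : List G)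
    rw [List.range_succ_eq_map, List.map_cons, List.map_map]; rfl
  · rw [eu, map_map]
    simp only [e0] at e
    rw [e]
    refine Multiset.map_congr rfl fun i hi => ?_
    simp only [comp]
    congr 2
    simp [Fin.ext_iff, Fin.val_add]

/-- A family of disjoint cyclic arrangements fills rows. -/
lemma cycles_ref {m : ℕ} (M : Finset (Fin (m + 1) → G)) {A : Bool → Finset G}
    (hval : ∀ ω ∈ M, FormsValid snd (cycF m) A ω)
    (hdisj : ∀ ω ∈ M, ∀ ω' ∈ M, ω ≠ ω' → FormsDisj snd (cycF m) ω ω') :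
    Ref (replicate M.card (Box.row (m + 1))) 0
      (M.biUnion fun ω => univ.image fun i => cycF m (i, true) ω).val (M.biUnion fun ω => univ.image fun i => cycF m (i, false) ω).val := by
  induction M using Finset.induction with
  | empty => exact Ref.refl 0
  | insert ω M hω ih =>
    have ih' := ih (fun x hx => hval x (mem_insert_of_mem hx))
      (fun x hx y hy => hdisj x (mem_insert_of_mem hx) y (mem_insert_of_mem hy))
    have inj : ∀ b, Injective fun i => cycF m (i, b) ω := by
      intro b i i' h
      exact congrArg fst ((hval ω (mem_insert_self _ _)).2 (i, b) (i', b) rfl h)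
    have dj : ∀ b, Disjoint (univ.image fun i => cycF m (i, b) ω) (M.biUnion fun ω => univ.image fun i => cycF m (i, b) ω) := by
      intro b
      rw [disjoint_left]
      intro c hc hc'
      simp only [mem_biUnion, mem_image, mem_univ, true_and] at hc hc'
      obtain ⟨i, hi⟩ := hc
      obtain ⟨ω', hω', i', hi'⟩ := hc'
      exact hdisj ω (mem_insert_self _ _) ω' (mem_insert_of_mem hω') (by rintro rfl; exact hω hω') (i, b) (i', b) rfl (hi.trans hi'.symm)
    rw [biUnion_insert, biUnion_insert, val_union (dj true), val_union (dj false), card_insert_of_notMem hω,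
      image_val_of_injOn (inj true).injOn, image_val_of_injOn (inj false).injOn, add_comm M.card, replicate_add]
    exact ((cyc_ref m ω).add ih').cast rfl rfl rfl rfl

lemma gaps_ref (Y : Multiset G) {k : ℕ} (hk : 1 ≤ k) :
    Ref (replicate Y.card (Box.row k)) (Y.map fun y => Box.gap y y (k - 1)) Y 0 := by
  obtain ⟨k, rfl⟩ : ∃ t, k = t + 1 := ⟨k - 1, by omega⟩
  induction Y using Multiset.induction with
  | empty => exact Ref.refl 0
  | cons y Y ih =>
    exact ((Ref.row y k).add ih).cast (by simp [replicate_succ]) (by simp) (by simp) (by simp)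

/-- All vertices and differences outside the reservoirs are used by complete rows of small length, up to few exceptions. -/
lemma exists_hostSmall (k : ℕ) (hk : 3 ≤ k) : ∃ η > 0, ∀ ε : ℝ, 0 < ε → ∃ N0 : ℕ,
    ∀ {G : Type} [AddCommGroup G] [Fintype G] [DecidableEq G], N0 ≤ card G →
    Half G →
    ∀ (E AV AC : Finset G) (W : Multiset (G × G)) (l p : ℕ), Wnd E W AV AC → (0 : G) ∈ E → (0 : G) ∉ AC → E.card ≤ 1000 →
    (∀ c ∈ E, c ≠ 0 → c ∈ AC) → (W.card : ℝ) ≤ η * card G → (1 - η) * card G ≤ AV.card →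
    (1 - η) * card G ≤ AC.card → AC.card + W.card = AV.card → l * k = AV.card + W.card + 2 * p →
    (k : ℝ) * (ε * card G) ≤ 2 * p →
    ∃ (Y Q : Finset G) (C1 : Multiset G) (ρ : ℕ), Ref (replicate l (Box.row k)) (wins W +
      (Y.val.map (fun y => Box.gap y y (k - 1)) + replicate ρ (Box.row k))) AV.val C1 ∧ C1 + Q.val = AC.val ∧
      (∀ c ∈ Q, c ∉ E) ∧ (Y.card : ℝ) ≤ ε * card G := by
  obtain ⟨m, rfl⟩ : ∃ t, k = t + 1 := ⟨k - 1, by omega⟩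
  have hm2 : 2 ≤ m := by omega
  set κ : ℝ := 10 * (16 * (2 * ((m : ℝ) + 1)) ^ 2) with hκ
  have hκp : 0 < κ := by positivity
  set η : ℝ := 1 / (κ * (m + 2)) with hη
  have hη0 : 0 < η := by positivity
  have hηκ : η * (m + 2) * κ = 1 := by rw [hη]; field_simp
  refine ⟨η, hη0, fun ε hε => ?_⟩
  obtain ⟨N1, hN1⟩ := forms_packing (I := Fin (m + 1) × Bool) (J := Bool) snd (r1 := m + 1) (by omega) (by simp)
    (by
      intro j
      rw [show (univ.filter fun i : Fin (m + 1) × Bool => i.2 = j) = univ.map ⟨fun i => (i, j), fun a b h => by simpa using h⟩ by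
        ext ⟨a, b⟩
        simp only [mem_filter, mem_univ, true_and, mem_map]
        exact ⟨by rintro rfl; exact ⟨a, rfl⟩, by rintro ⟨x, hx⟩; exact (congrArg snd hx).symm⟩, card_map, card_univ, card_fin]) ε hε
  refine ⟨max N1 ⌈1001 / η⌉₊, ?_⟩
  intro G _ _ _ hn h2 E AV AC W l p hW h0 h0' hE hEC hWc hAV hAC hVC hl hp
  obtain ⟨hn1, hn2⟩ := max_le_iff.1 hn
  rw [ceil_le, div_le_iff₀ hη0] at hn2
  set n : ℝ := (card G : ℝ) with hnn
  have hm0 : (0 : ℝ) ≤ m := cast_nonneg _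
  have hn0 : 0 ≤ n := cast_nonneg _
  have hcV : AV.card ≤ card G := card_le_univ _
  have hcC : AC.card ≤ card G := card_le_univ _
  have hEr : (E.card : ℝ) ≤ 1000 := by exact_mod_cast hE
  have hWE : (W.card : ℝ) + E.card + 1 ≤ 2 * (η * n) := by linarith
  have hκn : 40 * ((m : ℝ) + 1) ^ 2 * (η * n) ≤ n := by
    have h1 : 40 * ((m : ℝ) + 1) ^ 2 ≤ (m + 2) * κ := by rw [hκ]; nlinarith
    calc 40 * ((m : ℝ) + 1) ^ 2 * (η * n) ≤ (m + 2) * κ * (η * n) := by gcongr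
      _ = (η * (m + 2) * κ) * n := by ring
      _ = n := by rw [hηκ, one_mul]
  have hηn : 0 ≤ η * n := by positivity
  obtain ⟨r, UV, UC, href, hUV, hUC, hEU, hr⟩ := exists_start (k := m + 1) h2 hk hW h0 hEC (by
    have : ((2 * (card G - AV.card) + 4 * (card G - AC.card) + 10 * (m + 1) * (W.card + E.card + 1) : ℕ) : ℝ) < n := by
      push_cast [cast_sub hcV, cast_sub hcC]
      have : 10 * ((m : ℝ) + 1) * (W.card + E.card + 1) ≤ 10 * ((m : ℝ) + 1) * (2 * (η * n)) := by gcongr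
      have h3 : (6 + 20 * ((m : ℝ) + 1)) * (η * n) ≤ 30 * ((m : ℝ) + 1) ^ 2 * (η * n) := by
        gcongr; nlinarith
      have h4 : 0 < ((m : ℝ) + 1) ^ 2 * (η * n) := by
        have : 0 < η * n := by linarith
        positivity
      nlinarith
    exact Nat.cast_lt.1 this)
  have hb := href.eq
  have hbr : Bal (replicate r (Box.row (m + 1) : Box G)) = (r * (m + 1), r * (m + 1), 0) := by
    simp [Bal, bal]
  have hbw := bal_wins_card W
  rw [hbr] at hb
  have hb1 := congrArg fst hb
  have hb2 := congrArg (fun x => x.2.1) hb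
  simp only [fst_add, snd_add, hbw.1, hbw.2, pay, card_val] at hb1 hb2
  have hrr : (r : ℝ) ≤ 2 * (η * n) := by
    have : (r : ℝ) ≤ W.card + E.card := by exact_mod_cast hr
    linarith
  have hUVc : (UV.card : ℝ) ≤ (m + 1) * (2 * (η * n)) := by
    have h1 : (UV.card : ℝ) ≤ r * (m + 1) := by exact_mod_cast (by omega : UV.card ≤ r * (m + 1))
    have : (r : ℝ) * (m + 1) ≤ (2 * (η * n)) * (m + 1) := by gcongr
    linarith
  have hcA : (AV \ UV).card = (AC \ UC).card := by
    rw [card_sdiff_of_subset hUV, card_sdiff_of_subset hUC]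
    have := card_le_card hUV
    have := card_le_card hUC
    omega
  obtain ⟨M, -, hval, hdisj, hleft⟩ := hN1 (G := G) (Ω := Fin (m + 1) → G) (cycF m) (card G ^ (m - 1)) (pow_pos Fintype.card_pos _)
    (fun i i' h g g' => cycF_card hm2 h g g') hn1 (fun b => if b then AV \ UV else AC \ UC) (AV \ UV).card
    (by intro j; cases j <;> simp [hcA]) (by
      simp only [card_prod, card_fin, Fintype.card_bool]
      push_cast
      rw [card_sdiff_of_subset hUV, cast_sub (card_le_card hUV)]
      have h5 : n - (AV.card - UV.card) ≤ (m + 2) * (2 * (η * n)) := by linarith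
      calc (n - (AV.card - UV.card)) * (16 * (((m : ℝ) + 1) * 2) ^ 2)
          ≤ ((m + 2) * (2 * (η * n))) * (16 * (((m : ℝ) + 1) * 2) ^ 2) := by gcongr
        _ = (η * (m + 2) * κ) * n / 5 := by rw [hκ]; ring
        _ ≤ n := by rw [hηκ]; linarith) (fun _ => True) trivial (fun M _ _ _ => ⟨∅, by simp, fun _ _ _ _ => trivial⟩)
  have hMref := cycles_ref M hval hdisj
  set MV := M.biUnion fun ω => univ.image fun i => cycF m (i, true) ω with hMV
  set MC := M.biUnion fun ω => univ.image fun i => cycF m (i, false) ω with hMC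
  have sMV : MV ⊆ AV \ UV := by
    intro v hv
    simp only [hMV, mem_biUnion, mem_image, mem_univ, true_and] at hv
    obtain ⟨ω, hω, i, rfl⟩ := hv
    exact (hval ω hω).1 (i, true)
  have sMC : MC ⊆ AC \ UC := by
    intro v hv
    simp only [hMC, mem_biUnion, mem_image, mem_univ, true_and] at hv
    obtain ⟨ω, hω, i, rfl⟩ := hv
    exact (hval ω hω).1 (i, false)
  set Y := (AV \ UV) \ MV with hY
  set Q := (AC \ UC) \ MC with hQ
  have eV : AV.val = UV.val + MV.val + Y.val := by
    rw [add_assoc, ← val_union disjoint_sdiff, ← val_union]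
    · rw [union_sdiff_of_subset sMV, union_sdiff_of_subset hUV]
    · rw [union_sdiff_of_subset sMV]; exact disjoint_sdiff
  have eC : UC.val + MC.val + Q.val = AC.val := by
    rw [add_assoc, ← val_union disjoint_sdiff, ← val_union]
    · rw [union_sdiff_of_subset sMC, union_sdiff_of_subset hUC]
    · rw [union_sdiff_of_subset sMC]; exact disjoint_sdiff
  have hYc : (Y.card : ℝ) ≤ ε * n := by
    have := hleft true
    simp only [if_true] at this
    refine le_trans (cast_le.2 (card_le_card ?_)) (this.trans (by linarith))
    intro v hv
    rw [hY, mem_sdiff] at hv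
    refine mem_filter.2 ⟨hv.1, fun ω hω i hi h => hv.2 ?_⟩
    obtain ⟨i, b⟩ := i
    simp only at hi
    subst hi
    exact mem_biUnion.2 ⟨ω, hω, mem_image.2 ⟨i, mem_univ _, h⟩⟩
  have hMb := congrArg fst hMref.eq
  simp only [Bal, bal, Multiset.map_replicate, sum_replicate, Multiset.map_zero, sum_zero, pay, card_val,
    Prod.smul_mk, smul_eq_mul, zero_add] at hMb
  have hVc := congrArg Multiset.card eV
  simp only [card_add, card_val] at hVc
  have hrows : r + M.card + Y.card ≤ l := by
    have h1 : (((m + 1) * Y.card : ℕ) : ℝ) ≤ ((2 * p : ℕ) : ℝ) := by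
      push_cast at hp ⊢
      calc ((m : ℝ) + 1) * Y.card ≤ (m + 1) * (ε * n) := by gcongr
        _ ≤ 2 * p := hp
    have h1' := cast_le.1 h1
    refine Nat.le_of_mul_le_mul_right (c := m + 1) ?_ (by omega)
    rw [hl, hVc, add_mul, add_mul, hb1, hMb, mul_comm Y.card]
    omega
  refine ⟨Y, Q, UC.val + MC.val, l - (r + M.card + Y.card), ?_, eC, ?_, hYc⟩
  · have hg := gaps_ref Y.val (k := m + 1) (by omega)
    refine (((href.add hMref).add hg).add (Ref.refl (replicate (l - (r + M.card + Y.card)) (Box.row (m + 1))))).cast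
      ?_ ?_ ?_ ?_
    · rw [← replicate_add, ← replicate_add, ← replicate_add, card_val]
      congr 1; omega
    · rw [add_zero, add_assoc]
    · rw [add_zero, eV]
    · simp
  · intro c hc hcE
    rw [hQ, mem_sdiff, mem_sdiff] at hc
    refine hc.1.2 (hEU (mem_erase.2 ⟨?_, hcE⟩))
    rintro rfl
    exact h0' hc.1.1

/-- The exceptional element, its halves and the exceptional subgroup. -/
structure Spec (s : G) (D E : Finset G) (T : AddSubgroup G) : Prop where
  hT : ∀ x, x ∈ E ↔ x ∈ T
  hs : s ∈ T
  s2 : s + s = 0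
  hE : E.card ≤ 1000
  hD : insert 0 D ⊆ E
  hs100 : 100 * (univ.filter fun c : G => c + c = s).card ≤ card G
  h2 : Half G
  h16 : Thin D
  sml : ∀ x y, y ∉ E → Sml (y + (x + x))

lemma Spec.sub {s : G} {D E : Finset G} {T : AddSubgroup G} (h : Spec s D E T) : ∀ c ∉ E, s - c ∉ E := by
  intro c hc hc'
  rw [h.hT] at hc hc'
  exact hc (by simpa using T.sub_mem h.hs hc')

lemma Kit.cards {s : G} {E : Finset G} {δ : ℝ} {RV Rc R : Finset G} {g g' : Gd G} {AV AC : Finset G} {p : ℕ}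
    (h : Kit s E δ RV Rc R g g' AV AC p) : AC.card + (g + g').ws.card = AV.card ∧
      AV.card + (g + g').ws.card + 2 * p + 1 = card G ∧ (0 : G) ∉ AC ∧ (0 : G) ∉ AV := by
  have hb := h.bal_wins
  have hbw := bal_wins_card (g + g').ws
  have hb1 := congrArg fst hb
  have hb2 := congrArg (fun x => x.2.1) hb
  have hV := congrArg Multiset.card h.coverV
  have hC := congrArg Multiset.card h.coverC
  have hpos : 0 < card G := Fintype.card_pos
  simp only [fst_add, snd_add, hbw.1, hbw.2, pay, card_val, card_add,
    card_erase_of_mem (mem_univ (0 : G)), card_univ] at hb1 hb2 hV hC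
  refine ⟨by omega, by omega, fun h0 => ?_, fun h0 => ?_⟩
  · have : (0 : G) ∈ (univ.erase (0 : G)).val := by
      rw [← h.coverC]; exact mem_add.2 (Or.inl (mem_add.2 (Or.inl h0)))
    exact (mem_erase.1 this).1 rfl
  · have : (0 : G) ∈ (univ.erase (0 : G)).val := by
      rw [← h.coverV]; exact mem_add.2 (Or.inl (mem_add.2 (Or.inl h0)))
    exact (mem_erase.1 this).1 rfl

/-- The theorem for a fixed cycle length. -/
theorem exists_small (k : ℕ) (hk : 3 ≤ k) : ∃ N : ℕ, ∀ {G : Type} [AddCommGroup G] [Fintype G] [DecidableEq G]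
    {s : G} {D E : Finset G} {T : AddSubgroup G}, Spec s D E T → N ≤ card G → ∑ x : G, x = 0 →
    ∀ l, l * k + 1 = card G →
    HasOrth G l k := by
  obtain ⟨η, hη, hhost⟩ := exists_hostSmall k hk
  obtain ⟨δ, hδ, hkit⟩ := exists_kit η hη
  set j := (k - 3) / 2 with hj
  set K : ℕ := 3300 + 60 * j with hK
  set μ : ℝ := δ / (20 * ((K : ℝ) + 15)) with hμ
  have hKp : (0 : ℝ) < (K : ℝ) + 15 := by positivity
  have hμ0 : 0 < μ := by positivity
  have hμK : 20 * ((K : ℝ) + 15) * μ = δ := by rw [hμ]; field_simp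
  have hK0 : (0 : ℝ) ≤ K := cast_nonneg K
  obtain ⟨N1, hN1⟩ := hkit μ hμ0 (by nlinarith)
  have hk3 : (3 : ℝ) ≤ k := by exact_mod_cast hk
  set ε : ℝ := μ / (14 * (k : ℝ) ^ 2) with hε
  have hε0 : 0 < ε := by positivity
  have hεμ : 14 * (k : ℝ) ^ 2 * ε = μ := by rw [hε]; field_simp
  obtain ⟨N2, hN2⟩ := hhost ε hε0
  refine ⟨max (max N1 N2) (max ⌈40 * (k : ℝ) ^ 2 / μ⌉₊ (⌈2 * ((K : ℝ) + 15) / δ⌉₊ + 1)), ?_⟩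
  intro G _ _ _ s D E T hS hn hsum l hl
  simp only [max_le_iff] at hn
  obtain ⟨⟨hn1, hn2⟩, hn3, hn4⟩ := hn
  obtain ⟨RV, Rc, R, g, g', AV, AC, kit, hW, hEC, hWc, hAV, hAC⟩ :=
    hN1 s E D hn1 hS.hE hS.hD hS.sub hS.hs100 hS.h2 hS.h16
  set n : ℝ := (card G : ℝ) with hnn
  have hn3' : 40 * (k : ℝ) ^ 2 ≤ μ * n := by
    have := (ceil_le.1 hn3); rw [div_le_iff₀ hμ0] at this; linarith
  have hn4' : 2 * ((K : ℝ) + 15) < δ * n := by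
    have h1 : (⌈2 * ((K : ℝ) + 15) / δ⌉₊ : ℝ) + 1 ≤ n := by
      have := (cast_le (α := ℝ)).2 hn4
      rwa [cast_add, Nat.cast_one] at this
    have := le_ceil (2 * ((K : ℝ) + 15) / δ)
    have h3 : 2 * ((K : ℝ) + 15) / δ < n := by linarith
    rw [div_lt_iff₀ hδ] at h3; linarith
  set p := ⌊μ * n⌋₊ with hp
  have hp1 : (p : ℝ) ≤ μ * n := floor_le (by positivity)
  have hp2 : μ * n < p + 1 := Nat.lt_floor_add_one _
  obtain ⟨hc1, hc2, h0C, h0V⟩ := kit.cards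
  have h0E : (0 : G) ∈ E := hS.hD (mem_insert_self _ _)
  have hεn : 14 * (k : ℝ) ^ 2 * (ε * n) = μ * n := by rw [← mul_assoc, hεμ]
  have hεn0 : 0 ≤ ε * n := by positivity
  obtain ⟨Y, Q, C1, ρ, href, hQ, hQE, hY⟩ := hN2 hn2 hS.h2 E AV AC (g + g').ws l p hW h0E h0C hS.hE hEC hWc hAV hAC hc1 (by omega)
    (by nlinarith)
  have hb := href.eq
  have hbw := bal_wins_card (g + g').ws
  have hbY : Bal (Y.val.map fun y => Box.gap y y (k - 1)) = (Y.card * (k - 1), Y.card * k, 0) := by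
    simp [Bal, bal, Nat.sub_add_cancel (show 1 ≤ k by omega)]
  have hbr : ∀ l, Bal (replicate l (Box.row k : Box G)) = (l * k, l * k, 0) := by
    intro l; simp [Bal, bal]
  rw [Bal_add, Bal_add, hbY, hbr, hbr] at hb
  have hb1 := congrArg fst hb
  have hb2 := congrArg (fun x => x.2.1) hb
  have hQc := congrArg Multiset.card hQ
  simp only [fst_add, snd_add, hbw.1, hbw.2, pay, card_val, card_add] at hb1 hb2 hQc
  have hYk : Y.card * k = Y.card * (k - 1) + Y.card := by
    conv_lhs => rw [show k = (k - 1) + 1 by omega]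
    ring
  have hQY : Q.card = Y.card := by omega
  have hρ : 2 * p ≤ ρ * k + Y.card * k := by omega
  have hYμ : (Y.card : ℝ) ≤ μ * n := by
    have : 1 * (ε * n) ≤ 14 * (k : ℝ) ^ 2 * (ε * n) := by gcongr; nlinarith
    linarith
  have hmach : Mach s E RV Rc δ K j (j • s) (4 * p + Q.card) T := by
    refine ⟨kit.res, ?_, hS.hT, hS.hs, hS.s2, rfl, hS.sml, by have := hS.hE; omega⟩
    rw [hQY]; push_cast
    have h1 : 4 * (p : ℝ) + Y.card ≤ 5 * (μ * n) := by linarith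
    calc ((K : ℝ) + 15) * (4 * p + Y.card + 1) ≤ (K + 15) * (5 * (μ * n) + 1) := by gcongr
      _ = (20 * (K + 15) * μ) * n / 4 + (K + 15) := by ring
      _ < δ * n := by rw [hμK]; linarith
  refine kit.finish subset_rfl (by omega) hsum hl href hQ hQE le_rfl (hmach.solve (by omega) Y.val ?_)
  rw [card_val, card_val, hQY]
  refine Nat.le_of_mul_le_mul_right (c := k) ?_ (by omega)
  have : ((5 * (Y.card + (Y.card + 4) * k) * k + Y.card * k : ℕ) : ℝ) ≤ ((2 * p : ℕ) : ℝ) := by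
    push_cast
    calc 5 * ((Y.card : ℝ) + (Y.card + 4) * k) * k + Y.card * k = (6 * k + 5 * k ^ 2) * Y.card + 20 * (k : ℝ) ^ 2 := by ring
      _ ≤ 7 * k ^ 2 * (ε * n) + 20 * (k : ℝ) ^ 2 := by gcongr; nlinarith
      _ ≤ 2 * p := by nlinarith
  have := cast_le.1 this
  omega

/-- Vertices of an item: a single vertex or a window. -/
def ivt (x : G × G) : Multiset G := {x.1} + if x.1 = x.2 then 0 else {x.2}

/-- Window of an item. -/
def iwn (x : G × G) : Multiset (G × G) := if x.1 = x.2 then 0 else {x}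

/-- Last item of a path. -/
def plast : G × G → List (G × G) → G
  | x, [] => x.2
  | _, y :: l => plast y l

/-- Differences along a path of items. -/
def plc : G × G → List (G × G) → Multiset G
  | _, [] => 0
  | x, y :: l => (y.1 - x.2) ::ₘ plc y l

lemma plast_append (x : G × G) (l : List (G × G)) (y : G × G) (l' : List (G × G)) :
    plast x (l ++ y :: l') = plast y l' := by
  induction l generalizing x with
  | nil => rfl
  | cons z l ih => exact ih z

lemma plc_append (x : G × G) (l : List (G × G)) (y : G × G) (l' : List (G × G)) :
    plc x (l ++ y :: l') = plc x l + (y.1 - plast x l) ::ₘ plc y l' := by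
  induction l generalizing x with
  | nil => simp [plc, plast]
  | cons z l ih => rw [cons_append, plc, plc, ih, cons_add]; rfl

/-- A partial placement into rows with current end `a`, at least `q` free positions after it, and `t` gaps not yet touched. -/
def Emb (q k l : ℕ) (W S : Multiset (G × G)) (V C : Multiset G) (a : G) (t : ℕ) : Prop :=
  ∃ (b : G) (m : ℕ) (L : Multiset (G × G × ℕ)) (Y : Multiset G),
    Ref (replicate l (Box.row k)) (wins W + (wins S + (L.map fun p => Box.gap p.1 p.2.1 p.2.2) +
      {Box.gap a b m} + Y.map fun y => Box.gap y y (k - 1))) V C ∧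
    (∀ p ∈ L, 60 ≤ p.2.2 ∧ p.2.2 < 64) ∧ q ≤ m ∧ L.card + 1 + Y.card = l ∧ Y.card = t ∧ (∀ p ∈ S, p.1 ≠ p.2) ∧
    a ∈ V ∧ ∀ y ∈ Y, y ∈ V

lemma Ref.link (a b v : G) (m : ℕ) : Ref {Box.gap a b (m + 1)} {Box.gap v b m} {v} {v - a} :=
  ((Ref.split a v b 0 m).trans ((Ref.close a v).add_right {Box.gap v b m})).cast (by congr 2; omega) (by simp) (by simp) (by simp)

lemma Ref.skip (a b v : G) (m : ℕ) : Ref {Box.gap a b (m + 2)} (wins {(a, v)} + {Box.gap v b m}) {v} 0 :=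
  (Ref.split a v b 1 m).cast (by congr 2; omega) (by simp [wins]) rfl rfl

lemma Ref.item (b : G) (x : G × G) (m : ℕ) : ∃ m', m ≤ m' ∧
    Ref {Box.gap x.1 b (m + 2)} (wins (iwn x) + {Box.gap x.2 b m'}) (if x.1 = x.2 then 0 else {x.2}) 0 := by
  by_cases h : x.1 = x.2
  · exact ⟨m + 2, by omega, (Ref.refl _).cast rfl (by simp [iwn, h, wins]) (by simp [h]) rfl⟩
  · exact ⟨m, le_rfl, (Ref.skip x.1 b x.2 m).cast rfl (by simp [iwn, h, wins]) (by simp [h]) rfl⟩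

lemma ivt_nonempty (x : G × G) : x.1 ∈ ivt x ∧ x.2 ∈ ivt x := by
  by_cases h : x.1 = x.2 <;> simp [ivt, h]

lemma Emb.adv {k l : ℕ} {W S : Multiset (G × G)} {V C : Multiset G} {a : G} {t : ℕ} (h : Emb 64 k l W S V C a t)
    (x : G × G) (hx : x.1 ∉ V) : Emb 60 k l (W + iwn x) S (V + ivt x) (C + {x.1 - a}) x.2 t ∧
      Emb 60 k l (W + iwn x) ((a, x.1) ::ₘ S) (V + ivt x) C x.2 t := by
  obtain ⟨b, m, L, Y, href, hL, hm, hl, hY, hS, ha, hyV⟩ := h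
  obtain ⟨m, rfl⟩ : ∃ r, m = r + 4 := ⟨m - 4, by omega⟩
  constructor
  · obtain ⟨m', hm', hr⟩ := Ref.item b x (m + 1)
    refine ⟨b, m', L, Y, ?_, hL, by omega, hl, hY, hS, mem_add.2 (Or.inr (ivt_nonempty x).2), fun y hy => mem_add.2 (Or.inl (hyV y hy))⟩
    have := href.trans (((Ref.link a b x.1 (m + 3)).trans hr).add_right (wins W + (wins S + (L.map fun p => Box.gap p.1 p.2.1 p.2.2) +
      Y.map fun y => Box.gap y y (k - 1))) |>.cast (by abel) rfl rfl rfl)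
    exact this.cast rfl (by rw [wins_add]; abel) (by rw [ivt]) (by simp)
  · obtain ⟨m', hm', hr⟩ := Ref.item b x m
    refine ⟨b, m', L, Y, ?_, hL, by omega, hl, hY, ?_, mem_add.2 (Or.inr (ivt_nonempty x).2), fun y hy => mem_add.2 (Or.inl (hyV y hy))⟩
    · have := href.trans (((Ref.skip a b x.1 (m + 2)).trans (hr.add_right (wins {(a, x.1)}) |>.cast (by abel) rfl rfl rfl)).add_right
        (wins W + (wins S + (L.map fun p => Box.gap p.1 p.2.1 p.2.2) + Y.map fun y => Box.gap y y (k - 1))) |>.cast (by abel) rfl rfl rfl)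
      exact this.cast rfl (by rw [← singleton_add, wins_add, wins_add]; abel) (by rw [ivt]) (by simp)
    · intro p hp
      rcases Multiset.mem_cons.1 hp with rfl | hp
      · exact fun h : a = x.1 => hx (h ▸ ha)
      · exact hS p hp

lemma bal_gaps (L : Multiset (G × G × ℕ)) :
    (Bal (L.map fun p => Box.gap p.1 p.2.1 p.2.2)).1 = (L.map fun p => p.2.2).sum := by
  induction L using Multiset.induction with
  | empty => simp
  | cons p L ih => rw [map_cons, Bal_cons, fst_add, ih, map_cons, sum_cons]; rfl

lemma Emb.room {k l : ℕ} {W S : Multiset (G × G)} {V C : Multiset G} {a : G} {t : ℕ} (h : Emb 60 k l W S V C a t)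
    (hk : 65 ≤ k) (hb : V.card + W.card + S.card + 64 * l ≤ l * k) :
    Emb 64 k l W S V C a t ∨ ∃ c t', t = t' + 1 ∧ Emb 64 k l W S V C c t' := by
  obtain ⟨b, m, L, Y, href, hL, hm, hl, hY, hS, ha, hyV⟩ := h
  rcases le_or_gt 64 m with h64 | h64
  · exact Or.inl ⟨b, m, L, Y, href, hL, h64, hl, hY, hS, ha, hyV⟩
  right
  induction Y using Multiset.induction with
  | empty =>
    exfalso
    have h1 := congrArg fst href.eq
    rw [Bal_add, Bal_add, Bal_add, Bal_add] at h1
    simp only [fst_add, (bal_wins_card _).1, bal_gaps, Bal_singleton, bal, Multiset.map_zero, Bal_zero, Prod.fst_zero, pay] at h1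
    have h2 : (L.map fun p => p.2.2).sum ≤ L.card * 63 := by
      have := Multiset.sum_le_card_nsmul (L.map fun p => p.2.2) 63 (by
        intro x hx; obtain ⟨p, hp, rfl⟩ := Multiset.mem_map.1 hx; have := (hL p hp).2; omega)
      simpa using this
    have h3 : (Bal (replicate l (Box.row k : Box G))).1 = l * k := by simp [Bal, bal]
    rw [h3] at h1
    simp at hl
    omega
  | cons y Y _ =>
    rw [card_cons] at hl hY
    refine ⟨y, Y.card, hY.symm, y, k - 1, (a, b, m) ::ₘ L, Y, href.cast rfl ?_ rfl rfl, ?_, by omega, by rw [card_cons]; omega, rfl, hS,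
      hyV y (by simp), fun z hz => hyV z (by simp [hz])⟩
    · simp only [map_cons]; simp only [← singleton_add]; abel
    · intro p hp
      rcases Multiset.mem_cons.1 hp with rfl | hp
      · exact ⟨hm, h64⟩
      · exact hL p hp

lemma Emb.tail {k l : ℕ} (hk : 65 ≤ k) (r : List (G × G)) : ∀ (x : G × G) (W S : Multiset (G × G)) (V C : Multiset G) (t : ℕ),
    Emb 60 k l W S V C x.2 t → (V + (r.map ivt).sum).Nodup →
    (V + (r.map ivt).sum).card + (W + (r.map iwn).sum).card + S.card + t + 64 * l ≤ l * k →
    ∃ S' C' B t', Emb 60 k l (W + (r.map iwn).sum) S' (V + (r.map ivt).sum) C' (plast x r) t' ∧ C' + B = C + plc x r ∧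
      S'.card + t' ≤ S.card + t ∧ B.card + t' ≤ t := by
  induction r with
  | nil => intro x W S V C t h _ _; exact ⟨S, C, 0, t, by simpa [plast] using h, by simp [plc], le_rfl, by simp⟩
  | cons y r ih =>
    intro x W S V C t h hnd hb
    simp only [List.map_cons, List.sum_cons, ← add_assoc] at hnd hb ⊢
    have hy : y.1 ∉ V := fun hc => Multiset.disjoint_left.1 (nodup_add.1 (nodup_add.1 hnd).1).2.2 hc (ivt_nonempty y).1
    rcases h.room hk (by simp only [card_add] at hb; omega) with h1 | ⟨c, t', rfl, h1⟩
    · obtain ⟨S', C', B, t', e1, e2, e3, e4⟩ := ih y _ _ _ _ _ (h1.adv y hy).1 hnd hb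
      exact ⟨S', C', B, t', e1, by rw [e2, plc, ← singleton_add]; abel, e3, e4⟩
    · obtain ⟨S', C', B, t', e1, e2, e3, e4⟩ := ih y _ _ _ _ _ (h1.adv y hy).2 hnd (by rw [card_cons]; omega)
      rw [card_cons] at e3
      refine ⟨S', C', B + {y.1 - x.2}, t', e1, by rw [← add_assoc, e2, plc, ← singleton_add]; abel, by omega, ?_⟩
      rw [card_add, Multiset.card_singleton]; omega

/-- Placing a family of paths. -/
lemma Emb.paths {k l : ℕ} (hk : 65 ≤ k) (P : Multiset ((G × G) × List (G × G))) : ∀ (W S : Multiset (G × G)) (V C : Multiset G) (a : G) (t : ℕ),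
    Emb 60 k l W S V C a t → (V + (P.map fun q => ((q.1 :: q.2).map ivt).sum).sum).Nodup →
    (V + (P.map fun q => ((q.1 :: q.2).map ivt).sum).sum).card + (W + (P.map fun q => ((q.1 :: q.2).map iwn).sum).sum).card
      + S.card + t + P.card + 64 * l ≤ l * k →
    ∃ S' C' B a' t', Emb 60 k l (W + (P.map fun q => ((q.1 :: q.2).map iwn).sum).sum) S'
      (V + (P.map fun q => ((q.1 :: q.2).map ivt).sum).sum) C' a' t' ∧ C' + B = C + (P.map fun q => plc q.1 q.2).sum ∧
      S'.card + t' ≤ S.card + t + P.card ∧ B.card + t' ≤ t := by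
  induction P using Multiset.induction with
  | empty => intro W S V C a t h _ _; exact ⟨S, C, 0, a, t, by simpa using h, by simp, by simp, by simp⟩
  | cons q P ih =>
    intro W S V C a t h hnd hb
    simp only [map_cons, sum_cons, List.map_cons, List.sum_cons, ← add_assoc, card_cons] at ih hnd hb ⊢
    have hnd1 := (nodup_add.1 hnd).1
    have hq : q.1.1 ∉ V := fun hc => Multiset.disjoint_left.1 (nodup_add.1 (nodup_add.1 hnd1).1).2.2 hc (ivt_nonempty q.1).1
    obtain ⟨c, t1, ht1, h1⟩ : ∃ c t1, t1 ≤ t ∧ Emb 60 k l (W + iwn q.1) ((c, q.1.1) ::ₘ S) (V + ivt q.1) C q.1.2 t1 := by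
      rcases h.room hk (by simp only [card_add] at hb; omega) with h1 | ⟨c, t', rfl, h1⟩
      · exact ⟨a, t, le_rfl, (h1.adv q.1 hq).2⟩
      · exact ⟨c, t', by omega, (h1.adv q.1 hq).2⟩
    obtain ⟨S2, C2, B2, t2, e1, e2, e3, e4⟩ := Emb.tail hk q.2 q.1 _ _ _ _ _ h1 hnd1 (by
      simp only [card_add, card_cons] at hb ⊢; omega)
    rw [card_cons] at e3
    obtain ⟨S3, C3, B3, a', t3, f1, f2, f3, f4⟩ := ih _ _ _ _ _ _ e1 hnd (by omega)
    refine ⟨S3, C3, B3 + B2, a', t3, f1, ?_, by omega, by rw [card_add]; omega⟩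
    rw [← add_assoc, f2, add_right_comm, e2]

/-- Items of a family of paths. -/
def pits (P : Multiset ((G × G) × List (G × G))) : Multiset (G × G) := (P.map fun q => ((q.1 :: q.2 : List (G × G)) : Multiset (G × G))).sum

lemma pits_sum {α : Type} [AddCommMonoid α] (f : G × G → α) (P : Multiset ((G × G) × List (G × G))) :
    (P.map fun q => ((q.1 :: q.2).map f).sum).sum = ((pits P).map f).sum := by
  induction P using Multiset.induction with
  | empty => simp [pits]
  | cons q P ih =>
    have : pits (q ::ₘ P) = ((q.1 :: q.2 : List (G × G)) : Multiset (G × G)) + pits P := by simp [pits]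
    rw [map_cons, sum_cons, ih, this, Multiset.map_add, sum_add]
    simp

/-- The state of the path building process. -/
def PInv (X : Multiset (G × G)) (M : Finset (G × G)) : Prop :=
  ∃ P : Multiset ((G × G) × List (G × G)), pits P = X ∧ (P.map fun q => plc q.1 q.2).sum = M.val.map (fun ω => ω.2 - ω.1) ∧
    X.map snd = P.map (fun q => plast q.1 q.2) + M.val.map fst ∧
    X.map fst = P.map (fun q => q.1.1) + M.val.map snd

lemma PInv.merge {X : Multiset (G × G)} {M : Finset (G × G)} (h : PInv X M) (hf : (X.map fst).Nodup) :
    ∃ bad : Finset (G × G), bad.card ≤ card G ∧ ∀ ω ∉ bad, ω ∉ M → ω.1 ∈ X.map snd → ω.2 ∈ X.map fst →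
      (∀ ω' ∈ M, ω.1 ≠ ω'.1 ∧ ω.2 ≠ ω'.2) → PInv X (insert ω M) := by
  obtain ⟨P, h1, h2, h3, h4⟩ := h
  refine ⟨(P.map fun q => (plast q.1 q.2, q.1.1)).toFinset, ?_, ?_⟩
  · refine (toFinset_card_le _).trans ?_
    have e1 : (P.map fun q => q.1.1).Nodup := by rw [h4] at hf; exact (nodup_add.1 hf).1
    have := card_le_univ (⟨_, e1⟩ : Finset G)
    simpa using this
  · intro ω hω hM hω1 hω2 hd
    rw [h3, mem_add] at hω1
    rw [h4, mem_add] at hω2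
    have hω1 := hω1.resolve_right fun h => by
      obtain ⟨ω', hω', h⟩ := Multiset.mem_map.1 h
      exact (hd ω' hω').1 h.symm
    have hω2 := hω2.resolve_right fun h => by
      obtain ⟨ω', hω', h⟩ := Multiset.mem_map.1 h
      exact (hd ω' hω').2 h.symm
    obtain ⟨q, hq, e1⟩ := Multiset.mem_map.1 hω1
    obtain ⟨q', hq', e2⟩ := Multiset.mem_map.1 hω2
    obtain ⟨P, rfl⟩ := exists_cons_of_mem hq
    rcases Multiset.mem_cons.1 hq' with rfl | hq'
    · exact absurd (Multiset.mem_toFinset.2 (Multiset.mem_map.2 ⟨q', by simp, Prod.ext e1 e2⟩)) hω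
    obtain ⟨P, rfl⟩ := exists_cons_of_mem hq'
    refine ⟨(q.1, q.2 ++ q'.1 :: q'.2) ::ₘ P, ?_, ?_, ?_, ?_⟩
    · rw [← h1]
      simp only [pits, map_cons, sum_cons]
      rw [← add_assoc, coe_add]; rfl
    · rw [insert_val_of_notMem hM, map_cons _ _ M.val, ← h2, ← e1, ← e2]
      simp only [map_cons, sum_cons, plc_append]
      simp only [← singleton_add]; abel
    · rw [insert_val_of_notMem hM, h3, map_cons _ _ M.val, ← e1]
      simp only [map_cons, plast_append]
      simp only [← singleton_add]; abel
    · rw [insert_val_of_notMem hM, h4, map_cons _ _ M.val, ← e2]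
      simp only [map_cons]
      simp only [← singleton_add]; abel

/-- Almost all differences are used to join the items into few paths. -/
lemma exists_paths (ε : ℝ) (hε : 0 < ε) : ∃ N0 : ℕ, ∀ {G : Type} [AddCommGroup G] [Fintype G] [DecidableEq G], N0 ≤ card G →
    ∀ (X : Multiset (G × G)) (AC : Finset G), (X.map fst).Nodup → (X.map snd).Nodup → X.card ≤ AC.card →
    ((card G : ℝ) - X.card) * 144 ≤ card G →
    ∃ (P : Multiset ((G × G) × List (G × G))) (Q : Finset G), pits P = X ∧ (P.map fun q => plc q.1 q.2).sum + Q.val = AC.val ∧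
      Q.card + X.card = AC.card + P.card ∧ (P.card : ℝ) ≤ ε * card G := by
  obtain ⟨N0, hN0⟩ := forms_packing (I := Fin 3) (J := Fin 3) id (r1 := 1) one_pos (by simp) (by decide) ε hε
  refine ⟨N0, ?_⟩
  intro G _ _ _ hn X AC hf hs hX hm
  set F : Fin 3 → G × G → G := fun i ω => ![ω.1, ω.2, ω.2 - ω.1] i with hF
  obtain ⟨M, ⟨P, h1, h2, h3, h4⟩, hval, hdisj, hleft⟩ := hN0 F 1 one_pos (by
    intro i i' h g g'
    rw [card_eq_one]
    fin_cases i <;> fin_cases i' <;> simp [hF] at h ⊢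
    · exact ⟨g, g', by ext ⟨u, v⟩; simp⟩
    · exact ⟨g, g' + g, by ext ⟨u, v⟩; simp; intro h; subst h; exact sub_eq_iff_eq_add⟩
    · exact ⟨g', g, by ext ⟨u, v⟩; simp; tauto⟩
    · exact ⟨g - g', g, by ext ⟨u, v⟩; simp; constructor <;> rintro ⟨rfl, rfl⟩ <;> simp⟩
    · exact ⟨g', g + g', by ext ⟨u, v⟩; simp; constructor <;> rintro ⟨rfl, rfl⟩ <;> simp⟩
    · exact ⟨g' - g, g', by ext ⟨u, v⟩; simp; rintro rfl; constructor <;> rintro rfl <;> simp⟩) hn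
    ![⟨_, hs⟩, ⟨_, hf⟩, AC] X.card (by intro j; fin_cases j <;> simp [hX]) (by simpa using (by linarith)) (PInv X)
    ⟨X.map fun x => (x, []), by simp [pits, map_map, comp_def], by simp [plc, map_map, comp_def], by simp [plast, map_map, comp_def], by simp [map_map, comp_def]⟩
    (by
      intro M hM _ _
      obtain ⟨bad, hb, h⟩ := hM.merge hf
      exact ⟨bad, hb, fun ω hω hv hd => h ω hω (fun hc => hd ω hc 0 0 rfl rfl) (hv.1 0) (hv.1 1) fun ω' hω' => ⟨hd ω' hω' 0 0 rfl, hd ω' hω' 1 1 rfl⟩⟩)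
  have inj : ∀ i, Set.InjOn (F i) M := fun i ω hω ω' hω' h => by
    by_contra hne
    exact hdisj ω hω ω' hω' hne i i rfl h
  have hMC : M.image (F 2) ⊆ AC := image_subset_iff.2 fun ω hω => (hval ω hω).1 2
  have c1 := congrArg Multiset.card h3
  have c2 : (M.image (F 2)).card = M.card := card_image_of_injOn (inj 2)
  have c3 := card_le_card hMC
  simp only [Multiset.card_map, card_add, card_val] at c1
  refine ⟨P, AC \ M.image (F 2), h1, ?_, ?_, ?_⟩
  · have : (P.map fun q => plc q.1 q.2).sum = (M.image (F 2)).val := by rw [image_val_of_injOn (inj 2), h2]; rfl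
    rw [this, ← val_union disjoint_sdiff, union_sdiff_of_subset hMC]
  · rw [card_sdiff_of_subset hMC]; omega
  · refine le_trans ?_ ((hleft 0).trans (by simp))
    have e : (P.map fun q => plast q.1 q.2).Nodup := by rw [h3] at hs; exact (nodup_add.1 hs).1
    have : P.card = (⟨_, e⟩ : Finset G).card := by simp
    rw [this]
    refine cast_le.2 (card_le_card fun v hv => ?_)
    have mf : ∀ {p : G → Prop} {i : DecidablePred p} {s : Finset G}, v ∈ s → p v → v ∈ @filter G p i s :=
      fun h1 h2 => mem_filter.2 ⟨h1, h2⟩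
    refine mf ?_ ?_
    · show v ∈ X.map snd
      rw [h3]; exact mem_add.2 (Or.inl hv)
    · rintro ω hω i rfl rfl
      rw [h3] at hs
      exact Multiset.disjoint_left.1 (nodup_add.1 hs).2.2 hv (Multiset.mem_map.2 ⟨ω, hω, rfl⟩)

lemma items_sum {G : Type} [DecidableEq G] {W : Multiset (G × G)} {Z : Multiset G} (h : (W.map fst + W.map snd).Nodup) :
    ((W + Z.map fun v => (v, v)).map ivt).sum = W.map fst + W.map snd + Z ∧
      ((W + Z.map fun v => (v, v)).map iwn).sum = W := by
  have hne : ∀ x ∈ W, x.1 ≠ x.2 := fun x hx he => Multiset.disjoint_left.1 (nodup_add.1 h).2.2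
    (Multiset.mem_map_of_mem fst hx) (he ▸ Multiset.mem_map_of_mem snd hx)
  have e1 : W.map ivt = W.map fun x => {x.1} + {x.2} := Multiset.map_congr rfl fun x hx => by simp [ivt, hne x hx]
  have e2 : W.map iwn = W.map fun x => {x} := Multiset.map_congr rfl fun x hx => by simp [iwn, hne x hx]
  rw [Multiset.map_add, Multiset.map_add, map_map, map_map, e1, e2, sum_add, sum_add,
    Multiset.sum_map_add, sum_map_singleton]
  constructor
  · congr 1
    · rw [← sum_map_singleton (W.map fst), ← sum_map_singleton (W.map snd), map_map, map_map]
      rfl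
    · simp [comp_def, ivt]
  · simp [comp_def, iwn]

/-- The theorem for all large cycle lengths. -/
theorem exists_large : ∃ K0 N : ℕ, ∀ {G : Type} [AddCommGroup G] [Fintype G] [DecidableEq G]
    {s : G} {D E : Finset G} {T : AddSubgroup G}, Spec s D E T → N ≤ card G → ∑ x : G, x = 0 →
    ∀ k l, K0 ≤ k → l * k + 1 = card G →
    HasOrth G l k := by
  obtain ⟨δ, hδ, hkit⟩ := exists_kit (1 / 1000) (by norm_num)
  set μ : ℝ := min (δ / 200) 1 with hμ
  have hμ0 : 0 < μ := by positivity
  have hμδ : 200 * μ ≤ δ := by have := min_le_left (δ / 200) 1; linarith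
  have hμ1 : μ ≤ 1 := min_le_right _ _
  obtain ⟨N1, hN1⟩ := hkit μ hμ0 (by linarith)
  obtain ⟨N2, hN2⟩ := exists_paths (μ / 1000) (by positivity)
  refine ⟨max 65 ⌈1000 / μ⌉₊, max (max N1 N2) ⌈1000 / μ⌉₊, ?_⟩
  intro G _ _ _ s D E T hS hn hsum k l hk hl
  simp only [max_le_iff] at hn hk
  obtain ⟨⟨hn1, hn2⟩, hn3⟩ := hn
  obtain ⟨hk65, hk2⟩ := hk
  obtain ⟨RV, Rc, R, g, g', AV, AC, kit, hW, -, hWc, hAV, hAC⟩ :=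
    hN1 s E D hn1 hS.hE hS.hD hS.sub hS.hs100 hS.h2 hS.h16
  obtain ⟨hc1, hc2, h0C, h0V⟩ := kit.cards
  rw [ceil_le, div_le_iff₀ hμ0] at hn3 hk2
  have hlr : (l : ℝ) * k + 1 = card G := by exact_mod_cast hl
  set n : ℝ := (card G : ℝ) with hnn
  have hln : 1000 * (l : ℝ) ≤ μ * n := by
    have h1 : (l : ℝ) * 1000 ≤ l * (k * μ) := by gcongr
    nlinarith
  have hl0 : 0 < l := by
    rcases Nat.eq_zero_or_pos l with rfl | h
    · simp at hlr; nlinarith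
    · exact h
  have hμn : μ * n ≤ n := by nlinarith
  set p := ⌊μ * n⌋₊ with hp
  have hp1 : (p : ℝ) ≤ μ * n := floor_le (by positivity)
  have hp2 : μ * n < p + 1 := Nat.lt_floor_add_one _
  set ws := (g + g').ws with hws
  set Wv : Finset G := ⟨_, hW.nd⟩ with hWv
  have hWvc : Wv.card = 2 * ws.card := by
    simp only [hWv, card_mk, card_add, Multiset.card_map]; ring
  have hWvA : Wv ⊆ AV := fun v hv => hW.mem v hv
  have hZc := card_sdiff_of_subset hWvA
  have hWle := card_le_card hWvA
  have hroom : 2 * ws.card + l ≤ AV.card := by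
    have : ((2 * ws.card + l : ℕ) : ℝ) ≤ AV.card := by push_cast; linarith
    exact cast_le.1 this
  obtain ⟨Y, hY, hYc⟩ := exists_subset_card_eq (s := AV \ Wv) (n := l) (by omega)
  set Z := (AV \ Wv) \ Y with hZ
  have hZc2 := card_sdiff_of_subset hY
  rw [← hZ] at hZc2
  have eV : Y.val + (ws.map fst + ws.map snd + Z.val) = AV.val := by
    have : ws.map fst + ws.map snd = Wv.val := rfl
    rw [this, add_left_comm, ← val_union disjoint_sdiff, union_sdiff_of_subset hY, ← val_union disjoint_sdiff, union_sdiff_of_subset hWvA]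
  set X := ws + Z.val.map fun v => (v, v) with hX
  have hXc : X.card = ws.card + Z.card := by simp [hX]
  have hXA : X.card + l = AC.card := by omega
  have hXr : (X.card : ℝ) + l = AC.card := by exact_mod_cast hXA
  have hnd : (ws.map fst + ws.map snd + Z.val).Nodup := by
    have := AV.nodup; rw [← eV] at this; exact (nodup_add.1 this).2.1
  have hf : (X.map fst).Nodup := by
    refine nodup_of_le ?_ hnd
    rw [hX, Multiset.map_add, map_map, comp_def, map_id']
    exact add_le_add_left (Multiset.le_add_right _ _) _
  have hs : (X.map snd).Nodup := by
    refine nodup_of_le ?_ hnd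
    rw [hX, Multiset.map_add, map_map, comp_def, map_id']
    exact add_le_add_left (Multiset.le_add_left _ _) _
  obtain ⟨P, Q0, hPX, hPC, hQ0, hPc⟩ := hN2 hn2 X AC hf hs (by omega) (by linarith)
  obtain ⟨e1, e2⟩ := items_sum (Z := Z.val) hW.nd
  have hPr : 1000 * (P.card : ℝ) ≤ μ * n := by linarith
  have hbig : 80 * l + 20 * P.card ≤ 2 * p := by
    have : ((80 * l + 20 * P.card : ℕ) : ℝ) ≤ ((2 * p : ℕ) : ℝ) := by push_cast; linarith
    exact cast_le.1 this
  have hAVc := congrArg Multiset.card eV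
  rw [card_add, card_val, card_val, hYc] at hAVc
  obtain ⟨y, Y', hY'⟩ : ∃ y Y', Y.val = y ::ₘ Y' := by
    obtain ⟨y, hy⟩ := card_pos.1 (by omega : 0 < Y.card)
    exact ⟨y, _, (cons_erase hy).symm⟩
  have hY'c : Y'.card + 1 = l := by rw [← hYc, ← card_val, hY', card_cons]
  have hstart : Emb 60 k l 0 0 Y.val 0 y Y'.card := by
    refine ⟨y, k - 1, 0, Y', (gaps_ref Y.val (k := k) (by omega)).cast (by rw [card_val, hYc]) ?_ rfl rfl, by simp, by omega, by simp; omega, rfl,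
      by simp, by simp [hY'], fun z hz => by simp [hY', hz]⟩
    rw [hY', map_cons]; simp [wins]
  obtain ⟨S, C, B, a, t, ⟨b, m, L, Y2, href, hL, hm, hl2, ht, hSne, -, -⟩, hC, hSt, hBt⟩ := Emb.paths hk65 P _ _ _ _ _ _ hstart (by
      rw [pits_sum, hPX, e1, eV]; exact AV.nodup) (by
      rw [pits_sum, pits_sum, hPX, e1, e2, eV, card_val, zero_add, card_zero]; omega)
  rw [pits_sum, pits_sum, hPX, e1, e2, eV, zero_add] at href
  rw [zero_add] at hC
  rw [card_zero] at hSt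
  set L' := L + {(a, b, m)} + Y2.map fun y => (y, y, k - 1) with hL'
  have hrest : wins S + (L.map fun p => Box.gap p.1 p.2.1 p.2.2) + {Box.gap a b m} + (Y2.map fun y => Box.gap y y (k - 1)) =
      wins S + L'.map fun p => Box.gap p.1 p.2.1 p.2.2 := by
    simp [hL', map_map, add_assoc]
  have hL'c : L'.card = l := by simp [hL']; omega
  have hCQ : C + (B + Q0.val) = AC.val := by rw [← add_assoc, hC, hPC]
  set Q : Finset G := ⟨B + Q0.val, by have := AC.nodup; rw [← hCQ] at this; exact (nodup_add.1 this).2.1⟩ with hQ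
  have hQc : Q.card = B.card + Q0.card := by simp [hQ]
  rw [hrest] at href
  have hb := congrArg fst href.eq
  have hbr : (Bal (replicate l (Box.row k : Box G))).1 = l * k := by simp [Bal, bal]
  rw [hbr, Bal_add, Bal_add] at hb
  simp only [fst_add, (bal_wins_card _).1, bal_gaps, pay, card_val] at hb
  refine kit.finish (E := {0}) (Q := Q) (β := 4 * p + Q.card) (by simpa using hS.hD (mem_insert_self _ _)) (by omega) hsum hl href hCQ ?_ le_rfl
    (solve_large kit.res (by simpa using hS.hD (mem_insert_self _ _)) (by simp) (K := 1) ?_ le_rfl S hSne L' ?_ ?_ _ ?_)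
  · intro c hc hc0
    rw [mem_singleton] at hc0
    subst hc0
    refine h0C ?_
    show (0 : G) ∈ AC.val
    rw [← hCQ]; exact mem_add.2 (Or.inr hc)
  · have : (Q.card : ℝ) ≤ 2 * l + P.card := by exact_mod_cast (by omega : Q.card ≤ 2 * l + P.card)
    have h3 : 200 * (μ * n) ≤ δ * n := by nlinarith [cast_nonneg (α := ℝ) (card G)]
    push_cast
    linarith
  · intro q hq
    simp only [hL', mem_add, Multiset.mem_singleton, Multiset.mem_map] at hq
    rcases hq with (hq | rfl) | ⟨y, -, rfl⟩
    · exact (hL q hq).1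
    · exact hm
    · show 60 ≤ k - 1; omega
  · intro h0; rw [h0] at hL'c; simp at hL'c; omega
  · rw [hL'c]; show 3 * (B + Q0.val).card + _ + _ + _ ≤ _
    rw [card_add, card_val]
    omega

/-- A permutation all of whose nonzero orbits have length `k`. -/
lemma cycleType_of_orbits {φ : Equiv.Perm G} {k l : ℕ} (hk : 2 ≤ k) (hl : l * k + 1 = card G) (h0 : φ 0 = 0)
    (h : ∀ x ≠ 0, ∀ j, (φ ^ j) x = x ↔ k ∣ j) : φ.cycleType = replicate l k := by
  have hall : ∀ c ∈ φ.cycleType, c = k := by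
    intro c hc
    rw [Equiv.Perm.cycleType_def, Multiset.mem_map] at hc
    obtain ⟨f, hf, rfl⟩ := hc
    obtain ⟨hcy, hfx⟩ := Equiv.Perm.mem_cycleFactorsFinset_iff.1 hf
    show f.support.card = k
    rw [← hcy.orderOf]
    obtain ⟨x, hx⟩ := hcy.nonempty_support
    have hfe := Equiv.Perm.cycle_is_cycleOf hx hf
    have hx0 : x ≠ 0 := by
      rintro rfl
      exact (Equiv.Perm.mem_support.1 hx) (by rw [hfx _ hx, h0])
    have key : ∀ j, f ^ j = 1 ↔ k ∣ j := by
      intro j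
      rw [hcy.pow_eq_one_iff' (Equiv.Perm.mem_support.1 hx), ← h x hx0, hfe, Equiv.Perm.cycleOf_pow_apply_self]
    exact Nat.dvd_antisymm (orderOf_dvd_of_pow_eq_one ((key k).2 dvd_rfl)) ((key _).1 (pow_orderOf_eq_one f))
  have hsup : φ.support = univ.erase 0 := by
    ext x
    simp only [Equiv.Perm.mem_support, mem_erase, mem_univ, and_true]
    refine ⟨fun hx hx0 => hx (by rw [hx0, h0]), fun hx hx' => ?_⟩
    have := (h x hx 1).1 (by simpa using hx')
    have := Nat.le_of_dvd one_pos this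
    omega
  have hrep := Multiset.eq_replicate_card.2 hall
  have hsum := Equiv.Perm.sum_cycleType φ
  rw [hrep, hsup, card_erase_of_mem (mem_univ _), card_univ, ← hl, sum_replicate, smul_eq_mul, Nat.add_sub_cancel] at hsum
  rw [hrep, Nat.eq_of_mul_eq_mul_right (by omega) hsum]

lemma exists_two {l : ℕ} (hl : l * 2 + 1 = card G) :
    HasOrth G l 2 := by
  have h2 : ∀ x : G, x + x = 0 → x = 0 := by
    intro x hx
    have h1 : (card G) • x = 0 := card_nsmul_eq_zero
    rw [← hl, add_smul, mul_smul, two_nsmul, hx, smul_zero, zero_add, one_smul] at h1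
    exact h1
  refine ⟨Equiv.neg G, ?_, by simp, cycleType_of_orbits le_rfl hl (by simp) ?_⟩
  · refine Finite.injective_iff_bijective.1 fun x y hxy => ?_
    have hxy : -x - x = -y - y := hxy
    exact sub_eq_zero.1 (h2 _ (by rw [← sub_eq_zero] at hxy; rw [← neg_eq_zero, ← hxy]; abel))
  · intro x hx j
    have hsq : (Equiv.neg G) ^ 2 = 1 := by ext; simp [sq]
    rcases Nat.even_or_odd' j with ⟨i, rfl | rfl⟩
    · simp [pow_mul, hsq]
    · rw [pow_succ, pow_mul, hsq, one_pow, one_mul]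
      refine ⟨fun h => absurd (h2 x ?_) hx, fun h => by omega⟩
      have h : -x = x := h
      nth_rw 1 [← h]; simp

/-- Multiplication by a root of unity, for elementary abelian 2-groups. -/
lemma exists_elementary (h2 : ∀ x : G, x + x = 0) {k l : ℕ} (hk : 2 ≤ k) (hl : l * k + 1 = card G) (hl0 : 0 < l) :
    HasOrth G l k := by
  let _ : Module (ZMod 2) G := AddCommGroup.zmodModule fun x => by rw [two_nsmul, h2]
  have hcard := Module.card_eq_pow_finrank (K := ZMod 2) (V := G)
  rw [ZMod.card] at hcard
  set m := Module.finrank (ZMod 2) G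
  have hm : m ≠ 0 := by
    rintro h
    rw [h, pow_zero] at hcard
    have := Nat.mul_pos hl0 (by omega : 0 < k)
    omega
  let F := GaloisField 2 m
  let _ : Fintype F := Fintype.ofFinite F
  have hF : card F = card G := by
    rw [hcard, ← Nat.card_eq_fintype_card, GaloisField.card 2 m hm]
  let e : G ≃ₗ[ZMod 2] F := LinearEquiv.ofFinrankEq G F (GaloisField.finrank 2 hm).symm
  classical
  have hu : Nat.card Fˣ = l * k := by
    rw [Nat.card_eq_fintype_card, Fintype.card_units, hF, ← hl, Nat.add_sub_cancel]
  obtain ⟨g, hg⟩ := IsCyclic.exists_generator (α := Fˣ)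
  have hgo : orderOf g = l * k := by rw [orderOf_eq_card_of_forall_mem_zpowers hg, hu]
  have huo : orderOf (g ^ l) = k := by
    rw [orderOf_pow_of_dvd hl0.ne' (hgo ▸ dvd_mul_right _ _), hgo, Nat.mul_div_cancel_left _ hl0]
  set u := g ^ l
  let φ : Equiv.Perm G := (e.toEquiv.trans (Units.mulLeft u)).trans e.symm.toEquiv
  have hφ : ∀ x, φ x = e.symm ((u : F) * e x) := fun x => rfl
  have hpow : ∀ j x, (φ ^ j) x = e.symm (((u ^ j : Fˣ) : F) * e x) := by
    intro j
    induction j with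
    | zero => intro x; simp
    | succ j ih => intro x; rw [pow_succ', Equiv.Perm.mul_apply, ih, hφ, LinearEquiv.apply_symm_apply, pow_succ']; simp [mul_assoc]
  have h0 : φ 0 = 0 := by rw [hφ]; simp
  have hu1 : (u : F) - 1 ≠ 0 := by
    intro h
    have : u = 1 := Units.ext (by simpa using sub_eq_zero.1 h)
    rw [this, orderOf_one] at huo
    omega
  refine ⟨φ, Finite.injective_iff_bijective.1 fun x y hxy => ?_, h0, cycleType_of_orbits hk hl h0 fun x hx j => ?_⟩
  · have hxy : φ x - x = φ y - y := hxy
    have := congrArg e hxy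
    rw [map_sub, map_sub, hφ, hφ, LinearEquiv.apply_symm_apply, LinearEquiv.apply_symm_apply] at this
    refine e.injective (mul_left_cancel₀ hu1 ?_)
    linear_combination this
  · rw [hpow, LinearEquiv.symm_apply_eq, ← huo, orderOf_dvd_iff_pow_eq_one]
    have hex : e x ≠ 0 := by simpa using hx
    rw [mul_eq_right₀ hex, Units.val_eq_one]

lemma fibre_mul_le (κ : G) :
    (univ.filter fun c : G => c + c = κ).card * (univ.image fun c : G => c + c).card ≤ card G := by
  rw [← card_univ, card_eq_sum_card_image (fun c : G => c + c) univ, mul_comm, ← smul_eq_mul]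
  refine card_nsmul_le_sum _ _ _ fun y hy => ?_
  obtain ⟨b, -, rfl⟩ := mem_image.1 hy
  rcases (univ.filter fun c : G => c + c = κ).eq_empty_or_nonempty with h | ⟨a, ha⟩
  · simp [h]
  · simp only [mem_filter, mem_univ, true_and] at ha
    refine card_le_card_of_injOn (fun c => c - a + b) ?_ fun x _ y _ h => by simpa using h
    intro c hc
    simp only [coe_filter, mem_univ, true_and, mem_ofPred_eq] at hc ⊢
    rw [show c - a + b + (c - a + b) = (c + c) - (a + a) + (b + b) by abel, hc, ha]; abel

lemma exists_spec (hn : 10000 ≤ card G) {x : G} (hx : x + x ≠ 0) :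
    ∃ (s : G) (D E : Finset G) (T : AddSubgroup G), Spec s D E T := by
  set I := univ.image fun c : G => c + c with hI
  have memI : ∀ {y}, y ∈ I ↔ ∃ c, c + c = y := by simp [hI]
  have addI : ∀ {y z}, y ∈ I → z ∈ I → y + z ∈ I := by
    simp only [memI]
    rintro _ _ ⟨a, rfl⟩ ⟨b, rfl⟩
    exact ⟨a + b, by abel⟩
  have negI : ∀ {y}, y ∈ I → -y ∈ I := by
    simp only [memI]
    rintro _ ⟨a, rfl⟩
    exact ⟨-a, by abel⟩
  have zI : (0 : G) ∈ I := memI.2 ⟨0, by simp⟩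
  have hfib : ∀ κ : G, (univ.filter fun c : G => c + c = κ).card * I.card ≤ card G := fibre_mul_le
  have h2 : Half G := by
    intro κ
    have : 2 ≤ I.card := one_lt_card.2 ⟨x + x, memI.2 ⟨x, rfl⟩, 0, zI, hx⟩
    nlinarith [hfib κ]
  rcases le_or_gt 100 I.card with h | h
  · have h100 : ∀ κ : G, 100 * (univ.filter fun c : G => c + c = κ).card ≤ card G := fun κ => by nlinarith [hfib κ]
    exact ⟨0, ∅, {0}, ⊥, by simp, by simp, by simp, by simp, by simp, h100 _, h2, fun κ _ => by have := h100 κ; omega,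
      fun _ _ _ => h100 _⟩
  · have he : ∀ κ ∉ I, (univ.filter fun c : G => c + c = κ).card = 0 := by
      intro κ hκ
      rw [card_eq_zero, filter_eq_empty_iff]
      exact fun c _ hc => hκ (memI.2 ⟨c, hc⟩)
    obtain ⟨s, hs, hsI⟩ : ∃ s ∈ (univ.filter fun c : G => c + c = 0), s ∉ I := by
      by_contra! hcon
      have h1 : card G ≤ (univ.filter fun c : G => c + c = 0).card * I.card := by
        rw [← card_univ, card_eq_sum_card_image (fun c : G => c + c) univ, mul_comm, ← smul_eq_mul]
        refine sum_le_card_nsmul _ _ _ fun y hy => ?_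
        obtain ⟨b, -, rfl⟩ := mem_image.1 hy
        refine card_le_card_of_injOn (fun c => c - b) ?_ fun x _ y _ h => by simpa using h
        intro c hc
        simp only [coe_filter, mem_univ, true_and, mem_ofPred_eq] at hc ⊢
        rw [show c - b + (c - b) = (c + c) - (b + b) by abel, hc, sub_self]
      have h3 := card_le_card hcon
      nlinarith
    simp only [mem_filter, mem_univ, true_and] at hs
    have hns : -s = s := neg_eq_of_add_eq_zero_left hs
    have memE : ∀ {y}, y ∈ I ∪ I.image (· + s) ↔ y ∈ I ∨ y + s ∈ I := by
      intro y
      rw [mem_union]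
      refine or_congr_right ⟨fun h => ?_, fun h => mem_image.2 ⟨_, h, by rw [add_assoc, hs, add_zero]⟩⟩
      obtain ⟨z, hz, rfl⟩ := mem_image.1 h
      rwa [add_assoc, hs, add_zero]
    refine ⟨s, I, I ∪ I.image (· + s), { carrier := {y | y ∈ I ∪ I.image (· + s)}, add_mem' := ?_, zero_mem' := ?_, neg_mem' := ?_ },
      fun y => Iff.rfl, memE.2 (Or.inr (by rwa [hs])), hs, ?_, ?_, by rw [he s hsI]; simp, h2, fun κ hκ => by rw [he κ hκ]; simp, ?_⟩
    · intro a b ha hb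
      rw [mem_ofPred_eq, memE] at ha hb ⊢
      rcases ha with ha | ha <;> rcases hb with hb | hb
      · exact Or.inl (addI ha hb)
      · exact Or.inr (by rw [add_assoc]; exact addI ha hb)
      · exact Or.inr (by rw [add_right_comm]; exact addI ha hb)
      · have := addI ha hb
        rw [show a + s + (b + s) = a + b + (s + s) by abel, hs, add_zero] at this
        exact Or.inl this
    · exact memE.2 (Or.inl zI)
    · intro a ha
      rw [mem_ofPred_eq, memE] at ha ⊢
      refine ha.imp negI fun h => ?_
      have := negI h
      rwa [neg_add, hns] at this
    · have h3 := card_union_le I (I.image (· + s))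
      have h4 := card_image_le (s := I) (f := (· + s))
      omega
    · exact insert_subset (memE.2 (Or.inl zI)) subset_union_left
    · intro a y hy
      have hy' : y + (a + a) ∉ I := by
        intro h
        refine hy (memE.2 (Or.inl ?_))
        have := addI h (negI (memI.2 ⟨a, rfl⟩))
        rwa [add_neg_cancel_right] at this
      show 100 * _ ≤ _
      rw [he _ hy']; simp
end Res

end FGT

theorem fgt_conjecture_large_groups :
    ∃ N : ℕ, ∀ (G : Type) [AddCommGroup G] [Fintype G] [DecidableEq G],
      N ≤ Fintype.card G →
      (∑ g : G, g) = 0 →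
      ∀ k : ℕ, 2 ≤ k → k ∣ Fintype.card G - 1 →
      ∃ φ : Equiv.Perm G,
        Function.Bijective (fun g : G => φ g - g) ∧
        φ 0 = 0 ∧
        φ.cycleType = Multiset.replicate ((Fintype.card G - 1) / k) k := by
  obtain ⟨K0, N1, hL⟩ := FGT.exists_large
  choose! N2 hS using FGT.exists_small
  refine ⟨max (max 10000 N1) ((Finset.range K0).sup N2), ?_⟩
  intro G _ _ _ hn hsum k hk hdvd
  simp only [max_le_iff] at hn
  obtain ⟨⟨hn0, hn1⟩, hn2⟩ := hn
  obtain ⟨l, hl⟩ := hdvd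
  have hl' : l * k + 1 = Fintype.card G := by rw [mul_comm, ← hl]; omega
  have hl0 : 0 < l := by
    rcases Nat.eq_zero_or_pos l with rfl | h
    · omega
    · exact h
  rw [hl, Nat.mul_div_cancel_left _ (by omega)]
  by_cases h2 : ∀ x : G, x + x = 0
  · exact FGT.exists_elementary h2 hk hl' hl0
  push Not at h2
  obtain ⟨x, hx⟩ := h2
  obtain ⟨s, D, E, T, hT⟩ := FGT.exists_spec hn0 hx
  rcases hk.eq_or_lt with rfl | hk3
  · exact FGT.exists_two hl'
  rcases le_or_gt K0 k with h | h
  · exact hL hT hn1 hsum k l h hl'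
  · exact hS k hk3 hT ((Finset.le_sup (f := N2) (Finset.mem_range.2 h)).trans hn2) hsum l hl'
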